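/- Let α > 0 be fixed. With 𝒩_N(m) the number of real eigenvalues of the product of m independent N×N Gaussian matrices, for any sequence of positive integers (m_N) indexed by even N with m_N/N → α as N → ∞, the random variables 𝒩_N(m_N)/N converge in probability to the constant c(α) := ∫₀¹ erf(√(α/(8t))) dt; that is, for every ε > 0, the probability that |𝒩_N(m_N)/N − c(α)| > ε tends to 0 as N → ∞. -/

import Mathlib

open MeasureTheory ProbabilityTheory Filter

/-- The error function `erf x = (2/√π) ∫_0^x e^{-s²} ds`. -/
noncomputable def erf (x : ℝ) : ℝ :=
  (2 / Real.sqrt Real.pi) * ∫ s in (0:ℝ)..x, Real.exp (-s ^ 2)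

/-- `c(α) = ∫_0^1 erf(√(α/(8t))) dt`. -/
noncomputable def cFun (α : ℝ) : ℝ :=
  ∫ t in (0:ℝ)..1, erf (Real.sqrt (α / (8 * t)))

/-- The joint law of `m` independent `N × N` matrices with i.i.d. real Gaussian
entries of mean `0` and variance `1/N`. -/
noncomputable def ensembleMeasure (N m : ℕ) :
    Measure (Fin m → Fin N → Fin N → ℝ) :=
  Measure.pi fun _ =>
    Measure.pi fun _ => Measure.pi fun _ => gaussianReal 0 (1 / N)

/-- The product matrix `P = X_1 ⋯ X_m`. -/
noncomputable def prodMatrix (N m : ℕ) (ω : Fin m → Fin N → Fin N → ℝ) :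
    Matrix (Fin N) (Fin N) ℝ :=
  (List.ofFn fun i => Matrix.of (ω i)).prod

/-- The number of real eigenvalues of a matrix, i.e. the number of real roots of
its characteristic polynomial counted with multiplicity. -/
noncomputable def numRealEigs (N : ℕ) (P : Matrix (Fin N) (Fin N) ℝ) : ℕ :=
  (Matrix.charpoly P).roots.card

/-- The expected number of real eigenvalues of the product of `m` independent
`N × N` Gaussian matrices. -/
noncomputable def EN (N m : ℕ) : ℝ :=
  ∫ ω, (numRealEigs N (prodMatrix N m ω) : ℝ) ∂(ensembleMeasure N m)

/-- The variance of the number of real eigenvalues. -/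
noncomputable def VN (N m : ℕ) : ℝ :=
  variance (fun ω => (numRealEigs N (prodMatrix N m ω) : ℝ)) (ensembleMeasure N m)

namespace RealEig
open Set Function
open scoped ENNReal NNReal

section AreaFormula
variable {E : Type*} [NormedAddCommGroup E] [NormedSpace ℝ E] [FiniteDimensional ℝ E]
  [MeasurableSpace E] [BorelSpace E]

lemma exists_injOn_partition (f : E → E) (f' : E → E →L[ℝ] E)
    (hf : ∀ x, HasFDerivAt f (f' x) x) :
    ∃ t : ℕ → Set E, Pairwise (Disjoint on t) ∧ (∀ n, MeasurableSet (t n)) ∧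
      {x | (f' x).det ≠ 0} ⊆ ⋃ n, t n ∧ ∀ n, InjOn f ({x | (f' x).det ≠ 0} ∩ t n) := by
  classical
  let s : Set E := {x | (f' x).det ≠ 0}
  let r : (E →L[ℝ] E) → ℝ≥0 := fun A =>
    if h : A.det ≠ 0 then
      (if ‖((A.toContinuousLinearEquivOfDetNeZero h).symm : E →L[ℝ] E)‖₊ = 0 then 1
       else ‖((A.toContinuousLinearEquivOfDetNeZero h).symm : E →L[ℝ] E)‖₊⁻¹ / 2)
    else 1
  have rpos : ∀ A, r A ≠ 0 := by
    intro A
    simp only [r]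
    split_ifs with h h2
    · exact one_ne_zero
    · positivity
    · exact one_ne_zero
  obtain ⟨t, A, ht1, ht2, ht3, ht4, ht5⟩ :=
    exists_partition_approximatesLinearOn_of_hasFDerivWithinAt f s f'
      (fun x _ => (hf x).hasFDerivWithinAt) r rpos
  refine ⟨t, ht1, ht2, ht3, fun n => ?_⟩
  rcases s.eq_empty_or_nonempty with hs | hs
  · have : {x | (f' x).det ≠ 0} = ∅ := hs
    rw [this]; simp
  obtain ⟨y, hy, hA⟩ := ht5 hs n
  have hdet : (A n).det ≠ 0 := by rw [hA]; exact hy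
  have h4 := ht4 n
  have e1 : (((A n).toContinuousLinearEquivOfDetNeZero hdet : E ≃L[ℝ] E) : E →L[ℝ] E) = A n := by
    ext x; rfl
  rw [← e1] at h4
  refine ApproximatesLinearOn.injOn (f' := (A n).toContinuousLinearEquivOfDetNeZero hdet) h4 ?_
  rw [e1]
  simp only [r, dif_pos hdet]
  split_ifs with h2
  · left
    have h0 : (((A n).toContinuousLinearEquivOfDetNeZero hdet).symm : E →L[ℝ] E) = 0 := by
      simpa using h2
    refine ⟨fun a b => ?_⟩
    have ha : ∀ a : E, a = 0 := fun a => by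
      have := ((A n).toContinuousLinearEquivOfDetNeZero hdet).symm_apply_apply a
      rw [← this]
      exact DFunLike.congr_fun h0 _
    rw [ha a, ha b]
  · right
    exact NNReal.half_lt_self (inv_ne_zero h2)

/-- Area formula with multiplicity. -/
theorem lintegral_fiber_sum (μ : Measure E) [μ.IsAddHaarMeasure] (f : E → E) (f' : E → E →L[ℝ] E)
    (hf : ∀ x, HasFDerivAt f (f' x) x) (hdet : Measurable fun x => (f' x).det)
    (g : E → ℝ≥0∞) (hg : Measurable g) (hg0 : ∀ x, (f' x).det = 0 → g x = 0) :
    Measurable (fun y => ∑' x : f ⁻¹' {y}, g x) ∧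
      ∫⁻ y, ∑' x : f ⁻¹' {y}, g x ∂μ = ∫⁻ x, ENNReal.ofReal |(f' x).det| * g x ∂μ := by
  classical
  obtain ⟨t, ht1, ht2, ht3, ht4⟩ := exists_injOn_partition f f' hf
  set s : Set E := {x | (f' x).det ≠ 0} with hs
  have hsm : MeasurableSet s := (measurableSet_eq_fun hdet measurable_const).compl
  let S : ℕ → Set E := fun n => s ∩ t n
  have hS : ∀ n, MeasurableSet (S n) := fun n => hsm.inter (ht2 n)
  have hf'S : ∀ n, ∀ x ∈ S n, HasFDerivWithinAt f (f' x) (S n) x :=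
    fun n x _ => (hf x).hasFDerivWithinAt
  have emb : ∀ n, MeasurableEmbedding ((S n).domRestrict f) := fun n =>
    measurableEmbedding_of_fderivWithin (hS n) (hf'S n) (ht4 n)
  let h : ℕ → E → ℝ≥0∞ := fun n => Function.extend ((S n).domRestrict f) (fun x => g x) 0
  have hh : ∀ n, Measurable (h n) := fun n =>
    (emb n).measurable_extend (hg.comp measurable_subtype_coe) measurable_const
  have hval : ∀ n, ∀ x ∈ S n, h n (f x) = g x := fun n x hx =>
    (emb n).injective.extend_apply (fun x => g x) 0 ⟨x, hx⟩
  have hout : ∀ n, ∀ y ∉ f '' (S n), h n y = 0 := fun n y hy => by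
    refine Function.extend_apply' _ _ _ ?_
    rintro ⟨⟨x, hx⟩, hxy⟩
    exact hy ⟨x, hx, hxy⟩
  have hgsum : ∀ x, g x = ∑' n, (S n).indicator g x := by
    intro x
    by_cases hx : x ∈ s
    · obtain ⟨n, hn⟩ := mem_iUnion.1 (ht3 hx)
      rw [tsum_eq_single n]
      · exact (indicator_of_mem (show x ∈ S n from ⟨hx, hn⟩) g).symm
      · intro k hk
        refine indicator_of_notMem (fun hxk => ?_) g
        exact (ht1 hk).le_bot ⟨hxk.2, hn⟩
    · rw [hg0 x (by simpa [hs] using hx)]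
      symm
      refine ENNReal.tsum_eq_zero.2 fun n => indicator_of_notMem (fun hxk => hx hxk.1) g
  have key : ∀ y, ∑' x : f ⁻¹' {y}, g x = ∑' n, h n y := by
    intro y
    calc ∑' x : f ⁻¹' {y}, g x = ∑' x : f ⁻¹' {y}, ∑' n, (S n).indicator g x :=
          tsum_congr fun x => hgsum x
      _ = ∑' n, ∑' x : f ⁻¹' {y}, (S n).indicator g x := ENNReal.tsum_comm
      _ = ∑' n, h n y := by
          refine tsum_congr fun n => ?_
          by_cases hy : y ∈ f '' (S n)
          · obtain ⟨x, hx, rfl⟩ := hy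
            rw [tsum_eq_single ⟨x, rfl⟩, hval n x hx]
            · exact indicator_of_mem hx g
            · rintro ⟨x', hx'⟩ hne
              refine indicator_of_notMem (fun hxk => hne ?_) g
              exact Subtype.ext (ht4 n hxk hx hx')
          · rw [hout n y hy]
            refine ENNReal.tsum_eq_zero.2 ?_
            rintro ⟨x', hx'⟩
            refine indicator_of_notMem (fun hxk => hy ⟨x', hxk, hx'⟩) g
  constructor
  · simp_rw [key]
    exact Measurable.tsum hh
  · simp_rw [key]
    rw [lintegral_tsum fun n => (hh n).aemeasurable]
    have h1 : ∀ n, ∫⁻ y, h n y ∂μ = ∫⁻ x, ENNReal.ofReal |(f' x).det| * (S n).indicator g x ∂μ := by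
      intro n
      have him : MeasurableSet (f '' S n) := measurable_image_of_fderivWithin (hS n) (hf'S n) (ht4 n)
      calc ∫⁻ y, h n y ∂μ = ∫⁻ y in f '' S n, h n y ∂μ := by
            rw [← lintegral_indicator him]
            refine lintegral_congr fun y => ?_
            by_cases hy : y ∈ f '' S n
            · rw [indicator_of_mem hy]
            · rw [indicator_of_notMem hy, hout n y hy]
        _ = ∫⁻ x in S n, ENNReal.ofReal |(f' x).det| * h n (f x) ∂μ :=
            lintegral_image_eq_lintegral_abs_det_fderiv_mul μ (hS n) (hf'S n) (ht4 n) _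
        _ = _ := by
            rw [← lintegral_indicator (hS n)]
            refine lintegral_congr fun x => ?_
            by_cases hx : x ∈ S n
            · rw [indicator_of_mem hx, indicator_of_mem hx, hval n x hx]
            · rw [indicator_of_notMem hx, indicator_of_notMem hx, mul_zero]
    simp_rw [h1]
    rw [← lintegral_tsum]
    · refine lintegral_congr fun x => ?_
      rw [ENNReal.tsum_mul_left, ← hgsum x]
    · intro n
      exact ((ENNReal.measurable_ofReal.comp (_root_.continuous_abs.measurable.comp hdet)).mul
        (hg.indicator (hS n))).aemeasurable
end AreaFormula
open Matrix

section MatrixMeasure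
variable {ι κ : Type*}

instance matrixMeasurableSpace : MeasurableSpace (Matrix ι κ ℝ) :=
  inferInstanceAs (MeasurableSpace (ι → κ → ℝ))

noncomputable instance matrixMeasureSpace [Fintype ι] [Fintype κ] : MeasureSpace (Matrix ι κ ℝ) :=
  inferInstanceAs (MeasureSpace (ι → κ → ℝ))

instance matrixSecondCountable [Countable ι] [Countable κ] :
    SecondCountableTopology (Matrix ι κ ℝ) :=
  inferInstanceAs (SecondCountableTopology (ι → κ → ℝ))

instance matrixBorelSpace [Countable ι] [Countable κ] : BorelSpace (Matrix ι κ ℝ) :=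
  inferInstanceAs (BorelSpace (ι → κ → ℝ))

attribute [local instance] Matrix.normedAddCommGroup Matrix.normedSpace

/-- The Borel structure for the topology induced by the sup norm. -/
instance matrixNormBorelSpace [Fintype ι] [Fintype κ] :
    @BorelSpace (Matrix ι κ ℝ) (Matrix.normedAddCommGroup (m := ι) (n := κ)
      (α := ℝ)).toMetricSpace.toPseudoMetricSpace.toUniformSpace.toTopologicalSpace _ :=
  inferInstanceAs (BorelSpace (ι → κ → ℝ))

instance matrixIsAddHaar [Fintype ι] [Fintype κ] :
    (volume : Measure (Matrix ι κ ℝ)).IsAddHaarMeasure :=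
  Measure.pi.isAddHaarMeasure (fun _ : ι => (volume : Measure (κ → ℝ)))

/-- The Haar property for the topology induced by the sup norm. -/
instance matrixNormIsAddHaar [Fintype ι] [Fintype κ] :
    @Measure.IsAddHaarMeasure (Matrix ι κ ℝ) _ (Matrix.normedAddCommGroup (m := ι) (n := κ)
      (α := ℝ)).toMetricSpace.toPseudoMetricSpace.toUniformSpace.toTopologicalSpace _ volume :=
  Measure.pi.isAddHaarMeasure (fun _ : ι => (volume : Measure (κ → ℝ)))

instance matrixSigmaFinite [Fintype ι] [Fintype κ] :
    SigmaFinite (volume : Measure (Matrix ι κ ℝ)) :=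
  inferInstanceAs (SigmaFinite (volume : Measure (ι → κ → ℝ)))

variable [Fintype ι] [Fintype κ]

lemma lintegral_comp_linearMap {E : Type*} [NormedAddCommGroup E] [NormedSpace ℝ E]
    [FiniteDimensional ℝ E] [MeasurableSpace E] [BorelSpace E] (μ : Measure E) [μ.IsAddHaarMeasure]
    (f : E →ₗ[ℝ] E) (hf : LinearMap.det f ≠ 0) (g : E → ℝ≥0∞) :
    ∫⁻ x, g (f x) ∂μ = ENNReal.ofReal |LinearMap.det f|⁻¹ * ∫⁻ x, g x ∂μ := by
  have h := Measure.map_linearMap_addHaar_eq_smul_addHaar μ hf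
  let e := (LinearEquiv.ofIsUnitDet (f := f) (v := Module.finBasis ℝ E) (v' := Module.finBasis ℝ E)
    (by rw [LinearMap.det_toMatrix]; exact hf.isUnit)).toContinuousLinearEquiv
  have he : ∀ x, e x = f x := fun x => rfl
  have hm : MeasurableEmbedding f := by
    have := e.toHomeomorph.measurableEmbedding
    exact this
  rw [← hm.lintegral_map g, h, lintegral_smul_measure, abs_inv, smul_eq_mul]

/-- Currying matrices preserves Lebesgue measure. -/
lemma measurePreserving_uncurryMatrix :
    MeasurePreserving (fun (X : Matrix ι κ ℝ) (p : ι × κ) => X p.1 p.2) volume volume := by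
  have hmeas : Measurable (fun (X : Matrix ι κ ℝ) (p : ι × κ) => X p.1 p.2) := by
    refine measurable_pi_lambda _ fun p => ?_
    exact (measurable_pi_apply p.2).comp (measurable_pi_apply (X := fun _ : ι => κ → ℝ) p.1)
  refine ⟨hmeas, ?_⟩
  rw [volume_pi]
  symm
  refine Measure.pi_eq fun s hs => ?_
  rw [Measure.map_apply hmeas (MeasurableSet.univ_pi hs)]
  have : (fun (X : Matrix ι κ ℝ) (p : ι × κ) => X p.1 p.2) ⁻¹' (univ.pi s) =
      univ.pi (fun i : ι => univ.pi fun k : κ => s (i, k)) := by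
    ext X
    simp only [mem_preimage, mem_univ_pi, Prod.forall]
    exact ⟨fun h a _ b _ => h a b, fun h a b => h a (mem_univ a) b (mem_univ b)⟩
  rw [this]
  change (Measure.pi fun _ : ι => Measure.pi fun _ : κ => (volume : Measure ℝ)) _ = _
  rw [Measure.pi_pi]
  simp_rw [Measure.pi_pi]
  rw [Fintype.prod_prod_type]

/-- The measurable equivalence between matrices and functions on pairs. -/
def matrixEquivFun (ι κ : Type*) : Matrix ι κ ℝ ≃ᵐ (ι × κ → ℝ) where
  toFun X p := X p.1 p.2
  invFun f i k := f (i, k)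
  left_inv _ := rfl
  right_inv _ := rfl
  measurable_toFun := measurable_pi_lambda _ fun p =>
    (measurable_pi_apply p.2).comp (measurable_pi_apply (X := fun _ : ι => κ → ℝ) p.1)
  measurable_invFun := measurable_pi_lambda _ fun i => measurable_pi_lambda _ fun k =>
    measurable_pi_apply (i, k)

lemma measurePreserving_matrixEquivFun : MeasurePreserving (matrixEquivFun ι κ) volume volume :=
  measurePreserving_uncurryMatrix

lemma measurePreserving_transpose :
    MeasurePreserving (fun X : Matrix ι κ ℝ => Xᵀ) volume volume := by
  have h1 := (measurePreserving_matrixEquivFun (ι := ι) (κ := κ))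
  have h2 := volume_measurePreserving_piCongrLeft (fun _ : κ × ι => ℝ) (Equiv.prodComm ι κ)
  have h3 := (measurePreserving_matrixEquivFun (ι := κ) (κ := ι)).symm
  have := h3.comp (h2.comp h1)
  convert this using 1
  funext X
  ext i j
  change X j i = MeasurableEquiv.piCongrLeft (fun _ => ℝ) (Equiv.prodComm ι κ)
    ((matrixEquivFun ι κ) X) ((Equiv.prodComm ι κ) (j, i))
  rw [MeasurableEquiv.piCongrLeft_apply_apply]
  rfl

lemma det_mulRightLinearMap [DecidableEq κ] (A : Matrix κ κ ℝ) :
    LinearMap.det (mulRightLinearMap ι ℝ A : Matrix ι κ ℝ →ₗ[ℝ] Matrix ι κ ℝ) =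
      A.det ^ Fintype.card ι := by
  have : (mulRightLinearMap ι ℝ A : Matrix ι κ ℝ →ₗ[ℝ] Matrix ι κ ℝ) =
    (LinearMap.pi (fun i => (Matrix.vecMulLinear A) ∘ₗ LinearMap.proj i) :
      (ι → κ → ℝ) →ₗ[ℝ] (ι → κ → ℝ)) := rfl
  rw [this]
  erw [LinearMap.det_pi]
  have h2 : LinearMap.det (Matrix.vecMulLinear A) = A.det := by
    rw [← Matrix.det_transpose, ← LinearMap.det_toLin' Aᵀ]
    congr 1
    ext x i
    simp
  simp [h2]

lemma lintegral_mul_right [DecidableEq κ] (A : Matrix κ κ ℝ) (hA : A.det ≠ 0)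
    (g : Matrix ι κ ℝ → ℝ≥0∞) :
    ∫⁻ X : Matrix ι κ ℝ, g (X * A) = ENNReal.ofReal (|A.det|⁻¹ ^ Fintype.card ι) * ∫⁻ X, g X := by
  have := lintegral_comp_linearMap (volume : Measure (Matrix ι κ ℝ))
    (mulRightLinearMap ι ℝ A) (by rw [det_mulRightLinearMap]; exact pow_ne_zero _ hA) g
  rw [det_mulRightLinearMap, abs_pow, ← inv_pow] at this
  exact this

lemma lintegral_transpose (g : Matrix κ ι ℝ → ℝ≥0∞) :
    ∫⁻ X : Matrix ι κ ℝ, g Xᵀ = ∫⁻ X, g X := by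
  have hm : MeasurableEmbedding (fun X : Matrix ι κ ℝ => Xᵀ) :=
    (Homeomorph.mk (Equiv.mk (fun X : Matrix ι κ ℝ => Xᵀ) (fun X => Xᵀ) (fun X => rfl)
      (fun X => rfl)) (continuous_id.matrix_transpose)
      (continuous_id.matrix_transpose)).measurableEmbedding
  rw [← hm.lintegral_map g, measurePreserving_transpose.map_eq]

lemma lintegral_mul_left [DecidableEq ι] (A : Matrix ι ι ℝ) (hA : A.det ≠ 0)
    (g : Matrix ι κ ℝ → ℝ≥0∞) :
    ∫⁻ X : Matrix ι κ ℝ, g (A * X) = ENNReal.ofReal (|A.det|⁻¹ ^ Fintype.card κ) * ∫⁻ X, g X := by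
  have := lintegral_mul_right (ι := κ) Aᵀ (by rwa [Matrix.det_transpose]) (fun X => g Xᵀ)
  simp only [Matrix.transpose_mul, Matrix.transpose_transpose, Matrix.det_transpose] at this
  rw [lintegral_transpose (fun X => g (A * X)), lintegral_transpose] at this
  exact this

variable {α β : Type*} [Fintype α] [Fintype β]

end MatrixMeasure

section Density

lemma pi_withDensity {ι : Type*} [Fintype ι] {X : ι → Type*} [∀ i, MeasurableSpace (X i)]
    (ν : ∀ i, Measure (X i)) [∀ i, SigmaFinite (ν i)] (f : ∀ i, X i → ℝ)
    (hf : ∀ i, Integrable (f i) (ν i)) (hf0 : ∀ i x, 0 ≤ f i x)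
    [∀ i, SigmaFinite ((ν i).withDensity fun x => ENNReal.ofReal (f i x))] :
    Measure.pi (fun i => (ν i).withDensity fun x => ENNReal.ofReal (f i x)) =
      (Measure.pi ν).withDensity fun x => ENNReal.ofReal (∏ i, f i (x i)) := by
  classical
  refine Measure.pi_eq fun s hs => ?_
  rw [withDensity_apply _ (MeasurableSet.univ_pi hs)]
  have h1 : ∀ i, (ν i).withDensity (fun x => ENNReal.ofReal (f i x)) (s i) =
      ENNReal.ofReal (∫ x, (s i).indicator (f i) x ∂ν i) := by
    intro i
    rw [withDensity_apply _ (hs i), integral_indicator (hs i),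
      ofReal_integral_eq_lintegral_ofReal (hf i).integrableOn (ae_of_all _ (hf0 i))]
  simp_rw [h1]
  rw [← ENNReal.ofReal_prod_of_nonneg fun i _ =>
    integral_nonneg fun x => indicator_nonneg (fun x _ => hf0 i x) x,
    ← integral_fintype_prod_eq_prod, ofReal_integral_eq_lintegral_ofReal
      (Integrable.fintype_prod_dep fun i => (hf i).indicator (hs i))
      (ae_of_all _ fun x => Finset.prod_nonneg fun i _ => indicator_nonneg (fun x _ => hf0 i x) _),
    ← lintegral_indicator (MeasurableSet.univ_pi hs)]
  refine lintegral_congr fun x => ?_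
  by_cases hx : x ∈ univ.pi s
  · rw [indicator_of_mem hx]
    congr 1
    refine Finset.prod_congr rfl fun i _ => ?_
    rw [indicator_of_mem (hx i (mem_univ i))]
  · rw [indicator_of_notMem hx]
    simp only [mem_univ_pi, not_forall] at hx
    obtain ⟨i, hi⟩ := hx
    rw [Finset.prod_eq_zero (Finset.mem_univ i) (indicator_of_notMem hi _), ENNReal.ofReal_zero]

variable {ι κ : Type*} [Fintype ι] [Fintype κ]

/-- The law of a matrix with independent standard Gaussian entries. -/
noncomputable def stdGaussian (ι κ : Type*) [Fintype ι] [Fintype κ] : Measure (Matrix ι κ ℝ) :=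
  (Measure.pi fun _ => Measure.pi fun _ => gaussianReal 0 1 : Measure (ι → κ → ℝ))

instance : IsProbabilityMeasure (stdGaussian ι κ) :=
  inferInstanceAs (IsProbabilityMeasure
    (Measure.pi fun _ => Measure.pi fun _ => gaussianReal 0 1 : Measure (ι → κ → ℝ)))

/-- The density of `stdGaussian`. -/
noncomputable def stdDensity (X : Matrix ι κ ℝ) : ℝ :=
  (√(2 * Real.pi))⁻¹ ^ (Fintype.card ι * Fintype.card κ) *
    Real.exp (-(∑ i, ∑ j, X i j ^ 2) / 2)

lemma stdDensity_pos (X : Matrix ι κ ℝ) : 0 < stdDensity X := by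
  unfold stdDensity; positivity

lemma continuous_stdDensity : Continuous (stdDensity : Matrix ι κ ℝ → ℝ) := by
  unfold stdDensity
  have : ∀ i j, Continuous fun X : Matrix ι κ ℝ => X i j := fun i j =>
    continuous_id.matrix_elem i j
  fun_prop

lemma stdGaussian_eq : stdGaussian ι κ = volume.withDensity fun X => ENNReal.ofReal (stdDensity X) := by
  have hg : gaussianReal 0 1 = volume.withDensity fun x => ENNReal.ofReal (gaussianPDFReal 0 1 x) := by
    rw [gaussianReal_of_var_ne_zero 0 one_ne_zero]
    rfl
  have h1 : (Measure.pi fun _ : κ => gaussianReal 0 1) =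
      (volume : Measure (κ → ℝ)).withDensity
        fun x => ENNReal.ofReal (∏ j, gaussianPDFReal 0 1 (x j)) := by
    have : SigmaFinite (volume.withDensity fun x => ENNReal.ofReal (gaussianPDFReal 0 1 x)) := by
      rw [← hg]; infer_instance
    rw [hg, pi_withDensity (fun _ : κ => (volume : Measure ℝ)) (fun _ => gaussianPDFReal 0 1)
      (fun _ => integrable_gaussianPDFReal 0 1) (fun _ => gaussianPDFReal_nonneg 0 1)]
    rfl
  unfold stdGaussian
  have : SigmaFinite ((volume : Measure (κ → ℝ)).withDensity
      fun x => ENNReal.ofReal (∏ j, gaussianPDFReal 0 1 (x j))) := by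
    rw [← h1]; infer_instance
  rw [h1, pi_withDensity (fun _ : ι => (volume : Measure (κ → ℝ)))
    (fun _ x => ∏ j, gaussianPDFReal 0 1 (x j))
    (fun _ => Integrable.fintype_prod fun _ => integrable_gaussianPDFReal 0 1)
    (fun _ x => Finset.prod_nonneg fun j _ => gaussianPDFReal_nonneg 0 1 _)]
  change (volume : Measure (Matrix ι κ ℝ)).withDensity _ = _
  congr 1
  funext X
  congr 1
  unfold stdDensity gaussianPDFReal
  simp only [NNReal.coe_one, mul_one, sub_zero, Finset.prod_mul_distrib, Finset.prod_const,
    Finset.card_univ]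
  rw [← pow_mul, mul_comm (Fintype.card κ), ← Finset.prod_congr rfl
    (fun i _ => Real.exp_sum Finset.univ (fun j => -X i j ^ 2 / 2)), ← Real.exp_sum]
  congr 2
  simp_rw [← Finset.sum_div, Finset.sum_neg_distrib]

lemma lintegral_stdGaussian (F : Matrix ι κ ℝ → ℝ≥0∞) (hF : Measurable F) :
    ∫⁻ X, F X ∂stdGaussian ι κ = ∫⁻ X, ENNReal.ofReal (stdDensity X) * F X := by
  have h : Measurable fun X : Matrix ι κ ℝ => ENNReal.ofReal (stdDensity X) :=
    ENNReal.measurable_ofReal.comp continuous_stdDensity.measurable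
  rw [stdGaussian_eq, lintegral_withDensity_eq_lintegral_mul _ h hF]
  rfl

lemma sum_sq_eq_trace (X : Matrix ι κ ℝ) : ∑ i, ∑ j, X i j ^ 2 = (Xᵀ * X).trace := by
  rw [Finset.sum_comm]
  simp [Matrix.trace, Matrix.mul_apply, pow_two]

lemma stdDensity_orth_mul [DecidableEq ι] (O : Matrix ι ι ℝ) (hO : Oᵀ * O = 1) (X : Matrix ι κ ℝ) :
    stdDensity (O * X) = stdDensity X := by
  unfold stdDensity
  rw [sum_sq_eq_trace, sum_sq_eq_trace, Matrix.transpose_mul, Matrix.mul_assoc, ← Matrix.mul_assoc Oᵀ,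
    hO, Matrix.one_mul]

lemma sum_sq_transpose (X : Matrix ι κ ℝ) : ∑ i, ∑ j, Xᵀ i j ^ 2 = ∑ i, ∑ j, X i j ^ 2 := by
  rw [Finset.sum_comm]; rfl

lemma stdDensity_transpose (X : Matrix ι κ ℝ) : stdDensity Xᵀ = stdDensity X := by
  unfold stdDensity
  rw [sum_sq_transpose, mul_comm (Fintype.card κ)]

lemma stdDensity_mul_orth [DecidableEq κ] (O : Matrix κ κ ℝ) (hO : Oᵀ * O = 1) (X : Matrix ι κ ℝ) :
    stdDensity (X * O) = stdDensity X := by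
  have hO' : Oᵀᵀ * Oᵀ = 1 := by rw [Matrix.transpose_transpose]; exact mul_eq_one_comm.1 hO
  rw [← stdDensity_transpose, Matrix.transpose_mul, stdDensity_orth_mul _ hO', stdDensity_transpose]

lemma abs_det_of_orth [DecidableEq ι] {O : Matrix ι ι ℝ} (hO : Oᵀ * O = 1) : |O.det| = 1 := by
  have := congrArg Matrix.det hO
  rw [Matrix.det_mul, Matrix.det_transpose, Matrix.det_one] at this
  have h2 : |O.det| * |O.det| = 1 := by rw [← abs_mul, this, abs_one]
  nlinarith [abs_nonneg O.det]

end Density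

section Blocks
variable {ι κ α β : Type*} [Fintype ι] [Fintype κ] [Fintype α] [Fintype β]

lemma measurePreserving_fromRows :
    MeasurePreserving (fun p : Matrix α κ ℝ × Matrix β κ ℝ => fromRows p.1 p.2) volume volume := by
  have h := volume_measurePreserving_sumPiEquivProdPi_symm (fun _ : α ⊕ β => κ → ℝ)
  have e : (fun p : Matrix α κ ℝ × Matrix β κ ℝ => fromRows p.1 p.2) =
      (MeasurableEquiv.sumPiEquivProdPi (fun _ : α ⊕ β => κ → ℝ)).symm := by
    funext p
    ext i j
    rcases i with i | i <;> rfl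
  rw [e]
  exact h

lemma measurePreserving_fromCols :
    MeasurePreserving (fun p : Matrix ι α ℝ × Matrix ι β ℝ => fromCols p.1 p.2) volume volume := by
  have h := measurePreserving_transpose.comp (measurePreserving_fromRows (α := α) (β := β) (κ := ι))
  have h2 := (measurePreserving_transpose (ι := ι) (κ := α)).prod
    (measurePreserving_transpose (ι := ι) (κ := β))
  have e : (fun p : Matrix ι α ℝ × Matrix ι β ℝ => fromCols p.1 p.2) =
      ((fun X => Xᵀ) ∘ fun p : Matrix α ι ℝ × Matrix β ι ℝ => fromRows p.1 p.2) ∘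
        Prod.map (fun X => Xᵀ) (fun X => Xᵀ) := by
    funext p
    ext i j
    rcases j with j | j <;> rfl
  rw [e]
  exact h.comp h2

/-- Assembling a matrix from its blocks `(D, c, A, E)`. -/
def ofBlocks (p : Matrix β α ℝ × Matrix α β ℝ × Matrix α α ℝ × Matrix β β ℝ) :
    Matrix (α ⊕ β) (α ⊕ β) ℝ := fromBlocks p.2.2.1 p.2.1 p.1 p.2.2.2

lemma measurePreserving_ofBlocks :
    MeasurePreserving (ofBlocks (α := α) (β := β)) volume volume := by
  have h1 := measurePreserving_fromRows (α := α) (β := β) (κ := α ⊕ β)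
  have h2 := (measurePreserving_fromCols (ι := α) (α := α) (β := β)).prod
    (measurePreserving_fromCols (ι := β) (α := α) (β := β))
  have h3 : MeasurePreserving (fun p : Matrix β α ℝ × Matrix α β ℝ × Matrix α α ℝ × Matrix β β ℝ =>
      ((p.2.2.1, p.2.1), (p.1, p.2.2.2))) volume volume := by
    have a1 : MeasurePreserving (Prod.swap : Matrix β α ℝ × (Matrix α β ℝ × Matrix α α ℝ × Matrix β β ℝ) → _)
      volume volume := Measure.measurePreserving_swap
    have a2 : MeasurePreserving (MeasurableEquiv.prodAssoc (α := Matrix α β ℝ) (β := Matrix α α ℝ)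
      (γ := Matrix β β ℝ)).symm volume volume := (volume_preserving_prodAssoc).symm
    have a3 : MeasurePreserving (Prod.map (Prod.swap : Matrix α β ℝ × Matrix α α ℝ → _)
      (id : Matrix β β ℝ → _)) volume volume :=
        Measure.measurePreserving_swap.prod (MeasurePreserving.id _)
    have a4 := (a3.comp a2).prod (MeasurePreserving.id (volume : Measure (Matrix β α ℝ)))
    have a5 : MeasurePreserving (MeasurableEquiv.prodAssoc (α := Matrix α α ℝ × Matrix α β ℝ)
      (β := Matrix β β ℝ) (γ := Matrix β α ℝ)) volume volume := volume_preserving_prodAssoc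
    have a6 : MeasurePreserving (Prod.map (id : Matrix α α ℝ × Matrix α β ℝ → _)
      (Prod.swap : Matrix β β ℝ × Matrix β α ℝ → _)) volume volume :=
        (MeasurePreserving.id _).prod Measure.measurePreserving_swap
    exact a6.comp (a5.comp (a4.comp a1))
  have e : ofBlocks (α := α) (β := β) = (fun p : Matrix α (α ⊕ β) ℝ × Matrix β (α ⊕ β) ℝ =>
      fromRows p.1 p.2) ∘ Prod.map (fun p : Matrix α α ℝ × Matrix α β ℝ => fromCols p.1 p.2)
        (fun p : Matrix β α ℝ × Matrix β β ℝ => fromCols p.1 p.2) ∘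
      (fun p : Matrix β α ℝ × Matrix α β ℝ × Matrix α α ℝ × Matrix β β ℝ =>
        ((p.2.2.1, p.2.1), (p.1, p.2.2.2))) := by
    funext p
    ext i j
    rcases i with i | i <;> rcases j with j | j <;> rfl
  rw [e]
  exact h1.comp (h2.comp h3)

end Blocks

section OrthDecomp
variable {α β : Type*} [Fintype α] [Fintype β] [DecidableEq α] [DecidableEq β]

/-- The unipotent block lower triangular matrix. -/
def lowerUnip (U : Matrix β α ℝ) : Matrix (α ⊕ β) (α ⊕ β) ℝ := fromBlocks 1 0 U 1

open scoped MatrixOrder ComplexOrder in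
lemma exists_transpose_mul_self_eq_one_add (V : Matrix β α ℝ) :
    ∃ B : Matrix α α ℝ, Bᵀ * B = 1 + Vᵀ * V ∧ B.det ≠ 0 := by
  have h1 : (1 + Vᵀ * V).PosDef := by
    have h2 : (Vᵀ * V).PosSemidef := by
      have := Matrix.posSemidef_conjTranspose_mul_self V
      rwa [Matrix.conjTranspose_eq_transpose_of_trivial] at this
    exact Matrix.PosDef.one.add_posSemidef h2
  obtain ⟨B, hB⟩ := CStarAlgebra.nonneg_iff_eq_star_mul_self.mp h1.posSemidef.nonneg
  rw [Matrix.star_eq_conjTranspose, Matrix.conjTranspose_eq_transpose_of_trivial] at hB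
  refine ⟨B, hB.symm, fun h0 => ?_⟩
  have := h1.det_pos
  rw [hB, Matrix.det_mul, h0, mul_zero] at this
  exact lt_irrefl _ this

lemma lowerUnip_decomp (U : Matrix β α ℝ) :
    ∃ (O : Matrix (α ⊕ β) (α ⊕ β) ℝ) (R₁ : Matrix α α ℝ) (R₂ : Matrix α β ℝ) (R₃ : Matrix β β ℝ),
      Oᵀ * O = 1 ∧ lowerUnip U = O * fromBlocks R₁ R₂ 0 R₃ ∧ R₁ᵀ * R₁ = 1 + Uᵀ * U ∧
      R₁.det ≠ 0 ∧ R₃.det ≠ 0 ∧ |R₁.det| * |R₃.det| = 1 := by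
  obtain ⟨R, hR, hRd⟩ := exists_transpose_mul_self_eq_one_add U
  obtain ⟨S, hS, hSd⟩ := exists_transpose_mul_self_eq_one_add Uᵀ
  rw [Matrix.transpose_transpose] at hS
  have uR : IsUnit R.det := hRd.isUnit
  have uS : IsUnit S.det := hSd.isUnit
  have uRt : IsUnit Rᵀ.det := by rwa [Matrix.det_transpose]
  have uSt : IsUnit Sᵀ.det := by rwa [Matrix.det_transpose]
  let O : Matrix (α ⊕ β) (α ⊕ β) ℝ := fromBlocks R⁻¹ (-(Uᵀ * S⁻¹)) (U * R⁻¹) S⁻¹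
  have hO : Oᵀ * O = 1 := by
    simp only [O, Matrix.fromBlocks_transpose, Matrix.fromBlocks_multiply, Matrix.transpose_mul,
      Matrix.transpose_neg, Matrix.transpose_transpose, Matrix.transpose_nonsing_inv]
    rw [← Matrix.fromBlocks_one]
    congr 1
    · calc Rᵀ⁻¹ * R⁻¹ + Rᵀ⁻¹ * Uᵀ * (U * R⁻¹) = Rᵀ⁻¹ * (1 + Uᵀ * U) * R⁻¹ := by
            simp only [Matrix.mul_add, Matrix.add_mul, Matrix.mul_one, Matrix.mul_assoc]
        _ = 1 := by
            rw [← hR, ← Matrix.mul_assoc, Matrix.nonsing_inv_mul _ uRt, Matrix.one_mul,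
              Matrix.mul_nonsing_inv _ uR]
    · simp [Matrix.mul_assoc]
    · simp [Matrix.mul_assoc]
    · calc -(Sᵀ⁻¹ * U) * -(Uᵀ * S⁻¹) + Sᵀ⁻¹ * S⁻¹ = Sᵀ⁻¹ * (1 + U * Uᵀ) * S⁻¹ := by
            simp only [Matrix.mul_add, Matrix.add_mul, Matrix.mul_one, Matrix.mul_assoc,
              Matrix.neg_mul, Matrix.mul_neg, neg_neg]
            rw [add_comm]
        _ = 1 := by
            rw [← hS, ← Matrix.mul_assoc, Matrix.nonsing_inv_mul _ uSt, Matrix.one_mul,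
              Matrix.mul_nonsing_inv _ uS]
  have hO' : O * Oᵀ = 1 := mul_eq_one_comm.1 hO
  have hOL : Oᵀ * lowerUnip U = fromBlocks R (Rᵀ⁻¹ * Uᵀ) 0 Sᵀ⁻¹ := by
    simp only [O, lowerUnip, Matrix.fromBlocks_transpose, Matrix.fromBlocks_multiply,
      Matrix.transpose_mul, Matrix.transpose_neg, Matrix.transpose_transpose,
      Matrix.transpose_nonsing_inv]
    congr 1
    · calc Rᵀ⁻¹ * 1 + Rᵀ⁻¹ * Uᵀ * U = Rᵀ⁻¹ * (1 + Uᵀ * U) := by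
            simp only [Matrix.mul_add, Matrix.mul_one, Matrix.mul_assoc]
        _ = R := by rw [← hR, ← Matrix.mul_assoc, Matrix.nonsing_inv_mul _ uRt, Matrix.one_mul]
    · simp
    · simp
    · simp
  have hdec : lowerUnip U = O * fromBlocks R (Rᵀ⁻¹ * Uᵀ) 0 Sᵀ⁻¹ := by
    rw [← hOL, ← Matrix.mul_assoc, hO', Matrix.one_mul]
  have hS3 : (Sᵀ⁻¹).det ≠ 0 := by
    rw [Matrix.det_nonsing_inv, Ring.inverse_eq_inv', Matrix.det_transpose]
    exact inv_ne_zero hSd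
  refine ⟨O, R, _, Sᵀ⁻¹, hO, hdec, hR, hRd, hS3, ?_⟩
  have := congrArg (fun M => |Matrix.det M|) hdec
  simp only [Matrix.det_mul, abs_mul, abs_det_of_orth hO, Matrix.det_fromBlocks_zero₂₁, one_mul] at this
  rw [← this, lowerUnip, Matrix.det_fromBlocks_zero₁₂]
  simp
end OrthDecomp

section NullSets

/-- The functions on a real vector space which are polynomial along every line. -/
def polyOnLines (E : Type*) [AddCommGroup E] [Module ℝ E] : Subalgebra ℝ (E → ℝ) where
  carrier := {f | ∀ x y, ∃ p : Polynomial ℝ, ∀ t, p.eval t = f (x + t • y)}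
  mul_mem' := by
    intro f g hf hg x y
    obtain ⟨p, hp⟩ := hf x y
    obtain ⟨q, hq⟩ := hg x y
    exact ⟨p * q, fun t => by rw [Polynomial.eval_mul, hp, hq]; rfl⟩
  add_mem' := by
    intro f g hf hg x y
    obtain ⟨p, hp⟩ := hf x y
    obtain ⟨q, hq⟩ := hg x y
    exact ⟨p + q, fun t => by rw [Polynomial.eval_add, hp, hq]; rfl⟩
  algebraMap_mem' := fun r x y => ⟨Polynomial.C r, fun t => by rw [Polynomial.eval_C]; rfl⟩

lemma linearMap_mem_polyOnLines {E : Type*} [AddCommGroup E] [Module ℝ E] (l : E →ₗ[ℝ] ℝ) :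
    (l : E → ℝ) ∈ polyOnLines E := fun x y =>
  ⟨Polynomial.C (l x) + Polynomial.X * Polynomial.C (l y), fun t => by
    simp only [Polynomial.eval_add, Polynomial.eval_C, Polynomial.eval_mul, Polynomial.eval_X,
      map_add, map_smul, smul_eq_mul]⟩

lemma entry_mem_polyOnLines {ι κ : Type*} (i : ι) (j : κ) :
    (fun X : Matrix ι κ ℝ => X i j) ∈ polyOnLines (Matrix ι κ ℝ) :=
  linearMap_mem_polyOnLines (Matrix.entryLinearMap ℝ ℝ i j)

lemma det_mem_polyOnLines {E : Type*} [AddCommGroup E] [Module ℝ E] {ι : Type*} [Fintype ι]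
    [DecidableEq ι] (M : E → Matrix ι ι ℝ) (hM : ∀ i j, (fun x => M x i j) ∈ polyOnLines E) :
    (fun x => (M x).det) ∈ polyOnLines E := by
  have h : (fun x => (M x).det) = ∑ s : Equiv.Perm ι, (fun _ => ((Equiv.Perm.sign s : ℤ) : ℝ)) *
      ∏ i, fun x => M x (s i) i := by
    funext x
    simp [Matrix.det_apply']
  rw [h]
  refine Subalgebra.sum_mem _ fun s _ => Subalgebra.mul_mem _ ?_
    (Subalgebra.prod_mem _ fun i _ => hM _ _)
  exact Subalgebra.algebraMap_mem (polyOnLines E) (((Equiv.Perm.sign s : ℤ) : ℝ))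

lemma measure_zeros_eq_zero {E : Type*} [NormedAddCommGroup E] [NormedSpace ℝ E]
    [FiniteDimensional ℝ E] [MeasurableSpace E] [BorelSpace E] (μ : Measure E) [μ.IsAddHaarMeasure]
    {f : E → ℝ} (hf : f ∈ polyOnLines E) (hfm : Measurable f) {x₀ : E} (h0 : f x₀ ≠ 0) :
    ∀ᵐ x ∂μ, f x ≠ 0 := by
  have hproper : ProperSpace E := FiniteDimensional.proper_real E
  let Z := {x | f x = 0}
  have hZ : MeasurableSet Z := hfm (measurableSet_singleton 0)
  have hm : Measurable fun p : ℝ × E => x₀ + p.1 • (p.2 - x₀) := by fun_prop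
  have hW : MeasurableSet ((fun p : ℝ × E => x₀ + p.1 • (p.2 - x₀)) ⁻¹' Z) := hm hZ
  have h1 : ((volume : Measure ℝ).prod μ) ((fun p : ℝ × E => x₀ + p.1 • (p.2 - x₀)) ⁻¹' Z) = 0 := by
    rw [Measure.prod_apply_symm hW]
    simp only [lintegral_eq_zero_iff (measurable_measure_prodMk_right hW)]
    refine ae_of_all _ fun x => ?_
    obtain ⟨p, hp⟩ := hf x₀ (x - x₀)
    have hp0 : p ≠ 0 := by
      rintro rfl
      have := hp 0
      simp at this
      exact h0 this.symm
    refine (Set.Finite.measure_zero ((p.roots.toFinset.finite_toSet).subset ?_) volume)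
    intro t ht
    have ht' : f (x₀ + t • (x - x₀)) = 0 := ht
    simp [hp0, hp t, ht']
  rw [Measure.prod_apply hW, lintegral_eq_zero_iff (measurable_measure_prodMk_left hW)] at h1
  have h2 : ∃ t : ℝ, t ≠ 0 ∧ μ ((fun x => x₀ + t • (x - x₀)) ⁻¹' Z) = 0 := by
    have h3 : ∀ᵐ t : ℝ, t ≠ 0 := by
      simp [ae_iff]
    exact (h3.and h1).exists
  obtain ⟨t, ht, h4⟩ := h2
  have h5 : (fun x => x₀ + t • (x - x₀)) ⁻¹' Z =
      (fun x => x + -x₀) ⁻¹' ((t • ·) ⁻¹' ((x₀ + ·) ⁻¹' Z)) := by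
    ext x; simp [sub_eq_add_neg]
  rw [h5, measure_preimage_add_right, Measure.addHaar_preimage_smul _ ht,
    measure_preimage_add] at h4
  rw [mul_eq_zero] at h4
  rw [ae_iff]
  simp only [not_not]
  refine h4.resolve_left ?_
  simp [ht]

attribute [local instance] Matrix.normedAddCommGroup Matrix.normedSpace in
lemma ae_ne_zero_of_polyOnLines {ι κ : Type*} [Fintype ι] [Fintype κ] {f : Matrix ι κ ℝ → ℝ}
    (hf : f ∈ polyOnLines (Matrix ι κ ℝ)) (hfm : Measurable f) {x₀ : Matrix ι κ ℝ}
    (h0 : f x₀ ≠ 0) : ∀ᵐ x, f x ≠ 0 :=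
  measure_zeros_eq_zero volume hf hfm h0

variable {ι : Type*} [Fintype ι] [DecidableEq ι]

lemma measurable_det : Measurable (Matrix.det : Matrix ι ι ℝ → ℝ) :=
  (continuous_id.matrix_det).measurable

lemma ae_det_ne_zero : ∀ᵐ X : Matrix ι ι ℝ, X.det ≠ 0 :=
  ae_ne_zero_of_polyOnLines (det_mem_polyOnLines id fun i j => entry_mem_polyOnLines i j)
    measurable_det (x₀ := 1) (by simp)

end NullSets

section ProductLaw
variable {ι κ : Type*} [Fintype ι] [Fintype κ]

lemma stdGaussian_absolutelyContinuous : stdGaussian ι κ ≪ volume := by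
  rw [stdGaussian_eq]; exact withDensity_absolutelyContinuous _ _

variable [DecidableEq ι] [DecidableEq κ]

instance : MeasurableMul₂ (Matrix ι ι ℝ) :=
  ⟨(continuous_fst.matrix_mul continuous_snd).measurable⟩

/-- The law of a product of `k` independent standard Gaussian square matrices. -/
noncomputable def prodLaw (ι : Type*) [Fintype ι] [DecidableEq ι] : ℕ → Measure (Matrix ι ι ℝ)
  | 0 => Measure.dirac 1
  | k + 1 => stdGaussian ι ι ∗ₘ prodLaw ι k

instance (k : ℕ) : IsProbabilityMeasure (prodLaw ι k) := by
  induction k with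
  | zero => unfold prodLaw; infer_instance
  | succ k ih => unfold prodLaw; infer_instance

lemma prodLaw_succ' (k : ℕ) : prodLaw ι (k + 1) = prodLaw ι k ∗ₘ stdGaussian ι ι := by
  induction k with
  | zero => simp [prodLaw, Measure.dirac_one_mconv, Measure.mconv_dirac_one]
  | succ k ih =>
    rw [prodLaw, ih, ← Measure.mconv_assoc, ← prodLaw, ih]

lemma lintegral_prodLaw_zero (F : Matrix ι ι ℝ → ℝ≥0∞) (hF : Measurable F) :
    ∫⁻ X, F X ∂prodLaw ι 0 = F 1 := by
  rw [prodLaw, lintegral_dirac' _ hF]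

lemma lintegral_prodLaw_succ (k : ℕ) (F : Matrix ι ι ℝ → ℝ≥0∞) (hF : Measurable F) :
    ∫⁻ X, F X ∂prodLaw ι (k + 1) = ∫⁻ X, ∫⁻ Y, F (X * Y) ∂prodLaw ι k ∂stdGaussian ι ι := by
  rw [prodLaw, Measure.lintegral_mconv hF]

lemma lintegral_prodLaw_succ' (k : ℕ) (F : Matrix ι ι ℝ → ℝ≥0∞) (hF : Measurable F) :
    ∫⁻ X, F X ∂prodLaw ι (k + 1) = ∫⁻ X, ∫⁻ Y, F (Y * X) ∂prodLaw ι k ∂stdGaussian ι ι := by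
  rw [prodLaw_succ', Measure.lintegral_mconv hF, lintegral_lintegral_swap]
  exact (hF.comp measurable_mul).aemeasurable

lemma ae_prodLaw_det_ne_zero (k : ℕ) : ∀ᵐ X ∂prodLaw ι k, X.det ≠ 0 := by
  have hS : MeasurableSet {X : Matrix ι ι ℝ | X.det = 0} := measurable_det (measurableSet_singleton 0)
  induction k with
  | zero =>
    exact (ae_dirac_iff hS.compl).2 (by simp)
  | succ k ih =>
    have h := lintegral_prodLaw_succ k ({X : Matrix ι ι ℝ | X.det = 0}.indicator 1)
      (measurable_one.indicator hS)
    rw [lintegral_indicator_one hS] at h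
    rw [ae_iff]
    simp only [not_not]
    rw [h]
    refine (lintegral_eq_zero_iff' ?_).2 ?_
    · refine (Measurable.lintegral_prod_right' (f := fun p : Matrix ι ι ℝ × Matrix ι ι ℝ =>
        ({X : Matrix ι ι ℝ | X.det = 0}.indicator 1 (p.1 * p.2) : ℝ≥0∞)) ?_).aemeasurable
      exact (measurable_one.indicator hS).comp measurable_mul
    · filter_upwards [stdGaussian_absolutelyContinuous.ae_le ae_det_ne_zero] with X hX
      refine (lintegral_congr_ae ?_).trans lintegral_zero
      filter_upwards [ih] with Y hY
      simp [Matrix.det_mul, hX, hY]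

lemma lintegral_stdGaussian_mul_orth (O : Matrix κ κ ℝ) (hO : Oᵀ * O = 1)
    (F : Matrix ι κ ℝ → ℝ≥0∞) (hF : Measurable F) :
    ∫⁻ X, F (X * O) ∂stdGaussian ι κ = ∫⁻ X, F X ∂stdGaussian ι κ := by
  have hd : O.det ≠ 0 := by
    intro h
    have := abs_det_of_orth hO
    rw [h, abs_zero] at this
    exact zero_ne_one this
  have hm : Measurable fun X : Matrix ι κ ℝ => X * O :=
    (continuous_id.matrix_mul continuous_const).measurable
  have hFm : Measurable fun X : Matrix ι κ ℝ => F (X * O) := hF.comp hm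
  rw [lintegral_stdGaussian _ hFm, lintegral_stdGaussian _ hF]
  have := lintegral_mul_right (ι := ι) O hd (fun X => ENNReal.ofReal (stdDensity X) * F X)
  simpa [stdDensity_mul_orth O hO, abs_det_of_orth hO] using this

lemma lintegral_prodLaw_mul_orth (k : ℕ) (O : Matrix ι ι ℝ) (hO : Oᵀ * O = 1)
    (F : Matrix ι ι ℝ → ℝ≥0∞) (hF : Measurable F) :
    ∫⁻ X, F (X * O) ∂prodLaw ι (k + 1) = ∫⁻ X, F X ∂prodLaw ι (k + 1) := by
  have hm : Measurable fun X : Matrix ι ι ℝ => X * O :=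
    (continuous_id.matrix_mul continuous_const).measurable
  have hFm : Measurable fun X : Matrix ι ι ℝ => F (X * O) := hF.comp hm
  rw [prodLaw_succ', Measure.lintegral_mconv hFm, Measure.lintegral_mconv hF]
  refine lintegral_congr fun Y => ?_
  have := lintegral_stdGaussian_mul_orth O hO (fun X => F (Y * X))
    (hF.comp (measurable_const_mul Y))
  simpa [Matrix.mul_assoc] using this

end ProductLaw

section Sylvester
variable {α β : Type*} [Fintype α] [Fintype β] [DecidableEq α] [DecidableEq β]

/-- The Sylvester operator `W ↦ W b - y W`. -/
noncomputable def sylv (b : Matrix α α ℝ) (y : Matrix β β ℝ) : Matrix β α ℝ →ₗ[ℝ] Matrix β α ℝ where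
  toFun W := W * b - y * W
  map_add' W W' := by rw [Matrix.add_mul, Matrix.mul_add]; abel
  map_smul' t W := by
    rw [Matrix.smul_mul, Matrix.mul_smul, RingHom.id_apply, smul_sub]

@[simp] lemma sylv_apply (b : Matrix α α ℝ) (y : Matrix β β ℝ) (W : Matrix β α ℝ) :
    sylv b y W = W * b - y * W := rfl

/-- The determinant of the Sylvester operator: the resultant of the characteristic polynomials. -/
noncomputable def sylvDet (b : Matrix α α ℝ) (y : Matrix β β ℝ) : ℝ := LinearMap.det (sylv b y)

lemma continuous_sylvDet :
    Continuous fun p : Matrix α α ℝ × Matrix β β ℝ => sylvDet p.1 p.2 := by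
  unfold sylvDet
  simp_rw [← LinearMap.det_toMatrix (Matrix.stdBasis ℝ β α)]
  refine Continuous.matrix_det (continuous_matrix fun i j => ?_)
  simp only [LinearMap.toMatrix_apply, Matrix.stdBasis, Module.Basis.map_apply, sylv_apply]
  have h1 : Continuous fun p : Matrix α α ℝ × Matrix β β ℝ =>
      (stdBasis ℝ β α j) * p.1 - p.2 * stdBasis ℝ β α j :=
    (continuous_const.matrix_mul continuous_fst).sub (continuous_snd.matrix_mul continuous_const)
  have h2 := LinearMap.continuous_of_finiteDimensional ((Matrix.stdBasis ℝ β α).coord i)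
  exact h2.comp h1

lemma measurable_sylvDet :
    Measurable fun p : Matrix α α ℝ × Matrix β β ℝ => sylvDet p.1 p.2 :=
  continuous_sylvDet.measurable

lemma sylvDet_conj (b : Matrix α α ℝ) (y : Matrix β β ℝ) (g : Matrix α α ℝ) (h : Matrix β β ℝ)
    (hg : IsUnit g.det) (hh : IsUnit h.det) :
    sylvDet (g * b * g⁻¹) (h * y * h⁻¹) = sylvDet b y := by
  let e : Matrix β α ℝ ≃ₗ[ℝ] Matrix β α ℝ :=
    LinearEquiv.ofLinearMap (mulLeftLinearMap α ℝ h ∘ₗ mulRightLinearMap β ℝ g⁻¹)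
      (mulLeftLinearMap α ℝ h⁻¹ ∘ₗ mulRightLinearMap β ℝ g)
      (by ext1 W
          simp [← Matrix.mul_assoc, Matrix.mul_nonsing_inv _ hh]
          simp [Matrix.mul_assoc, Matrix.mul_nonsing_inv _ hg])
      (by ext1 W
          simp [← Matrix.mul_assoc, Matrix.nonsing_inv_mul _ hh]
          simp [Matrix.mul_assoc, Matrix.nonsing_inv_mul _ hg])
  unfold sylvDet
  rw [← LinearMap.det_conj (sylv b y) e]
  congr 1
  ext1 W
  simp [e, Matrix.mul_sub, Matrix.sub_mul]
  simp only [← Matrix.mul_assoc, Matrix.mul_nonsing_inv _ hh, Matrix.one_mul]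
  simp only [Matrix.mul_assoc, Matrix.mul_nonsing_inv _ hg, Matrix.mul_one]

lemma det_shear {V W : Type*} [AddCommGroup V] [AddCommGroup W] [Module ℝ V] [Module ℝ W]
    [FiniteDimensional ℝ V] [FiniteDimensional ℝ W] (S : V →ₗ[ℝ] V) (M : W →ₗ[ℝ] V)
    (L : V × W →ₗ[ℝ] V × W) (hL : ∀ v w, L (v, w) = (S v + M w, w)) :
    LinearMap.det L = LinearMap.det S := by
  let bV := Module.finBasis ℝ V
  let bW := Module.finBasis ℝ W
  rw [← LinearMap.det_toMatrix (bV.prod bW), ← LinearMap.det_toMatrix bV]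
  have : LinearMap.toMatrix (bV.prod bW) (bV.prod bW) L =
      fromBlocks (LinearMap.toMatrix bV bV S) (LinearMap.toMatrix bW bV M) 0 1 := by
    ext i j
    rcases i with i | i <;> rcases j with j | j <;>
      simp [LinearMap.toMatrix_apply, hL, Module.Basis.prod_apply, Matrix.one_apply, Finsupp.single_apply, eq_comm]
  rw [this, Matrix.det_fromBlocks_zero₂₁, Matrix.det_one, mul_one]

end Sylvester

section Triangular
variable {α β : Type*} [Fintype α] [Fintype β] [DecidableEq α] [DecidableEq β]

/-- Integration over block upper triangular matrices. -/
noncomputable def triInt (H : Matrix (α ⊕ β) (α ⊕ β) ℝ → ℝ≥0∞) : ℝ≥0∞ :=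
  ∫⁻ b : Matrix α α ℝ, ∫⁻ y : Matrix β β ℝ, ∫⁻ z : Matrix α β ℝ, H (fromBlocks b z 0 y)

lemma triInt_mul_left (R₁ : Matrix α α ℝ) (R₂ : Matrix α β ℝ) (R₃ : Matrix β β ℝ)
    (h₁ : R₁.det ≠ 0) (h₃ : R₃.det ≠ 0) (H : Matrix (α ⊕ β) (α ⊕ β) ℝ → ℝ≥0∞) :
    triInt (fun T => H (fromBlocks R₁ R₂ 0 R₃ * T)) =
      ENNReal.ofReal (|R₁.det|⁻¹ ^ (Fintype.card α + Fintype.card β) *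
        |R₃.det|⁻¹ ^ Fintype.card β) * triInt H := by
  unfold triInt
  simp only [fromBlocks_multiply, Matrix.mul_zero, Matrix.zero_mul, add_zero, zero_add]
  have hz : ∀ (b : Matrix α α ℝ) (y : Matrix β β ℝ),
      ∫⁻ z : Matrix α β ℝ, H (fromBlocks (R₁ * b) (R₁ * z + R₂ * y) 0 (R₃ * y)) =
        ENNReal.ofReal (|R₁.det|⁻¹ ^ Fintype.card β) *
          ∫⁻ z : Matrix α β ℝ, H (fromBlocks (R₁ * b) z 0 (R₃ * y)) := by
    intro b y
    rw [lintegral_mul_left R₁ h₁ (fun z : Matrix α β ℝ =>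
      H (fromBlocks (R₁ * b) (z + R₂ * y) 0 (R₃ * y))),
      lintegral_add_right_eq_self (fun z : Matrix α β ℝ => H (fromBlocks (R₁ * b) z 0 (R₃ * y)))]
  simp_rw [hz, lintegral_const_mul' _ _ ENNReal.ofReal_ne_top]
  have hy : ∀ b : Matrix α α ℝ,
      ∫⁻ y : Matrix β β ℝ, ∫⁻ z : Matrix α β ℝ, H (fromBlocks (R₁ * b) z 0 (R₃ * y)) =
        ENNReal.ofReal (|R₃.det|⁻¹ ^ Fintype.card β) *
          ∫⁻ y : Matrix β β ℝ, ∫⁻ z : Matrix α β ℝ, H (fromBlocks (R₁ * b) z 0 y) := fun b =>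
    lintegral_mul_left R₃ h₃ (fun y : Matrix β β ℝ =>
      ∫⁻ z : Matrix α β ℝ, H (fromBlocks (R₁ * b) z 0 y))
  simp_rw [hy, lintegral_const_mul' _ _ ENNReal.ofReal_ne_top]
  rw [lintegral_mul_left R₁ h₁ (fun b : Matrix α α ℝ =>
    ∫⁻ y : Matrix β β ℝ, ∫⁻ z : Matrix α β ℝ, H (fromBlocks b z 0 y)), ← mul_assoc, ← mul_assoc,
    ← ENNReal.ofReal_mul (by positivity), ← ENNReal.ofReal_mul (by positivity)]
  congr 2
  ring

lemma triInt_mul_right (R₁ : Matrix α α ℝ) (R₂ : Matrix α β ℝ) (R₃ : Matrix β β ℝ)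
    (h₁ : R₁.det ≠ 0) (h₃ : R₃.det ≠ 0) (H : Matrix (α ⊕ β) (α ⊕ β) ℝ → ℝ≥0∞) :
    triInt (fun T => H (T * fromBlocks R₁ R₂ 0 R₃)) =
      ENNReal.ofReal (|R₁.det|⁻¹ ^ Fintype.card α *
        |R₃.det|⁻¹ ^ (Fintype.card α + Fintype.card β)) * triInt H := by
  unfold triInt
  simp only [fromBlocks_multiply, Matrix.mul_zero, Matrix.zero_mul, add_zero, zero_add]
  have hz : ∀ (b : Matrix α α ℝ) (y : Matrix β β ℝ),
      ∫⁻ z : Matrix α β ℝ, H (fromBlocks (b * R₁) (b * R₂ + z * R₃) 0 (y * R₃)) =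
        ENNReal.ofReal (|R₃.det|⁻¹ ^ Fintype.card α) *
          ∫⁻ z : Matrix α β ℝ, H (fromBlocks (b * R₁) z 0 (y * R₃)) := by
    intro b y
    rw [lintegral_mul_right R₃ h₃ (fun z : Matrix α β ℝ =>
      H (fromBlocks (b * R₁) (b * R₂ + z) 0 (y * R₃))),
      lintegral_add_left_eq_self (fun z : Matrix α β ℝ => H (fromBlocks (b * R₁) z 0 (y * R₃)))]
  simp_rw [hz, lintegral_const_mul' _ _ ENNReal.ofReal_ne_top]
  have hy : ∀ b : Matrix α α ℝ,
      ∫⁻ y : Matrix β β ℝ, ∫⁻ z : Matrix α β ℝ, H (fromBlocks (b * R₁) z 0 (y * R₃)) =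
        ENNReal.ofReal (|R₃.det|⁻¹ ^ Fintype.card β) *
          ∫⁻ y : Matrix β β ℝ, ∫⁻ z : Matrix α β ℝ, H (fromBlocks (b * R₁) z 0 y) := fun b =>
    lintegral_mul_right R₃ h₃ (fun y : Matrix β β ℝ =>
      ∫⁻ z : Matrix α β ℝ, H (fromBlocks (b * R₁) z 0 y))
  simp_rw [hy, lintegral_const_mul' _ _ ENNReal.ofReal_ne_top]
  rw [lintegral_mul_right R₁ h₁ (fun b : Matrix α α ℝ =>
    ∫⁻ y : Matrix β β ℝ, ∫⁻ z : Matrix α β ℝ, H (fromBlocks b z 0 y)), ← mul_assoc, ← mul_assoc,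
    ← ENNReal.ofReal_mul (by positivity), ← ENNReal.ofReal_mul (by positivity)]
  congr 2
  ring

lemma triInt_const_mul (c : ℝ≥0∞) (hc : c ≠ ⊤) (H : Matrix (α ⊕ β) (α ⊕ β) ℝ → ℝ≥0∞) :
    triInt (fun T => c * H T) = c * triInt H := by
  unfold triInt
  simp_rw [lintegral_const_mul' _ _ hc]

lemma triInt_congr {H H' : Matrix (α ⊕ β) (α ⊕ β) ℝ → ℝ≥0∞}
    (h : ∀ b z y, b.det ≠ 0 → y.det ≠ 0 → H (fromBlocks b z 0 y) = H' (fromBlocks b z 0 y)) :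
    triInt H = triInt H' := by
  unfold triInt
  refine lintegral_congr_ae ?_
  filter_upwards [ae_det_ne_zero (ι := α)] with b hb
  refine lintegral_congr_ae ?_
  filter_upwards [ae_det_ne_zero (ι := β)] with y hy
  exact lintegral_congr fun z => h b z y hb hy

lemma stdDensity_fromBlocks (b : Matrix α α ℝ) (z : Matrix α β ℝ) (y : Matrix β β ℝ) :
    stdDensity (fromBlocks b z 0 y) = (√(2 * Real.pi))⁻¹ ^ (Fintype.card α * Fintype.card β) *
      (stdDensity b * stdDensity y * stdDensity z) := by
  unfold stdDensity
  simp only [Fintype.sum_sum_type, fromBlocks_apply₁₁, fromBlocks_apply₁₂, fromBlocks_apply₂₁,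
    fromBlocks_apply₂₂, Fintype.card_sum, Matrix.zero_apply]
  rw [show ∀ a b c d e f g : ℝ, a * ((b * c) * (d * e) * (f * g)) = (a * b * d * f) * (c * e * g) by
    intros; ring, ← Real.exp_add, ← Real.exp_add, ← pow_add, ← pow_add, ← pow_add]
  congr 2
  · ring
  · simp only [Finset.sum_add_distrib]
    simp
    ring

end Triangular

section Area
variable {α β : Type*} [Fintype α] [Fintype β] [DecidableEq α] [DecidableEq β]

attribute [local instance] Matrix.normedAddCommGroup Matrix.normedSpace

/-- Matrix multiplication as a continuous bilinear map. -/
noncomputable def mulBilin (ι κ μ : Type*) [Fintype ι] [Fintype κ] [Fintype μ] :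
    Matrix ι κ ℝ →L[ℝ] Matrix κ μ ℝ →L[ℝ] Matrix ι μ ℝ :=
  LinearMap.toContinuousBilinearMap (LinearMap.mk₂ ℝ (fun (A : Matrix ι κ ℝ) (B : Matrix κ μ ℝ) => A * B)
    Matrix.add_mul Matrix.smul_mul Matrix.mul_add (fun c A B => Matrix.mul_smul A c B))

@[simp] lemma mulBilin_apply {ι κ μ : Type*} [Fintype ι] [Fintype κ] [Fintype μ]
    (A : Matrix ι κ ℝ) (B : Matrix κ μ ℝ) : mulBilin ι κ μ A B = A * B := rfl

lemma hasFDerivAt_matrix_mul {ι κ μ E : Type*} [Fintype ι] [Fintype κ] [Fintype μ]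
    [NormedAddCommGroup E] [NormedSpace ℝ E] {u : E → Matrix ι κ ℝ} {v : E → Matrix κ μ ℝ}
    {u' : E →L[ℝ] Matrix ι κ ℝ} {v' : E →L[ℝ] Matrix κ μ ℝ} {x : E}
    (hu : HasFDerivAt u u' x) (hv : HasFDerivAt v v' x) :
    HasFDerivAt (fun y => u y * v y)
      ((mulBilin ι κ μ).precompR E (u x) v' + (mulBilin ι κ μ).precompL E u' (v x)) x :=
  (mulBilin ι κ μ).hasFDerivAt_of_bilinear hu hv

/-- The coordinates `(U, c, A, E)`. -/
abbrev Coord (α β : Type*) : Type _ :=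
  Matrix β α ℝ × Matrix α β ℝ × Matrix α α ℝ × Matrix β β ℝ

/-- The map sending `(U, c, A, E)` to the blocks `(D, c, A, E)` of the matrix for which the graph
of `U` is an invariant subspace. -/
def graphMap (x : Coord α β) : Coord α β :=
  (x.1 * x.2.2.1 + x.1 * x.2.1 * x.1 - x.2.2.2 * x.1, x.2)

/-- The partial derivative of `graphMap` in the directions of the blocks. -/
def graphShear (U : Matrix β α ℝ) : Matrix α β ℝ × Matrix α α ℝ × Matrix β β ℝ →ₗ[ℝ] Matrix β α ℝ where
  toFun w := U * w.2.1 + U * w.1 * U - w.2.2 * U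
  map_add' w w' := by
    simp only [Prod.snd_add, Prod.fst_add, Matrix.mul_add, Matrix.add_mul]; abel
  map_smul' t w := by
    simp only [Prod.smul_snd, Prod.smul_fst, Matrix.mul_smul, Matrix.smul_mul,
      RingHom.id_apply, smul_sub, smul_add]

lemma graphMap_deriv (x : Coord α β) : ∃ f' : Coord α β →L[ℝ] Coord α β,
    HasFDerivAt (graphMap (α := α) (β := β)) f' x ∧
      f'.det = sylvDet (x.2.2.1 + x.2.1 * x.1) (x.2.2.2 - x.1 * x.2.1) := by
  have hU := ContinuousLinearMap.hasFDerivAt (x := x)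
    (ContinuousLinearMap.fst ℝ (Matrix β α ℝ) (Matrix α β ℝ × Matrix α α ℝ × Matrix β β ℝ))
  have hw := ContinuousLinearMap.hasFDerivAt (x := x)
    (ContinuousLinearMap.snd ℝ (Matrix β α ℝ) (Matrix α β ℝ × Matrix α α ℝ × Matrix β β ℝ))
  have hc := hw.fst
  have hA := hw.snd.fst
  have hE := hw.snd.snd
  have h := (((hasFDerivAt_matrix_mul hU hA).add
    (hasFDerivAt_matrix_mul (hasFDerivAt_matrix_mul hU hc) hU)).sub
      (hasFDerivAt_matrix_mul hE hU)).prodMk hw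
  refine ⟨_, h, ?_⟩
  refine det_shear (sylv (x.2.2.1 + x.2.1 * x.1) (x.2.2.2 - x.1 * x.2.1))
    (graphShear x.1) _ ?_
  intro u w
  change ((x.1 * w.2.1 + u * x.2.2.1) + ((x.1 * x.2.1) * u + (x.1 * w.1 + u * x.2.1) * x.1) -
    (x.2.2.2 * u + w.2.2 * x.1), w) = (u * (x.2.2.1 + x.2.1 * x.1) - (x.2.2.2 - x.1 * x.2.1) * u +
      (x.1 * w.2.1 + x.1 * w.1 * x.1 - w.2.2 * x.1), w)
  congr 1
  simp only [Matrix.mul_add, Matrix.add_mul, Matrix.sub_mul, ← Matrix.mul_assoc]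
  abel

/-- The matrices `U` whose graph is an invariant subspace of `P`. -/
def invGraph (P : Matrix (α ⊕ β) (α ⊕ β) ℝ) : Set (Matrix β α ℝ) :=
  {U | U * P.toBlocks₁₁ + U * P.toBlocks₁₂ * U - P.toBlocks₂₂ * U = P.toBlocks₂₁}

/-- The sum of `G` over the restrictions and quotients of `P` by its invariant graphs. -/
noncomputable def graphSum (Φ : Matrix α α ℝ → Matrix β β ℝ → ℝ≥0∞)
    (P : Matrix (α ⊕ β) (α ⊕ β) ℝ) : ℝ≥0∞ :=
  ∑' U : invGraph P, Φ (P.toBlocks₁₁ + P.toBlocks₁₂ * U.1) (P.toBlocks₂₂ - U.1 * P.toBlocks₁₂)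

/-- The invariant graphs as a fiber of `graphMap`. -/
def invGraphEquiv (y : Coord α β) :
    invGraph (ofBlocks y) ≃ graphMap (α := α) (β := β) ⁻¹' {y} where
  toFun U := ⟨(U.1, y.2), by
    have := U.2
    simp only [invGraph, ofBlocks, toBlocks_fromBlocks₁₁, toBlocks_fromBlocks₁₂,
      toBlocks_fromBlocks₂₁, toBlocks_fromBlocks₂₂, mem_ofPred_eq] at this
    simp only [graphMap, mem_preimage, mem_singleton_iff, this]⟩
  invFun x := ⟨x.1.1, by
    obtain ⟨x, rfl⟩ := x
    simp [invGraph, ofBlocks, graphMap]⟩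
  left_inv U := rfl
  right_inv x := by
    obtain ⟨x, rfl⟩ := x
    rfl

lemma graphSum_ofBlocks_eq (Φ : Matrix α α ℝ → Matrix β β ℝ → ℝ≥0∞)
    (g : Coord α β → ℝ≥0∞) (y : Coord α β) :
    g y * graphSum Φ (ofBlocks y) = ∑' x : graphMap (α := α) (β := β) ⁻¹' {y},
      g (graphMap x.1) * Φ (x.1.2.2.1 + x.1.2.1 * x.1.1) (x.1.2.2.2 - x.1.1 * x.1.2.1) := by
  unfold graphSum
  rw [← ENNReal.tsum_mul_left, ← (invGraphEquiv y).tsum_eq]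
  refine tsum_congr fun U => ?_
  have h1 : graphMap (invGraphEquiv y U).1 = y := (invGraphEquiv y U).2
  rw [h1]
  rfl

/-- The diagonal blocks of `P` in the coordinates adapted to an invariant graph. -/
def coordDiag (x : Coord α β) : Matrix α α ℝ × Matrix β β ℝ :=
  (x.2.2.1 + x.2.1 * x.1, x.2.2.2 - x.1 * x.2.1)

lemma measurable_coordDiag : Measurable (coordDiag (α := α) (β := β)) := by
  have h1 : Continuous fun x : Coord α β => x.2.1 * x.1 :=
    Continuous.matrix_mul (continuous_fst.comp continuous_snd) continuous_fst
  have h2 : Continuous fun x : Coord α β => x.1 * x.2.1 :=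
    Continuous.matrix_mul continuous_fst (continuous_fst.comp continuous_snd)
  have h3 : Continuous fun x : Coord α β => x.2.2.1 :=
    continuous_fst.comp (continuous_snd.comp continuous_snd)
  have h4 : Continuous fun x : Coord α β => x.2.2.2 :=
    continuous_snd.comp (continuous_snd.comp continuous_snd)
  exact ((h3.add h1).prodMk (h4.sub h2)).measurable

lemma measurable_toCoord : Measurable fun P : Matrix (α ⊕ β) (α ⊕ β) ℝ =>
    (P.toBlocks₂₁, P.toBlocks₁₂, P.toBlocks₁₁, P.toBlocks₂₂) := by
  refine Measurable.prodMk ?_ (Measurable.prodMk ?_ (Measurable.prodMk ?_ ?_)) <;>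
  exact (continuous_matrix fun i j => continuous_id.matrix_elem _ _).measurable

instance coordNormIsAddHaar :
    @Measure.IsAddHaarMeasure (Coord α β) _ (Prod.normedAddCommGroup :
      NormedAddCommGroup (Coord α β)).toMetricSpace.toPseudoMetricSpace.toUniformSpace.toTopologicalSpace _ volume := by
  have h1 := matrixNormIsAddHaar (ι := α) (κ := α)
  have h2 := matrixNormIsAddHaar (ι := β) (κ := β)
  have h3 := matrixNormIsAddHaar (ι := α) (κ := β)
  have h4 := matrixNormIsAddHaar (ι := β) (κ := α)
  exact @Measure.prod.instIsAddHaarMeasure _ _ _ _ _ _ _ _ volume volume h4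
    (@Measure.prod.instIsAddHaarMeasure _ _ _ _ _ _ _ _ volume volume h3
      (@Measure.prod.instIsAddHaarMeasure _ _ _ _ _ _ _ _ volume volume h1 h2 _ _ _ _) _ _ _ _) _ _ _ _

lemma lintegral_mul_graphSum_coord (Φ : Matrix α α ℝ → Matrix β β ℝ → ℝ≥0∞)
    (hΦ : Measurable (uncurry Φ)) (h0 : ∀ b y, sylvDet b y = 0 → Φ b y = 0)
    (g : Coord α β → ℝ≥0∞) (hg : Measurable g) :
    Measurable (fun y => g y * graphSum Φ (ofBlocks y)) ∧
      ∫⁻ y, g y * graphSum Φ (ofBlocks y) = ∫⁻ x : Coord α β,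
        ENNReal.ofReal |sylvDet (coordDiag x).1 (coordDiag x).2| *
        (g (graphMap x) * Φ (coordDiag x).1 (coordDiag x).2) := by
  choose f' hf' hdet using graphMap_deriv (α := α) (β := β)
  have hdet' : ∀ x, (f' x).det = sylvDet (coordDiag x).1 (coordDiag x).2 := hdet
  clear hdet
  have hdm : Measurable fun x => (f' x).det := by
    have h1 : (fun x => (f' x).det) =
        (fun p : Matrix α α ℝ × Matrix β β ℝ => sylvDet p.1 p.2) ∘ coordDiag := funext hdet'
    rw [h1]
    exact measurable_sylvDet.comp measurable_coordDiag
  have hΦc : Measurable fun x : Coord α β => Φ (coordDiag x).1 (coordDiag x).2 :=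
    hΦ.comp measurable_coordDiag
  have hgm : Measurable (graphMap (α := α) (β := β)) := by
    have : Continuous (graphMap (α := α) (β := β)) :=
      continuous_iff_continuousAt.2 fun x => (hf' x).continuousAt
    exact this.measurable
  have h := lintegral_fiber_sum (volume : Measure (Coord α β)) (graphMap (α := α) (β := β)) f' hf' hdm
    (fun x => g (graphMap x) * Φ (coordDiag x).1 (coordDiag x).2)
    ((hg.comp hgm).mul hΦc) (by
      intro x hx
      rw [hdet'] at hx
      simp only [h0 (coordDiag x).1 (coordDiag x).2 hx, mul_zero])
  simp_rw [graphSum_ofBlocks_eq Φ g]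
  simp_rw [hdet'] at h
  exact h

lemma lintegral_coord_shear
    (J : Matrix β α ℝ × Matrix α α ℝ × Matrix β β ℝ × Matrix α β ℝ → ℝ≥0∞) (hJ : Measurable J) :
    ∫⁻ x : Coord α β, J (x.1, x.2.2.1 + x.2.1 * x.1, x.2.2.2 - x.1 * x.2.1, x.2.1) =
      ∫⁻ U : Matrix β α ℝ, ∫⁻ b : Matrix α α ℝ, ∫⁻ y : Matrix β β ℝ, ∫⁻ z : Matrix α β ℝ,
        J (U, b, y, z) := by
  have hm3 : Measurable fun x : Coord α β => (x.1, x.2.2.1 + x.2.1 * x.1,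
      x.2.2.2 - x.1 * x.2.1, x.2.1) := by
    have hfst : Measurable fun x : Coord α β => (coordDiag x).1 := by
      have : (fun x : Coord α β => (coordDiag x).1) = Prod.fst ∘ coordDiag := rfl
      rw [this]; exact measurable_fst.comp measurable_coordDiag
    have hsnd : Measurable fun x : Coord α β => (coordDiag x).2 := by
      have : (fun x : Coord α β => (coordDiag x).2) = Prod.snd ∘ coordDiag := rfl
      rw [this]; exact measurable_snd.comp measurable_coordDiag
    exact measurable_fst.prodMk (hfst.prodMk (hsnd.prodMk (by fun_prop)))
  have hJ' : Measurable fun x : Coord α β =>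
      J (x.1, x.2.2.1 + x.2.1 * x.1, x.2.2.2 - x.1 * x.2.1, x.2.1) := hJ.comp hm3
  rw [Measure.volume_eq_prod, lintegral_prod _ hJ'.aemeasurable]
  refine lintegral_congr fun U => ?_
  have hJ'U : Measurable fun w : Matrix α β ℝ × Matrix α α ℝ × Matrix β β ℝ =>
      J (U, w.2.1 + w.1 * U, w.2.2 - U * w.1, w.1) := by
    have hm : Measurable fun w : Matrix α β ℝ × Matrix α α ℝ × Matrix β β ℝ => (U, w) := by fun_prop
    exact hJ'.comp hm
  rw [Measure.volume_eq_prod, lintegral_prod _ hJ'U.aemeasurable]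
  have h1 : ∀ c : Matrix α β ℝ, ∫⁻ w : Matrix α α ℝ × Matrix β β ℝ,
      J (U, w.1 + c * U, w.2 - U * c, c) =
        ∫⁻ b : Matrix α α ℝ, ∫⁻ y : Matrix β β ℝ, J (U, b, y, c) := by
    intro c
    have hm : Measurable fun w : Matrix α α ℝ × Matrix β β ℝ =>
        J (U, w.1 + c * U, w.2 - U * c, c) := by
      have hm : Measurable fun w : Matrix α α ℝ × Matrix β β ℝ => (c, w) := by fun_prop
      exact hJ'U.comp hm
    rw [Measure.volume_eq_prod, lintegral_prod _ hm.aemeasurable]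
    simp_rw [sub_eq_add_neg]
    rw [← lintegral_add_right_eq_self
      (fun b : Matrix α α ℝ => ∫⁻ y : Matrix β β ℝ, J (U, b, y, c)) (c * U)]
    refine lintegral_congr fun A => ?_
    exact lintegral_add_right_eq_self (fun y : Matrix β β ℝ => J (U, A + c * U, y, c)) (-(U * c))
  refine (lintegral_congr h1).trans ?_
  have hm1 : Measurable fun p : (Matrix α β ℝ × Matrix α α ℝ) × Matrix β β ℝ =>
      J (U, p.1.2, p.2, p.1.1) := by
    have hm : Measurable fun p : (Matrix α β ℝ × Matrix α α ℝ) × Matrix β β ℝ =>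
      (U, p.1.2, p.2, p.1.1) := by fun_prop
    exact hJ.comp hm
  rw [lintegral_lintegral_swap (Measurable.lintegral_prod_right' hm1).aemeasurable]
  refine lintegral_congr fun b => ?_
  have hm2 : Measurable fun p : Matrix α β ℝ × Matrix β β ℝ => J (U, b, p.2, p.1) := by
    have hm : Measurable fun p : Matrix α β ℝ × Matrix β β ℝ => (U, b, p.2, p.1) := by fun_prop
    exact hJ.comp hm
  exact lintegral_lintegral_swap hm2.aemeasurable

lemma ofBlocks_graphMap (x : Coord α β) : ofBlocks (graphMap x) = lowerUnip x.1 *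
    fromBlocks (x.2.2.1 + x.2.1 * x.1) x.2.1 0 (x.2.2.2 - x.1 * x.2.1) * lowerUnip (-x.1) := by
  simp only [ofBlocks, graphMap, lowerUnip, fromBlocks_multiply, Matrix.one_mul, Matrix.zero_mul,
    Matrix.mul_zero, Matrix.mul_one, add_zero, zero_add, Matrix.mul_neg]
  congr 1
  · abel
  · simp only [Matrix.mul_add, Matrix.add_mul, Matrix.sub_mul, ← Matrix.mul_assoc]
    abel
  · abel

lemma measurable_graphSum (Φ : Matrix α α ℝ → Matrix β β ℝ → ℝ≥0∞)
    (hΦ : Measurable (uncurry Φ)) (h0 : ∀ b y, sylvDet b y = 0 → Φ b y = 0) :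
    Measurable (graphSum Φ) ∧ ∀ g : Matrix (α ⊕ β) (α ⊕ β) ℝ → ℝ≥0∞, Measurable g →
      ∫⁻ P, g P * graphSum Φ P = ∫⁻ U, triInt fun T => g (lowerUnip U * T * lowerUnip (-U)) *
        (ENNReal.ofReal |sylvDet T.toBlocks₁₁ T.toBlocks₂₂| * Φ T.toBlocks₁₁ T.toBlocks₂₂) := by
  have key := lintegral_mul_graphSum_coord Φ hΦ h0
  have hofb : ∀ P : Matrix (α ⊕ β) (α ⊕ β) ℝ,
      ofBlocks (P.toBlocks₂₁, P.toBlocks₁₂, P.toBlocks₁₁, P.toBlocks₂₂) = P := fun P =>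
    fromBlocks_toBlocks P
  have hmeas : Measurable (graphSum Φ) := by
    have := ((key 1 measurable_one).1).comp measurable_toCoord
    simpa [comp_def, hofb] using this
  refine ⟨hmeas, fun g hg => ?_⟩
  have hgS : Measurable fun P => g P * graphSum Φ P := hg.mul hmeas
  rw [← measurePreserving_ofBlocks.lintegral_comp hgS,
    (key (fun y => g (ofBlocks y)) (hg.comp measurePreserving_ofBlocks.measurable)).2]
  have hc1 : Continuous fun p : Matrix β α ℝ × Matrix α α ℝ × Matrix β β ℝ × Matrix α β ℝ =>
      lowerUnip p.1 * fromBlocks p.2.1 p.2.2.2 0 p.2.2.1 * lowerUnip (-p.1) := by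
    refine Continuous.matrix_mul (Continuous.matrix_mul ?_ ?_) ?_ <;>
    refine Continuous.matrix_fromBlocks ?_ ?_ ?_ ?_ <;> fun_prop
  have hm2 : Measurable fun p : Matrix β α ℝ × Matrix α α ℝ × Matrix β β ℝ × Matrix α β ℝ =>
    (p.2.1, p.2.2.1) := by fun_prop
  have hΦm : Measurable fun p : Matrix β α ℝ × Matrix α α ℝ × Matrix β β ℝ × Matrix α β ℝ =>
      ENNReal.ofReal |sylvDet p.2.1 p.2.2.1| * Φ p.2.1 p.2.2.1 := by
    have h1 : Measurable fun q : Matrix α α ℝ × Matrix β β ℝ =>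
        ENNReal.ofReal |sylvDet q.1 q.2| * Φ q.1 q.2 :=
      (ENNReal.measurable_ofReal.comp measurable_sylvDet.abs).mul hΦ
    generalize hh : (fun q : Matrix α α ℝ × Matrix β β ℝ =>
        ENNReal.ofReal |sylvDet q.1 q.2| * Φ q.1 q.2) = f at h1
    have h2 : ∀ p : Matrix β α ℝ × Matrix α α ℝ × Matrix β β ℝ × Matrix α β ℝ,
      ENNReal.ofReal |sylvDet p.2.1 p.2.2.1| * Φ p.2.1 p.2.2.1 = f (p.2.1, p.2.2.1) := by
      intro p; rw [← hh]
    simp_rw [h2]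
    exact h1.comp hm2
  have hgm : Measurable fun p : Matrix β α ℝ × Matrix α α ℝ × Matrix β β ℝ × Matrix α β ℝ =>
      g (lowerUnip p.1 * fromBlocks p.2.1 p.2.2.2 0 p.2.2.1 * lowerUnip (-p.1)) :=
    hg.comp hc1.measurable
  have h := lintegral_coord_shear (fun p => g (lowerUnip p.1 * fromBlocks p.2.1 p.2.2.2 0 p.2.2.1 *
    lowerUnip (-p.1)) * (ENNReal.ofReal |sylvDet p.2.1 p.2.2.1| * Φ p.2.1 p.2.2.1)) (hgm.mul hΦm)
  simp only [triInt, toBlocks_fromBlocks₁₁, toBlocks_fromBlocks₂₂]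
  rw [← h]
  refine lintegral_congr fun x => ?_
  rw [ofBlocks_graphMap, ← mul_assoc, mul_comm _ (g _), mul_assoc]
  rfl

end Area

section FourFold
variable {A B C D : Type*} [MeasureSpace A] [MeasureSpace B] [MeasureSpace C] [MeasureSpace D]
  [SigmaFinite (volume : Measure A)] [SigmaFinite (volume : Measure B)]
  [SigmaFinite (volume : Measure C)] [SigmaFinite (volume : Measure D)]

lemma lintegral_fourfold (f : A × B × C × D → ℝ≥0∞) (hf : Measurable f) :
    ∫⁻ x, f x = ∫⁻ a, ∫⁻ b, ∫⁻ c, ∫⁻ d, f (a, b, c, d) := by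
  rw [Measure.volume_eq_prod, lintegral_prod _ hf.aemeasurable]
  refine lintegral_congr fun a => ?_
  have h1 : Measurable fun x : B × C × D => f (a, x) := by fun_prop
  rw [Measure.volume_eq_prod, lintegral_prod _ h1.aemeasurable]
  refine lintegral_congr fun b => ?_
  have h2 : Measurable fun x : C × D => f (a, b, x) := by fun_prop
  rw [Measure.volume_eq_prod, lintegral_prod _ h2.aemeasurable]

lemma lintegral_fourfold_cbad (f : A × B × C × D → ℝ≥0∞) (hf : Measurable f) :
    ∫⁻ x, f x = ∫⁻ c, ∫⁻ b, ∫⁻ a, ∫⁻ d, f (a, b, c, d) := by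
  have h1 : ∀ a, ∫⁻ b, ∫⁻ c, ∫⁻ d, f (a, b, c, d) = ∫⁻ c, ∫⁻ b, ∫⁻ d, f (a, b, c, d) := by
    intro a
    refine lintegral_lintegral_swap (Measurable.aemeasurable ?_)
    refine Measurable.lintegral_prod_right' (f := fun p : (B × C) × D => f (a, p.1.1, p.1.2, p.2)) ?_
    fun_prop
  rw [lintegral_fourfold f hf]
  simp_rw [h1]
  rw [lintegral_lintegral_swap]
  · refine lintegral_congr fun c => ?_
    refine lintegral_lintegral_swap (Measurable.aemeasurable ?_)
    refine Measurable.lintegral_prod_right' (f := fun p : (A × B) × D => f (p.1.1, p.1.2, c, p.2)) ?_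
    fun_prop
  · refine Measurable.aemeasurable ?_
    refine Measurable.lintegral_prod_right'
      (f := fun p : (A × C) × B => ∫⁻ d, f (p.1.1, p.2, p.1.2, d)) ?_
    refine Measurable.lintegral_prod_right'
      (f := fun p : ((A × C) × B) × D => f (p.1.1.1, p.1.2, p.1.1.2, p.2)) ?_
    fun_prop

lemma lintegral_fourfold_acdb (f : A × B × C × D → ℝ≥0∞) (hf : Measurable f) :
    ∫⁻ x, f x = ∫⁻ a, ∫⁻ c, ∫⁻ d, ∫⁻ b, f (a, b, c, d) := by
  rw [lintegral_fourfold f hf]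
  refine lintegral_congr fun a => ?_
  rw [lintegral_lintegral_swap]
  · refine lintegral_congr fun c => ?_
    refine lintegral_lintegral_swap (Measurable.aemeasurable ?_)
    fun_prop
  · refine Measurable.aemeasurable ?_
    refine Measurable.lintegral_prod_right' (f := fun p : (B × C) × D => f (a, p.1.1, p.1.2, p.2)) ?_
    fun_prop

end FourFold

section QR
variable {α β : Type*} [Fintype α] [Fintype β] [DecidableEq α] [DecidableEq β]

/-- Invariance under left multiplication by orthogonal matrices. -/
def LeftOrthInv {ι κ γ : Type*} [Fintype ι] [DecidableEq ι] (F : Matrix ι κ ℝ → γ) : Prop :=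
  ∀ O : Matrix ι ι ℝ, Oᵀ * O = 1 → ∀ X, F (O * X) = F X

/-- The Jacobian weight `√det(1 + UᵀU)` of a graph. -/
noncomputable def graphWeight (U : Matrix β α ℝ) : ℝ := Real.sqrt (1 + Uᵀ * U).det

lemma measurable_graphWeight : Measurable (graphWeight (α := α) (β := β)) := by
  have h : Continuous (graphWeight (α := α) (β := β)) := by
    refine Real.continuous_sqrt.comp (Continuous.matrix_det ?_)
    exact continuous_const.add (continuous_id.matrix_transpose.matrix_mul continuous_id)
  exact h.measurable

/-- The total mass of the graph weights. -/
noncomputable def graphMass (α β : Type*) [Fintype α] [Fintype β] [DecidableEq α] : ℝ≥0∞ :=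
  ∫⁻ U : Matrix β α ℝ, ENNReal.ofReal ((graphWeight U)⁻¹ ^ (Fintype.card α + Fintype.card β))

lemma lowerUnip_decomp' (U : Matrix β α ℝ) : ∃ (O : Matrix (α ⊕ β) (α ⊕ β) ℝ) (R₁ : Matrix α α ℝ)
    (R₂ : Matrix α β ℝ) (R₃ : Matrix β β ℝ), Oᵀ * O = 1 ∧
      lowerUnip U = O * fromBlocks R₁ R₂ 0 R₃ ∧ |R₁.det| = graphWeight U ∧ R₁.det ≠ 0 ∧
      R₃.det ≠ 0 ∧ |R₃.det| = |R₁.det|⁻¹ := by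
  obtain ⟨O, R₁, R₂, R₃, hO, hL, hR, h1, h3, h13⟩ := lowerUnip_decomp U
  refine ⟨O, R₁, R₂, R₃, hO, hL, ?_, h1, h3, ?_⟩
  · rw [graphWeight, ← hR, det_mul, det_transpose, Real.sqrt_mul_self_eq_abs]
  · exact eq_inv_of_mul_eq_one_right h13

lemma triInt_congr' {H H' : Matrix (α ⊕ β) (α ⊕ β) ℝ → ℝ≥0∞}
    (h : ∀ b z y, H (fromBlocks b z 0 y) = H' (fromBlocks b z 0 y)) : triInt H = triInt H' :=
  triInt_congr fun b z y _ _ => h b z y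

lemma lintegral_eq_graph (K : Matrix (α ⊕ β) (α ⊕ β) ℝ → ℝ≥0∞) (hK : Measurable K) :
    ∫⁻ X, K X = ∫⁻ U : Matrix β α ℝ, triInt fun T =>
      ENNReal.ofReal (|T.toBlocks₁₁.det| ^ Fintype.card β) * K (lowerUnip U * T) := by
  have hKb : Measurable fun p : Coord α β => K (ofBlocks p) :=
    hK.comp measurePreserving_ofBlocks.measurable
  rw [← measurePreserving_ofBlocks.lintegral_comp hK, lintegral_fourfold_cbad _ hKb]
  have h1 : ∀ᵐ a : Matrix α α ℝ, ∀ z : Matrix α β ℝ,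
      ∫⁻ D : Matrix β α ℝ, ∫⁻ e : Matrix β β ℝ, K (ofBlocks (D, z, a, e)) =
      ∫⁻ U : Matrix β α ℝ, ∫⁻ y : Matrix β β ℝ, ENNReal.ofReal (|a.det| ^ Fintype.card β) *
        K (lowerUnip U * fromBlocks a z 0 y) := by
    filter_upwards [ae_det_ne_zero (ι := α)] with a ha z
    have h2 := lintegral_mul_right a ha
      (fun D : Matrix β α ℝ => ∫⁻ e : Matrix β β ℝ, K (ofBlocks (D, z, a, e)))
    have hp : 0 < |a.det| := abs_pos.2 ha
    have h3 : ∀ U : Matrix β α ℝ, ∫⁻ e : Matrix β β ℝ, K (ofBlocks (U * a, z, a, e)) =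
        ∫⁻ y : Matrix β β ℝ, K (lowerUnip U * fromBlocks a z 0 y) := by
      intro U
      rw [← lintegral_add_right_eq_self (fun e : Matrix β β ℝ => K (ofBlocks (U * a, z, a, e))) (U * z)]
      refine lintegral_congr fun y => ?_
      congr 1
      simp only [ofBlocks, lowerUnip, fromBlocks_multiply, Matrix.one_mul, Matrix.zero_mul,
        Matrix.mul_zero, add_zero]
      rw [add_comm y]
    simp_rw [h3] at h2
    have h4 : ∀ U : Matrix β α ℝ, ∫⁻ y : Matrix β β ℝ, ENNReal.ofReal (|a.det| ^ Fintype.card β) *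
        K (lowerUnip U * fromBlocks a z 0 y) = ENNReal.ofReal (|a.det| ^ Fintype.card β) *
        ∫⁻ y : Matrix β β ℝ, K (lowerUnip U * fromBlocks a z 0 y) := fun U =>
      lintegral_const_mul' _ _ ENNReal.ofReal_ne_top
    simp_rw [h4]
    rw [lintegral_const_mul' _ _ ENNReal.ofReal_ne_top, h2, ← mul_assoc,
      ← ENNReal.ofReal_mul (by positivity), ← mul_pow, mul_inv_cancel₀ hp.ne', one_pow,
      ENNReal.ofReal_one, one_mul]
  have hcont : Continuous fun p : Coord α β =>
      lowerUnip p.1 * fromBlocks p.2.2.1 p.2.1 0 p.2.2.2 := by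
    refine Continuous.matrix_mul ?_ ?_ <;>
    refine Continuous.matrix_fromBlocks ?_ ?_ ?_ ?_ <;> fun_prop
  have hmK : Measurable fun p : Coord α β =>
      K (lowerUnip p.1 * fromBlocks p.2.2.1 p.2.1 0 p.2.2.2) := hK.comp hcont.measurable
  have hmd : Measurable fun p : Coord α β => ENNReal.ofReal (|p.2.2.1.det| ^ Fintype.card β) := by
    have : Continuous fun p : Coord α β => p.2.2.1.det := by
      refine Continuous.matrix_det ?_
      fun_prop
    exact ENNReal.measurable_ofReal.comp (this.abs.pow _).measurable
  have hm := hmd.mul hmK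
  rw [lintegral_congr_ae (h1.mono fun a ha => lintegral_congr ha)]
  have h5 := (lintegral_fourfold_cbad _ hm).symm.trans (lintegral_fourfold_acdb _ hm)
  simp only [Pi.mul_apply] at h5
  simp only [triInt, toBlocks_fromBlocks₁₁]
  exact h5

lemma lintegral_eq_triInt (K : Matrix (α ⊕ β) (α ⊕ β) ℝ → ℝ≥0∞) (hK : Measurable K)
    (hinv : LeftOrthInv K) :
    ∫⁻ X, K X = graphMass α β * triInt fun T : Matrix (α ⊕ β) (α ⊕ β) ℝ =>
      ENNReal.ofReal (|T.toBlocks₁₁.det| ^ Fintype.card β) * K T := by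
  rw [lintegral_eq_graph K hK, graphMass, ← lintegral_mul_const]
  swap
  · exact ENNReal.measurable_ofReal.comp (measurable_graphWeight.inv.pow_const _)
  refine lintegral_congr fun U => ?_
  obtain ⟨O, R₁, R₂, R₃, hO, hL, hw, h1, h3, h13⟩ := lowerUnip_decomp' U
  have hp : 0 < |R₁.det| := abs_pos.2 h1
  have h4 := triInt_mul_left R₁ R₂ R₃ h1 h3 (fun T : Matrix (α ⊕ β) (α ⊕ β) ℝ =>
      ENNReal.ofReal (|T.toBlocks₁₁.det| ^ Fintype.card β) * K T)
  have h5 : (triInt fun T => ENNReal.ofReal (|T.toBlocks₁₁.det| ^ Fintype.card β) *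
      K (lowerUnip U * T)) = triInt fun T => ENNReal.ofReal (|R₁.det|⁻¹ ^ Fintype.card β) *
      (ENNReal.ofReal (|(fromBlocks R₁ R₂ 0 R₃ * T).toBlocks₁₁.det| ^ Fintype.card β) *
        K (fromBlocks R₁ R₂ 0 R₃ * T)) := by
    refine triInt_congr' fun b z y => ?_
    rw [hL, Matrix.mul_assoc, hinv O hO, ← mul_assoc, ← ENNReal.ofReal_mul (by positivity)]
    simp only [fromBlocks_multiply, toBlocks_fromBlocks₁₁, Matrix.mul_zero, add_zero, det_mul,
      abs_mul]
    rw [← mul_pow, inv_mul_cancel_left₀ hp.ne']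
  rw [h5, triInt_const_mul _ ENNReal.ofReal_ne_top, h4, ← mul_assoc,
    ← ENNReal.ofReal_mul (by positivity), h13, ← hw]
  congr 2
  have h6 : |R₁.det|⁻¹ ^ Fintype.card β * |R₁.det| ^ Fintype.card β = 1 := by
    rw [← mul_pow, inv_mul_cancel₀ hp.ne', one_pow]
  rw [inv_inv, pow_add]
  linear_combination |R₁.det|⁻¹ ^ Fintype.card β * |R₁.det|⁻¹ ^ Fintype.card α * h6

/-- The constant of the block triangular decomposition of the Gaussian measure. -/
noncomputable def qrConst (α β : Type*) [Fintype α] [Fintype β] [DecidableEq α] : ℝ≥0∞ :=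
  graphMass α β *
    ENNReal.ofReal ((Real.sqrt (2 * Real.pi))⁻¹ ^ (Fintype.card α * Fintype.card β))

lemma triInt_gaussian (H : Matrix (α ⊕ β) (α ⊕ β) ℝ → ℝ≥0∞) (hH : Measurable H) :
    (triInt fun T => ENNReal.ofReal (stdDensity T) * H T) =
      ENNReal.ofReal ((Real.sqrt (2 * Real.pi))⁻¹ ^ (Fintype.card α * Fintype.card β)) *
      ∫⁻ b, ∫⁻ y, ∫⁻ z, H (fromBlocks b z 0 y)
        ∂stdGaussian α β ∂stdGaussian β β ∂stdGaussian α α := by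
  have hc : Continuous fun p : (Matrix α α ℝ × Matrix β β ℝ) × Matrix α β ℝ =>
      fromBlocks p.1.1 p.2 0 p.1.2 := by
    refine Continuous.matrix_fromBlocks ?_ ?_ ?_ ?_ <;> fun_prop
  have hm : Measurable fun p : (Matrix α α ℝ × Matrix β β ℝ) × Matrix α β ℝ =>
      H (fromBlocks p.1.1 p.2 0 p.1.2) := hH.comp hc.measurable
  have hm1 : Measurable fun p : Matrix α α ℝ × Matrix β β ℝ =>
      ∫⁻ z, H (fromBlocks p.1 z 0 p.2) ∂stdGaussian α β := Measurable.lintegral_prod_right' hm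
  have hm2 : Measurable fun b : Matrix α α ℝ =>
      ∫⁻ y, ∫⁻ z, H (fromBlocks b z 0 y) ∂stdGaussian α β ∂stdGaussian β β :=
    Measurable.lintegral_prod_right' hm1
  rw [lintegral_stdGaussian _ hm2, ← lintegral_const_mul' _ _ ENNReal.ofReal_ne_top]
  refine lintegral_congr fun b => ?_
  have hm1b : Measurable fun y : Matrix β β ℝ =>
      ∫⁻ z, H (fromBlocks b z 0 y) ∂stdGaussian α β := hm1.comp measurable_prodMk_left
  rw [lintegral_stdGaussian _ hm1b, ← lintegral_const_mul' _ _ ENNReal.ofReal_ne_top,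
    ← lintegral_const_mul' _ _ ENNReal.ofReal_ne_top]
  refine lintegral_congr fun y => ?_
  have hmb : Measurable fun z : Matrix α β ℝ => H (fromBlocks b z 0 y) := by
    have h : Measurable fun z : Matrix α β ℝ => ((b, y), z) := measurable_prodMk_left
    exact hm.comp h
  rw [lintegral_stdGaussian _ hmb, ← lintegral_const_mul' _ _ ENNReal.ofReal_ne_top,
    ← lintegral_const_mul' _ _ ENNReal.ofReal_ne_top,
    ← lintegral_const_mul' _ _ ENNReal.ofReal_ne_top]
  refine lintegral_congr fun z => ?_
  beta_reduce
  rw [stdDensity_fromBlocks, ENNReal.ofReal_mul (by positivity),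
    ENNReal.ofReal_mul (mul_pos (stdDensity_pos _) (stdDensity_pos _)).le,
    ENNReal.ofReal_mul (stdDensity_pos _).le]
  ring

lemma lintegral_stdGaussian_eq_qr (F : Matrix (α ⊕ β) (α ⊕ β) ℝ → ℝ≥0∞) (hF : Measurable F)
    (hinv : LeftOrthInv F) :
    ∫⁻ X, F X ∂stdGaussian (α ⊕ β) (α ⊕ β) = qrConst α β *
      ∫⁻ b, ∫⁻ y, ∫⁻ z, ENNReal.ofReal (|b.det| ^ Fintype.card β) * F (fromBlocks b z 0 y)
        ∂stdGaussian α β ∂stdGaussian β β ∂stdGaussian α α := by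
  have hd : Measurable fun X : Matrix (α ⊕ β) (α ⊕ β) ℝ => ENNReal.ofReal (stdDensity X) :=
    ENNReal.measurable_ofReal.comp continuous_stdDensity.measurable
  have hd1 : Measurable fun X : Matrix (α ⊕ β) (α ⊕ β) ℝ =>
      ENNReal.ofReal (|X.toBlocks₁₁.det| ^ Fintype.card β) := by
    have : Continuous fun X : Matrix (α ⊕ β) (α ⊕ β) ℝ => X.toBlocks₁₁.det :=
      Continuous.matrix_det (continuous_matrix fun i j => continuous_id.matrix_elem _ _)
    exact ENNReal.measurable_ofReal.comp (this.abs.pow _).measurable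
  have hdF : Measurable fun X : Matrix (α ⊕ β) (α ⊕ β) ℝ =>
    ENNReal.ofReal (stdDensity X) * F X := hd.mul hF
  have hd1F : Measurable fun X : Matrix (α ⊕ β) (α ⊕ β) ℝ =>
    ENNReal.ofReal (|X.toBlocks₁₁.det| ^ Fintype.card β) * F X := hd1.mul hF
  rw [lintegral_stdGaussian F hF, lintegral_eq_triInt _ hdF]
  swap
  · intro O hO X
    beta_reduce
    rw [stdDensity_orth_mul O hO, hinv O hO]
  have h := triInt_gaussian _ hd1F
  simp only [toBlocks_fromBlocks₁₁] at h
  simp_rw [mul_left_comm (ENNReal.ofReal (|_| ^ _)) (ENNReal.ofReal (stdDensity _))]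
  rw [h, qrConst, mul_assoc]

end QR

section Star
variable {α β : Type*} [Fintype α] [Fintype β] [DecidableEq α] [DecidableEq β]

lemma measurable_matrix_inv {ι : Type*} [Fintype ι] [DecidableEq ι] :
    Measurable fun Y : Matrix ι ι ℝ => Y⁻¹ := by
  have h1 : (fun Y : Matrix ι ι ℝ => Y⁻¹) = fun Y => (Y.det)⁻¹ • Y.adjugate := by
    funext Y
    rw [Matrix.inv_def, Ring.inverse_eq_inv']
  rw [h1]
  have h2 : Continuous fun Y : Matrix ι ι ℝ => Y.adjugate := continuous_id.matrix_adjugate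
  have h3 : Measurable fun Y : Matrix ι ι ℝ => (Y.det)⁻¹ := measurable_det.inv
  have h4 : Continuous fun p : ℝ × Matrix ι ι ℝ => p.1 • p.2 := continuous_fst.smul continuous_snd
  exact h4.measurable.comp (h3.prodMk h2.measurable)

lemma ae_stdGaussian_det_ne_zero {ι : Type*} [Fintype ι] [DecidableEq ι] :
    ∀ᵐ X ∂stdGaussian ι ι, X.det ≠ 0 :=
  stdGaussian_absolutelyContinuous.ae_le ae_det_ne_zero

lemma leftOrthInv_lintegral_mul (k : ℕ) {ι : Type*} [Fintype ι] [DecidableEq ι]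
    (F : Matrix ι ι ℝ → ℝ≥0∞) (hF : Measurable F) (hinv : LeftOrthInv F) :
    LeftOrthInv fun X : Matrix ι ι ℝ => ∫⁻ Y, F (Y * X) ∂prodLaw ι k := by
  intro O hO X
  have hm : ∀ X : Matrix ι ι ℝ, Measurable fun Y : Matrix ι ι ℝ => F (Y * X) := fun X =>
    hF.comp (continuous_id.matrix_mul continuous_const).measurable
  rcases k with _ | k
  · beta_reduce
    rw [lintegral_prodLaw_zero _ (hm _), lintegral_prodLaw_zero _ (hm _)]
    rw [Matrix.one_mul, Matrix.one_mul, hinv O hO]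
  · have h := lintegral_prodLaw_mul_orth k O hO _ (hm X)
    simp only [Matrix.mul_assoc] at h
    exact h

lemma lintegral_prodLaw_of_tri (k : ℕ) : ∀ (F : Matrix (α ⊕ β) (α ⊕ β) ℝ → ℝ≥0∞), Measurable F →
    LeftOrthInv F → ∀ (K : ℝ≥0∞), K ≠ ⊤ → ∀ g : Matrix α α ℝ → Matrix β β ℝ → ℝ≥0∞,
    Measurable (uncurry g) →
    (∀ b z y, b.det ≠ 0 → y.det ≠ 0 → F (fromBlocks b z 0 y) =
      K * ENNReal.ofReal (|b.det|⁻¹ ^ Fintype.card β) * g b y) →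
    ∫⁻ X, F X ∂prodLaw (α ⊕ β) k =
      K * qrConst α β ^ k * ∫⁻ b, ∫⁻ y, g b y ∂prodLaw β k ∂prodLaw α k := by
  induction k with
  | zero =>
    intro F hF _ K _ g hg h
    have hg1 : Measurable fun b : Matrix α α ℝ => ∫⁻ y, g b y ∂prodLaw β 0 :=
      Measurable.lintegral_prod_right' hg
    have hg2 : Measurable fun y : Matrix β β ℝ => g 1 y := hg.comp measurable_prodMk_left
    rw [lintegral_prodLaw_zero F hF, lintegral_prodLaw_zero _ hg1, lintegral_prodLaw_zero _ hg2]
    have := h 1 0 1 (by simp) (by simp)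
    rw [fromBlocks_one] at this
    simp [this]
  | succ k ih =>
    intro F hF hinv K hK g hg h
    have hmF : Measurable fun p : Matrix (α ⊕ β) (α ⊕ β) ℝ × Matrix (α ⊕ β) (α ⊕ β) ℝ =>
        F (p.2 * p.1) := by
      have : Continuous fun p : Matrix (α ⊕ β) (α ⊕ β) ℝ × Matrix (α ⊕ β) (α ⊕ β) ℝ => p.2 * p.1 :=
        continuous_snd.matrix_mul continuous_fst
      exact hF.comp this.measurable
    have hmH : Measurable fun X : Matrix (α ⊕ β) (α ⊕ β) ℝ => ∫⁻ Y, F (Y * X) ∂prodLaw (α ⊕ β) k :=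
      Measurable.lintegral_prod_right' hmF
    rw [lintegral_prodLaw_succ' k F hF, lintegral_stdGaussian_eq_qr _ hmH
      (leftOrthInv_lintegral_mul k F hF hinv)]
    have hstep : ∀ᵐ b ∂stdGaussian α α, ∀ᵐ y ∂stdGaussian β β, ∀ z : Matrix α β ℝ,
        ENNReal.ofReal (|b.det| ^ Fintype.card β) *
          ∫⁻ Y, F (Y * fromBlocks b z 0 y) ∂prodLaw (α ⊕ β) k =
        K * qrConst α β ^ k * ∫⁻ b', ∫⁻ y', g (b' * b) (y' * y) ∂prodLaw β k ∂prodLaw α k := by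
      filter_upwards [ae_stdGaussian_det_ne_zero (ι := α)] with b hb
      filter_upwards [ae_stdGaussian_det_ne_zero (ι := β)] with y hy z
      have hp : 0 < |b.det| := abs_pos.2 hb
      have hm1 : Measurable fun Y : Matrix (α ⊕ β) (α ⊕ β) ℝ => F (Y * fromBlocks b z 0 y) :=
        hF.comp (continuous_id.matrix_mul continuous_const).measurable
      have hgm : Measurable (uncurry fun (b' : Matrix α α ℝ) (y' : Matrix β β ℝ) =>
          g (b' * b) (y' * y)) := by
        have hc : Continuous fun p : Matrix α α ℝ × Matrix β β ℝ => (p.1 * b, p.2 * y) :=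
          (continuous_fst.matrix_mul continuous_const).prodMk
            (continuous_snd.matrix_mul continuous_const)
        exact hg.comp hc.measurable
      have h1 := ih (fun Y => F (Y * fromBlocks b z 0 y)) hm1
        (fun O hO X => by beta_reduce; rw [Matrix.mul_assoc, hinv O hO])
        (K * ENNReal.ofReal (|b.det|⁻¹ ^ Fintype.card β)) (ENNReal.mul_ne_top hK ENNReal.ofReal_ne_top)
        (fun b' y' => g (b' * b) (y' * y)) hgm (by
          intro b' z' y' hb' hy'
          simp only [fromBlocks_multiply, Matrix.mul_zero, Matrix.zero_mul, add_zero, zero_add]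
          rw [h _ _ _ (by rw [det_mul]; exact mul_ne_zero hb' hb)
            (by rw [det_mul]; exact mul_ne_zero hy' hy), det_mul, abs_mul, mul_inv, mul_pow,
            mul_comm (|b'.det|⁻¹ ^ _), ENNReal.ofReal_mul (by positivity), mul_assoc K _ (ENNReal.ofReal _)])
      rw [h1]
      have h2 : ENNReal.ofReal (|b.det| ^ Fintype.card β) *
          ENNReal.ofReal (|b.det|⁻¹ ^ Fintype.card β) = 1 := by
        rw [← ENNReal.ofReal_mul (by positivity), ← mul_pow, mul_inv_cancel₀ hp.ne', one_pow,
          ENNReal.ofReal_one]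
      rw [mul_right_comm K, ← mul_assoc, mul_comm (K * qrConst α β ^ k) (ENNReal.ofReal _),
        ← mul_assoc, h2, one_mul]
    have hm4 : Measurable fun p : ((Matrix α α ℝ × Matrix β β ℝ) × Matrix α α ℝ) × Matrix β β ℝ =>
        g (p.1.2 * p.1.1.1) (p.2 * p.1.1.2) := by
      have hc : Continuous fun p : ((Matrix α α ℝ × Matrix β β ℝ) × Matrix α α ℝ) × Matrix β β ℝ =>
          (p.1.2 * p.1.1.1, p.2 * p.1.1.2) :=
        (Continuous.matrix_mul (by fun_prop) (by fun_prop)).prodMk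
          (Continuous.matrix_mul (by fun_prop) (by fun_prop))
      exact hg.comp hc.measurable
    have hm3 : Measurable fun p : (Matrix α α ℝ × Matrix β β ℝ) × Matrix α α ℝ =>
        ∫⁻ y', g (p.2 * p.1.1) (y' * p.1.2) ∂prodLaw β k := Measurable.lintegral_prod_right' hm4
    have hm2 : Measurable fun p : Matrix α α ℝ × Matrix β β ℝ =>
        ∫⁻ b', ∫⁻ y', g (b' * p.1) (y' * p.2) ∂prodLaw β k ∂prodLaw α k :=
      Measurable.lintegral_prod_right' hm3
    have hm1 : Measurable fun b : Matrix α α ℝ => ∫⁻ y, ∫⁻ b', ∫⁻ y',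
        g (b' * b) (y' * y) ∂prodLaw β k ∂prodLaw α k ∂stdGaussian β β :=
      Measurable.lintegral_prod_right' hm2
    have hL : ∫⁻ b, ∫⁻ y, ∫⁻ z, ENNReal.ofReal (|b.det| ^ Fintype.card β) *
        ∫⁻ Y, F (Y * fromBlocks b z 0 y) ∂prodLaw (α ⊕ β) k
        ∂stdGaussian α β ∂stdGaussian β β ∂stdGaussian α α =
        K * qrConst α β ^ k * ∫⁻ b, ∫⁻ y, ∫⁻ b', ∫⁻ y', g (b' * b) (y' * y)
          ∂prodLaw β k ∂prodLaw α k ∂stdGaussian β β ∂stdGaussian α α := by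
      rw [← lintegral_const_mul _ hm1]
      refine lintegral_congr_ae ?_
      filter_upwards [hstep] with b hb
      have hm2b : Measurable fun y : Matrix β β ℝ => ∫⁻ b', ∫⁻ y',
        g (b' * b) (y' * y) ∂prodLaw β k ∂prodLaw α k := hm2.comp measurable_prodMk_left
      rw [← lintegral_const_mul _ hm2b]
      refine lintegral_congr_ae ?_
      filter_upwards [hb] with y hy
      simp_rw [hy]
      rw [lintegral_const, measure_univ, mul_one]
    have hgα : Measurable fun b : Matrix α α ℝ => ∫⁻ y, g b y ∂prodLaw β (k + 1) :=
      Measurable.lintegral_prod_right' hg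
    have hR : ∫⁻ b, ∫⁻ y, ∫⁻ b', ∫⁻ y', g (b' * b) (y' * y)
          ∂prodLaw β k ∂prodLaw α k ∂stdGaussian β β ∂stdGaussian α α =
        ∫⁻ b, ∫⁻ y, g b y ∂prodLaw β (k + 1) ∂prodLaw α (k + 1) := by
      rw [lintegral_prodLaw_succ' k _ hgα]
      refine lintegral_congr fun b => ?_
      have hm3b : Measurable fun p : Matrix β β ℝ × Matrix α α ℝ =>
          ∫⁻ y', g (p.2 * b) (y' * p.1) ∂prodLaw β k := by
        have h : Measurable fun p : Matrix β β ℝ × Matrix α α ℝ => ((b, p.1), p.2) := by fun_prop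
        exact hm3.comp h
      rw [lintegral_lintegral_swap hm3b.aemeasurable]
      refine lintegral_congr fun b' => ?_
      have hgb : Measurable fun y : Matrix β β ℝ => g (b' * b) y := hg.comp measurable_prodMk_left
      rw [lintegral_prodLaw_succ' k _ hgb]
    rw [hL, hR, pow_succ]
    ring

/-- The function of `Y` obtained from an integral over block triangular matrices by the substitution
`X = T Y⁻¹`. -/
noncomputable def triShift (ψ : Matrix α α ℝ → Matrix β β ℝ → ℝ≥0∞)
    (Y : Matrix (α ⊕ β) (α ⊕ β) ℝ) : ℝ≥0∞ :=
  ENNReal.ofReal (|Y.det|⁻¹ ^ (Fintype.card α + Fintype.card β)) *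
    triInt fun T => ENNReal.ofReal (stdDensity (T * Y⁻¹)) * ψ T.toBlocks₁₁ T.toBlocks₂₂

lemma leftOrthInv_triShift (ψ : Matrix α α ℝ → Matrix β β ℝ → ℝ≥0∞) :
    LeftOrthInv (triShift ψ) := by
  intro O hO Y
  have hO' : O⁻¹ = Oᵀ := Matrix.inv_eq_left_inv hO
  have hOt : (Oᵀ)ᵀ * Oᵀ = 1 := by
    rw [transpose_transpose]; exact mul_eq_one_comm.1 hO
  unfold triShift
  rw [det_mul, abs_mul, abs_det_of_orth hO, one_mul, Matrix.mul_inv_rev, hO']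
  congr 2
  funext T
  rw [← Matrix.mul_assoc, stdDensity_mul_orth _ hOt]

lemma triInt_conj (U : Matrix β α ℝ) (ψ : Matrix α α ℝ → Matrix β β ℝ → ℝ≥0∞)
    (hψ : ∀ b y g h, IsUnit (Matrix.det g) → IsUnit (Matrix.det h) →
      ψ (g * b * g⁻¹) (h * y * h⁻¹) = ψ b y) : ∃ O : Matrix (α ⊕ β) (α ⊕ β) ℝ, Oᵀ * O = 1 ∧
    ∀ Y : Matrix (α ⊕ β) (α ⊕ β) ℝ, (ENNReal.ofReal (|Y.det|⁻¹ ^ (Fintype.card α + Fintype.card β)) *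
      triInt fun T => ENNReal.ofReal (stdDensity (lowerUnip U * T * lowerUnip (-U) * Y⁻¹)) *
        ψ T.toBlocks₁₁ T.toBlocks₂₂) =
      ENNReal.ofReal ((graphWeight U)⁻¹ ^ (Fintype.card α + Fintype.card β)) * triShift ψ (Y * O) := by
  obtain ⟨O, R₁, R₂, R₃, hO, hL, hw, h1, h3, h13⟩ := lowerUnip_decomp' U
  refine ⟨O, hO, fun Y => ?_⟩
  have hO' : O⁻¹ = Oᵀ := Matrix.inv_eq_left_inv hO
  have hp : 0 < |R₁.det| := abs_pos.2 h1
  have hu1 : IsUnit R₁ := (Matrix.isUnit_iff_isUnit_det _).2 (isUnit_iff_ne_zero.2 h1)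
  have hu3 : IsUnit R₃ := (Matrix.isUnit_iff_isUnit_det _).2 (isUnit_iff_ne_zero.2 h3)
  have hRinv : (fromBlocks R₁ R₂ 0 R₃)⁻¹ = fromBlocks R₁⁻¹ (-(R₁⁻¹ * R₂ * R₃⁻¹)) 0 R₃⁻¹ :=
    Matrix.inv_fromBlocks_zero₂₁_of_isUnit_iff _ _ _ ⟨fun _ => hu3, fun _ => hu1⟩
  have hL' : lowerUnip (-U) = (fromBlocks R₁ R₂ 0 R₃)⁻¹ * O⁻¹ := by
    rw [← Matrix.mul_inv_rev, ← hL]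
    symm
    apply Matrix.inv_eq_left_inv
    simp [lowerUnip, fromBlocks_multiply]
  set H : Matrix (α ⊕ β) (α ⊕ β) ℝ → ℝ≥0∞ := fun T =>
    ENNReal.ofReal (stdDensity (T * (Y * O)⁻¹)) * ψ T.toBlocks₁₁ T.toBlocks₂₂ with hH
  have h4 : (triInt fun T => ENNReal.ofReal (stdDensity (lowerUnip U * T * lowerUnip (-U) * Y⁻¹)) *
        ψ T.toBlocks₁₁ T.toBlocks₂₂) = triInt fun T => H (fromBlocks R₁ R₂ 0 R₃ *
          (T * fromBlocks R₁⁻¹ (-(R₁⁻¹ * R₂ * R₃⁻¹)) 0 R₃⁻¹)) := by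
    refine triInt_congr' fun b z y => ?_
    simp only [hH]
    congr 1
    · rw [← hRinv, hL', hL, Matrix.mul_inv_rev]
      simp only [Matrix.mul_assoc]
      rw [stdDensity_orth_mul O hO]
    · simp only [fromBlocks_multiply, Matrix.mul_zero, Matrix.zero_mul, add_zero, zero_add,
        toBlocks_fromBlocks₁₁, toBlocks_fromBlocks₂₂, ← Matrix.mul_assoc]
      rw [hψ _ _ _ _ (isUnit_iff_ne_zero.2 h1) (isUnit_iff_ne_zero.2 h3)]
  have hd1 : R₁⁻¹.det ≠ 0 := by
    rw [Matrix.det_nonsing_inv, Ring.inverse_eq_inv']; exact inv_ne_zero h1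
  have hd3 : R₃⁻¹.det ≠ 0 := by
    rw [Matrix.det_nonsing_inv, Ring.inverse_eq_inv']; exact inv_ne_zero h3
  rw [h4, triInt_mul_right _ _ _ hd1 hd3 (fun T => H (fromBlocks R₁ R₂ 0 R₃ * T)),
    triInt_mul_left _ _ _ h1 h3 H, triShift, det_mul, abs_mul, abs_det_of_orth hO, mul_one]
  rw [Matrix.det_nonsing_inv, Ring.inverse_eq_inv', abs_inv, Matrix.det_nonsing_inv,
    Ring.inverse_eq_inv', abs_inv, h13, inv_inv, ← mul_assoc, ← mul_assoc, ← mul_assoc,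
    ← ENNReal.ofReal_mul (by positivity), ← ENNReal.ofReal_mul (by positivity),
    ← ENNReal.ofReal_mul (by rw [← hw]; positivity), ← hw]
  congr 2
  have h6 : ∀ n : ℕ, |R₁.det|⁻¹ ^ n * |R₁.det| ^ n = 1 := fun n => by
    rw [← mul_pow, inv_mul_cancel₀ hp.ne', one_pow]
  simp only [pow_add]
  linear_combination |Y.det|⁻¹ ^ Fintype.card α * |Y.det|⁻¹ ^ Fintype.card β *
    |R₁.det|⁻¹ ^ Fintype.card α * |R₁.det|⁻¹ ^ Fintype.card β * (h6 (Fintype.card α) *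
      (|R₁.det|⁻¹ ^ Fintype.card β * |R₁.det| ^ Fintype.card β) + h6 (Fintype.card β))

lemma triShift_fromBlocks (ψ : Matrix α α ℝ → Matrix β β ℝ → ℝ≥0∞) (hψ : Measurable (uncurry ψ))
    (b : Matrix α α ℝ) (z : Matrix α β ℝ) (y : Matrix β β ℝ) (hb : b.det ≠ 0) (hy : y.det ≠ 0) :
    triShift ψ (fromBlocks b z 0 y) =
      ENNReal.ofReal ((Real.sqrt (2 * Real.pi))⁻¹ ^ (Fintype.card α * Fintype.card β)) *
        ENNReal.ofReal (|b.det|⁻¹ ^ Fintype.card β) *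
        ∫⁻ b₁, ∫⁻ y₁, ψ (b₁ * b) (y₁ * y) ∂stdGaussian β β ∂stdGaussian α α := by
  have hpb : 0 < |b.det| := abs_pos.2 hb
  have hpy : 0 < |y.det| := abs_pos.2 hy
  have hT : IsUnit (fromBlocks b z 0 y).det := by
    rw [det_fromBlocks_zero₂₁]; exact isUnit_iff_ne_zero.2 (mul_ne_zero hb hy)
  set H : Matrix (α ⊕ β) (α ⊕ β) ℝ → ℝ≥0∞ := fun T =>
    ENNReal.ofReal (stdDensity (T * (fromBlocks b z 0 y)⁻¹)) * ψ T.toBlocks₁₁ T.toBlocks₂₂ with hH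
  have h1 := triInt_mul_right b z y hb hy H
  have h2 : (triInt fun T => H (T * fromBlocks b z 0 y)) =
      triInt fun T => ENNReal.ofReal (stdDensity T) * ψ (T.toBlocks₁₁ * b) (T.toBlocks₂₂ * y) := by
    refine triInt_congr' fun b' z' y' => ?_
    simp only [hH]
    rw [Matrix.mul_nonsing_inv_cancel_right _ _ hT]
    simp only [fromBlocks_multiply, Matrix.mul_zero, Matrix.zero_mul, add_zero, zero_add,
        toBlocks_fromBlocks₁₁, toBlocks_fromBlocks₂₂]
  have hm : Measurable fun T : Matrix (α ⊕ β) (α ⊕ β) ℝ =>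
      ψ (T.toBlocks₁₁ * b) (T.toBlocks₂₂ * y) := by
    have hc : Continuous fun T : Matrix (α ⊕ β) (α ⊕ β) ℝ =>
        (T.toBlocks₁₁ * b, T.toBlocks₂₂ * y) := by
      refine Continuous.prodMk (Continuous.matrix_mul ?_ continuous_const)
        (Continuous.matrix_mul ?_ continuous_const) <;>
      exact continuous_matrix fun i j => continuous_id.matrix_elem _ _
    exact hψ.comp hc.measurable
  rw [h2, triInt_gaussian _ hm] at h1
  simp only [toBlocks_fromBlocks₁₁, toBlocks_fromBlocks₂₂, lintegral_const, measure_univ,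
    mul_one] at h1
  have h3 : triShift ψ (fromBlocks b z 0 y) = ENNReal.ofReal (|b.det|⁻¹ ^ Fintype.card β) *
      (ENNReal.ofReal (|b.det|⁻¹ ^ Fintype.card α *
        |y.det|⁻¹ ^ (Fintype.card α + Fintype.card β)) * triInt H) := by
    rw [triShift, ← mul_assoc, ← ENNReal.ofReal_mul (by positivity), det_fromBlocks_zero₂₁, abs_mul,
      mul_inv, mul_pow, pow_add |b.det|⁻¹]
    congr 2
    ring
  rw [h3, ← h1]
  ring

lemma measurable_triShift_aux (ψ : Matrix α α ℝ → Matrix β β ℝ → ℝ≥0∞) (hψ : Measurable (uncurry ψ)) :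
    Measurable fun p : Matrix β α ℝ × Matrix (α ⊕ β) (α ⊕ β) ℝ =>
      ENNReal.ofReal (|p.2.det|⁻¹ ^ (Fintype.card α + Fintype.card β)) *
      triInt fun T => ENNReal.ofReal (stdDensity (lowerUnip p.1 * T * lowerUnip (-p.1) * p.2⁻¹)) *
        ψ T.toBlocks₁₁ T.toBlocks₂₂ := by
  have hd : Measurable fun p : Matrix β α ℝ × Matrix (α ⊕ β) (α ⊕ β) ℝ =>
      ENNReal.ofReal (|p.2.det|⁻¹ ^ (Fintype.card α + Fintype.card β)) := by
    have h : Measurable fun Y : Matrix (α ⊕ β) (α ⊕ β) ℝ =>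
      ENNReal.ofReal (|Y.det|⁻¹ ^ (Fintype.card α + Fintype.card β)) :=
      ENNReal.measurable_ofReal.comp ((measurable_det.abs.inv).pow_const _)
    exact h.comp measurable_snd
  refine hd.mul ?_
  have hc : Continuous fun q : Matrix β α ℝ × (Matrix α α ℝ × Matrix β β ℝ × Matrix α β ℝ) ×
      Matrix (α ⊕ β) (α ⊕ β) ℝ =>
      lowerUnip q.1 * fromBlocks q.2.1.1 q.2.1.2.2 0 q.2.1.2.1 * lowerUnip (-q.1) * q.2.2 := by
    refine Continuous.matrix_mul (Continuous.matrix_mul (Continuous.matrix_mul ?_ ?_) ?_) ?_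
    on_goal 4 => fun_prop
    all_goals refine Continuous.matrix_fromBlocks ?_ ?_ ?_ ?_ <;> fun_prop
  have hρ := ENNReal.measurable_ofReal.comp (continuous_stdDensity.comp hc).measurable
  have hre : Measurable fun q : (((Matrix β α ℝ × Matrix (α ⊕ β) (α ⊕ β) ℝ) × Matrix α α ℝ) ×
      Matrix β β ℝ) × Matrix α β ℝ =>
      (q.1.1.1.1, (q.1.1.2, q.1.2, q.2), (q.1.1.1.2)⁻¹) := by
    have hi : Measurable fun q : (((Matrix β α ℝ × Matrix (α ⊕ β) (α ⊕ β) ℝ) × Matrix α α ℝ) ×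
      Matrix β β ℝ) × Matrix α β ℝ => (q.1.1.1.2)⁻¹ :=
      measurable_matrix_inv.comp (by fun_prop :
        Measurable fun q : (((Matrix β α ℝ × Matrix (α ⊕ β) (α ⊕ β) ℝ) × Matrix α α ℝ) ×
      Matrix β β ℝ) × Matrix α β ℝ => q.1.1.1.2)
    fun_prop
  have hψ' : Measurable fun q : (((Matrix β α ℝ × Matrix (α ⊕ β) (α ⊕ β) ℝ) × Matrix α α ℝ) ×
      Matrix β β ℝ) × Matrix α β ℝ => ψ q.1.1.2 q.1.2 := by
    have h : Measurable fun q : (((Matrix β α ℝ × Matrix (α ⊕ β) (α ⊕ β) ℝ) × Matrix α α ℝ) ×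
      Matrix β β ℝ) × Matrix α β ℝ => (q.1.1.2, q.1.2) := by fun_prop
    exact hψ.comp h
  have hm := (hρ.comp hre).mul hψ'
  have h3 := Measurable.lintegral_prod_right' (ν := (volume : Measure (Matrix α β ℝ))) hm
  have h2 := Measurable.lintegral_prod_right' (ν := (volume : Measure (Matrix β β ℝ))) h3
  have h1 := Measurable.lintegral_prod_right' (ν := (volume : Measure (Matrix α α ℝ))) h2
  simp only [triInt, toBlocks_fromBlocks₁₁, toBlocks_fromBlocks₂₂]
  exact h1

lemma measurable_triShift (ψ : Matrix α α ℝ → Matrix β β ℝ → ℝ≥0∞) (hψ : Measurable (uncurry ψ)) :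
    Measurable (triShift ψ) := by
  have h := (measurable_triShift_aux ψ hψ).comp
    (measurable_prodMk_left (x := (0 : Matrix β α ℝ)))
  have h1 : lowerUnip (0 : Matrix β α ℝ) = 1 := fromBlocks_one
  have h2 : triShift ψ = (fun p : Matrix β α ℝ × Matrix (α ⊕ β) (α ⊕ β) ℝ =>
      ENNReal.ofReal (|p.2.det|⁻¹ ^ (Fintype.card α + Fintype.card β)) *
      triInt fun T => ENNReal.ofReal (stdDensity (lowerUnip p.1 * T * lowerUnip (-p.1) * p.2⁻¹)) *
        ψ T.toBlocks₁₁ T.toBlocks₂₂) ∘ Prod.mk 0 := by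
    funext Y
    simp only [Function.comp_apply, neg_zero, h1, Matrix.one_mul, Matrix.mul_one, triShift]
  rw [h2]
  exact h

lemma measurable_stdGaussian_mul (ψ : Matrix α α ℝ → Matrix β β ℝ → ℝ≥0∞)
    (hψ : Measurable (uncurry ψ)) :
    (Measurable fun p : (Matrix α α ℝ × Matrix β β ℝ) × Matrix α α ℝ =>
      ∫⁻ y', ψ (p.2 * p.1.1) (y' * p.1.2) ∂stdGaussian β β) ∧
    Measurable fun p : Matrix α α ℝ × Matrix β β ℝ =>
      ∫⁻ b', ∫⁻ y', ψ (b' * p.1) (y' * p.2) ∂stdGaussian β β ∂stdGaussian α α := by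
  have hm4 : Measurable fun p : ((Matrix α α ℝ × Matrix β β ℝ) × Matrix α α ℝ) × Matrix β β ℝ =>
      ψ (p.1.2 * p.1.1.1) (p.2 * p.1.1.2) := by
    have hc : Continuous fun p : ((Matrix α α ℝ × Matrix β β ℝ) × Matrix α α ℝ) × Matrix β β ℝ =>
        (p.1.2 * p.1.1.1, p.2 * p.1.1.2) :=
      (Continuous.matrix_mul (by fun_prop) (by fun_prop)).prodMk
        (Continuous.matrix_mul (by fun_prop) (by fun_prop))
    exact hψ.comp hc.measurable
  have hm3 : Measurable fun p : (Matrix α α ℝ × Matrix β β ℝ) × Matrix α α ℝ =>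
      ∫⁻ y', ψ (p.2 * p.1.1) (y' * p.1.2) ∂stdGaussian β β := Measurable.lintegral_prod_right' hm4
  have hm2 : Measurable fun p : Matrix α α ℝ × Matrix β β ℝ =>
      ∫⁻ b', ∫⁻ y', ψ (b' * p.1) (y' * p.2) ∂stdGaussian β β ∂stdGaussian α α :=
    Measurable.lintegral_prod_right' hm3
  exact ⟨hm3, hm2⟩

lemma lintegral_prodLaw_prodLaw_succ (k : ℕ) (ψ : Matrix α α ℝ → Matrix β β ℝ → ℝ≥0∞)
    (hψ : Measurable (uncurry ψ)) :
    ∫⁻ b, ∫⁻ y, ∫⁻ b₁, ∫⁻ y₁, ψ (b₁ * b) (y₁ * y) ∂stdGaussian β β ∂stdGaussian α α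
      ∂prodLaw β k ∂prodLaw α k = ∫⁻ b, ∫⁻ y, ψ b y ∂prodLaw β (k + 1) ∂prodLaw α (k + 1) := by
  have hm3 := (measurable_stdGaussian_mul ψ hψ).1
  have hψα : Measurable fun b : Matrix α α ℝ => ∫⁻ y, ψ b y ∂prodLaw β (k + 1) :=
    Measurable.lintegral_prod_right' hψ
  rw [lintegral_prodLaw_succ k _ hψα]
  have hma : Measurable fun p : Matrix α α ℝ × Matrix α α ℝ =>
      ∫⁻ y, ψ (p.1 * p.2) y ∂prodLaw β (k + 1) := by
    have : Continuous fun p : Matrix α α ℝ × Matrix α α ℝ => p.1 * p.2 :=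
      continuous_fst.matrix_mul continuous_snd
    exact hψα.comp this.measurable
  rw [lintegral_lintegral_swap (μ := stdGaussian α α) (ν := prodLaw α k)
    (f := fun x x' => ∫⁻ y, ψ (x * x') y ∂prodLaw β (k + 1)) hma.aemeasurable]
  refine lintegral_congr fun b => ?_
  have hm3b : Measurable fun p : Matrix β β ℝ × Matrix α α ℝ =>
      ∫⁻ y', ψ (p.2 * b) (y' * p.1) ∂stdGaussian β β := by
    have h : Measurable fun p : Matrix β β ℝ × Matrix α α ℝ => ((b, p.1), p.2) := by fun_prop
    exact hm3.comp h
  rw [lintegral_lintegral_swap hm3b.aemeasurable]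
  refine lintegral_congr fun b' => ?_
  have hgb : Measurable fun y : Matrix β β ℝ => ψ (b' * b) y := hψ.comp measurable_prodMk_left
  rw [lintegral_prodLaw_succ k _ hgb]
  have hmb : Measurable fun p : Matrix β β ℝ × Matrix β β ℝ => ψ (b' * b) (p.1 * p.2) := by
    have : Continuous fun p : Matrix β β ℝ × Matrix β β ℝ => p.1 * p.2 :=
      continuous_fst.matrix_mul continuous_snd
    exact hgb.comp this.measurable
  rw [lintegral_lintegral_swap (μ := stdGaussian β β) (ν := prodLaw β k)
    (f := fun y y' => ψ (b' * b) (y * y')) hmb.aemeasurable]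

/-- The joint law of the restriction and the quotient of a product of Gaussian matrices along its
invariant graphs. -/
theorem lintegral_graphSum_prodLaw (k : ℕ) (Φ : Matrix α α ℝ → Matrix β β ℝ → ℝ≥0∞)
    (hΦ : Measurable (uncurry Φ)) (h0 : ∀ b y, sylvDet b y = 0 → Φ b y = 0)
    (hconj : ∀ b y g h, IsUnit (Matrix.det g) → IsUnit (Matrix.det h) →
      Φ (g * b * g⁻¹) (h * y * h⁻¹) = Φ b y) :
    ∫⁻ P, graphSum Φ P ∂prodLaw (α ⊕ β) (k + 1) = qrConst α β ^ (k + 1) *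
      ∫⁻ b, ∫⁻ y, ENNReal.ofReal |sylvDet b y| * Φ b y
        ∂prodLaw β (k + 1) ∂prodLaw α (k + 1) := by
  obtain ⟨hS, harea⟩ := measurable_graphSum Φ hΦ h0
  obtain ⟨ψ, hψdef⟩ : ∃ ψ : Matrix α α ℝ → Matrix β β ℝ → ℝ≥0∞, ∀ b y, ψ b y =
    ENNReal.ofReal |sylvDet b y| * Φ b y := ⟨_, fun _ _ => rfl⟩
  have hψ : Measurable (uncurry ψ) := by
    have : uncurry ψ = fun p => ENNReal.ofReal |sylvDet p.1 p.2| * uncurry Φ p :=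
      funext fun p => hψdef p.1 p.2
    rw [this]
    exact (ENNReal.measurable_ofReal.comp measurable_sylvDet.abs).mul hΦ
  have hψconj : ∀ b y g h, IsUnit (Matrix.det g) → IsUnit (Matrix.det h) →
      ψ (g * b * g⁻¹) (h * y * h⁻¹) = ψ b y := by
    intro b y g h hg hh
    rw [hψdef, hψdef, hconj b y g h hg hh, sylvDet_conj b y g h hg hh]
  have hmS : Measurable fun p : Matrix (α ⊕ β) (α ⊕ β) ℝ × Matrix (α ⊕ β) (α ⊕ β) ℝ =>
      graphSum Φ (p.1 * p.2) := by
    have : Continuous fun p : Matrix (α ⊕ β) (α ⊕ β) ℝ × Matrix (α ⊕ β) (α ⊕ β) ℝ => p.1 * p.2 :=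
      continuous_fst.matrix_mul continuous_snd
    exact hS.comp this.measurable
  simp_rw [← hψdef] at harea ⊢
  rw [lintegral_prodLaw_succ k _ hS, lintegral_lintegral_swap hmS.aemeasurable]
  have hY : ∀ᵐ Y ∂prodLaw (α ⊕ β) k, ∫⁻ X, graphSum Φ (X * Y) ∂stdGaussian (α ⊕ β) (α ⊕ β) =
      ∫⁻ U : Matrix β α ℝ, ENNReal.ofReal (|Y.det|⁻¹ ^ (Fintype.card α + Fintype.card β)) *
      triInt fun T => ENNReal.ofReal (stdDensity (lowerUnip U * T * lowerUnip (-U) * Y⁻¹)) *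
        ψ T.toBlocks₁₁ T.toBlocks₂₂ := by
    filter_upwards [ae_prodLaw_det_ne_zero k] with Y hYd
    have hm1 : Measurable fun X : Matrix (α ⊕ β) (α ⊕ β) ℝ => graphSum Φ (X * Y) :=
      hS.comp (continuous_id.matrix_mul continuous_const).measurable
    have hρm : Measurable fun P : Matrix (α ⊕ β) (α ⊕ β) ℝ =>
        ENNReal.ofReal (stdDensity (P * Y⁻¹)) := by
      have : Continuous fun P : Matrix (α ⊕ β) (α ⊕ β) ℝ => P * Y⁻¹ :=
        continuous_id.matrix_mul continuous_const
      exact ENNReal.measurable_ofReal.comp (continuous_stdDensity.comp this).measurable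
    have h1 := lintegral_mul_right Y hYd (fun P : Matrix (α ⊕ β) (α ⊕ β) ℝ =>
      ENNReal.ofReal (stdDensity (P * Y⁻¹)) * graphSum Φ P)
    simp only [Matrix.mul_nonsing_inv_cancel_right _ _ (isUnit_iff_ne_zero.2 hYd)] at h1
    rw [lintegral_stdGaussian _ hm1, h1, harea _ hρm, Fintype.card_sum,
      lintegral_const_mul' _ _ ENNReal.ofReal_ne_top]
  rw [lintegral_congr_ae hY, lintegral_lintegral_swap]
  swap
  · exact ((measurable_triShift_aux ψ hψ).comp measurable_swap).aemeasurable
  have hGm := measurable_triShift ψ hψ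
  have hU : ∀ U : Matrix β α ℝ, ∫⁻ Y, ENNReal.ofReal (|Y.det|⁻¹ ^ (Fintype.card α + Fintype.card β)) *
      (triInt fun T => ENNReal.ofReal (stdDensity (lowerUnip U * T * lowerUnip (-U) * Y⁻¹)) *
        ψ T.toBlocks₁₁ T.toBlocks₂₂) ∂prodLaw (α ⊕ β) k =
      ENNReal.ofReal ((graphWeight U)⁻¹ ^ (Fintype.card α + Fintype.card β)) *
        ∫⁻ Y, triShift ψ Y ∂prodLaw (α ⊕ β) k := by
    intro U
    obtain ⟨O, hO, h⟩ := triInt_conj U ψ hψconj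
    simp_rw [h]
    rw [lintegral_const_mul' _ _ ENNReal.ofReal_ne_top]
    congr 1
    have := leftOrthInv_lintegral_mul k _ hGm (leftOrthInv_triShift ψ) O hO 1
    simpa using this
  simp_rw [hU]
  have hgw : Measurable fun U : Matrix β α ℝ =>
      ENNReal.ofReal ((graphWeight U)⁻¹ ^ (Fintype.card α + Fintype.card β)) :=
    ENNReal.measurable_ofReal.comp (measurable_graphWeight.inv.pow_const _)
  rw [lintegral_mul_const _ hgw]
  have hm2 := (measurable_stdGaussian_mul ψ hψ).2
  rw [lintegral_prodLaw_of_tri k _ hGm (leftOrthInv_triShift ψ) _ ENNReal.ofReal_ne_top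
    (fun b y => ∫⁻ b₁, ∫⁻ y₁, ψ (b₁ * b) (y₁ * y) ∂stdGaussian β β ∂stdGaussian α α) hm2
    (triShift_fromBlocks ψ hψ)]
  have hfin := lintegral_prodLaw_prodLaw_succ k ψ hψ
  rw [hfin, pow_succ]
  have h7 : ∫⁻ U : Matrix β α ℝ,
      ENNReal.ofReal ((graphWeight U)⁻¹ ^ (Fintype.card α + Fintype.card β)) = graphMass α β := rfl
  rw [h7, qrConst]
  ring

lemma qrConst_mul (α β : Type*) [Fintype α] [Fintype β] [DecidableEq α] [DecidableEq β] :
    qrConst α β * ∫⁻ b, ENNReal.ofReal (|b.det| ^ Fintype.card β) ∂stdGaussian α α = 1 := by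
  have h := lintegral_stdGaussian_eq_qr (α := α) (β := β) (fun _ => 1) measurable_const
    (fun _ _ _ => rfl)
  simp only [mul_one, lintegral_const, measure_univ] at h
  exact h.symm

lemma qrConst_ne_zero (α β : Type*) [Fintype α] [Fintype β] [DecidableEq α] [DecidableEq β] :
    qrConst α β ≠ 0 := by
  intro h
  have := qrConst_mul α β
  simp [h] at this

lemma qrConst_ne_top (α β : Type*) [Fintype α] [Fintype β] [DecidableEq α] [DecidableEq β] :
    qrConst α β ≠ ⊤ := by
  intro h
  have := qrConst_mul α β
  rw [h, ENNReal.top_mul'] at this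
  split_ifs at this <;> simp at this

end Star

section Resultant
open Polynomial
variable {β : Type*} [Fintype β] [DecidableEq β]

lemma det_fromBlocks_of_commute (A B C D : Matrix β β ℝ) (h : C * D = D * C) :
    (fromBlocks A B C D).det = (A * D - B * C).det := by
  have key : ∀ t : ℝ, (D + t • (1 : Matrix β β ℝ)).det ≠ 0 →
      (fromBlocks A B C (D + t • (1 : Matrix β β ℝ))).det =
        (A * (D + t • (1 : Matrix β β ℝ)) - B * C).det := by
    intro t ht
    refine mul_right_cancel₀ ht ?_
    have h1 : (fromBlocks (D + t • (1 : Matrix β β ℝ)) 0 (-C) 1).det =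
        (D + t • (1 : Matrix β β ℝ)).det := by
      rw [det_fromBlocks_zero₁₂, det_one, mul_one]
    conv_lhs => rw [← h1]
    rw [← det_mul, fromBlocks_multiply]
    have h2 : C * (D + t • (1 : Matrix β β ℝ)) + (D + t • (1 : Matrix β β ℝ)) * -C = 0 := by
      simp [Matrix.mul_add, Matrix.add_mul, h]
    rw [h2, Matrix.mul_one, det_fromBlocks_zero₂₁]
    simp [sub_eq_add_neg]
  have hfin : Dense {t : ℝ | (D + t • (1 : Matrix β β ℝ)).det ≠ 0} := by
    have : {t : ℝ | (D + t • (1 : Matrix β β ℝ)).det ≠ 0} =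
        ((-D).charpoly.rootSet ℝ)ᶜ := by
      ext t
      have e : D + t • (1 : Matrix β β ℝ) = Matrix.scalar β t - (-D) := by
        rw [Matrix.scalar_apply, sub_neg_eq_add, add_comm, smul_one_eq_diagonal]
      simp only [Set.mem_ofPred_eq, mem_compl_iff, Polynomial.mem_rootSet, not_and, ne_eq,
        Polynomial.coe_aeval_eq_eval, eval_charpoly, e]
      exact ⟨fun h _ => h, fun h => h (charpoly_monic _).ne_zero⟩
    rw [this]
    exact (Polynomial.rootSet_finite _ _).countable.dense_compl ℝ
  have hc1 : Continuous fun t : ℝ => (fromBlocks A B C (D + t • (1 : Matrix β β ℝ))).det := by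
    fun_prop
  have hc2 : Continuous fun t : ℝ => (A * (D + t • (1 : Matrix β β ℝ)) - B * C).det := by
    fun_prop
  have := congrFun (Continuous.ext_on hfin hc1 hc2 fun t ht => key t ht) 0
  simpa using this

/-- Matrices with two columns as pairs of columns. -/
def twoCols (β : Type*) : Matrix β (Fin 2) ℝ ≃ₗ[ℝ] (β ⊕ β → ℝ) where
  toFun W := Sum.elim (fun i => W i 0) (fun i => W i 1)
  map_add' W W' := by ext (i | i) <;> rfl
  map_smul' t W := by ext (i | i) <;> rfl
  invFun w := of fun i j => if j = 0 then w (Sum.inl i) else w (Sum.inr i)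
  left_inv W := by ext i j; fin_cases j <;> rfl
  right_inv w := by ext (i | i) <;> rfl

lemma sylvDet_eq_det_charpoly (b : Matrix (Fin 2) (Fin 2) ℝ) (y : Matrix β β ℝ) :
    sylvDet b y = (aeval y b.charpoly).det := by
  have h1 : sylvDet b y = (fromBlocks (b 0 0 • (1 : Matrix β β ℝ) - y) (b 1 0 • 1) (b 0 1 • 1)
      (b 1 1 • (1 : Matrix β β ℝ) - y)).det := by
    unfold sylvDet
    rw [← LinearMap.det_conj (sylv b y) (twoCols β), ← LinearMap.det_toLin']
    congr 1
    refine LinearMap.ext fun w => ?_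
    obtain ⟨W, rfl⟩ := (twoCols β).surjective w
    simp only [LinearMap.comp_apply, LinearEquiv.coe_coe, LinearEquiv.symm_apply_apply,
      sylv_apply, toLin'_apply]
    have hW : twoCols β W = Sum.elim (fun i => W i 0) (fun i => W i 1) := rfl
    have hS : ∀ V : Matrix β (Fin 2) ℝ, twoCols β V = Sum.elim (fun i => V i 0) (fun i => V i 1) :=
      fun _ => rfl
    have hy : ∀ (c : ℝ) (v : β → ℝ), (c • (1 : Matrix β β ℝ)) *ᵥ v = c • v := by
      intro c v
      rw [smul_mulVec, one_mulVec]
    rw [hS (W * b - y * W), hW, fromBlocks_mulVec]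
    simp only [Sum.elim_comp_inl, Sum.elim_comp_inr, sub_mulVec, hy]
    congr 1
    all_goals
      ext i
      simp only [Matrix.sub_apply, Matrix.mul_apply, Fin.sum_univ_two, Pi.add_apply, Pi.sub_apply,
        Pi.smul_apply, smul_eq_mul, mulVec, dotProduct]
      ring
  rw [h1, det_fromBlocks_of_commute _ _ _ _ (by simp), charpoly_fin_two]
  congr 1
  simp [Matrix.sub_mul, Matrix.mul_sub, Matrix.trace_fin_two, Matrix.det_fin_two, sq,
    Algebra.algebraMap_eq_smul_one, add_smul, smul_smul, sub_smul]
  simp only [Matrix.add_mul, smul_mul_assoc, Matrix.one_mul]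
  rw [mul_comm (b 1 0), smul_sub, smul_smul]
  abel

lemma det_aeval_of_splits {K : Type*} [Field K] (A : Matrix β β K) (p : K[X]) (hp : p.Monic)
    (hs : p.Splits) : (aeval A p).det =
      (p.roots.map fun r => (-1) ^ Fintype.card β * A.charpoly.eval r).prod := by
  conv_lhs => rw [hs.eq_prod_roots_of_monic hp]
  induction p.roots using Multiset.induction with
  | empty => simp
  | cons r s ih =>
    simp only [Multiset.map_cons, Multiset.prod_cons, map_mul, det_mul, ih]
    congr 1
    rw [eval_charpoly, ← det_neg]
    simp [Algebra.algebraMap_eq_smul_one, smul_one_eq_diagonal]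

/-- The complexification of a real polynomial. -/
noncomputable abbrev cx (p : ℝ[X]) : ℂ[X] := p.map Complex.ofRealHom

lemma det_aeval_ofReal (A : Matrix β β ℝ) (p : ℝ[X]) :
    (((aeval A p).det : ℝ) : ℂ) = (aeval (A.map Complex.ofRealHom) (cx p)).det := by
  have h := RingHom.map_det Complex.ofRealHom (aeval A p)
  rw [Complex.ofRealHom_eq_coe] at h
  rw [h]
  congr 1
  have := Polynomial.map_aeval_eq_aeval_map (S := Matrix β β ℝ) (T := ℂ) (U := Matrix β β ℂ)
    (φ := Complex.ofRealHom) (ψ := Complex.ofRealHom.mapMatrix) (by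
      ext x i j
      simp [Matrix.algebraMap_matrix_apply, Matrix.map_apply]
      split_ifs <;> simp) p A
  rw [this]
  rfl

lemma ofReal_sylvDet (b : Matrix (Fin 2) (Fin 2) ℝ) (y : Matrix β β ℝ) :
    ((sylvDet b y : ℝ) : ℂ) = ((cx b.charpoly).roots.map fun r => (cx y.charpoly).eval r).prod := by
  have hcard : Multiset.card (cx b.charpoly).roots = 2 := by
    rw [← (IsAlgClosed.splits _).natDegree_eq_card_roots, natDegree_map,
      charpoly_natDegree_eq_dim, Fintype.card_fin]
  rw [sylvDet_eq_det_charpoly, det_aeval_ofReal, det_aeval_of_splits _ _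
    ((charpoly_monic b).map _) (IsAlgClosed.splits _), Multiset.prod_map_mul,
    Multiset.map_const', Multiset.prod_replicate, hcard, ← pow_mul, mul_comm (Fintype.card β), pow_mul,
    neg_one_sq, one_pow, one_mul, charpoly_map]

lemma sylvDet_eq_det_aeval (b : Matrix (Fin 2) (Fin 2) ℝ) (y : Matrix β β ℝ) :
    sylvDet b y = (aeval b y.charpoly).det := by
  apply Complex.ofReal_injective
  have hcard : Multiset.card (cx b.charpoly).roots = 2 := by
    rw [← (IsAlgClosed.splits _).natDegree_eq_card_roots, natDegree_map,
      charpoly_natDegree_eq_dim, Fintype.card_fin]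
  rw [ofReal_sylvDet, det_aeval_ofReal, det_aeval_of_splits _ _
    ((charpoly_monic y).map _) (IsAlgClosed.splits _), charpoly_map]
  have hb := (IsAlgClosed.splits (cx b.charpoly)).eq_prod_roots_of_monic ((charpoly_monic b).map _)
  have hy := (IsAlgClosed.splits (cx y.charpoly)).eq_prod_roots_of_monic ((charpoly_monic y).map _)
  have e1 : ∀ r, (cx y.charpoly).eval r = ((cx y.charpoly).roots.map fun s => r - s).prod := by
    intro r
    conv_lhs => rw [hy]
    simp [eval_multiset_prod]
  have e2 : ∀ r, (cx b.charpoly).eval r = ((cx b.charpoly).roots.map fun s => r - s).prod := by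
    intro r
    conv_lhs => rw [hb]
    simp [eval_multiset_prod]
  simp only [e1]
  have e3 : ∀ r, (-1) ^ Fintype.card (Fin 2) * (cx b.charpoly).eval r =
      ((cx b.charpoly).roots.map fun s => s - r).prod := by
    intro r
    rw [e2, Fintype.card_fin]
    have h := Multiset.prod_map_neg ((cx b.charpoly).roots.map fun s => r - s)
    rw [Multiset.card_map, hcard, Multiset.map_map] at h
    rw [← h]
    simp
  have e4 : (fun r => (-1) ^ Fintype.card (Fin 2) * eval r (cx b.charpoly)) =
    fun r => ((cx b.charpoly).roots.map fun s => s - r).prod := funext e3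
  rw [show (fun r => (-1) ^ Fintype.card (Fin 2) * eval r (Polynomial.map Complex.ofRealHom b.charpoly)) = _ from e4]
  exact Multiset.prod_map_prod_map _ _

end Resultant

section Count
open Polynomial

/-- The sign of a real number as an integer. -/
noncomputable def isgn (x : ℝ) : ℤ := (SignType.sign x : ℤ)

lemma isgn_mul (x y : ℝ) : isgn (x * y) = isgn x * isgn y := by
  simp [isgn, sign_mul]

lemma isgn_pos {x : ℝ} (h : 0 < x) : isgn x = 1 := by simp [isgn, sign_pos h]
lemma isgn_neg {x : ℝ} (h : x < 0) : isgn x = -1 := by simp [isgn, sign_neg h]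

lemma isgn_prod (s : Finset ℝ) (f : ℝ → ℝ) : isgn (∏ b ∈ s, f b) = ∏ b ∈ s, isgn (f b) := by
  induction s using Finset.induction with
  | empty => simp [isgn]
  | insert a s ha ih => rw [Finset.prod_insert ha, Finset.prod_insert ha, isgn_mul, ih]

lemma sum_prod_isgn (S : Finset ℝ) :
    ∑ a ∈ S, ∏ b ∈ S.erase a, isgn (a - b) = if Even S.card then 0 else 1 := by
  induction S using Finset.induction_on_max with
  | empty => simp
  | insert M S hM ih =>
    have hMS : M ∉ S := fun h => lt_irrefl _ (hM M h)
    rw [Finset.sum_insert hMS, Finset.erase_insert hMS, Finset.card_insert_of_notMem hMS]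
    have h1 : ∏ b ∈ S, isgn (M - b) = 1 :=
      Finset.prod_eq_one fun b hb => isgn_pos (sub_pos.2 (hM b hb))
    have h2 : ∀ a ∈ S, ∏ b ∈ (insert M S).erase a, isgn (a - b) =
        -∏ b ∈ S.erase a, isgn (a - b) := by
      intro a ha
      rw [Finset.erase_insert_of_ne (hM a ha).ne', Finset.prod_insert (by simp [hMS]),
        isgn_neg (sub_neg.2 (hM a ha))]
      ring
    rw [h1, Finset.sum_congr rfl h2, Finset.sum_neg_distrib, ih]
    by_cases h : Even S.card
    · simp [h, Nat.even_add_one]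
    · simp [h, Nat.even_add_one]

lemma isgn_const_of_roots_eq_zero {h : ℝ[X]} (hh : h.roots = 0) (hne : h ≠ 0) (x y : ℝ) :
    isgn (h.eval x) = isgn (h.eval y) := by
  have hno : ∀ z, h.eval z ≠ 0 := by
    intro z hz
    have : z ∈ h.roots := (mem_roots hne).2 hz
    simp [hh] at this
  have key : ∀ x y, h.eval x < 0 → 0 < h.eval y → False := by
    intro x y hx hy
    obtain ⟨z, hz⟩ := mem_range_of_exists_le_of_exists_ge (c := (0 : ℝ)) h.continuous
      ⟨x, hx.le⟩ ⟨y, hy.le⟩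
    exact hno z hz
  rcases lt_or_gt_of_ne (hno x) with hx | hx <;> rcases lt_or_gt_of_ne (hno y) with hy | hy
  · rw [isgn_neg hx, isgn_neg hy]
  · exact (key x y hx hy).elim
  · exact (key y x hy hx).elim
  · rw [isgn_pos hx, isgn_pos hy]

lemma sum_isgn_derivative {χ : ℝ[X]} (hs : χ.Separable) (he : Even χ.roots.toFinset.card) :
    ∑ a ∈ χ.roots.toFinset, isgn ((derivative χ).eval a) = 0 := by
  classical
  obtain ⟨h, hh, -, hr⟩ := exists_prod_multiset_X_sub_C_mul χ
  have hχ : χ ≠ 0 := hs.ne_zero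
  have hne : h ≠ 0 := by
    rintro rfl
    exact hχ (by rw [← hh, mul_zero])
  set S := χ.roots.toFinset with hS
  have hprod : (χ.roots.map fun a => X - C a).prod = ∏ a ∈ S, (X - C a) := by
    rw [Finset.prod, hS, Multiset.toFinset_val, (nodup_roots hs).dedup]
  rw [hprod] at hh
  have hd : ∀ a ∈ S, (derivative χ).eval a = h.eval a * ∏ b ∈ S.erase a, (a - b) := by
    intro a ha
    rw [← hh, ← Finset.mul_prod_erase S _ ha, mul_assoc, derivative_mul]
    simp [eval_prod, mul_comm]
  have e : ∀ a ∈ S, isgn ((derivative χ).eval a) =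
      isgn (h.eval 0) * ∏ b ∈ S.erase a, isgn (a - b) := by
    intro a ha
    rw [hd a ha, isgn_mul, isgn_prod, isgn_const_of_roots_eq_zero hr hne a 0]
  rw [Finset.sum_congr rfl e, ← Finset.mul_sum, sum_prod_isgn, if_pos he, mul_zero]

/-- Monic quadratic divisors. -/
def quadDiv (χ : ℝ[X]) : Set ℝ[X] := {p | p.Monic ∧ p.natDegree = 2 ∧ p ∣ χ}

/-- The real quadratic with two given real roots. -/
noncomputable def realQuad (x : ℝ × ℝ) : ℝ[X] := (X - C x.1) * (X - C x.2)

/-- The real quadratic with a given pair of conjugate roots. -/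
noncomputable def complexQuad (z : ℂ) : ℝ[X] := X ^ 2 - C (2 * z.re) * X + C (‖z‖ ^ 2)

lemma realQuad_monic (x : ℝ × ℝ) : (realQuad x).Monic := (monic_X_sub_C _).mul (monic_X_sub_C _)

lemma realQuad_natDegree (x : ℝ × ℝ) : (realQuad x).natDegree = 2 := by
  rw [realQuad, (monic_X_sub_C _).natDegree_mul (monic_X_sub_C _)]
  simp

lemma complexQuad_monic (z : ℂ) : (complexQuad z).Monic := by
  unfold complexQuad; monicity!

lemma complexQuad_natDegree (z : ℂ) : (complexQuad z).natDegree = 2 := by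
  unfold complexQuad; compute_degree!

lemma cx_complexQuad (z : ℂ) : cx (complexQuad z) = (X - C z) * (X - C (starRingEnd ℂ z)) := by
  have h1 : (2 * (z.re : ℂ)) = z + starRingEnd ℂ z := by
    rw [Complex.add_conj]; push_cast; rfl
  have h2 : ((‖z‖ ^ 2 : ℝ) : ℂ) = z * starRingEnd ℂ z := by
    rw [Complex.mul_conj, Complex.normSq_eq_norm_sq]
  simp only [cx, complexQuad, Polynomial.map_add, Polynomial.map_sub, Polynomial.map_mul,
    Polynomial.map_pow, map_X, map_C, Complex.ofRealHom_eq_coe, h2]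
  rw [show ((2 * z.re : ℝ) : ℂ) = z + starRingEnd ℂ z by
    rw [← h1, Complex.ofReal_mul, Complex.ofReal_ofNat]]
  simp only [C_add, C_mul]
  ring

lemma cx_roots_realQuad (x : ℝ × ℝ) : (cx (realQuad x)).roots = {(x.1 : ℂ), (x.2 : ℂ)} := by
  have : cx (realQuad x) = (({(x.1 : ℂ), (x.2 : ℂ)} : Multiset ℂ).map fun a => X - C a).prod := by
    simp [cx, realQuad]
  rw [this, roots_multiset_prod_X_sub_C]

lemma cx_roots_complexQuad (z : ℂ) : (cx (complexQuad z)).roots = {z, starRingEnd ℂ z} := by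
  have : cx (complexQuad z) =
      (({z, starRingEnd ℂ z} : Multiset ℂ).map fun a => X - C a).prod := by
    rw [cx_complexQuad]; simp
  rw [this, roots_multiset_prod_X_sub_C]

lemma realQuad_resultant {χ q : ℝ[X]} {x : ℝ × ℝ} (h : χ = realQuad x * q) :
    (derivative χ).eval x.1 * (derivative χ).eval x.2 =
      -((x.1 - x.2) ^ 2) * (q.eval x.1 * q.eval x.2) := by
  rw [h, realQuad]
  simp
  ring

lemma eval_ofReal_cx (q : ℝ[X]) (x : ℝ) : (cx q).eval (x : ℂ) = ((q.eval x : ℝ) : ℂ) := by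
  rw [cx, eval_map, ← Complex.ofRealHom_eq_coe, eval₂_at_apply]
  rfl

lemma eval_conj_cx (q : ℝ[X]) (z : ℂ) :
    (cx q).eval (starRingEnd ℂ z) = starRingEnd ℂ ((cx q).eval z) := by
  have := aeval_conj q z
  rwa [aeval_def, aeval_def, ← eval_map, ← eval_map] at this

lemma cx_ne_zero {χ : ℝ[X]} (h : χ ≠ 0) : cx χ ≠ 0 :=
  (Polynomial.map_ne_zero_iff Complex.ofReal_injective).2 h

lemma quadDiv_cases {χ p : ℝ[X]} (hs : χ.Separable) (hp : p ∈ quadDiv χ) :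
    (∃ x : ℝ × ℝ, x.1 < x.2 ∧ x.1 ∈ χ.roots.toFinset ∧ x.2 ∈ χ.roots.toFinset ∧ p = realQuad x) ∨
      (∃ z : ℂ, 0 < z.im ∧ z ∈ (cx χ).roots.toFinset ∧ p = complexQuad z) := by
  obtain ⟨hm, hd, hdvd⟩ := hp
  have hχ : χ ≠ 0 := hs.ne_zero
  by_cases hr : ∃ a, p.IsRoot a
  · left
    obtain ⟨a, ha⟩ := hr
    obtain ⟨r, hr⟩ := dvd_iff_isRoot.2 ha
    have hrm : r.Monic := (monic_X_sub_C a).of_mul_monic_left (hr ▸ hm)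
    have hrd : r.natDegree = 1 := by
      have := (monic_X_sub_C a).natDegree_mul hrm
      rw [← hr, hd, natDegree_X_sub_C] at this
      omega
    obtain ⟨b, hb⟩ : ∃ b, r = X - C b := ⟨-r.coeff 0, by
      conv_lhs => rw [hrm.eq_X_add_C hrd]
      simp⟩
    subst hb
    have hra : χ.IsRoot a := by
      obtain ⟨q, hq⟩ := hdvd
      rw [hq, hr]; simp
    have hrb : χ.IsRoot b := by
      obtain ⟨q, hq⟩ := hdvd
      rw [hq, hr]; simp
    have hab : a ≠ b := by
      rintro rfl
      have := hs.squarefree (X - C a) (hr ▸ hdvd)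
      exact not_isUnit_X_sub_C a this
    rcases lt_or_gt_of_ne hab with h | h
    · exact ⟨(a, b), h, by simp [hχ]; exact hra, by simp [hχ]; exact hrb, hr⟩
    · exact ⟨(b, a), h, by simp [hχ]; exact hrb, by simp [hχ]; exact hra, by
        rw [hr, realQuad, mul_comm]⟩
  · right
    obtain ⟨z, hz⟩ := Complex.exists_root (f := cx p) (by
      rw [degree_map, degree_eq_natDegree hm.ne_zero, hd]; norm_num)
    have him : z.im ≠ 0 := by
      intro h0
      apply hr
      refine ⟨z.re, ?_⟩
      have hz' : z = (z.re : ℂ) := Complex.ext rfl (by simp [h0])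
      rw [IsRoot, hz', eval_ofReal_cx] at hz
      exact_mod_cast hz
    have key : ∀ w : ℂ, (cx p).IsRoot w → 0 < w.im →
        ∃ z : ℂ, 0 < z.im ∧ z ∈ (cx χ).roots.toFinset ∧ p = complexQuad z := by
      intro w hw hpos
      refine ⟨w, hpos, ?_, ?_⟩
      · rw [Multiset.mem_toFinset, mem_roots (cx_ne_zero hχ)]
        exact hw.dvd (Polynomial.map_dvd _ hdvd)
      · have h1 : complexQuad w ∣ p := quadratic_dvd_of_aeval_eq_zero_im_ne_zero p
          (by rw [aeval_def, ← eval_map]; exact hw) hpos.ne'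
        exact eq_of_monic_of_dvd_of_natDegree_le (complexQuad_monic w) hm h1
          (by rw [hd, complexQuad_natDegree])
    rcases lt_or_gt_of_ne him with h | h
    · refine key (starRingEnd ℂ z) ?_ (by simpa using h)
      rw [IsRoot, eval_conj_cx, hz, map_zero]
    · exact key z hz h

lemma card_roots_split {χ : ℝ[X]} (hs : χ.Separable) :
    χ.roots.toFinset.card + 2 * ((cx χ).roots.toFinset.filter fun z => 0 < z.im).card =
      χ.natDegree := by
  classical
  have hχ : χ ≠ 0 := hs.ne_zero
  have hcx := cx_ne_zero hχ
  have hmem : ∀ z, z ∈ (cx χ).roots.toFinset ↔ (cx χ).eval z = 0 := by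
    intro z
    rw [Multiset.mem_toFinset, mem_roots hcx, IsRoot]
  have h0 : (cx χ).roots.toFinset.card = χ.natDegree := by
    rw [Multiset.toFinset_card_of_nodup (nodup_roots hs.map),
      ← (IsAlgClosed.splits (cx χ)).natDegree_eq_card_roots, natDegree_map]
  have h1 : ((cx χ).roots.toFinset.filter fun z => z.im < 0).card =
      ((cx χ).roots.toFinset.filter fun z => 0 < z.im).card := by
    refine Finset.card_bij' (fun z _ => starRingEnd ℂ z) (fun z _ => starRingEnd ℂ z) ?_ ?_ ?_ ?_
    · intro z hz
      rw [Finset.mem_filter, hmem] at hz ⊢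
      rw [eval_conj_cx, hz.1, map_zero]
      exact ⟨rfl, by simpa using hz.2⟩
    · intro z hz
      rw [Finset.mem_filter, hmem] at hz ⊢
      rw [eval_conj_cx, hz.1, map_zero]
      exact ⟨rfl, by simpa using hz.2⟩
    · intro z _; simp
    · intro z _; simp
  have h2 : ((cx χ).roots.toFinset.filter fun z => z.im = 0).card = χ.roots.toFinset.card := by
    refine Finset.card_bij' (fun z _ => z.re) (fun x _ => (x : ℂ)) ?_ ?_ ?_ ?_
    · intro z hz
      rw [Finset.mem_filter, hmem] at hz
      have hz' : z = (z.re : ℂ) := Complex.ext rfl (by simp [hz.2])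
      rw [Multiset.mem_toFinset, mem_roots hχ, IsRoot]
      have := hz.1
      rw [hz', eval_ofReal_cx] at this
      exact_mod_cast this
    · intro x hx
      rw [Multiset.mem_toFinset, mem_roots hχ, IsRoot] at hx
      rw [Finset.mem_filter, hmem, eval_ofReal_cx, hx]
      simp
    · intro z hz
      rw [Finset.mem_filter] at hz
      exact Complex.ext rfl (by simp [hz.2])
    · intro x _; simp
  have h3 := Finset.card_filter_add_card_filter_not (s := (cx χ).roots.toFinset)
    (p := fun z => z.im = 0)
  have h4 := Finset.card_filter_add_card_filter_not
    (s := (cx χ).roots.toFinset.filter fun z => ¬ z.im = 0) (p := fun z => 0 < z.im)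
  have h5 : ((cx χ).roots.toFinset.filter fun z => ¬ z.im = 0).filter (fun z => 0 < z.im) =
      (cx χ).roots.toFinset.filter fun z => 0 < z.im := by
    rw [Finset.filter_filter]
    exact Finset.filter_congr fun z _ => ⟨fun h => h.2, fun h => ⟨h.ne', h⟩⟩
  have h6 : ((cx χ).roots.toFinset.filter fun z => ¬ z.im = 0).filter (fun z => ¬ 0 < z.im) =
      (cx χ).roots.toFinset.filter fun z => z.im < 0 := by
    rw [Finset.filter_filter]
    exact Finset.filter_congr fun z _ => ⟨fun h => lt_of_le_of_ne (not_lt.1 h.2) h.1,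
      fun h => ⟨h.ne, not_lt.2 h.le⟩⟩
  rw [h5, h6] at h4
  omega

lemma sum_pairs_isgn (S : Finset ℝ) (s : ℝ → ℤ) (h1 : ∀ a ∈ S, s a * s a = 1)
    (h0 : ∑ a ∈ S, s a = 0) :
    2 * ∑ x ∈ (S ×ˢ S).filter (fun x => x.1 < x.2), s x.1 * s x.2 = -(S.card : ℤ) := by
  classical
  have hall : ∑ x ∈ S ×ˢ S, s x.1 * s x.2 = 0 := by
    rw [Finset.sum_product]
    simp only [← Finset.mul_sum, h0, mul_zero, Finset.sum_const_zero]
  have hsplit := Finset.sum_filter_add_sum_filter_not (S ×ˢ S) (fun x => x.1 < x.2)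
    (fun x => s x.1 * s x.2)
  have hsplit2 := Finset.sum_filter_add_sum_filter_not
    ((S ×ˢ S).filter fun x => ¬ x.1 < x.2) (fun x => x.2 < x.1) (fun x => s x.1 * s x.2)
  have e1 : ∑ x ∈ ((S ×ˢ S).filter fun x => ¬ x.1 < x.2).filter (fun x => x.2 < x.1),
      s x.1 * s x.2 = ∑ x ∈ (S ×ˢ S).filter (fun x => x.1 < x.2), s x.1 * s x.2 := by
    refine Finset.sum_bij' (fun x _ => x.swap) (fun x _ => x.swap) ?_ ?_ ?_ ?_ ?_
    · intro x hx
      simp only [Finset.mem_filter, Finset.mem_product, Prod.fst_swap, Prod.snd_swap] at hx ⊢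
      tauto
    · intro x hx
      simp only [Finset.mem_filter, Finset.mem_product, Prod.fst_swap, Prod.snd_swap] at hx ⊢
      exact ⟨⟨⟨hx.1.2, hx.1.1⟩, hx.2.le.not_gt⟩, hx.2⟩
    · intro x _; simp
    · intro x _; simp
    · intro x _; simp [mul_comm]
  have e2 : ∑ x ∈ ((S ×ˢ S).filter fun x => ¬ x.1 < x.2).filter (fun x => ¬ x.2 < x.1),
      s x.1 * s x.2 = S.card := by
    have : ∑ x ∈ ((S ×ˢ S).filter fun x => ¬ x.1 < x.2).filter (fun x => ¬ x.2 < x.1),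
      s x.1 * s x.2 = ∑ a ∈ S, s a * s a := by
      refine Finset.sum_bij' (fun x _ => x.1) (fun a _ => (a, a)) ?_ ?_ ?_ ?_ ?_
      · intro x hx
        simp only [Finset.mem_filter, Finset.mem_product] at hx
        exact hx.1.1.1
      · intro a ha
        simp [ha]
      · intro x hx
        simp only [Finset.mem_filter, Finset.mem_product] at hx
        exact Prod.ext rfl (le_antisymm (not_lt.1 hx.2) (not_lt.1 hx.1.2))
      · intro a _; rfl
      · intro x hx
        simp only [Finset.mem_filter, Finset.mem_product] at hx
        have : x.1 = x.2 := le_antisymm (not_lt.1 hx.2) (not_lt.1 hx.1.2)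
        rw [this]
    rw [this, Finset.sum_congr rfl h1]
    simp
  rw [e1, e2] at hsplit2
  linarith

lemma realQuad_injOn : Set.InjOn realQuad {x | x.1 < x.2} := by
  intro x hx y hy h
  simp only [Set.mem_ofPred_eq] at hx hy
  have h1 : (x.1 - y.1) * (x.1 - y.2) = 0 := by
    have := congrArg (Polynomial.eval x.1) h
    simpa [realQuad] using this.symm
  have h2 : (x.2 - y.1) * (x.2 - y.2) = 0 := by
    have := congrArg (Polynomial.eval x.2) h
    simpa [realQuad] using this.symm
  rcases mul_eq_zero.1 h1 with h1 | h1 <;> rcases mul_eq_zero.1 h2 with h2 | h2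
  · exact absurd hx (by linarith)
  · exact Prod.ext (by linarith) (by linarith)
  · exact absurd hx (by linarith)
  · exact absurd hx (by linarith)

lemma complexQuad_injOn : Set.InjOn complexQuad {z | 0 < z.im} := by
  intro z hz w hw h
  simp only [Set.mem_ofPred_eq] at hz hw
  have h1 : z ∈ (cx (complexQuad w)).roots := by
    rw [← h, cx_roots_complexQuad]; simp
  rw [cx_roots_complexQuad] at h1
  simp only [Multiset.insert_eq_cons, Multiset.mem_cons, Multiset.mem_singleton] at h1
  rcases h1 with h1 | h1
  · exact h1
  · rw [h1] at hz
    simp at hz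
    exact absurd hz (by linarith)

lemma realQuad_ne_complexQuad (x : ℝ × ℝ) {z : ℂ} (hz : 0 < z.im) : realQuad x ≠ complexQuad z := by
  intro h
  have h1 : z ∈ (cx (realQuad x)).roots := by
    rw [h, cx_roots_complexQuad]; simp
  rw [cx_roots_realQuad] at h1
  simp only [Multiset.insert_eq_cons, Multiset.mem_cons, Multiset.mem_singleton] at h1
  rcases h1 with h1 | h1 <;> simp [h1] at hz

lemma realQuad_mem_quadDiv {χ : ℝ[X]} {x : ℝ × ℝ} (hχ : χ ≠ 0) (hx : x.1 < x.2)
    (h1 : x.1 ∈ χ.roots.toFinset) (h2 : x.2 ∈ χ.roots.toFinset) : realQuad x ∈ quadDiv χ := by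
  refine ⟨realQuad_monic x, realQuad_natDegree x, ?_⟩
  rw [Multiset.mem_toFinset, mem_roots hχ] at h1 h2
  exact IsCoprime.mul_dvd (isCoprime_X_sub_C_of_isUnit_sub
    (isUnit_iff_ne_zero.2 (sub_ne_zero.2 hx.ne))) (dvd_iff_isRoot.2 h1) (dvd_iff_isRoot.2 h2)

lemma complexQuad_mem_quadDiv {χ : ℝ[X]} {z : ℂ} (hχ : χ ≠ 0) (hz : 0 < z.im)
    (h1 : z ∈ (cx χ).roots.toFinset) : complexQuad z ∈ quadDiv χ := by
  refine ⟨complexQuad_monic z, complexQuad_natDegree z, ?_⟩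
  rw [Multiset.mem_toFinset, mem_roots (cx_ne_zero hχ)] at h1
  exact quadratic_dvd_of_aeval_eq_zero_im_ne_zero χ (by rw [aeval_def, ← eval_map]; exact h1) hz.ne'

theorem quadDiv_count {χ : ℝ[X]} (hs : χ.Separable) {n : ℕ} (hd : χ.natDegree = 2 * n) :
    ∃ Dp Dm : Finset ℝ[X], (∀ p, p ∈ quadDiv χ ↔ p ∈ Dp ∨ p ∈ Dm) ∧
      (∀ p ∈ Dp, ∀ (q : ℝ[X]) (R : ℝ), χ = p * q →
        (R : ℂ) = ((cx p).roots.map fun r => (cx q).eval r).prod → 0 < R) ∧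
      (∀ p ∈ Dm, ∀ (q : ℝ[X]) (R : ℝ), χ = p * q →
        (R : ℂ) = ((cx p).roots.map fun r => (cx q).eval r).prod → R < 0) ∧
      Dp.card = Dm.card + n ∧ Dm.card ≤ (2 * n) ^ 2 := by
  classical
  have hχ : χ ≠ 0 := hs.ne_zero
  set S := χ.roots.toFinset with hS
  set Cu := (cx χ).roots.toFinset.filter fun z => 0 < z.im with hCu
  have hcard : S.card + 2 * Cu.card = 2 * n := hd ▸ card_roots_split hs
  set s : ℝ → ℤ := fun a => isgn ((derivative χ).eval a) with hsdef
  have hs0 : ∑ a ∈ S, s a = 0 := sum_isgn_derivative hs ⟨n - Cu.card, by rw [← hS]; omega⟩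
  have hder : ∀ a ∈ S, (derivative χ).eval a ≠ 0 := by
    intro a ha
    rw [hS, Multiset.mem_toFinset, mem_roots hχ] at ha
    exact hs.eval₂_derivative_ne_zero (RingHom.id ℝ) (x := a) ha
  have hs1 : ∀ a ∈ S, s a = 1 ∨ s a = -1 := by
    intro a ha
    rcases lt_or_gt_of_ne (hder a ha) with h | h
    · exact Or.inr (isgn_neg h)
    · exact Or.inl (isgn_pos h)
  have hpairs := sum_pairs_isgn S s (fun a ha => by
    rcases hs1 a ha with h | h <;> rw [h] <;> rfl) hs0
  set T := (S ×ˢ S).filter (fun x => x.1 < x.2) with hT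
  have hTmem : ∀ x ∈ T, x.1 ∈ S ∧ x.2 ∈ S ∧ x.1 < x.2 := by
    intro x hx
    simp only [hT, Finset.mem_filter, Finset.mem_product] at hx
    tauto
  set Tp := T.filter fun x => s x.1 * s x.2 = -1 with hTp
  set Tm := T.filter fun x => ¬ s x.1 * s x.2 = -1 with hTm
  have hTm1 : ∀ x ∈ Tm, s x.1 * s x.2 = 1 := by
    intro x hx
    rw [hTm, Finset.mem_filter] at hx
    obtain ⟨h1, h2, -⟩ := hTmem x hx.1
    rcases hs1 _ h1 with h1 | h1 <;> rcases hs1 _ h2 with h2 | h2 <;> rw [h1, h2] at hx ⊢ <;>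
      simp at hx ⊢
  have hsum : ∑ x ∈ T, s x.1 * s x.2 = (Tm.card : ℤ) - Tp.card := by
    rw [← Finset.sum_filter_add_sum_filter_not T (fun x => s x.1 * s x.2 = -1),
      Finset.sum_congr rfl (fun x hx => (Finset.mem_filter.1 hx).2), Finset.sum_congr rfl hTm1]
    simp only [Finset.sum_const, nsmul_eq_mul]
    ring
  have hres : ∀ x ∈ T, ∀ (q : ℝ[X]) (R : ℝ), χ = realQuad x * q →
      (R : ℂ) = ((cx (realQuad x)).roots.map fun r => (cx q).eval r).prod →
      s x.1 * s x.2 = -isgn R := by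
    intro x hx q R hq hR
    obtain ⟨h1, h2, hlt⟩ := hTmem x hx
    rw [cx_roots_realQuad] at hR
    simp only [Multiset.insert_eq_cons, Multiset.map_cons, Multiset.map_singleton,
      Multiset.prod_cons, Multiset.prod_singleton, eval_ofReal_cx] at hR
    have hR' : R = q.eval x.1 * q.eval x.2 := by exact_mod_cast hR
    rw [hsdef]
    simp only
    rw [← isgn_mul, realQuad_resultant hq, ← hR', isgn_mul, isgn_neg]
    · ring
    · have : 0 < (x.1 - x.2) ^ 2 := by
        have := sub_ne_zero.2 hlt.ne
        positivity
      linarith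
  have hTpinj : Set.InjOn realQuad (Tp : Set (ℝ × ℝ)) := realQuad_injOn.mono fun x hx =>
    (hTmem x (Finset.mem_filter.1 (Finset.mem_coe.1 hx)).1).2.2
  have hTminj : Set.InjOn realQuad (Tm : Set (ℝ × ℝ)) := realQuad_injOn.mono fun x hx =>
    (hTmem x (Finset.mem_filter.1 (Finset.mem_coe.1 hx)).1).2.2
  have hCinj : Set.InjOn complexQuad (Cu : Set ℂ) := complexQuad_injOn.mono fun z hz =>
    (Finset.mem_filter.1 (Finset.mem_coe.1 hz)).2
  have hdisj : Disjoint (Tp.image realQuad) (Cu.image complexQuad) := by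
    rw [Finset.disjoint_left]
    intro p hp hp'
    obtain ⟨x, -, rfl⟩ := Finset.mem_image.1 hp
    obtain ⟨z, hz, h⟩ := Finset.mem_image.1 hp'
    exact realQuad_ne_complexQuad x (Finset.mem_filter.1 hz).2 h.symm
  refine ⟨Tp.image realQuad ∪ Cu.image complexQuad, Tm.image realQuad, ?_, ?_, ?_, ?_, ?_⟩
  · intro p
    constructor
    · intro hp
      rcases quadDiv_cases hs hp with ⟨x, hx, h1, h2, rfl⟩ | ⟨z, hz, h1, rfl⟩
      · have hxT : x ∈ T := by
          simp only [hT, Finset.mem_filter, Finset.mem_product]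
          exact ⟨⟨h1, h2⟩, hx⟩
        by_cases h : s x.1 * s x.2 = -1
        · exact Or.inl (Finset.mem_union_left _ (Finset.mem_image_of_mem _
            (Finset.mem_filter.2 ⟨hxT, h⟩)))
        · exact Or.inr (Finset.mem_image_of_mem _ (Finset.mem_filter.2 ⟨hxT, h⟩))
      · exact Or.inl (Finset.mem_union_right _ (Finset.mem_image_of_mem _
          (Finset.mem_filter.2 ⟨h1, hz⟩)))
    · rintro (h | h)
      · rcases Finset.mem_union.1 h with h | h
        · obtain ⟨x, hx, rfl⟩ := Finset.mem_image.1 h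
          obtain ⟨h1, h2, hlt⟩ := hTmem x (Finset.mem_filter.1 hx).1
          exact realQuad_mem_quadDiv hχ hlt h1 h2
        · obtain ⟨z, hz, rfl⟩ := Finset.mem_image.1 h
          exact complexQuad_mem_quadDiv hχ (Finset.mem_filter.1 hz).2 (Finset.mem_filter.1 hz).1
      · obtain ⟨x, hx, rfl⟩ := Finset.mem_image.1 h
        obtain ⟨h1, h2, hlt⟩ := hTmem x (Finset.mem_filter.1 hx).1
        exact realQuad_mem_quadDiv hχ hlt h1 h2
  · intro p hp q R hq hR
    rcases Finset.mem_union.1 hp with h | h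
    · obtain ⟨x, hx, rfl⟩ := Finset.mem_image.1 h
      have h1 := hres x (Finset.mem_filter.1 hx).1 q R hq hR
      rw [(Finset.mem_filter.1 hx).2] at h1
      rcases lt_trichotomy R 0 with h | h | h
      · rw [isgn_neg h] at h1; simp at h1
      · rw [h] at h1; simp [isgn] at h1
      · exact h
    · obtain ⟨z, hz, rfl⟩ := Finset.mem_image.1 h
      rw [cx_roots_complexQuad] at hR
      simp only [Multiset.insert_eq_cons, Multiset.map_cons, Multiset.map_singleton,
        Multiset.prod_cons, Multiset.prod_singleton, eval_conj_cx] at hR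
      rw [Complex.mul_conj] at hR
      have hR' : R = Complex.normSq ((cx q).eval z) := by exact_mod_cast hR
      rw [hR']
      refine Complex.normSq_pos.2 fun h0 => ?_
      have hsq : (cx χ).Separable := hs.map
      have h1 : (X - C z) * (X - C z) ∣ cx χ := by
        rw [hq, cx, Polynomial.map_mul]
        refine mul_dvd_mul ?_ (dvd_iff_isRoot.2 h0)
        rw [show Polynomial.map Complex.ofRealHom (complexQuad z) = _ from cx_complexQuad z]
        exact dvd_mul_right _ _
      exact not_isUnit_X_sub_C z (hsq.squarefree _ h1)
  · intro p hp q R hq hR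
    obtain ⟨x, hx, rfl⟩ := Finset.mem_image.1 hp
    have h1 := hres x (Finset.mem_filter.1 hx).1 q R hq hR
    rw [hTm1 x hx] at h1
    rcases lt_trichotomy R 0 with h | h | h
    · exact h
    · rw [h] at h1; simp [isgn] at h1
    · rw [isgn_pos h] at h1; simp at h1
  · rw [Finset.card_union_of_disjoint hdisj, Finset.card_image_of_injOn hTpinj,
      Finset.card_image_of_injOn hTminj, Finset.card_image_of_injOn hCinj]
    rw [hsum] at hpairs
    omega
  · rw [Finset.card_image_of_injOn hTminj]
    calc Tm.card ≤ T.card := Finset.card_filter_le _ _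
      _ ≤ (S ×ˢ S).card := Finset.card_filter_le _ _
      _ = S.card ^ 2 := by rw [Finset.card_product, sq]
      _ ≤ (2 * n) ^ 2 := Nat.pow_le_pow_left (by omega) 2

end Count

section Generic
open Polynomial
variable {ι : Type*} [Fintype ι] [DecidableEq ι]

/-- A subalgebra of functions of a matrix containing the entries contains the coefficients of the
characteristic polynomial. -/
lemma coeff_charpoly_mem (𝒮 : Subalgebra ℝ (Matrix ι ι ℝ → ℝ))
    (h𝒮 : ∀ i j, (fun P : Matrix ι ι ℝ => P i j) ∈ 𝒮) (k : ℕ) :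
    (fun P : Matrix ι ι ℝ => P.charpoly.coeff k) ∈ 𝒮 := by
  have h : ∀ p : MvPolynomial (ι × ι) ℝ,
      (fun P : Matrix ι ι ℝ => MvPolynomial.eval₂Hom (RingHom.id ℝ) (fun x => P x.1 x.2) p) ∈ 𝒮 := by
    intro p
    induction p using MvPolynomial.induction_on with
    | C a =>
      simp only [MvPolynomial.coe_eval₂Hom, MvPolynomial.eval₂_C]
      exact 𝒮.algebraMap_mem a
    | add p q hp hq =>
      simp only [map_add]
      exact 𝒮.add_mem hp hq
    | mul_X p x hp =>
      simp only [map_mul]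
      refine 𝒮.mul_mem hp ?_
      simp only [MvPolynomial.coe_eval₂Hom, MvPolynomial.eval₂_X]
      exact h𝒮 x.1 x.2
  have := h ((charpoly.univ ℝ ι).coeff k)
  simp only [charpoly.univ_coeff_eval₂Hom] at this
  exact this

lemma pow_entry_mem (𝒮 : Subalgebra ℝ (Matrix ι ι ℝ → ℝ))
    (h𝒮 : ∀ i j, (fun P : Matrix ι ι ℝ => P i j) ∈ 𝒮) (k : ℕ) (i j : ι) :
    (fun P : Matrix ι ι ℝ => (P ^ k) i j) ∈ 𝒮 := by
  induction k generalizing i j with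
  | zero => exact 𝒮.algebraMap_mem ((1 : Matrix ι ι ℝ) i j)
  | succ k ih =>
    have : (fun P : Matrix ι ι ℝ => (P ^ (k + 1)) i j) =
        ∑ l, (fun P : Matrix ι ι ℝ => (P ^ k) i l) * fun P : Matrix ι ι ℝ => P l j := by
      funext P
      simp [pow_succ, Matrix.mul_apply]
    rw [this]
    exact 𝒮.sum_mem fun l _ => 𝒮.mul_mem (ih i l) (h𝒮 l j)

/-- Continuous functions of a matrix which are polynomial along lines. -/
noncomputable def polyFun (ι : Type*) [Fintype ι] : Subalgebra ℝ (Matrix ι ι ℝ → ℝ) :=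
  polyOnLines (Matrix ι ι ℝ) ⊓ continuousSubalgebra

lemma entry_mem_polyFun (i j : ι) : (fun P : Matrix ι ι ℝ => P i j) ∈ polyFun ι :=
  ⟨entry_mem_polyOnLines i j, by
    show Continuous fun P : Matrix ι ι ℝ => P i j
    fun_prop⟩

lemma continuous_coeff_charpoly (k : ℕ) :
    Continuous fun P : Matrix ι ι ℝ => P.charpoly.coeff k :=
  (coeff_charpoly_mem (polyFun ι) entry_mem_polyFun k).2

lemma ae_det_ne_zero_of_polyFun (M : Matrix ι ι ℝ → Matrix ι ι ℝ)
    (hM : ∀ i j, (fun P => M P i j) ∈ polyFun ι) {P₀ : Matrix ι ι ℝ} (h0 : (M P₀).det ≠ 0) :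
    ∀ᵐ P : Matrix ι ι ℝ, (M P).det ≠ 0 := by
  refine ae_ne_zero_of_polyOnLines (det_mem_polyOnLines M fun i j => (hM i j).1) ?_ h0
  exact (Continuous.matrix_det (continuous_matrix fun i j => (hM i j).2)).measurable

/-- The diagonal matrix with entries `0, 1, 2, …`. -/
noncomputable def countDiag (ι : Type*) [Fintype ι] [DecidableEq ι] : Matrix ι ι ℝ :=
  diagonal fun i => ((Fintype.equivFin ι i : ℕ) : ℝ)

lemma countDiag_injective : Injective fun i : ι => ((Fintype.equivFin ι i : ℕ) : ℝ) := by
  intro i j h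
  simpa [Fin.val_inj] using h

lemma aeval_diagonal (d : ι → ℝ) (p : ℝ[X]) :
    aeval (diagonal d) p = diagonal fun i => p.eval (d i) := by
  have := Polynomial.aeval_algHom_apply (Matrix.diagonalAlgHom (n := ι) (α := ℝ) ℝ) d p
  rw [show diagonal d = Matrix.diagonalAlgHom ℝ d from rfl, this]
  show diagonal (aeval d p) = _
  congr 1
  funext i
  have := Polynomial.aeval_algHom_apply (Pi.evalAlgHom ℝ (fun _ : ι => ℝ) i) d p
  rw [show (aeval d p) i = Pi.evalAlgHom ℝ (fun _ : ι => ℝ) i (aeval d p) from rfl, ← this]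
  simp [Polynomial.coe_aeval_eq_eval]

lemma separable_countDiag : (countDiag ι).charpoly.Separable := by
  rw [countDiag, charpoly_diagonal]
  exact separable_prod_X_sub_C_iff.2 countDiag_injective

lemma separable_of_det_ne_zero (P : Matrix ι ι ℝ)
    (h : (aeval P (derivative P.charpoly)).det ≠ 0) : P.charpoly.Separable := by
  refine (isCoprime_iff_aeval_ne_zero_of_isAlgClosed ℝ ℂ _ _).2 fun z => ?_
  by_contra! hc
  obtain ⟨h1, h2⟩ := hc
  have e1 : (P.map Complex.ofRealHom).charpoly.eval z = 0 := by
    rw [charpoly_map, eval_map]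
    exact h1
  rw [eval_charpoly] at e1
  have e2 : (cx (derivative P.charpoly)).eval z = 0 := by
    rw [eval_map]
    exact h2
  obtain ⟨q, hq⟩ := dvd_iff_isRoot.2 e2
  apply h
  apply Complex.ofReal_injective
  rw [det_aeval_ofReal, hq, map_mul, det_mul]
  have e3 : aeval (P.map Complex.ofRealHom) (X - C z) =
      -(Matrix.scalar ι z - P.map Complex.ofRealHom) := by
    simp [Algebra.algebraMap_eq_smul_one, smul_one_eq_diagonal]
  rw [e3, det_neg, e1]
  simp

lemma ae_separable : ∀ᵐ P : Matrix ι ι ℝ, P.charpoly.Separable := by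
  refine (ae_det_ne_zero_of_polyFun (fun P => aeval P (derivative P.charpoly)) (fun i j => ?_)
    (P₀ := countDiag ι) ?_).mono fun P => separable_of_det_ne_zero P
  · have : (fun P : Matrix ι ι ℝ => aeval P (derivative P.charpoly) i j) =
        ∑ k ∈ Finset.range (Fintype.card ι + 1), ((k : ℝ) + 1) •
          ((fun P : Matrix ι ι ℝ => P.charpoly.coeff (k + 1)) *
            fun P : Matrix ι ι ℝ => (P ^ k) i j) := by
      funext P
      have hd : (derivative P.charpoly).natDegree < Fintype.card ι + 1 := by
        have := natDegree_derivative_le P.charpoly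
        rw [charpoly_natDegree_eq_dim] at this
        omega
      rw [aeval_eq_sum_range' hd, Matrix.sum_apply, Finset.sum_apply]
      refine Finset.sum_congr rfl fun k _ => ?_
      simp [coeff_derivative]
      ring
    rw [this]
    exact (polyFun ι).sum_mem fun k _ => (polyFun ι).smul_mem ((polyFun ι).mul_mem
      (coeff_charpoly_mem _ entry_mem_polyFun _) (pow_entry_mem _ entry_mem_polyFun _ _ _)) _
  · have hs := separable_countDiag (ι := ι)
    rw [show aeval (countDiag ι) = aeval (diagonal fun i : ι =>
      ((Fintype.equivFin ι i : ℕ) : ℝ)) from rfl, aeval_diagonal, det_diagonal,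
      Finset.prod_ne_zero_iff]
    intro i _
    have := hs.eval₂_derivative_ne_zero (RingHom.id ℝ)
      (x := ((Fintype.equivFin ι i : ℕ) : ℝ)) ?_
    · simpa using this
    · simp only [countDiag, charpoly_diagonal, eval₂_id]
      rw [eval_prod]
      exact Finset.prod_eq_zero (Finset.mem_univ i) (by simp)

/-- The Krylov matrix of the all-ones vector. -/
noncomputable def krylov (P : Matrix ι ι ℝ) : Matrix ι ι ℝ :=
  of fun i j => ((P ^ (Fintype.equivFin ι j : ℕ)) *ᵥ 1) i

lemma ae_krylov : ∀ᵐ P : Matrix ι ι ℝ, (krylov P).det ≠ 0 := by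
  refine ae_det_ne_zero_of_polyFun krylov (fun i j => ?_) (P₀ := countDiag ι) ?_
  · have : (fun P : Matrix ι ι ℝ => krylov P i j) =
        ∑ l, fun P : Matrix ι ι ℝ => (P ^ (Fintype.equivFin ι j : ℕ)) i l := by
      funext P
      simp [krylov, mulVec, dotProduct]
    rw [this]
    exact (polyFun ι).sum_mem fun l _ => pow_entry_mem _ entry_mem_polyFun _ _ _
  · have : krylov (countDiag ι) = (vandermonde fun k : Fin (Fintype.card ι) => ((k : ℕ) : ℝ)).submatrix
        (Fintype.equivFin ι) (Fintype.equivFin ι) := by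
      ext i j
      simp [krylov, countDiag, diagonal_pow, mulVec_diagonal, vandermonde_apply]
    rw [this, det_submatrix_equiv_self, det_vandermonde_ne_zero_iff]
    intro i j h
    simpa [Fin.val_inj] using h

lemma krylov_ne_zero {P : Matrix ι ι ℝ} (h : (krylov P).det ≠ 0) {q : ℝ[X]}
    (hq : q ≠ 0) (hd : q.natDegree < Fintype.card ι) : aeval P q *ᵥ 1 ≠ 0 := by
  intro h0
  have h1 : krylov P *ᵥ (fun j => q.coeff (Fintype.equivFin ι j)) = aeval P q *ᵥ 1 := by
    rw [aeval_eq_sum_range' hd, Finset.sum_range, sum_mulVec]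
    ext i
    rw [Finset.sum_apply, ← (Fintype.equivFin ι).sum_comp]
    simp [krylov, mulVec, dotProduct, mul_comm, smul_mulVec, Finset.mul_sum, Finset.sum_mul]
  rw [h0] at h1
  have h2 := Matrix.eq_zero_of_mulVec_eq_zero h h1
  apply hq
  ext k
  by_cases hk : k < Fintype.card ι
  · have := congrFun h2 ((Fintype.equivFin ι).symm ⟨k, hk⟩)
    simpa using this
  · rw [coeff_eq_zero_of_natDegree_lt (by omega), coeff_zero]

end Generic

section Bijection
open Polynomial
variable {α β : Type*} [Fintype α] [Fintype β] [DecidableEq α] [DecidableEq β]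

lemma charpoly_conj {A M B : Matrix α α ℝ} (h : B * A = 1) :
    (A * M * B).charpoly = M.charpoly := by
  rw [Matrix.mul_assoc, charpoly_mul_comm, Matrix.mul_assoc, h, Matrix.mul_one]

lemma invGraph_charpoly {P : Matrix (α ⊕ β) (α ⊕ β) ℝ} {U : Matrix β α ℝ} (hU : U ∈ invGraph P) :
    P.charpoly = (P.toBlocks₁₁ + P.toBlocks₁₂ * U).charpoly *
      (P.toBlocks₂₂ - U * P.toBlocks₁₂).charpoly := by
  have h := ofBlocks_graphMap ((U, P.toBlocks₁₂, P.toBlocks₁₁, P.toBlocks₂₂) : Coord α β)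
  have e : ofBlocks (graphMap ((U, P.toBlocks₁₂, P.toBlocks₁₁, P.toBlocks₂₂) : Coord α β)) = P := by
    conv_rhs => rw [← fromBlocks_toBlocks P, ← (show _ = _ from hU)]
    rfl
  rw [e] at h
  have h2 : lowerUnip (-U) * lowerUnip U = (1 : Matrix (α ⊕ β) (α ⊕ β) ℝ) := by
    simp [lowerUnip, fromBlocks_multiply]
  conv_lhs => rw [h, charpoly_conj h2, charpoly_fromBlocks_zero₂₁]

lemma aeval_mul_of_intertwine {V : Matrix β α ℝ} {b : Matrix α α ℝ} {y : Matrix β β ℝ}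
    (h : y * V = V * b) (p : ℝ[X]) : aeval y p * V = V * aeval b p := by
  induction p using Polynomial.induction_on' with
  | add p q hp hq => simp only [map_add, Matrix.add_mul, Matrix.mul_add, hp, hq]
  | monomial k a =>
    have hk : y ^ k * V = V * b ^ k := by
      induction k with
      | zero => simp
      | succ k ih => rw [pow_succ, Matrix.mul_assoc, h, ← Matrix.mul_assoc, ih, Matrix.mul_assoc,
          ← pow_succ]
    simp only [aeval_monomial, Algebra.algebraMap_eq_smul_one, smul_mul_assoc, one_mul]
    rw [Matrix.smul_mul, hk, Matrix.mul_smul]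

lemma invGraph_injOn {P : Matrix (α ⊕ β) (α ⊕ β) ℝ} (hP : P.charpoly.Separable) :
    InjOn (fun U : Matrix β α ℝ => (P.toBlocks₁₁ + P.toBlocks₁₂ * U).charpoly) (invGraph P) := by
  intro U hU U' hU' h
  beta_reduce at h
  have hs := hP
  rw [invGraph_charpoly hU] at hs
  obtain ⟨u, v, huv⟩ := hs.isCoprime
  have e0 : (P.toBlocks₂₂ - U * P.toBlocks₁₂) * (U' - U) =
      (U' - U) * (P.toBlocks₁₁ + P.toBlocks₁₂ * U') := by
    have a1 : U * P.toBlocks₁₁ + U * P.toBlocks₁₂ * U - P.toBlocks₂₂ * U = P.toBlocks₂₁ := hU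
    have a2 : U' * P.toBlocks₁₁ + U' * P.toBlocks₁₂ * U' - P.toBlocks₂₂ * U' = P.toBlocks₂₁ := hU'
    have a3 := a1.trans a2.symm
    simp only [Matrix.mul_sub, Matrix.sub_mul, Matrix.mul_add, ← Matrix.mul_assoc]
    rw [← sub_eq_zero] at a3 ⊢
    rw [← a3]
    abel
  have e1 := aeval_mul_of_intertwine e0 (P.toBlocks₁₁ + P.toBlocks₁₂ * U').charpoly
  rw [aeval_self_charpoly, Matrix.mul_zero, ← h] at e1
  have e2 := congrArg (aeval (P.toBlocks₂₂ - U * P.toBlocks₁₂)) huv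
  rw [map_add, map_mul, map_mul, aeval_self_charpoly, mul_zero, add_zero, map_one] at e2
  have e3 : U' - U = 0 := by
    rw [← Matrix.one_mul (U' - U), ← e2, Matrix.mul_assoc, e1, Matrix.mul_zero]
  exact (sub_eq_zero.1 e3).symm

lemma exists_invGraph_of_mul_eq {P : Matrix (α ⊕ β) (α ⊕ β) ℝ} {K : Matrix (α ⊕ β) α ℝ}
    {C : Matrix α α ℝ} (h : P * K = K * C) (hK : K.toRows₁.det ≠ 0) :
    ∃ U ∈ invGraph P, (P.toBlocks₁₁ + P.toBlocks₁₂ * U).charpoly = C.charpoly := by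
  obtain ⟨T, S, rfl⟩ : ∃ T S, K = fromRows T S := ⟨K.toRows₁, K.toRows₂, (fromRows_toRows K).symm⟩
  rw [toRows₁_fromRows] at hK
  have hT := Ne.isUnit hK
  rw [← fromBlocks_toBlocks P, fromBlocks_mul_fromRows, fromRows_mul, fromRows_inj.eq_iff] at h
  obtain ⟨h1, h2⟩ := h
  have e : P.toBlocks₁₁ + P.toBlocks₁₂ * (S * T⁻¹) = T * C * T⁻¹ := by
    rw [← h1, Matrix.add_mul, Matrix.mul_assoc P.toBlocks₁₁, mul_nonsing_inv _ hT, Matrix.mul_one,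
      Matrix.mul_assoc]
  refine ⟨S * T⁻¹, ?_, ?_⟩
  · show S * T⁻¹ * P.toBlocks₁₁ + S * T⁻¹ * P.toBlocks₁₂ * (S * T⁻¹) - P.toBlocks₂₂ * (S * T⁻¹) = _
    rw [Matrix.mul_assoc (S * T⁻¹) P.toBlocks₁₂, ← Matrix.mul_add, e]
    rw [show S * T⁻¹ * (T * C * T⁻¹) = S * C * T⁻¹ by
      rw [Matrix.mul_assoc S, ← Matrix.mul_assoc T⁻¹, ← Matrix.mul_assoc T⁻¹,
        nonsing_inv_mul _ hT, Matrix.one_mul, Matrix.mul_assoc], ← h2, Matrix.add_mul,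
      Matrix.mul_assoc P.toBlocks₂₁, mul_nonsing_inv _ hT, Matrix.mul_one, Matrix.mul_assoc,
      add_sub_cancel_right]
  · rw [e]
    exact charpoly_conj (nonsing_inv_mul _ hT)

end Bijection

section Count
open Polynomial
variable {β : Type*} [Fintype β] [DecidableEq β]

/-- The quadratic divisor `p` of `P.charpoly` has a two-column matrix of generalized Krylov vectors. -/
lemma exists_quad_columns {ι : Type*} [Fintype ι] [DecidableEq ι] {P : Matrix ι ι ℝ}
    (hP : (krylov P).det ≠ 0) {p : ℝ[X]} (hp : p ∈ quadDiv P.charpoly) :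
    ∃ (K : Matrix ι (Fin 2) ℝ) (C : Matrix (Fin 2) (Fin 2) ℝ), P * K = K * C ∧ C.charpoly = p ∧
      ∃ L : Matrix (Fin 2) ι ℝ, L * K = 1 := by
  obtain ⟨hm, hd, q, hq⟩ := hp
  have hqm : q.Monic := hm.of_mul_monic_left (hq ▸ charpoly_monic P)
  have hdeg : Fintype.card ι = 2 + q.natDegree := by
    rw [← charpoly_natDegree_eq_dim P, hq, hm.natDegree_mul hqm, hd]
  have hpe : p = X ^ 2 + C (p.coeff 1) * X + C (p.coeff 0) := by
    conv_lhs => rw [hm.as_sum, hd]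
    simp [Finset.sum_range_succ]
    ring
  set w := aeval P q *ᵥ (1 : ι → ℝ) with hw
  have hpw : aeval P p *ᵥ w = 0 := by
    rw [hw, mulVec_mulVec, ← map_mul, ← hq, aeval_self_charpoly, zero_mulVec]
  have hPP : P *ᵥ (P *ᵥ w) = -p.coeff 0 • w - p.coeff 1 • P *ᵥ w := by
    rw [hpe] at hpw
    simp only [map_add, map_mul, map_pow, aeval_X, aeval_C, Algebra.algebraMap_eq_smul_one,
      add_mulVec, smul_mul_assoc, one_mul, smul_mulVec, one_mulVec, sq, ← mulVec_mulVec] at hpw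
    rw [← sub_eq_zero, ← hpw, neg_smul]
    abel
  have hKv : ∀ v : Fin 2 → ℝ, (of fun i j => ![w, P *ᵥ w] j i : Matrix ι (Fin 2) ℝ) *ᵥ v =
      v 0 • w + v 1 • P *ᵥ w := by
    intro v
    ext i
    simp [mulVec, dotProduct, Fin.sum_univ_two, mul_comm]
  refine ⟨of fun i j => ![w, P *ᵥ w] j i, !![0, -p.coeff 0; 1, -p.coeff 1], ?_, ?_, ?_⟩
  · ext i j
    have e1 := congrFun hPP i
    fin_cases j
    · simp [Matrix.mul_apply, Fin.sum_univ_two, mulVec, dotProduct]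
    · simp only [Pi.sub_apply, Pi.smul_apply, smul_eq_mul] at e1
      simp only [Matrix.mul_apply, Fin.sum_univ_two, of_apply]
      simp
      simp only [mulVec, dotProduct] at e1 ⊢
      rw [e1]
      ring
  · rw [charpoly_fin_two]
    conv_rhs => rw [hpe]
    simp [trace_fin_two, det_fin_two]
  · have hinj : Injective (of fun i j => ![w, P *ᵥ w] j i : Matrix ι (Fin 2) ℝ).mulVec := by
      rw [← coe_mulVecLin, ← LinearMap.ker_eq_bot, LinearMap.ker_eq_bot']
      intro v hv
      rw [mulVecLin_apply, hKv] at hv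
      by_contra hne
      have hl : C (v 1) * X + C (v 0) ≠ 0 := by
        intro h
        apply hne
        have h0 := congrArg (coeff · 0) h
        have h1 := congrArg (coeff · 1) h
        simp at h0 h1
        ext i
        fin_cases i <;> simp [h0, h1]
      refine krylov_ne_zero hP (mul_ne_zero hl hqm.ne_zero) ?_ ?_
      · have := natDegree_mul_le (p := C (v 1) * X + C (v 0)) (q := q)
        have := natDegree_linear_le (a := v 1) (b := v 0)
        omega
      · rw [map_mul, ← mulVec_mulVec, ← hw, ← hv]
        simp only [map_add, map_mul, aeval_X, aeval_C, Algebra.algebraMap_eq_smul_one,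
          add_mulVec, smul_mul_assoc, one_mul, smul_mulVec, one_mulVec]
        abel
    obtain ⟨g, hg⟩ := LinearMap.exists_leftInverse_of_injective
      (of fun i j => ![w, P *ᵥ w] j i : Matrix ι (Fin 2) ℝ).mulVecLin
      (LinearMap.ker_eq_bot.2 (by rw [coe_mulVecLin]; exact hinj))
    refine ⟨LinearMap.toMatrix' g, ?_⟩
    have := congrArg LinearMap.toMatrix' hg
    rwa [LinearMap.toMatrix'_comp, LinearMap.toMatrix'_id, show (mulVecLin _ : (Fin 2 → ℝ) →ₗ[ℝ] (ι → ℝ)) = toLin' _ from rfl,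
      LinearMap.toMatrix'_toLin'] at this

end Count

section Count
open Polynomial
variable {β : Type*} [Fintype β] [DecidableEq β]

/-- Indicator of a positive resultant. -/
noncomputable def posInd (b : Matrix (Fin 2) (Fin 2) ℝ) (y : Matrix β β ℝ) : ℝ≥0∞ :=
  if 0 < sylvDet b y then 1 else 0

/-- Indicator of a negative resultant. -/
noncomputable def negInd (b : Matrix (Fin 2) (Fin 2) ℝ) (y : Matrix β β ℝ) : ℝ≥0∞ :=
  if sylvDet b y < 0 then 1 else 0

lemma measurable_posInd : Measurable (uncurry (posInd (β := β))) :=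
  Measurable.ite (measurableSet_lt measurable_const continuous_sylvDet.measurable)
    measurable_const measurable_const

lemma measurable_negInd : Measurable (uncurry (negInd (β := β))) :=
  Measurable.ite (measurableSet_lt continuous_sylvDet.measurable measurable_const)
    measurable_const measurable_const

lemma posInd_of_eq_zero (b : Matrix (Fin 2) (Fin 2) ℝ) (y : Matrix β β ℝ) (h : sylvDet b y = 0) :
    posInd b y = 0 := by simp [posInd, h]

lemma negInd_of_eq_zero (b : Matrix (Fin 2) (Fin 2) ℝ) (y : Matrix β β ℝ) (h : sylvDet b y = 0) :
    negInd b y = 0 := by simp [negInd, h]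

/-- The signed count of the invariant graphs of `P`. -/
def GoodCount (n : ℕ) (P : Matrix (Fin 2 ⊕ β) (Fin 2 ⊕ β) ℝ) : Prop :=
  graphSum posInd P = graphSum negInd P + n ∧ graphSum negInd P ≤ (2 * n) ^ 2

lemma measurableSet_goodCount (n : ℕ) :
    MeasurableSet {P : Matrix (Fin 2 ⊕ β) (Fin 2 ⊕ β) ℝ | GoodCount n P} := by
  have h1 := (measurable_graphSum (posInd (β := β)) measurable_posInd posInd_of_eq_zero).1
  have h2 := (measurable_graphSum (negInd (β := β)) measurable_negInd negInd_of_eq_zero).1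
  exact (measurableSet_eq_fun h1 (h2.add measurable_const)).inter
    (measurableSet_le h2 measurable_const)

lemma tsum_quadDiv {χ : ℝ[X]} {D : Finset ℝ[X]} (hD : ∀ p ∈ D, p ∈ quadDiv χ)
    (f : ℝ[X] → ℝ≥0∞) (h1 : ∀ p ∈ D, f p = 1) (h0 : ∀ p ∈ quadDiv χ, p ∉ D → f p = 0) :
    ∑' p : quadDiv χ, f p = D.card := by
  rw [tsum_subtype, tsum_eq_sum (s := D)]
  · rw [Finset.sum_congr rfl fun p hp => ?_, Finset.sum_const, nsmul_one]
    rw [indicator_of_mem (hD p hp), h1 p hp]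
  · intro p hp
    by_cases h : p ∈ quadDiv χ
    · rw [indicator_of_mem h, h0 p h hp]
    · rw [indicator_of_notMem h]

lemma goodCount_of_separable {l : ℕ} (hβ : Fintype.card β = 2 * l)
    {P : Matrix (Fin 2 ⊕ β) (Fin 2 ⊕ β) ℝ} (hs : P.charpoly.Separable)
    (hU : ∀ p ∈ quadDiv P.charpoly, ∃ U ∈ invGraph P,
      (P.toBlocks₁₁ + P.toBlocks₁₂ * U).charpoly = p) : GoodCount (l + 1) P := by
  have hd : P.charpoly.natDegree = 2 * (l + 1) := by
    rw [charpoly_natDegree_eq_dim, Fintype.card_sum, hβ, Fintype.card_fin]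
    ring
  obtain ⟨Dp, Dm, hD, hp, hm, hc, hle⟩ := quadDiv_count hs hd
  have hmem : ∀ U : invGraph P,
      (P.toBlocks₁₁ + P.toBlocks₁₂ * U.1).charpoly ∈ quadDiv P.charpoly := fun U =>
    ⟨charpoly_monic _, by rw [charpoly_natDegree_eq_dim, Fintype.card_fin],
      ⟨_, invGraph_charpoly U.2⟩⟩
  let e : invGraph P ≃ quadDiv P.charpoly := Equiv.ofBijective (fun U => ⟨_, hmem U⟩) (by
    constructor
    · intro U V h
      exact Subtype.ext (invGraph_injOn hs U.2 V.2 (congrArg Subtype.val h))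
    · rintro ⟨p, hp⟩
      obtain ⟨U, hU, h⟩ := hU p hp
      exact ⟨⟨U, hU⟩, Subtype.ext h⟩)
  have hpos : ∀ U : invGraph P, (e U).1 ∈ Dp → 0 < sylvDet (P.toBlocks₁₁ + P.toBlocks₁₂ * U.1)
      (P.toBlocks₂₂ - U.1 * P.toBlocks₁₂) := fun U h =>
    hp _ h _ _ (invGraph_charpoly U.2) (ofReal_sylvDet _ _)
  have hneg : ∀ U : invGraph P, (e U).1 ∈ Dm → sylvDet (P.toBlocks₁₁ + P.toBlocks₁₂ * U.1)
      (P.toBlocks₂₂ - U.1 * P.toBlocks₁₂) < 0 := fun U h =>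
    hm _ h _ _ (invGraph_charpoly U.2) (ofReal_sylvDet _ _)
  have hdis : ∀ p ∈ quadDiv P.charpoly, p ∈ Dp → p ∉ Dm := fun p hq h1 h2 => by
    obtain ⟨U, hU⟩ := e.surjective ⟨p, hq⟩
    have e1 : (e U).1 = p := congrArg Subtype.val hU
    exact lt_asymm (hpos U (e1 ▸ h1)) (hneg U (e1 ▸ h2))
  classical
  have hcp : graphSum posInd P = Dp.card := by
    rw [← tsum_quadDiv (fun p h => (hD p).2 (Or.inl h)) (fun p => if p ∈ Dp then 1 else 0)
      (fun p h => if_pos h) (fun p _ h => if_neg h), graphSum, ← e.tsum_eq]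
    refine tsum_congr fun U => ?_
    unfold posInd
    congr 1
    refine propext ⟨fun h => ?_, hpos U⟩
    rcases (hD _).1 (e U).2 with h' | h'
    · exact h'
    · exact absurd h (lt_asymm (hneg U h'))
  have hcm : graphSum negInd P = Dm.card := by
    rw [← tsum_quadDiv (fun p h => (hD p).2 (Or.inr h)) (fun p => if p ∈ Dm then 1 else 0)
      (fun p h => if_pos h) (fun p _ h => if_neg h), graphSum, ← e.tsum_eq]
    refine tsum_congr fun U => ?_
    unfold negInd
    congr 1
    refine propext ⟨fun h => ?_, hneg U⟩
    rcases (hD _).1 (e U).2 with h' | h'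
    · exact absurd h (lt_asymm (hpos U h'))
    · exact h'
  refine ⟨?_, ?_⟩
  · rw [hcp, hcm, hc]
    push_cast
    ring
  · rw [hcm]
    exact_mod_cast hle

lemma ae_conj_goodCount {l : ℕ} (hβ : Fintype.card β = 2 * l)
    {P : Matrix (Fin 2 ⊕ β) (Fin 2 ⊕ β) ℝ} (hs : P.charpoly.Separable)
    (hP : (krylov P).det ≠ 0) :
    ∀ᵐ g : Matrix (Fin 2 ⊕ β) (Fin 2 ⊕ β) ℝ, GoodCount (l + 1) (g * P * g⁻¹) := by
  have hd : P.charpoly.natDegree = 2 * (l + 1) := by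
    rw [charpoly_natDegree_eq_dim, Fintype.card_sum, hβ, Fintype.card_fin]
    ring
  obtain ⟨Dp, Dm, hD, -⟩ := quadDiv_count hs hd
  have hfin : (quadDiv P.charpoly).Countable := by
    classical
    refine ((Dp ∪ Dm).finite_toSet.subset fun p hp => ?_).countable
    simpa using (hD p).1 hp
  have key : ∀ p ∈ quadDiv P.charpoly, ∀ᵐ g : Matrix (Fin 2 ⊕ β) (Fin 2 ⊕ β) ℝ,
      g.det ≠ 0 → ∃ U ∈ invGraph (g * P * g⁻¹),
        ((g * P * g⁻¹).toBlocks₁₁ + (g * P * g⁻¹).toBlocks₁₂ * U).charpoly = p := by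
    intro p hp
    obtain ⟨K, C, hK, hC, L, hL⟩ := exists_quad_columns hP hp
    have hae : ∀ᵐ g : Matrix (Fin 2 ⊕ β) (Fin 2 ⊕ β) ℝ, (g * K).toRows₁.det ≠ 0 := by
      refine ae_ne_zero_of_polyOnLines
        (det_mem_polyOnLines (fun g : Matrix (Fin 2 ⊕ β) (Fin 2 ⊕ β) ℝ => (g * K).toRows₁)
          fun i j => ?_) ?_
        (x₀ := fromRows L 0) ?_
      · have : (fun g : Matrix (Fin 2 ⊕ β) (Fin 2 ⊕ β) ℝ => (g * K).toRows₁ i j) =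
            ∑ k, K k j • fun g : Matrix (Fin 2 ⊕ β) (Fin 2 ⊕ β) ℝ => g (Sum.inl i) k := by
          funext g
          simp [toRows₁, Matrix.mul_apply, mul_comm]
        rw [this]
        exact (polyOnLines _).sum_mem fun k _ =>
          (polyOnLines _).smul_mem (entry_mem_polyOnLines _ _) _
      · refine Continuous.measurable (Continuous.matrix_det ?_)
        exact (continuous_id.matrix_mul continuous_const).matrix_submatrix Sum.inl id
      · rw [fromRows_mul, toRows₁_fromRows, hL, det_one]
        exact one_ne_zero
    filter_upwards [hae] with g hg hdet
    have := exists_invGraph_of_mul_eq (P := g * P * g⁻¹) (K := g * K) (C := C) ?_ hg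
    · rwa [hC] at this
    · rw [← Matrix.mul_assoc, Matrix.mul_assoc (g * P), nonsing_inv_mul _ hdet.isUnit,
        Matrix.mul_one, Matrix.mul_assoc, hK, Matrix.mul_assoc]
  filter_upwards [(ae_ball_iff hfin).2 key, ae_det_ne_zero] with g hg hdet
  have hch : (g * P * g⁻¹).charpoly = P.charpoly := charpoly_conj (nonsing_inv_mul _ hdet.isUnit)
  refine goodCount_of_separable hβ (hch ▸ hs) ?_
  rw [hch]
  exact fun p hp => hg p hp hdet

lemma ae_of_ae_conj {ι : Type*} [Fintype ι] [DecidableEq ι] {g : Matrix ι ι ℝ} (hg : g.det ≠ 0)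
    {S : Set (Matrix ι ι ℝ)} (hS : MeasurableSet S) (h : ∀ᵐ P : Matrix ι ι ℝ, g * P * g⁻¹ ∈ S) :
    ∀ᵐ P : Matrix ι ι ℝ, P ∈ S := by
  have hg' : (g⁻¹).det ≠ 0 := by
    rw [det_nonsing_inv, Ring.inverse_eq_inv']
    exact inv_ne_zero hg
  have e1 := lintegral_mul_left g hg fun P : Matrix ι ι ℝ => Sᶜ.indicator 1 (P * g⁻¹)
  have e2 := lintegral_mul_right g⁻¹ hg' fun P : Matrix ι ι ℝ => Sᶜ.indicator (1 : Matrix ι ι ℝ → ℝ≥0∞) P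
  rw [e2, ← mul_assoc] at e1
  have e3 : ∫⁻ X : Matrix ι ι ℝ, Sᶜ.indicator (1 : Matrix ι ι ℝ → ℝ≥0∞) (g * X * g⁻¹) = 0 := by
    rw [lintegral_eq_zero_iff]
    · filter_upwards [h] with P hP
      exact indicator_of_notMem (notMem_compl_iff.2 hP) _
    · exact (measurable_one.indicator hS.compl).comp
        (((continuous_const.matrix_mul continuous_id).matrix_mul continuous_const).measurable)
  rw [e3] at e1
  have e4 := (mul_eq_zero.1 e1.symm).resolve_left ?_
  · rw [lintegral_indicator_one hS.compl] at e4
    exact e4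
  · rw [← ENNReal.ofReal_mul (by positivity)]
    have : 0 < |g.det|⁻¹ ^ Fintype.card ι * |(g⁻¹).det|⁻¹ ^ Fintype.card ι := by
      have := abs_pos.2 hg
      have := abs_pos.2 hg'
      positivity
    exact (ENNReal.ofReal_pos.2 this).ne'

theorem ae_goodCount {l : ℕ} (hβ : Fintype.card β = 2 * l) :
    ∀ᵐ P : Matrix (Fin 2 ⊕ β) (Fin 2 ⊕ β) ℝ, GoodCount (l + 1) P := by
  have h1 : ∀ᵐ P : Matrix (Fin 2 ⊕ β) (Fin 2 ⊕ β) ℝ, ∀ᵐ g : Matrix (Fin 2 ⊕ β) (Fin 2 ⊕ β) ℝ,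
      GoodCount (l + 1) (g * P * g⁻¹) := by
    filter_upwards [ae_separable, ae_krylov] with P hs hP
    exact ae_conj_goodCount hβ hs hP
  rw [Measure.ae_ae_comm] at h1
  · obtain ⟨g, hg, hdet⟩ := (h1.and ae_det_ne_zero).exists
    exact ae_of_ae_conj hdet (measurableSet_goodCount _) hg
  · have hm : Measurable fun x : Matrix (Fin 2 ⊕ β) (Fin 2 ⊕ β) ℝ ×
        Matrix (Fin 2 ⊕ β) (Fin 2 ⊕ β) ℝ => x.2 * x.1 * x.2⁻¹ :=
      (measurable_snd.mul measurable_fst).mul (measurable_matrix_inv.comp measurable_snd)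
    exact hm (measurableSet_goodCount _)

lemma prodLaw_absolutelyContinuous {ι : Type*} [Fintype ι] [DecidableEq ι] (k : ℕ) :
    prodLaw ι (k + 1) ≪ volume := by
  refine Measure.AbsolutelyContinuous.mk fun S hS h => ?_
  have hm : Measurable (S.indicator (1 : Matrix ι ι ℝ → ℝ≥0∞)) := measurable_one.indicator hS
  rw [← lintegral_indicator_one hS, lintegral_prodLaw_succ' k _ hm, lintegral_lintegral_swap]
  · rw [lintegral_eq_zero_iff' ]
    · filter_upwards [ae_prodLaw_det_ne_zero k] with Y hY
      have hY' : Measurable fun X : Matrix ι ι ℝ => S.indicator (1 : Matrix ι ι ℝ → ℝ≥0∞) (Y * X) :=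
        hm.comp (continuous_const.matrix_mul continuous_id).measurable
      show ∫⁻ X, S.indicator 1 (Y * X) ∂stdGaussian ι ι = 0
      rw [lintegral_eq_zero_iff hY']
      refine stdGaussian_absolutelyContinuous ?_
      have e1 := lintegral_mul_left Y hY (S.indicator (1 : Matrix ι ι ℝ → ℝ≥0∞))
      rw [lintegral_indicator_one hS, h, mul_zero, lintegral_eq_zero_iff hY'] at e1
      exact e1
    · refine (Measurable.lintegral_prod_right' (f := fun p : Matrix ι ι ℝ × Matrix ι ι ℝ =>
        S.indicator 1 (p.1 * p.2)) (hm.comp measurable_mul)).aemeasurable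
  · exact (hm.comp (measurable_snd.mul measurable_fst)).aemeasurable

lemma graphSum_mul_charpoly {α : Type*} [Fintype α] [DecidableEq α] (F : ℝ[X] → ℝ≥0∞)
    (φ : Matrix α α ℝ → Matrix β β ℝ → ℝ≥0∞) (P : Matrix (α ⊕ β) (α ⊕ β) ℝ) :
    graphSum (fun b y => F (b.charpoly * y.charpoly) * φ b y) P = F P.charpoly * graphSum φ P := by
  unfold graphSum
  rw [← ENNReal.tsum_mul_left]
  refine tsum_congr fun U => ?_
  beta_reduce
  rw [← invGraph_charpoly U.2]

end Count

section Reindex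
variable {ι κ : Type*} [Fintype ι] [Fintype κ] [DecidableEq ι] [DecidableEq κ]

lemma measurePreserving_comp_equiv {E : Type*} [MeasurableSpace E] (μ : Measure E)
    [IsProbabilityMeasure μ] (e : ι ≃ κ) :
    MeasurePreserving (fun x : ι → E => x ∘ e.symm) (Measure.pi fun _ => μ)
      (Measure.pi fun _ => μ) := by
  have := measurePreserving_piCongrLeft (fun _ : κ => μ) e
  convert this using 1
  funext x j
  have h := MeasurableEquiv.coe_piCongrLeft (π := fun _ : κ => E) e
  rw [h]
  conv_rhs => rw [← e.apply_symm_apply j]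
  rw [Equiv.piCongrLeft_apply_apply]
  rfl

lemma measurePreserving_reindex_stdGaussian (e : ι ≃ κ) :
    MeasurePreserving (fun X : Matrix ι ι ℝ => X.submatrix e.symm e.symm)
      (stdGaussian ι ι) (stdGaussian κ κ) := by
  have h1 := measurePreserving_comp_equiv (Measure.pi fun _ : ι => gaussianReal 0 1) e
  have h2 := measurePreserving_pi (ι := κ) (fun _ => Measure.pi fun _ : ι => gaussianReal 0 1)
    (fun _ => Measure.pi fun _ : κ => gaussianReal 0 1)
    (fun _ => measurePreserving_comp_equiv (gaussianReal 0 1) e)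
  exact h2.comp h1

lemma measurePreserving_reindex_prodLaw (e : ι ≃ κ) (k : ℕ) :
    MeasurePreserving (fun X : Matrix ι ι ℝ => X.submatrix e.symm e.symm)
      (prodLaw ι k) (prodLaw κ k) := by
  have hm := (measurePreserving_reindex_stdGaussian e).measurable
  refine ⟨hm, ?_⟩
  induction k with
  | zero =>
    unfold prodLaw
    rw [Measure.map_dirac' hm]
    simp
  | succ k ih =>
    have h := Measure.map_mconv_monoidHom (μ := stdGaussian ι ι) (ν := prodLaw ι k)
      ((reindexAlgEquiv ℝ ℝ e : Matrix ι ι ℝ →* Matrix κ κ ℝ)) hm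
    have h1 := (measurePreserving_reindex_stdGaussian e).map_eq
    unfold prodLaw
    rw [← h1]
    conv_rhs => rw [← ih]
    exact h

end Reindex

section CharMeasurable
open Polynomial

/-- Measurability of a function of the characteristic polynomial of `N × N` matrices. -/
def CharMeas {E : Type*} [MeasurableSpace E] (N : ℕ) (f : ℝ[X] → E) : Prop :=
  Measurable fun P : Matrix (Fin N) (Fin N) ℝ => f P.charpoly

variable {ι κ : Type*} [Fintype ι] [Fintype κ] [DecidableEq ι] [DecidableEq κ]
  {E : Type*} [MeasurableSpace E]

lemma CharMeas.charpoly {N : ℕ} {f : ℝ[X] → E} (hf : CharMeas N f) (hι : Fintype.card ι = N) :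
    Measurable fun P : Matrix ι ι ℝ => f P.charpoly := by
  let e := Fintype.equivFinOfCardEq hι
  have hm := (measurePreserving_reindex_stdGaussian e).measurable
  have := Measurable.comp (g := fun P : Matrix (Fin N) (Fin N) ℝ => f P.charpoly) hf hm
  convert this using 2 with P
  exact congrArg f (charpoly_reindex e P).symm

lemma CharMeas.charpoly_mul {N : ℕ} {f : ℝ[X] → E} (hf : CharMeas N f)
    (h : Fintype.card ι + Fintype.card κ = N) :
    Measurable fun p : Matrix ι ι ℝ × Matrix κ κ ℝ => f (p.1.charpoly * p.2.charpoly) := by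
  have h1 := hf.charpoly (ι := ι ⊕ κ) (by rw [Fintype.card_sum, h])
  have h2 : Measurable fun p : Matrix ι ι ℝ × Matrix κ κ ℝ => fromBlocks p.1 0 0 p.2 :=
    (continuous_fst.matrix_fromBlocks continuous_const continuous_const continuous_snd).measurable
  have := Measurable.comp (g := fun P : Matrix (ι ⊕ κ) (ι ⊕ κ) ℝ => f P.charpoly) h1 h2
  convert this using 2 with p
  simp [charpoly_fromBlocks_zero₂₁]

lemma lintegral_charpoly_reindex {N : ℕ} {f : ℝ[X] → ℝ≥0∞} (hf : CharMeas N f)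
    (hι : Fintype.card ι = N) (k : ℕ) :
    ∫⁻ P, f P.charpoly ∂prodLaw ι k = ∫⁻ P, f P.charpoly ∂prodLaw (Fin N) k := by
  let e := Fintype.equivFinOfCardEq hι
  have h : Measurable fun P : Matrix (Fin N) (Fin N) ℝ => f P.charpoly := hf
  rw [← (measurePreserving_reindex_prodLaw e k).lintegral_comp h]
  refine lintegral_congr fun P => ?_
  exact congrArg f (charpoly_reindex e P).symm

end CharMeasurable

section Signed
open Polynomial
variable {β : Type*} [Fintype β] [DecidableEq β]

lemma lintegral_mul_graphSum_aux (k : ℕ) {F : ℝ[X] → ℝ≥0∞}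
    (hF : CharMeas (2 + Fintype.card β) F)
    (φ : Matrix (Fin 2) (Fin 2) ℝ → Matrix β β ℝ → ℝ≥0∞) (hφ : Measurable (uncurry φ))
    (h0 : ∀ b y, sylvDet b y = 0 → φ b y = 0) (hφ' : ∀ b y b' y', sylvDet b y = sylvDet b' y' →
      φ b y = φ b' y') :
    ∫⁻ P, F P.charpoly * graphSum φ P ∂prodLaw (Fin 2 ⊕ β) (k + 1) =
      qrConst (Fin 2) β ^ (k + 1) * ∫⁻ p, ENNReal.ofReal |sylvDet p.1 p.2| * (φ p.1 p.2) *
        F (p.1.charpoly * p.2.charpoly) ∂(prodLaw (Fin 2) (k + 1)).prod (prodLaw β (k + 1)) := by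
  have hFm : Measurable fun p : Matrix (Fin 2) (Fin 2) ℝ × Matrix β β ℝ =>
      F (p.1.charpoly * p.2.charpoly) := hF.charpoly_mul (by rw [Fintype.card_fin])
  have hΦ : Measurable (uncurry fun (b : Matrix (Fin 2) (Fin 2) ℝ) (y : Matrix β β ℝ) =>
    F (b.charpoly * y.charpoly) * φ b y) := hFm.mul hφ
  have h := lintegral_graphSum_prodLaw k _ hΦ (fun b y hb => by rw [h0 b y hb, mul_zero]) ?_
  · simp_rw [graphSum_mul_charpoly] at h
    rw [h, lintegral_prod]
    · congr 1
      refine lintegral_congr fun b => lintegral_congr fun y => ?_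
      ring
    · have hs := continuous_sylvDet (α := Fin 2) (β := β)
      exact ((hs.measurable.abs.ennreal_ofReal.mul hφ).mul hFm).aemeasurable
  · intro b y g h hg hh
    rw [charpoly_conj (nonsing_inv_mul _ hg), charpoly_conj (nonsing_inv_mul _ hh)]
    rw [hφ' _ _ _ _ (sylvDet_conj b y g h hg hh)]

/-- Signed reduction: a pair of eigenvalues is split off with the sign of the resultant. -/
theorem lintegral_signed {l : ℕ} (hβ : Fintype.card β = 2 * l) (k : ℕ) {F : ℝ[X] → ℝ≥0∞}
    (hF : CharMeas (2 * (l + 1)) F) :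
    qrConst (Fin 2) β ^ (k + 1) * ∫⁻ p, ENNReal.ofReal (sylvDet p.1 p.2) *
        F (p.1.charpoly * p.2.charpoly) ∂(prodLaw (Fin 2) (k + 1)).prod (prodLaw β (k + 1)) =
      (l + 1 : ℕ) * ∫⁻ P, F P.charpoly ∂prodLaw (Fin (2 * (l + 1))) (k + 1) +
      qrConst (Fin 2) β ^ (k + 1) * ∫⁻ p, ENNReal.ofReal (-sylvDet p.1 p.2) *
        F (p.1.charpoly * p.2.charpoly) ∂(prodLaw (Fin 2) (k + 1)).prod (prodLaw β (k + 1)) ∧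
    qrConst (Fin 2) β ^ (k + 1) * ∫⁻ p, ENNReal.ofReal (-sylvDet p.1 p.2) *
        F (p.1.charpoly * p.2.charpoly) ∂(prodLaw (Fin 2) (k + 1)).prod (prodLaw β (k + 1)) ≤
      (2 * (l + 1 : ℕ)) ^ 2 * ∫⁻ P, F P.charpoly ∂prodLaw (Fin (2 * (l + 1))) (k + 1) := by
  have hN : 2 + Fintype.card β = 2 * (l + 1) := by rw [hβ]; ring
  have hF' : CharMeas (2 + Fintype.card β) F := hN ▸ hF
  have hp := lintegral_mul_graphSum_aux k hF' posInd measurable_posInd posInd_of_eq_zero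
    (fun b y b' y' h => by rw [posInd, posInd, h])
  have hn := lintegral_mul_graphSum_aux k hF' negInd measurable_negInd negInd_of_eq_zero
    (fun b y b' y' h => by rw [negInd, negInd, h])
  have e1 : ∀ (b : Matrix (Fin 2) (Fin 2) ℝ) (y : Matrix β β ℝ),
      ENNReal.ofReal |sylvDet b y| * posInd b y = ENNReal.ofReal (sylvDet b y) := by
    intro b y
    unfold posInd
    split_ifs with h
    · rw [abs_of_pos h, mul_one]
    · rw [mul_zero, ENNReal.ofReal_of_nonpos (not_lt.1 h)]
  have e2 : ∀ (b : Matrix (Fin 2) (Fin 2) ℝ) (y : Matrix β β ℝ),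
      ENNReal.ofReal |sylvDet b y| * negInd b y = ENNReal.ofReal (-sylvDet b y) := by
    intro b y
    unfold negInd
    split_ifs with h
    · rw [abs_of_neg h, mul_one]
    · rw [mul_zero, ENNReal.ofReal_of_nonpos (neg_nonpos.2 (not_lt.1 h))]
  simp_rw [e1] at hp
  simp_rw [e2] at hn
  have hcard : Fintype.card (Fin 2 ⊕ β) = 2 * (l + 1) := by
    rw [Fintype.card_sum, Fintype.card_fin, hN]
  have hFP : Measurable fun P : Matrix (Fin 2 ⊕ β) (Fin 2 ⊕ β) ℝ => F P.charpoly :=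
    hF.charpoly hcard
  have hgn := (measurable_graphSum (negInd (β := β)) measurable_negInd negInd_of_eq_zero).1
  have hgood : ∀ᵐ P ∂prodLaw (Fin 2 ⊕ β) (k + 1), GoodCount (l + 1) P :=
    (prodLaw_absolutelyContinuous k).ae_le (ae_goodCount hβ)
  rw [← hp, ← hn, ← lintegral_charpoly_reindex hF hcard]
  constructor
  · rw [← lintegral_const_mul _ hFP, ← lintegral_add_left (hFP.const_mul _)]
    refine lintegral_congr_ae ?_
    filter_upwards [hgood] with P hP
    rw [hP.1]
    ring
  · rw [← lintegral_const_mul _ hFP]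
    refine lintegral_mono_ae ?_
    filter_upwards [hgood] with P hP
    rw [mul_comm]
    gcongr
    exact hP.2

end Signed

section SignedReal
open Polynomial
variable {β : Type*} [Fintype β] [DecidableEq β]

lemma enorm_eq_ofReal_add (x : ℝ) : ‖x‖ₑ = ENNReal.ofReal x + ENNReal.ofReal (-x) := by
  rcases le_total 0 x with h | h
  · rw [Real.enorm_of_nonneg h, ENNReal.ofReal_of_nonpos (neg_nonpos.2 h), add_zero]
  · rw [← enorm_neg, Real.enorm_of_nonneg (neg_nonneg.2 h), ENNReal.ofReal_of_nonpos h, zero_add]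

lemma exists_lintegral_abs_le {l : ℕ} (hβ : Fintype.card β = 2 * l) (k : ℕ) :
    ∃ K : ℝ≥0∞, K ≠ ∞ ∧ ∀ F : ℝ[X] → ℝ≥0∞, CharMeas (2 * (l + 1)) F →
    ∫⁻ p, ‖sylvDet p.1 p.2‖ₑ * F (p.1.charpoly * p.2.charpoly)
      ∂(prodLaw (Fin 2) (k + 1)).prod (prodLaw β (k + 1)) ≤
    K * ∫⁻ P, F P.charpoly ∂prodLaw (Fin (2 * (l + 1))) (k + 1) := by
  set c := qrConst (Fin 2) β ^ (k + 1) with hc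
  have hc0 : c ≠ 0 := pow_ne_zero _ (qrConst_ne_zero _ _)
  have hct : c ≠ ∞ := ENNReal.pow_ne_top (qrConst_ne_top _ _)
  refine ⟨c⁻¹ * ((l + 1 : ℕ) + 2 * (2 * (l + 1 : ℕ)) ^ 2), ?_, fun F hF => ?_⟩
  · refine ENNReal.mul_ne_top (ENNReal.inv_ne_top.2 hc0) ?_
    simp only [ne_eq, ENNReal.add_eq_top, ENNReal.natCast_ne_top, false_or]
    refine ENNReal.mul_ne_top (by simp) (ENNReal.pow_ne_top (ENNReal.mul_ne_top (by simp) ?_))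
    exact ENNReal.natCast_ne_top _
  · obtain ⟨h1, h2⟩ := lintegral_signed hβ k hF
    have hFm : Measurable fun p : Matrix (Fin 2) (Fin 2) ℝ × Matrix β β ℝ =>
      F (p.1.charpoly * p.2.charpoly) := hF.charpoly_mul (by rw [Fintype.card_fin, hβ]; ring)
    rw [← hc] at h1 h2
    rw [mul_assoc, ← one_mul (lintegral _ _), ← ENNReal.inv_mul_cancel hc0 hct, mul_assoc]
    refine mul_le_mul_right ?_ _
    simp_rw [enorm_eq_ofReal_add, add_mul]
    have hm : Measurable fun p : Matrix (Fin 2) (Fin 2) ℝ × Matrix β β ℝ =>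
      ENNReal.ofReal (sylvDet p.1 p.2) * F (p.1.charpoly * p.2.charpoly) :=
      measurable_sylvDet.ennreal_ofReal.mul hFm
    rw [lintegral_add_left hm, mul_add, h1]
    refine (add_le_add (add_le_add le_rfl h2) h2).trans_eq ?_
    ring

lemma integrable_signed {l : ℕ} (hβ : Fintype.card β = 2 * l) (k : ℕ) {f : ℝ[X] → ℝ}
    (hf : CharMeas (2 * (l + 1)) f)
    (hi : Integrable (fun P => f P.charpoly) (prodLaw (Fin (2 * (l + 1))) (k + 1))) :
    Integrable (fun p : Matrix (Fin 2) (Fin 2) ℝ × Matrix β β ℝ =>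
      sylvDet p.1 p.2 * f (p.1.charpoly * p.2.charpoly))
      ((prodLaw (Fin 2) (k + 1)).prod (prodLaw β (k + 1))) := by
  have hFm : Measurable fun p : Matrix (Fin 2) (Fin 2) ℝ × Matrix β β ℝ =>
    f (p.1.charpoly * p.2.charpoly) := hf.charpoly_mul (by rw [Fintype.card_fin, hβ]; ring)
  refine ⟨(measurable_sylvDet.mul hFm).aestronglyMeasurable, ?_⟩
  obtain ⟨K, hK, h⟩ := exists_lintegral_abs_le hβ k
  have := h (fun q => ‖f q‖ₑ) (Measurable.enorm hf)
  simp_rw [hasFiniteIntegral_iff_enorm, enorm_mul]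
  refine this.trans_lt (ENNReal.mul_lt_top hK.lt_top ?_)
  exact hasFiniteIntegral_iff_enorm.1 hi.2

lemma CharMeas.max_zero {N : ℕ} {f : ℝ[X] → ℝ} (hf : CharMeas N f) :
    CharMeas N fun q => max (f q) 0 := Measurable.max hf measurable_const

lemma CharMeas.neg {N : ℕ} {f : ℝ[X] → ℝ} (hf : CharMeas N f) :
    CharMeas N fun q => -f q := Measurable.neg hf

lemma integral_signed_of_nonneg {l : ℕ} (hβ : Fintype.card β = 2 * l) (k : ℕ) {f : ℝ[X] → ℝ}
    (h0 : ∀ q, 0 ≤ f q) (hf : CharMeas (2 * (l + 1)) f)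
    (hi : Integrable (fun P => f P.charpoly) (prodLaw (Fin (2 * (l + 1))) (k + 1))) :
    (l + 1 : ℕ) * ∫ P, f P.charpoly ∂prodLaw (Fin (2 * (l + 1))) (k + 1) =
    (qrConst (Fin 2) β ^ (k + 1)).toReal *
      ∫ p : Matrix (Fin 2) (Fin 2) ℝ × Matrix β β ℝ, sylvDet p.1 p.2 *
        f (p.1.charpoly * p.2.charpoly) ∂(prodLaw (Fin 2) (k + 1)).prod (prodLaw β (k + 1)) := by
  have hg := integrable_signed hβ k hf hi
  have hF : CharMeas (2 * (l + 1)) fun q => ENNReal.ofReal (f q) := Measurable.ennreal_ofReal hf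
  obtain ⟨h1, h2⟩ := lintegral_signed hβ k hF
  rw [integral_eq_lintegral_pos_part_sub_lintegral_neg_part hg]
  simp_rw [← neg_mul, ENNReal.ofReal_mul' (h0 _)]
  have hfin : ∫⁻ P, ENNReal.ofReal (f P.charpoly) ∂prodLaw (Fin (2 * (l + 1))) (k + 1) ≠ ∞ :=
    ((lintegral_ofReal_le_lintegral_enorm _).trans_lt (hasFiniteIntegral_iff_enorm.1 hi.2)).ne
  rw [integral_eq_lintegral_of_nonneg_ae (ae_of_all _ fun P => h0 _)
    (Measurable.aestronglyMeasurable hf), mul_sub, ← ENNReal.toReal_mul, ← ENNReal.toReal_mul, h1,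
    ENNReal.toReal_add]
  · rw [ENNReal.toReal_mul, ENNReal.toReal_natCast]
    ring
  · exact ENNReal.mul_ne_top (ENNReal.natCast_ne_top _) hfin
  · refine ne_top_of_le_ne_top (ENNReal.mul_ne_top ?_ hfin) h2
    exact ENNReal.pow_ne_top (ENNReal.mul_ne_top (by simp) (ENNReal.natCast_ne_top _))

theorem integral_signed {l : ℕ} (hβ : Fintype.card β = 2 * l) (k : ℕ) {f : ℝ[X] → ℝ}
    (hf : CharMeas (2 * (l + 1)) f)
    (hi : Integrable (fun P => f P.charpoly) (prodLaw (Fin (2 * (l + 1))) (k + 1))) :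
    (l + 1 : ℕ) * ∫ P, f P.charpoly ∂prodLaw (Fin (2 * (l + 1))) (k + 1) =
    (qrConst (Fin 2) β ^ (k + 1)).toReal *
      ∫ p : Matrix (Fin 2) (Fin 2) ℝ × Matrix β β ℝ, sylvDet p.1 p.2 *
        f (p.1.charpoly * p.2.charpoly) ∂(prodLaw (Fin 2) (k + 1)).prod (prodLaw β (k + 1)) := by
  have hip : Integrable (fun P => max (f P.charpoly) 0) (prodLaw (Fin (2 * (l + 1))) (k + 1)) :=
    hi.pos_part
  have him : Integrable (fun P => max (-f P.charpoly) 0) (prodLaw (Fin (2 * (l + 1))) (k + 1)) :=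
    hi.neg_part
  have hp := integral_signed_of_nonneg (f := fun q => max (f q) 0) hβ k
    (fun q => le_max_right _ _) hf.max_zero hip
  have hm := integral_signed_of_nonneg (f := fun q => max (-f q) 0) hβ k
    (fun q => le_max_right _ _) hf.neg.max_zero him
  have hgp := integrable_signed (f := fun q => max (f q) 0) hβ k hf.max_zero hip
  have hgm := integrable_signed (f := fun q => max (-f q) 0) hβ k hf.neg.max_zero him
  have hsub : ∀ x : ℝ, x = max x 0 - max (-x) 0 := fun x => by
    rcases le_total 0 x with h | h
    · rw [max_eq_left h, max_eq_right (neg_nonpos.2 h), sub_zero]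
    · rw [max_eq_right h, max_eq_left (neg_nonneg.2 h), zero_sub, neg_neg]
  have e1 : ∫ P, f P.charpoly ∂prodLaw (Fin (2 * (l + 1))) (k + 1) =
      ∫ P, max (f P.charpoly) 0 ∂prodLaw (Fin (2 * (l + 1))) (k + 1) -
      ∫ P, max (-f P.charpoly) 0 ∂prodLaw (Fin (2 * (l + 1))) (k + 1) := by
    rw [← integral_sub hip him]
    exact integral_congr_ae (ae_of_all _ fun P => hsub _)
  have e2 : ∫ p : Matrix (Fin 2) (Fin 2) ℝ × Matrix β β ℝ, sylvDet p.1 p.2 *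
        f (p.1.charpoly * p.2.charpoly) ∂(prodLaw (Fin 2) (k + 1)).prod (prodLaw β (k + 1)) =
      ∫ p : Matrix (Fin 2) (Fin 2) ℝ × Matrix β β ℝ, sylvDet p.1 p.2 *
        max (f (p.1.charpoly * p.2.charpoly)) 0
          ∂(prodLaw (Fin 2) (k + 1)).prod (prodLaw β (k + 1)) -
      ∫ p : Matrix (Fin 2) (Fin 2) ℝ × Matrix β β ℝ, sylvDet p.1 p.2 *
        max (-f (p.1.charpoly * p.2.charpoly)) 0
          ∂(prodLaw (Fin 2) (k + 1)).prod (prodLaw β (k + 1)) := by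
    rw [← integral_sub hgp hgm]
    refine integral_congr_ae (ae_of_all _ fun p => ?_)
    beta_reduce
    rw [← mul_sub, ← hsub]
  rw [e1, e2, mul_sub, mul_sub, hp, hm]

end SignedReal

section Iterate
open Polynomial

lemma measurePreserving_finCons {E : Type*} [MeasurableSpace E] (μ : Measure E)
    [IsProbabilityMeasure μ] (l : ℕ) :
    MeasurePreserving (fun p : E × (Fin l → E) => (Fin.cons p.1 p.2 : Fin (l + 1) → E))
      (μ.prod (Measure.pi fun _ => μ)) (Measure.pi fun _ => μ) := by
  have := (measurePreserving_piFinSuccAbove (fun _ : Fin (l + 1) => μ) 0).symm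
  convert this using 1
  funext p
  exact (Fin.insertNth_zero' p.1 p.2).symm

/-- The product of the resultants of the pairs of members of a family of `2 × 2` matrices. -/
noncomputable def vand {l : ℕ} (B : Fin l → Matrix (Fin 2) (Fin 2) ℝ) : ℝ :=
  ∏ s, ∏ t ∈ Finset.Ioi s, (aeval (B s) (B t).charpoly).det

lemma vand_cons {l : ℕ} (b : Matrix (Fin 2) (Fin 2) ℝ) (B : Fin l → Matrix (Fin 2) (Fin 2) ℝ) :
    vand (Fin.cons b B : Fin (l + 1) → Matrix (Fin 2) (Fin 2) ℝ) =
      (aeval b (∏ s, (B s).charpoly)).det * vand B := by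
  have h : ∀ s : Finset (Fin l), (aeval b (∏ t ∈ s, (B t).charpoly)).det =
      ∏ t ∈ s, (aeval b (B t).charpoly).det := by
    intro s
    classical
    induction s using Finset.induction_on with
    | empty => simp
    | insert a s ha ih => rw [Finset.prod_insert ha, Finset.prod_insert ha, map_mul, det_mul, ih]
  rw [vand, Fin.prod_univ_succ, Fin.prod_Ioi_zero, h]
  simp [vand, Fin.prod_Ioi_succ]

lemma charpoly_blockDiagonal' {l : ℕ} (B : Fin l → Matrix (Fin 2) (Fin 2) ℝ) :
    (blockDiagonal B).charpoly = ∏ s, (B s).charpoly := by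
  have : charmatrix (blockDiagonal B) = blockDiagonal fun s => charmatrix (B s) := by
    ext ⟨i, s⟩ ⟨j, t⟩
    simp only [charmatrix_apply, blockDiagonal_apply, diagonal_apply, Prod.mk.injEq]
    split_ifs <;> simp_all
  rw [charpoly, this, det_blockDiagonal]
  rfl

lemma CharMeas.charpoly_prod {E : Type*} [MeasurableSpace E] {l : ℕ} {f : ℝ[X] → E}
    (hf : CharMeas (2 * l) f) :
    Measurable fun B : Fin l → Matrix (Fin 2) (Fin 2) ℝ => f (∏ s, (B s).charpoly) := by
  have h1 := hf.charpoly (ι := Fin 2 × Fin l) (by simp)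
  have h2 : Measurable fun B : Fin l → Matrix (Fin 2) (Fin 2) ℝ => blockDiagonal B :=
    (Continuous.matrix_blockDiagonal continuous_id).measurable
  have := Measurable.comp (g := fun P : Matrix (Fin 2 × Fin l) (Fin 2 × Fin l) ℝ => f P.charpoly)
    h1 h2
  convert this using 2 with B
  exact congrArg f (charpoly_blockDiagonal' B).symm

lemma measurable_vand (l : ℕ) :
    Measurable fun B : Fin l → Matrix (Fin 2) (Fin 2) ℝ => vand B := by
  unfold vand
  refine Finset.measurable_prod _ fun s _ => Finset.measurable_prod _ fun t _ => ?_
  simp_rw [← sylvDet_eq_det_aeval]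
  have h : Measurable fun B : Fin l → Matrix (Fin 2) (Fin 2) ℝ => (B s, B t) :=
    (measurable_pi_apply s).prodMk (measurable_pi_apply t)
  exact measurable_sylvDet.comp h

lemma measurable_section {A B E : Type*} [MeasurableSpace A] [MeasurableSpace B]
    [MeasurableSpace E] (F : A → B → E) (h : Measurable fun p : A × B => F p.1 p.2) (a : A) :
    Measurable (F a) := h.of_uncurry_left

lemma CharMeas.det_aeval_mul {l : ℕ} (b : Matrix (Fin 2) (Fin 2) ℝ) {f : ℝ[X] → ℝ}
    (hf : CharMeas (2 * (l + 1)) f) :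
    CharMeas (2 * l) fun q => (aeval b q).det * f (b.charpoly * q) := by
  have h0 : Fintype.card (Fin 2) + Fintype.card (Fin (2 * l)) = 2 * (l + 1) := by simp; ring
  have h1 : Measurable fun y : Matrix (Fin (2 * l)) (Fin (2 * l)) ℝ => f (b.charpoly * y.charpoly) :=
    measurable_section (fun (b : Matrix (Fin 2) (Fin 2) ℝ)
      (y : Matrix (Fin (2 * l)) (Fin (2 * l)) ℝ) => f (b.charpoly * y.charpoly))
      (hf.charpoly_mul h0) b
  have h2 : Measurable fun y : Matrix (Fin (2 * l)) (Fin (2 * l)) ℝ => (aeval b y.charpoly).det := by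
    simp_rw [← sylvDet_eq_det_aeval]
    exact measurable_section (fun (b : Matrix (Fin 2) (Fin 2) ℝ)
      (y : Matrix (Fin (2 * l)) (Fin (2 * l)) ℝ) => sylvDet b y) measurable_sylvDet b
  exact h2.mul h1

lemma CharMeas.enorm_det_aeval_mul {l : ℕ} (b : Matrix (Fin 2) (Fin 2) ℝ) {f : ℝ[X] → ℝ≥0∞}
    (hf : CharMeas (2 * (l + 1)) f) :
    CharMeas (2 * l) fun q => ‖(aeval b q).det‖ₑ * f (b.charpoly * q) := by
  have h0 : Fintype.card (Fin 2) + Fintype.card (Fin (2 * l)) = 2 * (l + 1) := by simp; ring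
  have h1 : Measurable fun y : Matrix (Fin (2 * l)) (Fin (2 * l)) ℝ => f (b.charpoly * y.charpoly) :=
    measurable_section (fun (b : Matrix (Fin 2) (Fin 2) ℝ)
      (y : Matrix (Fin (2 * l)) (Fin (2 * l)) ℝ) => f (b.charpoly * y.charpoly))
      (hf.charpoly_mul h0) b
  have h2 : Measurable fun y : Matrix (Fin (2 * l)) (Fin (2 * l)) ℝ =>
      ‖(aeval b y.charpoly).det‖ₑ := by
    simp_rw [← sylvDet_eq_det_aeval]
    exact (measurable_section (fun (b : Matrix (Fin 2) (Fin 2) ℝ)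
      (y : Matrix (Fin (2 * l)) (Fin (2 * l)) ℝ) => sylvDet b y) measurable_sylvDet b).enorm
  exact h2.mul h1

theorem exists_lintegral_vand_le (k l : ℕ) :
    ∃ K : ℝ≥0∞, K ≠ ∞ ∧ ∀ F : ℝ[X] → ℝ≥0∞, CharMeas (2 * l) F →
    ∫⁻ B, ‖vand B‖ₑ * F (∏ s, (B s).charpoly)
      ∂(Measure.pi fun _ : Fin l => prodLaw (Fin 2) (k + 1)) ≤
    K * ∫⁻ P, F P.charpoly ∂prodLaw (Fin (2 * l)) (k + 1) := by
  induction l with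
  | zero =>
    refine ⟨1, by simp, fun F hF => ?_⟩
    have h1 : ∀ P : Matrix (Fin (2 * 0)) (Fin (2 * 0)) ℝ, P.charpoly = 1 := fun P => by
      simp [charpoly]
    simp [vand, h1]
  | succ l ih =>
    obtain ⟨K, hK, ih⟩ := ih
    obtain ⟨K', hK', h⟩ := exists_lintegral_abs_le (β := Fin (2 * l)) (l := l) (by simp) k
    refine ⟨K * K', ENNReal.mul_ne_top hK hK', fun F hF => ?_⟩
    have hm1 : Measurable fun B : Fin (l + 1) → Matrix (Fin 2) (Fin 2) ℝ =>
        ‖vand B‖ₑ * F (∏ s, (B s).charpoly) := (measurable_vand _).enorm.mul hF.charpoly_prod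
    have hcons := measurePreserving_finCons (prodLaw (Fin 2) (k + 1)) l
    rw [← hcons.lintegral_comp hm1]
    have hm2 : Measurable fun p : Matrix (Fin 2) (Fin 2) ℝ × (Fin l → Matrix (Fin 2) (Fin 2) ℝ) =>
        ‖vand (Fin.cons p.1 p.2 : Fin (l + 1) → Matrix (Fin 2) (Fin 2) ℝ)‖ₑ *
          F (∏ s, ((Fin.cons p.1 p.2 : Fin (l + 1) → Matrix (Fin 2) (Fin 2) ℝ) s).charpoly) :=
      hm1.comp hcons.measurable
    rw [lintegral_prod _ hm2.aemeasurable]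
    have h0 : Fintype.card (Fin 2) + Fintype.card (Fin (2 * l)) = 2 * (l + 1) := by simp; ring
    have hm3 : Measurable fun p : Matrix (Fin 2) (Fin 2) ℝ ×
        Matrix (Fin (2 * l)) (Fin (2 * l)) ℝ =>
        ‖sylvDet p.1 p.2‖ₑ * F (p.1.charpoly * p.2.charpoly) :=
      measurable_sylvDet.enorm.mul (hF.charpoly_mul h0)
    have h' := h F hF
    rw [lintegral_prod _ hm3.aemeasurable] at h'
    rw [mul_assoc]
    refine le_trans ?_ (mul_le_mul_right h' K)
    rw [← lintegral_const_mul _ hm3.lintegral_prod_right']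
    refine lintegral_mono fun b => ?_
    beta_reduce
    refine le_trans (le_of_eq ?_) ((ih _ (hF.enorm_det_aeval_mul b)).trans (le_of_eq ?_))
    · refine lintegral_congr fun B => ?_
      rw [vand_cons, enorm_mul]
      simp only [Fin.prod_univ_succ, Fin.cons_zero, Fin.cons_succ]
      ring
    · simp_rw [sylvDet_eq_det_aeval]

lemma integrable_vand_mul (k l : ℕ) {f : ℝ[X] → ℝ} (hf : CharMeas (2 * l) f)
    (hi : Integrable (fun P => f P.charpoly) (prodLaw (Fin (2 * l)) (k + 1))) :
    Integrable (fun B => vand B * f (∏ s, (B s).charpoly))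
      (Measure.pi fun _ : Fin l => prodLaw (Fin 2) (k + 1)) := by
  refine ⟨((measurable_vand l).mul hf.charpoly_prod).aestronglyMeasurable, ?_⟩
  obtain ⟨K, hK, h⟩ := exists_lintegral_vand_le k l
  have := h (fun q => ‖f q‖ₑ) (Measurable.enorm hf)
  simp_rw [hasFiniteIntegral_iff_enorm, enorm_mul]
  refine this.trans_lt (ENNReal.mul_lt_top hK.lt_top ?_)
  exact hasFiniteIntegral_iff_enorm.1 hi.2

theorem exists_integral_charpoly_eq (k l : ℕ) :
    ∃ C : ℝ, ∀ f : ℝ[X] → ℝ, CharMeas (2 * l) f →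
    Integrable (fun P => f P.charpoly) (prodLaw (Fin (2 * l)) (k + 1)) →
    ∫ P, f P.charpoly ∂prodLaw (Fin (2 * l)) (k + 1) =
    C * ∫ B, vand B * f (∏ s, (B s).charpoly)
      ∂(Measure.pi fun _ : Fin l => prodLaw (Fin 2) (k + 1)) := by
  induction l with
  | zero =>
    refine ⟨1, fun F hF _ => ?_⟩
    have h1 : ∀ P : Matrix (Fin (2 * 0)) (Fin (2 * 0)) ℝ, P.charpoly = 1 := fun P => by
      simp [charpoly]
    simp [vand, h1]
  | succ l ih =>
    obtain ⟨C, ih⟩ := ih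
    set c := (qrConst (Fin 2) (Fin (2 * l)) ^ (k + 1)).toReal with hc
    refine ⟨((l + 1 : ℕ) : ℝ)⁻¹ * (c * C), fun f hf hi => ?_⟩
    have hs := integral_signed (β := Fin (2 * l)) (by simp) k hf hi
    have his := integrable_signed (β := Fin (2 * l)) (by simp) k hf hi
    have hiv := integrable_vand_mul k (l + 1) hf hi
    have hcons := measurePreserving_finCons (prodLaw (Fin 2) (k + 1)) l
    have hm1 : Measurable fun B : Fin (l + 1) → Matrix (Fin 2) (Fin 2) ℝ =>
        vand B * f (∏ s, (B s).charpoly) := (measurable_vand _).mul hf.charpoly_prod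
    have hiv' := (hcons.integrable_comp hm1.aestronglyMeasurable).2 hiv
    have e1 : ∫ B, vand B * f (∏ s, (B s).charpoly)
        ∂(Measure.pi fun _ : Fin (l + 1) => prodLaw (Fin 2) (k + 1)) =
        ∫ b, ∫ B, vand B * ((aeval b (∏ s, (B s).charpoly)).det *
          f (b.charpoly * ∏ s, (B s).charpoly))
          ∂(Measure.pi fun _ : Fin l => prodLaw (Fin 2) (k + 1)) ∂prodLaw (Fin 2) (k + 1) := by
      rw [← hcons.map_eq, integral_map hcons.measurable.aemeasurable hm1.aestronglyMeasurable]
      refine (integral_prod _ hiv').trans ?_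
      refine integral_congr_ae (ae_of_all _ fun b => integral_congr_ae (ae_of_all _ fun B => ?_))
      simp only [Function.comp_apply]
      rw [vand_cons]
      simp only [Fin.prod_univ_succ, Fin.cons_zero, Fin.cons_succ]
      ring
    rw [← hc, integral_prod _ his] at hs
    have e2 : ∫ b, ∫ y, sylvDet b y * f (b.charpoly * y.charpoly)
        ∂prodLaw (Fin (2 * l)) (k + 1) ∂prodLaw (Fin 2) (k + 1) =
        ∫ b, C * ∫ B, vand B * ((aeval b (∏ s, (B s).charpoly)).det *
          f (b.charpoly * ∏ s, (B s).charpoly))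
          ∂(Measure.pi fun _ : Fin l => prodLaw (Fin 2) (k + 1)) ∂prodLaw (Fin 2) (k + 1) := by
      refine integral_congr_ae ?_
      filter_upwards [his.prod_right_ae] with b hb
      have := ih _ (hf.det_aeval_mul b) (by simpa only [sylvDet_eq_det_aeval] using hb)
      rw [← this]
      simp_rw [sylvDet_eq_det_aeval]
    rw [e1, mul_assoc, mul_assoc, ← integral_const_mul, ← e2, ← hs, ← mul_assoc,
      inv_mul_cancel₀ (by positivity), one_mul]

end Iterate

section Rho
open Polynomial

/-- The coefficients of the remainder of a polynomial modulo the characteristic polynomial of `b`,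
as linear functionals. -/
noncomputable def rho (b : Matrix (Fin 2) (Fin 2) ℝ) (ε : ℕ) : ℝ[X] →ₗ[ℝ] ℝ :=
  (lcoeff ℝ ε).comp (modByMonicHom b.charpoly)

variable (b : Matrix (Fin 2) (Fin 2) ℝ)

lemma rho_eq (q g : ℝ[X]) (α β : ℝ) (h : q = C α + C β * X + b.charpoly * g) :
    rho b 0 q = α ∧ rho b 1 q = β := by
  have hm := b.charpoly_monic
  have hd : (C α + C β * X : ℝ[X]).degree < b.charpoly.degree := by
    rw [charpoly_degree_eq_dim, add_comm, Fintype.card_fin]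
    exact lt_of_le_of_lt degree_linear_le (by norm_num)
  have : q %ₘ b.charpoly = C α + C β * X :=
    (div_modByMonic_unique g _ hm ⟨h.symm, hd⟩).2
  simp [rho, modByMonicHom, this]

lemma rho_decomp (q : ℝ[X]) :
    q = C (rho b 0 q) + C (rho b 1 q) * X + b.charpoly * (q /ₘ b.charpoly) := by
  have hm := b.charpoly_monic
  conv_lhs => rw [← modByMonic_add_div q b.charpoly]
  congr 1
  have hd : (q %ₘ b.charpoly).natDegree ≤ 1 := by
    have hc : b.charpoly.natDegree = 2 := by rw [charpoly_natDegree_eq_dim, Fintype.card_fin]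
    have h1 := natDegree_modByMonic_lt q hm fun h => by
      rw [h, natDegree_one] at hc
      omega
    omega
  rw [eq_X_add_C_of_natDegree_le_one hd, add_comm]
  rfl

lemma rho_X_mul (q : ℝ[X]) :
    rho b 0 (X * q) = -b.det * rho b 1 q ∧
    rho b 1 (X * q) = rho b 0 q + b.trace * rho b 1 q := by
  refine rho_eq b _ (C (rho b 1 q) + X * (q /ₘ b.charpoly)) _ _ ?_
  conv_lhs => rw [rho_decomp b q]
  rw [charpoly_fin_two]
  simp only [map_mul, map_add, map_neg]
  ring

lemma rho_charpoly_mul (g : ℝ[X]) : rho b 0 (b.charpoly * g) = 0 ∧ rho b 1 (b.charpoly * g) = 0 :=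
  rho_eq b _ g 0 0 (by simp)

lemma rho_one : rho b 0 1 = 1 ∧ rho b 1 1 = 0 := rho_eq b _ 0 1 0 (by simp)

lemma det_aeval_eq_rho (q : ℝ[X]) :
    (aeval b q).det = rho b 0 q * rho b 1 (X * q) - rho b 0 (X * q) * rho b 1 q := by
  obtain ⟨h0, h1⟩ := rho_X_mul b q
  rw [h0, h1]
  conv_lhs => rw [rho_decomp b q]
  rw [map_add, map_mul (aeval b) b.charpoly, aeval_self_charpoly, zero_mul, add_zero]
  simp [det_fin_two, trace_fin_two, Matrix.algebraMap_matrix_apply, mul_apply]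
  ring

lemma det_aeval_charpoly_comm (c : Matrix (Fin 2) (Fin 2) ℝ) :
    (aeval b c.charpoly).det = (aeval c b.charpoly).det := by
  simp [charpoly_fin_two, det_fin_two, trace_fin_two, Matrix.algebraMap_matrix_apply, pow_two,
    mul_apply]
  ring

/-- The confluent Vandermonde matrix of a family of `2 × 2` matrices. -/
noncomputable def vandMatrix {l : ℕ} (B : Fin l → Matrix (Fin 2) (Fin 2) ℝ) :
    Matrix (Fin l × Fin 2) (Fin l × Fin 2) ℝ :=
  of fun p c => rho (B p.1) p.2 (X ^ (2 * (c.1 : ℕ) + c.2))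

variable {l : ℕ}

/-- The Newton basis attached to a family of `2 × 2` matrices. -/
noncomputable def newton (B : Fin l → Matrix (Fin 2) (Fin 2) ℝ) (c : Fin l × Fin 2) : ℝ[X] :=
  X ^ (c.2 : ℕ) * ∏ t ∈ Finset.Iio c.1, (B t).charpoly

lemma newton_natDegree (B : Fin l → Matrix (Fin 2) (Fin 2) ℝ) (c : Fin l × Fin 2) :
    (newton B c).natDegree = 2 * (c.1 : ℕ) + c.2 := by
  rw [newton, ((monic_X_pow _).natDegree_mul (monic_prod_of_monic _ _ fun t _ => charpoly_monic _)),
    natDegree_X_pow, natDegree_prod_of_monic _ _ fun t _ => charpoly_monic _]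
  simp [charpoly_natDegree_eq_dim]
  ring

lemma newton_monic (B : Fin l → Matrix (Fin 2) (Fin 2) ℝ) (c : Fin l × Fin 2) :
    (newton B c).Monic :=
  (monic_X_pow _).mul (monic_prod_of_monic _ _ fun t _ => charpoly_monic _)

lemma sum_fin_prod_two (f : ℕ → ℝ) :
    ∑ c : Fin l × Fin 2, f (2 * (c.1 : ℕ) + c.2) = ∑ i ∈ Finset.range (2 * l), f i := by
  rw [mul_comm 2 l, ← Fin.sum_univ_eq_sum_range, ← finProdFinEquiv.sum_comp]
  refine Finset.sum_congr rfl fun c _ => ?_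
  rw [finProdFinEquiv_apply_val, add_comm]

lemma det_block_two {M : Matrix (Fin l × Fin 2) (Fin l × Fin 2) ℝ}
    (h : M.BlockTriangular Prod.fst) :
    M.det = ∏ s, (M (s, 0) (s, 0) * M (s, 1) (s, 1) - M (s, 0) (s, 1) * M (s, 1) (s, 0)) := by
  rw [h.det_fintype]
  refine Finset.prod_congr rfl fun s _ => ?_
  let e : Fin 2 ≃ { a : Fin l × Fin 2 // a.1 = s } :=
    ⟨fun i => ⟨(s, i), rfl⟩, fun a => a.1.2, fun i => rfl, fun a => by
      obtain ⟨⟨a, i⟩, rfl⟩ := a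
      rfl⟩
  rw [← det_submatrix_equiv_self e, det_fin_two]
  rfl

theorem vand_eq_det (B : Fin l → Matrix (Fin 2) (Fin 2) ℝ) : vand B = (vandMatrix B).det := by
  set T : Matrix (Fin l × Fin 2) (Fin l × Fin 2) ℝ :=
    of fun c d => (newton B d).coeff (2 * (c.1 : ℕ) + c.2) with hT
  have hT1 : T.det = 1 := by
    rw [det_block_two]
    · refine Finset.prod_eq_one fun s _ => ?_
      have h0 := newton_natDegree B (s, 0)
      have h1 := newton_natDegree B (s, 1)
      have m0 := (newton_monic B (s, 0)).coeff_natDegree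
      have m1 := (newton_monic B (s, 1)).coeff_natDegree
      have z : (newton B (s, 0)).coeff (2 * (s : ℕ) + 1) = 0 :=
        coeff_eq_zero_of_natDegree_lt (by rw [h0]; simp)
      rw [h0] at m0
      rw [h1] at m1
      simp only [hT, of_apply, Fin.val_zero, Fin.val_one] at *
      rw [m0, m1, z]
      ring
    · intro c d hcd
      change (newton B d).coeff (2 * (c.1 : ℕ) + c.2) = 0
      refine coeff_eq_zero_of_natDegree_lt ?_
      rw [newton_natDegree]
      have := d.2.2
      have h2 : (d.1 : ℕ) < c.1 := hcd
      omega
  have hVT : vandMatrix B * T = of fun p d => rho (B p.1) p.2 (newton B d) := by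
    ext p d
    have hlt : (newton B d).natDegree < 2 * l := by
      rw [newton_natDegree]
      have := d.2.2
      have := d.1.2
      omega
    rw [mul_apply, of_apply]
    conv_rhs => rw [as_sum_range' (newton B d) (2 * l) hlt, map_sum]
    rw [← sum_fin_prod_two (l := l)]
    refine Finset.sum_congr rfl fun c _ => ?_
    rw [← C_mul_X_pow_eq_monomial, ← smul_eq_C_mul, map_smul, smul_eq_mul, mul_comm]
    rfl
  have hdet : (vandMatrix B).det = (vandMatrix B * T).det := by rw [det_mul, hT1, mul_one]
  have htr : ∀ s t : Fin l, ∀ δ : Fin 2, s < t → ∀ ε : Fin 2, rho (B s) ε (newton B (t, δ)) = 0 := by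
    intro s t δ hst ε
    have : newton B (t, δ) = (B s).charpoly * (X ^ (δ : ℕ) *
        ∏ u ∈ (Finset.Iio t).erase s, (B u).charpoly) := by
      rw [newton, ← Finset.mul_prod_erase (Finset.Iio t) _ (Finset.mem_Iio.2 hst)]
      ring
    rw [this]
    obtain ⟨h0, h1⟩ := rho_charpoly_mul (B s) (X ^ (δ : ℕ) *
        ∏ u ∈ (Finset.Iio t).erase s, (B u).charpoly)
    fin_cases ε
    · exact h0
    · exact h1
  rw [hdet, hVT, ← det_transpose, det_block_two]
  · have h : ∀ s : Finset (Fin l), ∀ b : Matrix (Fin 2) (Fin 2) ℝ, (aeval b (∏ t ∈ s, (B t).charpoly)).det =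
        ∏ t ∈ s, (aeval b (B t).charpoly).det := by
      intro s b
      induction s using Finset.induction_on with
      | empty => simp
      | insert a s ha ih => rw [Finset.prod_insert ha, Finset.prod_insert ha, map_mul, det_mul, ih]
    have e : ∀ s : Fin l, ∏ t ∈ Finset.Iio s, (aeval (B s) (B t).charpoly).det =
        (aeval (B s) (newton B (s, 0))).det := by
      intro s
      rw [← h]
      simp [newton]
    rw [vand, Finset.prod_comm' (t' := Finset.univ) (s' := fun t => Finset.Iio t)]
    · refine Finset.prod_congr rfl fun s _ => ?_
      simp_rw [det_aeval_charpoly_comm _ (B s)]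
      rw [e, det_aeval_eq_rho]
      have hX : X * newton B (s, 0) = newton B (s, 1) := by simp [newton]
      rw [hX]
      simp only [transpose_apply, of_apply, Fin.val_zero, Fin.val_one]
      ring
    · intro x y
      simp
  · intro c d hcd
    exact htr _ _ _ hcd _

end Rho

section Pfaffian
variable {l : ℕ}

/-- The alternating sum obtained by expanding a determinant along pairs of rows. -/
noncomputable def pairSum (A : Fin l → Fin l × Fin 2 → Fin l × Fin 2 → ℝ) : ℝ :=
  ∑ σ : Equiv.Perm (Fin l × Fin 2), (Equiv.Perm.sign σ : ℝ) * ∏ s, A s (σ (s, 0)) (σ (s, 1))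

lemma pairSum_update (A : Fin l → Fin l × Fin 2 → Fin l × Fin 2 → ℝ) (s : Fin l)
    (X : Fin l × Fin 2 → Fin l × Fin 2 → ℝ) :
    pairSum (update A s X) = ∑ σ : Equiv.Perm (Fin l × Fin 2), (Equiv.Perm.sign σ : ℝ) *
      (X (σ (s, 0)) (σ (s, 1)) * ∏ t ∈ Finset.univ.erase s, A t (σ (t, 0)) (σ (t, 1))) := by
  refine Finset.sum_congr rfl fun σ _ => ?_
  rw [← Finset.mul_prod_erase Finset.univ _ (Finset.mem_univ s), update_self]
  congr 2
  refine Finset.prod_congr rfl fun t ht => ?_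
  rw [update_of_ne (Finset.ne_of_mem_erase ht)]

lemma pairSum_update_symm (A : Fin l → Fin l × Fin 2 → Fin l × Fin 2 → ℝ) (s : Fin l)
    (X : Fin l × Fin 2 → Fin l × Fin 2 → ℝ) (hX : ∀ c d, X c d = X d c) :
    pairSum (update A s X) = 0 := by
  have hne : ((s, 0) : Fin l × Fin 2) ≠ (s, 1) := by simp
  have h : pairSum (update A s X) = -pairSum (update A s X) := by
    conv_lhs => rw [pairSum_update, ← Equiv.sum_comp (Equiv.mulRight (Equiv.swap (s, 0) (s, 1)))]
    rw [pairSum_update, ← Finset.sum_neg_distrib]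
    refine Finset.sum_congr rfl fun σ _ => ?_
    have hp : ∏ t ∈ Finset.univ.erase s, A t ((σ * Equiv.swap (s, 0) (s, 1) : Equiv.Perm (Fin l × Fin 2)) (t, 0))
        ((σ * Equiv.swap (s, 0) (s, 1) : Equiv.Perm (Fin l × Fin 2)) (t, 1)) =
        ∏ t ∈ Finset.univ.erase s, A t (σ (t, 0)) (σ (t, 1)) := by
      refine Finset.prod_congr rfl fun t ht => ?_
      have ht := Finset.ne_of_mem_erase ht
      simp only [Equiv.Perm.mul_apply]
      rw [Equiv.swap_apply_of_ne_of_ne, Equiv.swap_apply_of_ne_of_ne] <;> simp [ht]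
    simp only [Equiv.coe_mulRight]
    rw [hp, map_mul, Equiv.Perm.sign_swap hne]
    simp only [Equiv.Perm.mul_apply, Equiv.swap_apply_left, Equiv.swap_apply_right]
    rw [hX]
    push_cast
    ring
  linarith

lemma pairSum_update_congr (A : Fin l → Fin l × Fin 2 → Fin l × Fin 2 → ℝ) (s : Fin l)
    (X Y : Fin l × Fin 2 → Fin l × Fin 2 → ℝ) (h : ∀ c d, X c d - X d c = Y c d - Y d c) :
    pairSum (update A s X) = pairSum (update A s Y) := by
  have h0 := pairSum_update_symm A s (fun c d => X c d - Y c d) (fun c d => by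
    have := h c d
    linarith)
  rw [pairSum_update] at h0 ⊢
  rw [pairSum_update, ← sub_eq_zero, ← Finset.sum_sub_distrib, ← h0]
  refine Finset.sum_congr rfl fun σ _ => ?_
  ring

lemma pairSum_congr (X Y : Fin l × Fin 2 → Fin l × Fin 2 → ℝ)
    (h : ∀ c d, X c d - X d c = Y c d - Y d c) :
    pairSum (fun _ : Fin l => X) = pairSum (fun _ : Fin l => Y) := by
  have : ∀ T : Finset (Fin l), pairSum (fun _ : Fin l => X) =
      pairSum (fun s : Fin l => if s ∈ T then Y else X) := by
    intro T
    induction T using Finset.induction_on with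
    | empty => simp
    | insert a T ha ih =>
      rw [ih]
      have e1 : (fun s : Fin l => if s ∈ T then Y else X) =
          update (fun s : Fin l => if s ∈ T then Y else X) a X := by
        rw [eq_comm, update_eq_self_iff, if_neg ha]
      have e2 : (fun s : Fin l => if s ∈ insert a T then Y else X) =
          update (fun s : Fin l => if s ∈ T then Y else X) a Y := by
        funext s
        by_cases hs : s = a
        · subst hs
          simp
        · rw [update_of_ne hs]
          simp [hs]
      rw [e1, e2]
      exact pairSum_update_congr _ _ _ _ h
  rw [this Finset.univ]
  simp

theorem exists_pairSum_eq_det (l : ℕ) :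
    ∃ K : ℝ, ∀ A : Fin l × Fin 2 → Fin l × Fin 2 → ℝ,
    (∀ j j' ε, A (j, ε) (j', ε) = A (j', ε) (j, ε)) →
    pairSum (fun _ : Fin l => A) =
      K * (of fun j k : Fin l => A (j, 0) (k, 1) - A (k, 1) (j, 0)).det := by
  refine ⟨∑ J : Fin l → Fin l, (of fun p q : Fin l × Fin 2 =>
    if J p.1 = q.1 ∧ p.2 = q.2 then (1 : ℝ) else 0).det, fun A hA => ?_⟩
  set H : Matrix (Fin l) (Fin l) ℝ := of fun j k : Fin l => A (j, 0) (k, 1) - A (k, 1) (j, 0)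
    with hH
  set G : Matrix (Fin l × Fin 2) (Fin l × Fin 2) ℝ :=
    blockDiagonal fun ε : Fin 2 => if ε = 0 then 1 else H with hG
  have hGdet : G.det = H.det := by
    rw [hG, det_blockDiagonal, Fin.prod_univ_two]
    simp
  set Y : Fin l × Fin 2 → Fin l × Fin 2 → ℝ := fun c d => ∑ j, G (j, 0) c * G (j, 1) d with hY
  have hYe : ∀ c d, Y c d = if c.2 = 0 ∧ d.2 = 1 then H c.1 d.1 else 0 := by
    rintro ⟨j, ε⟩ ⟨k, δ⟩
    simp only [hY, hG, blockDiagonal_apply]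
    fin_cases ε <;> fin_cases δ <;> simp [one_apply]
  rw [pairSum_congr A Y]
  · unfold pairSum
    simp only [hY]
    simp_rw [Finset.prod_univ_sum, Fintype.piFinset_univ, Finset.mul_sum]
    rw [Finset.sum_comm, Finset.sum_mul]
    refine Finset.sum_congr rfl fun J _ => ?_
    rw [← hGdet, ← det_mul, ← det_transpose, det_apply']
    refine Finset.sum_congr rfl fun σ _ => ?_
    congr 1
    rw [Fintype.prod_prod_type]
    refine Finset.prod_congr rfl fun s _ => ?_
    rw [Fin.prod_univ_two]
    have : ∀ ε c, ((of fun p q : Fin l × Fin 2 =>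
        if J p.1 = q.1 ∧ p.2 = q.2 then (1 : ℝ) else 0) * G) (s, ε) c = G (J s, ε) c := by
      intro ε c
      rw [mul_apply, Finset.sum_eq_single (J s, ε)]
      · simp
      · rintro ⟨j, δ⟩ _ hne
        rw [of_apply, if_neg, zero_mul]
        rintro ⟨rfl, rfl⟩
        exact hne rfl
      · simp
    rw [transpose_apply, transpose_apply, this, this]
  · rintro ⟨j, ε⟩ ⟨k, δ⟩
    rw [hYe, hYe]
    fin_cases ε <;> fin_cases δ
    · simpa using sub_eq_zero.2 (hA j k 0)
    · simp [hH]
    · simp [hH]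
    · simpa using sub_eq_zero.2 (hA j k 1)

end Pfaffian

section Moments
variable {Ω : Type*} [MeasurableSpace Ω] {μ : Measure Ω}

/-- All absolute moments of `f` are finite. -/
def AllMom (f : Ω → ℝ) (μ : Measure Ω) : Prop :=
  AEStronglyMeasurable f μ ∧ ∀ k : ℕ, Integrable (fun x => |f x| ^ k) μ

lemma AllMom.integrable {f : Ω → ℝ} (hf : AllMom f μ) : Integrable f μ := by
  refine (hf.2 1).mono' hf.1 (ae_of_all _ fun x => ?_)
  simp

lemma allMom_const [IsFiniteMeasure μ] (c : ℝ) : AllMom (fun _ : Ω => c) μ :=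
  ⟨aestronglyMeasurable_const, fun _ => integrable_const _⟩

lemma AllMom.mul {f g : Ω → ℝ} (hf : AllMom f μ) (hg : AllMom g μ) :
    AllMom (fun x => f x * g x) μ := by
  refine ⟨hf.1.mul hg.1, fun k => ?_⟩
  refine ((hf.2 (2 * k)).add (hg.2 (2 * k))).mono' ((hf.1.mul hg.1).norm.pow k)
    (ae_of_all _ fun x => ?_)
  simp only [Pi.add_apply, abs_mul, mul_pow, Real.norm_eq_abs, abs_pow, abs_abs]
  have h1 : 0 ≤ |f x| ^ k := by positivity
  have h2 : 0 ≤ |g x| ^ k := by positivity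
  rw [mul_comm 2 k, pow_mul, pow_mul]
  nlinarith [sq_nonneg (|f x| ^ k - |g x| ^ k), mul_nonneg h1 h2]

lemma AllMom.add {f g : Ω → ℝ} (hf : AllMom f μ) (hg : AllMom g μ) :
    AllMom (fun x => f x + g x) μ := by
  refine ⟨hf.1.add hg.1, fun k => ?_⟩
  refine (((hf.2 k).add (hg.2 k)).const_mul (2 ^ (k - 1))).mono' ((hf.1.add hg.1).norm.pow k)
    (ae_of_all _ fun x => ?_)
  simp only [Pi.add_apply, Real.norm_eq_abs, abs_pow, abs_abs]
  exact (pow_le_pow_left₀ (abs_nonneg _) (abs_add_le _ _) k).trans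
    (add_pow_le (abs_nonneg _) (abs_nonneg _) k)

lemma AllMom.congr {f g : Ω → ℝ} (hf : AllMom f μ) (h : ∀ x, f x = g x) : AllMom g μ := by
  rwa [← funext h]

lemma AllMom.neg {f : Ω → ℝ} (hf : AllMom f μ) : AllMom (fun x => -f x) μ :=
  ⟨hf.1.neg, fun k => by simpa using hf.2 k⟩

lemma AllMom.sub {f g : Ω → ℝ} (hf : AllMom f μ) (hg : AllMom g μ) :
    AllMom (fun x => f x - g x) μ := (hf.add hg.neg).congr fun _ => (sub_eq_add_neg _ _).symm

lemma AllMom.abs {f : Ω → ℝ} (hf : AllMom f μ) : AllMom (fun x => |f x|) μ :=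
  ⟨hf.1.norm, fun k => by simpa using hf.2 k⟩

lemma AllMom.pow [IsFiniteMeasure μ] {f : Ω → ℝ} (hf : AllMom f μ) (k : ℕ) :
    AllMom (fun x => f x ^ k) μ := by
  induction k with
  | zero => simpa using allMom_const 1
  | succ k ih => simpa [pow_succ] using ih.mul hf

lemma AllMom.sum [IsFiniteMeasure μ] {κ : Type*} (s : Finset κ) {f : κ → Ω → ℝ}
    (hf : ∀ i, AllMom (f i) μ) :
    AllMom (fun x => ∑ i ∈ s, f i x) μ := by
  classical
  induction s using Finset.induction_on with
  | empty => simpa using allMom_const 0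
  | insert a s ha ih => simpa [Finset.sum_insert ha] using (hf a).add ih

lemma AllMom.comp {Ω' : Type*} [MeasurableSpace Ω'] {ν : Measure Ω'} {T : Ω' → Ω}
    (hT : MeasurePreserving T ν μ) {f : Ω → ℝ} (hf : AllMom f μ) : AllMom (fun x => f (T x)) ν :=
  ⟨hf.1.comp_measurePreserving hT, fun k => hT.integrable_comp_of_integrable (hf.2 k)⟩

lemma AllMom.of_comp {Ω' : Type*} [MeasurableSpace Ω'] {ν : Measure Ω'} {T : Ω' → Ω}
    (hT : MeasurePreserving T ν μ) {f : Ω → ℝ} (hm : Measurable f)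
    (hf : AllMom (fun x => f (T x)) ν) : AllMom f μ :=
  ⟨hm.aestronglyMeasurable, fun k =>
    (hT.integrable_comp (hm.abs.pow_const k).aestronglyMeasurable).1 (hf.2 k)⟩

lemma AllMom.bdd_mul {f g : Ω → ℝ} (hf : AllMom f μ) (hg : AEStronglyMeasurable g μ) {c : ℝ}
    (hc : ∀ x, |g x| ≤ c) : Integrable (fun x => g x * f x) μ :=
  hf.integrable.bdd_mul hg (ae_of_all _ hc)

lemma allMom_gaussian : AllMom (fun x : ℝ => x) (gaussianReal 0 1) := by
  refine ⟨measurable_id.aestronglyMeasurable, fun k => ?_⟩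
  have := (memLp_id_gaussianReal (μ := 0) (v := 1) k).integrable_norm_pow'
  simpa using this

variable {ι : Type*} [Fintype ι] [DecidableEq ι]

lemma measurePreserving_entry_stdGaussian (i j : ι) :
    MeasurePreserving (fun X : Matrix ι ι ℝ => X i j) (stdGaussian ι ι) (gaussianReal 0 1) := by
  have h1 := measurePreserving_eval (fun _ : ι => Measure.pi fun _ : ι => gaussianReal 0 1) i
  have h2 := measurePreserving_eval (fun _ : ι => gaussianReal 0 1) j
  exact h2.comp h1

lemma measurable_entry (i j : ι) : Measurable fun X : Matrix ι ι ℝ => X i j :=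
  (measurePreserving_entry_stdGaussian i j).measurable

lemma measurePreserving_mul_prodLaw (k : ℕ) :
    MeasurePreserving (fun p : Matrix ι ι ℝ × Matrix ι ι ℝ => p.1 * p.2)
      ((stdGaussian ι ι).prod (prodLaw ι k)) (prodLaw ι (k + 1)) := by
  refine ⟨(continuous_fst.matrix_mul continuous_snd).measurable, rfl⟩

lemma allMom_entry (k : ℕ) (i j : ι) :
    AllMom (fun X : Matrix ι ι ℝ => X i j) (prodLaw ι k) := by
  induction k generalizing i j with
  | zero =>
    refine ⟨(measurable_entry i j).aestronglyMeasurable, fun k => ?_⟩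
    unfold prodLaw
    exact integrable_dirac (by simp)
  | succ k ih =>
    refine AllMom.of_comp (measurePreserving_mul_prodLaw k) (measurable_entry i j) ?_
    simp only [mul_apply]
    refine AllMom.sum _ fun a => AllMom.mul ?_ ?_
    · have h := AllMom.comp (measurePreserving_entry_stdGaussian (ι := ι) i a) allMom_gaussian
      exact AllMom.comp (measurePreserving_fst (ν := prodLaw ι k)) h
    · exact AllMom.comp (measurePreserving_snd (μ := stdGaussian ι ι)) (ih a j)

end Moments

section RootCount
open Polynomial

lemma continuous_coeff_mul {A : Type*} [TopologicalSpace A] {p q : A → ℝ[X]}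
    (hp : ∀ i, Continuous fun a => (p a).coeff i) (hq : ∀ i, Continuous fun a => (q a).coeff i) :
    ∀ i, Continuous fun a => (p a * q a).coeff i := by
  intro i
  simp_rw [coeff_mul]
  exact continuous_finsetSum _ fun x _ => (hp _).mul (hq _)

lemma continuous_coeff_prod {A κ : Type*} [TopologicalSpace A] (s : Finset κ) {p : κ → A → ℝ[X]}
    (hp : ∀ j i, Continuous fun a => (p j a).coeff i) :
    ∀ i, Continuous fun a => (∏ j ∈ s, p j a).coeff i := by
  classical
  induction s using Finset.induction_on with
  | empty => simp [continuous_const]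
  | insert a s ha ih =>
    simp_rw [Finset.prod_insert ha]
    exact continuous_coeff_mul (hp a) ih

lemma measurableSet_of_isClosed_image {A B : Type*} [TopologicalSpace A] [TopologicalSpace B]
    [SigmaCompactSpace (A × B)] [T2Space A] [MeasurableSpace A] [BorelSpace A] {Z : Set (A × B)}
    (hZ : IsClosed Z) : MeasurableSet (Prod.fst '' Z) := by
  obtain ⟨K, hK, hKu⟩ := (isSigmaCompact_univ.of_isClosed_subset hZ (subset_univ _)).image continuous_fst
  rw [← hKu]
  exact MeasurableSet.iUnion fun n => (hK n).measurableSet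

variable {ι : Type*} [Fintype ι] [DecidableEq ι]

lemma measurable_card_roots :
    Measurable fun P : Matrix ι ι ℝ => P.charpoly.roots.card := by
  refine measurable_of_Ici fun k => ?_
  set N := Fintype.card ι with hN
  let g : (Fin k → ℝ) × (Fin (N + 1) → ℝ) → ℝ[X] := fun x =>
    (∏ i, (X - C (x.1 i))) * ∑ j : Fin (N + 1), C (x.2 j) * X ^ (j : ℕ)
  have hg : ∀ i, Continuous fun x => (g x).coeff i := by
    refine continuous_coeff_mul (continuous_coeff_prod _ fun j i => ?_) fun i => ?_
    · simp only [coeff_sub, coeff_C]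
      refine continuous_const.sub ?_
      split_ifs
      · exact (continuous_apply j).comp continuous_fst
      · exact continuous_const
    · simp only [finsetSum_coeff, coeff_C_mul]
      exact continuous_finsetSum _ fun j _ =>
        ((continuous_apply j).comp continuous_snd).mul continuous_const
  have hZ : IsClosed {p : Matrix ι ι ℝ × ((Fin k → ℝ) × (Fin (N + 1) → ℝ)) |
      ∀ i, p.1.charpoly.coeff i = (g p.2).coeff i} := by
    simp only [ofPred_forall]
    exact isClosed_iInter fun i => isClosed_eq
      ((continuous_coeff_charpoly i).comp continuous_fst) ((hg i).comp continuous_snd)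
  have : SigmaCompactSpace (Matrix ι ι ℝ) := inferInstanceAs (SigmaCompactSpace (ι → ι → ℝ))
  convert measurableSet_of_isClosed_image hZ using 1
  ext P
  simp only [mem_preimage, mem_Ici, mem_image, mem_ofPred_eq, Prod.exists, exists_and_right,
    exists_eq_right]
  have hP0 : P.charpoly ≠ 0 := P.charpoly_monic.ne_zero
  constructor
  · intro h
    obtain ⟨s, hs, hsk⟩ : ∃ s ≤ P.charpoly.roots, s.card = k := by
      obtain ⟨s, hs⟩ := Multiset.card_pos_iff_exists_mem.1
        (show 0 < (Multiset.powersetCard k P.charpoly.roots).card by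
          rw [Multiset.card_powersetCard]
          exact Nat.choose_pos h)
      exact ⟨s, Multiset.mem_powersetCard.1 hs⟩
    obtain ⟨x, hx⟩ : ∃ x : Fin k → ℝ, Finset.univ.val.map x = s := by
      subst hsk
      induction s using Quotient.inductionOn with
      | h L =>
        exact ⟨fun i => L.get i, (Fin.univ_val_map _).trans (congrArg _ (List.ofFn_get L))⟩
    have hd : ∏ i, (X - C (x i)) ∣ P.charpoly := by
      have := (Multiset.prod_X_sub_C_dvd_iff_le_roots hP0 s).2 hs
      rw [← hx, Multiset.map_map] at this
      exact this
    obtain ⟨q, hq⟩ := hd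
    have hq0 : q ≠ 0 := by
      rintro rfl
      exact hP0 (by rw [hq, mul_zero])
    have hqd : q.natDegree < N + 1 := by
      have := natDegree_le_of_dvd (Dvd.intro_left _ hq.symm) hP0
      rw [charpoly_natDegree_eq_dim] at this
      omega
    refine ⟨x, fun j => q.coeff j, fun i => ?_⟩
    have : g (x, fun j => q.coeff j) = P.charpoly := by
      conv_rhs => rw [hq, as_sum_range_C_mul_X_pow' _ hqd]
      rw [← Fin.sum_univ_eq_sum_range (fun j => C (q.coeff j) * X ^ j)]
    rw [this]
  · rintro ⟨x, c, h⟩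
    have h : P.charpoly = g (x, c) := Polynomial.ext h
    have hd : ((Finset.univ.val.map x).map fun a => X - C a).prod ∣ P.charpoly := by
      rw [h, Multiset.map_map]
      exact Dvd.intro _ rfl
    have := Multiset.card_le_card ((Multiset.prod_X_sub_C_dvd_iff_le_roots hP0 _).1 hd)
    simpa using this

end RootCount

section DeBruijn
open Polynomial

lemma allMom_trace (k : ℕ) : AllMom (fun b : Matrix (Fin 2) (Fin 2) ℝ => b.trace)
    (prodLaw (Fin 2) k) := by
  simp only [trace_fin_two]
  exact (allMom_entry k 0 0).add (allMom_entry k 1 1)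

lemma allMom_det (k : ℕ) : AllMom (fun b : Matrix (Fin 2) (Fin 2) ℝ => b.det)
    (prodLaw (Fin 2) k) := by
  simp only [det_fin_two]
  exact ((allMom_entry k 0 0).mul (allMom_entry k 1 1)).sub
    ((allMom_entry k 0 1).mul (allMom_entry k 1 0))

lemma allMom_rho (k c : ℕ) :
    AllMom (fun b : Matrix (Fin 2) (Fin 2) ℝ => rho b 0 (X ^ c)) (prodLaw (Fin 2) k) ∧
    AllMom (fun b : Matrix (Fin 2) (Fin 2) ℝ => rho b 1 (X ^ c)) (prodLaw (Fin 2) k) := by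
  induction c with
  | zero => simp [rho_one, allMom_const]
  | succ c ih =>
    simp only [pow_succ', rho_X_mul]
    exact ⟨(allMom_det k).neg.mul ih.2, ih.1.add ((allMom_trace k).mul ih.2)⟩

/-- The `2 × 2` minors of the matrix of remainders of monomials modulo the characteristic
polynomial. -/
noncomputable def minor (b : Matrix (Fin 2) (Fin 2) ℝ) (c d : ℕ) : ℝ :=
  rho b 0 (X ^ c) * rho b 1 (X ^ d) - rho b 0 (X ^ d) * rho b 1 (X ^ c)

lemma allMom_minor (k c d : ℕ) : AllMom (fun b => minor b c d) (prodLaw (Fin 2) k) :=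
  ((allMom_rho k c).1.mul (allMom_rho k d).2).sub ((allMom_rho k d).1.mul (allMom_rho k c).2)

lemma rho_neg (b : Matrix (Fin 2) (Fin 2) ℝ) (c : ℕ) :
    rho (-b) 0 (X ^ c) = (-1) ^ c * rho b 0 (X ^ c) ∧
    rho (-b) 1 (X ^ c) = (-1) ^ (c + 1) * rho b 1 (X ^ c) := by
  induction c with
  | zero => simp [rho_one]
  | succ c ih =>
    have hd : (-b).det = b.det := by simp [det_fin_two]
    have ht : (-b).trace = -b.trace := trace_neg b
    rw [pow_succ', (rho_X_mul _ _).1, (rho_X_mul _ _).2, (rho_X_mul _ _).1, (rho_X_mul _ _).2,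
      ih.1, ih.2, hd, ht]
    constructor <;> ring

lemma minor_neg (b : Matrix (Fin 2) (Fin 2) ℝ) (c d : ℕ) :
    minor (-b) c d = (-1) ^ (c + d + 1) * minor b c d := by
  rw [minor, minor, (rho_neg b c).1, (rho_neg b c).2, (rho_neg b d).1, (rho_neg b d).2]
  ring

lemma measurePreserving_mul_orth {ι : Type*} [Fintype ι] [DecidableEq ι] (k : ℕ)
    (O : Matrix ι ι ℝ) (hO : Oᵀ * O = 1) :
    MeasurePreserving (fun X : Matrix ι ι ℝ => X * O) (prodLaw ι (k + 1)) (prodLaw ι (k + 1)) := by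
  have hm : Measurable fun X : Matrix ι ι ℝ => X * O :=
    (continuous_id.matrix_mul continuous_const).measurable
  refine ⟨hm, Measure.ext_of_lintegral _ fun F hF => ?_⟩
  rw [lintegral_map hF hm, lintegral_prodLaw_mul_orth k O hO F hF]

lemma integral_mul_minor_eq_zero (k c d : ℕ) (hcd : Even (c + d))
    (ψ : Matrix (Fin 2) (Fin 2) ℝ → ℝ) (hψ : Measurable ψ) (hψn : ∀ b, ψ (-b) = ψ b) :
    ∫ b, ψ b * minor b c d ∂prodLaw (Fin 2) (k + 1) = 0 := by
  have hm := measurePreserving_mul_orth k (-1 : Matrix (Fin 2) (Fin 2) ℝ) (by simp)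
  have hmeas := (hψ.aestronglyMeasurable (μ := prodLaw (Fin 2) (k + 1))).mul
    (allMom_minor (k + 1) c d).1
  have h : ∫ b, ψ b * minor b c d ∂prodLaw (Fin 2) (k + 1) =
      -∫ b, ψ b * minor b c d ∂prodLaw (Fin 2) (k + 1) := by
    rw [← integral_neg]
    conv_lhs => rw [← hm.map_eq]
    rw [integral_map hm.measurable.aemeasurable (by rw [hm.map_eq]; exact hmeas)]
    refine integral_congr_ae (ae_of_all _ fun b => ?_)
    beta_reduce
    rw [mul_neg, mul_one, hψn, minor_neg, pow_succ, hcd.neg_one_pow]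
    ring
  linarith

theorem integral_vand_eq_pairSum (k l : ℕ) (ψ : Matrix (Fin 2) (Fin 2) ℝ → ℝ) (hψ : Measurable ψ)
    (c : ℝ) (hc : ∀ b, |ψ b| ≤ c) :
    ∫ B, vand B * ∏ s, ψ (B s) ∂(Measure.pi fun _ : Fin l => prodLaw (Fin 2) (k + 1)) =
    pairSum fun _ : Fin l => fun p q => ∫ b, ψ b * (rho b 0 (X ^ (2 * (p.1 : ℕ) + p.2)) *
      rho b 1 (X ^ (2 * (q.1 : ℕ) + q.2))) ∂prodLaw (Fin 2) (k + 1) := by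
  have hInt : ∀ a d : ℕ, Integrable (fun b => ψ b * (rho b 0 (X ^ a) * rho b 1 (X ^ d)))
      (prodLaw (Fin 2) (k + 1)) := fun a d =>
    AllMom.bdd_mul ((allMom_rho (k + 1) a).1.mul (allMom_rho (k + 1) d).2)
      hψ.aestronglyMeasurable hc
  have e : ∀ B : Fin l → Matrix (Fin 2) (Fin 2) ℝ, vand B * ∏ s, ψ (B s) =
      ∑ σ : Equiv.Perm (Fin l × Fin 2), (Equiv.Perm.sign σ : ℝ) *
        ∏ s, (ψ (B s) * (rho (B s) 0 (X ^ (2 * ((σ (s, 0)).1 : ℕ) + (σ (s, 0)).2)) *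
          rho (B s) 1 (X ^ (2 * ((σ (s, 1)).1 : ℕ) + (σ (s, 1)).2)))) := by
    intro B
    rw [vand_eq_det, ← det_transpose, det_apply', Finset.sum_mul]
    refine Finset.sum_congr rfl fun σ _ => ?_
    rw [mul_assoc, Fintype.prod_prod_type, ← Finset.prod_mul_distrib]
    congr 1
    refine Finset.prod_congr rfl fun s _ => ?_
    rw [Fin.prod_univ_two, mul_comm]
    rfl
  simp_rw [e]
  rw [integral_finsetSum]
  · refine Finset.sum_congr rfl fun σ _ => ?_
    rw [integral_const_mul]
    congr 1
    exact integral_fintype_prod_eq_prod (fun s b => ψ b *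
      (rho b 0 (X ^ (2 * ((σ (s, 0)).1 : ℕ) + (σ (s, 0)).2)) *
          rho b 1 (X ^ (2 * ((σ (s, 1)).1 : ℕ) + (σ (s, 1)).2))))
  · intro σ _
    refine Integrable.const_mul ?_ _
    exact Integrable.fintype_prod (f := fun s b => ψ b *
      (rho b 0 (X ^ (2 * ((σ (s, 0)).1 : ℕ) + (σ (s, 0)).2)) *
          rho b 1 (X ^ (2 * ((σ (s, 1)).1 : ℕ) + (σ (s, 1)).2)))) fun s => hInt _ _

/-- Indicator of a pair of real eigenvalues. -/
noncomputable def realInd (b : Matrix (Fin 2) (Fin 2) ℝ) : ℝ := (b.charpoly.roots.card / 2 : ℕ)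

lemma card_roots_fin_two (b : Matrix (Fin 2) (Fin 2) ℝ) :
    b.charpoly.roots.card = 0 ∨ b.charpoly.roots.card = 2 := by
  have hd : b.charpoly.natDegree = 2 := by rw [charpoly_natDegree_eq_dim, Fintype.card_fin]
  by_cases h : b.charpoly.roots = 0
  · exact Or.inl (by rw [h, Multiset.card_zero])
  · obtain ⟨x, hx⟩ := Multiset.exists_mem_of_ne_zero h
    right
    have hs : b.charpoly.Splits := Splits.of_natDegree_eq_two hd (isRoot_of_mem_roots hx)
    exact hs.natDegree_eq_card_roots.symm.trans hd

lemma measurable_realInd : Measurable realInd :=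
  (Measurable.of_discrete (f := fun n : ℕ => ((n / 2 : ℕ) : ℝ))).comp measurable_card_roots

lemma realInd_eq (b : Matrix (Fin 2) (Fin 2) ℝ) : realInd b = 0 ∨ realInd b = 1 := by
  rcases card_roots_fin_two b with h | h <;> simp [realInd, h]

lemma realInd_neg (b : Matrix (Fin 2) (Fin 2) ℝ) : realInd (-b) = realInd b := by
  have h : (-b).charpoly = b.charpoly.comp (-X) := by
    simp [charpoly_fin_two, det_fin_two, trace_fin_two]
    ring
  rw [realInd, realInd, h, roots_comp_neg_X, Multiset.card_map]

/-- Half the number of real roots, rounded down. -/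
noncomputable def kap (q : ℝ[X]) : ℕ := q.roots.card / 2

lemma kap_prod {l : ℕ} (B : Fin l → Matrix (Fin 2) (Fin 2) ℝ) (w : ℝ) :
    (1 + w) ^ kap (∏ s, (B s).charpoly) = ∏ s, (1 + w * realInd (B s)) := by
  have h1 : (∏ s, (B s).charpoly).roots.card = ∑ s, (B s).charpoly.roots.card := by
    rw [roots_prod _ _ (Finset.prod_ne_zero_iff.2 fun s _ => (B s).charpoly_monic.ne_zero), Multiset.card_bind]
    rfl
  have h2 : kap (∏ s, (B s).charpoly) = ∑ s, (B s).charpoly.roots.card / 2 := by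
    rw [kap, h1]
    refine Nat.div_eq_of_eq_mul_right two_pos ?_
    rw [Finset.mul_sum]
    refine Finset.sum_congr rfl fun s _ => ?_
    rcases card_roots_fin_two (B s) with h | h <;> simp [h]
  rw [h2, ← Finset.prod_pow_eq_pow_sum]
  refine Finset.prod_congr rfl fun s _ => ?_
  rcases card_roots_fin_two (B s) with h | h <;> simp [h, realInd]

lemma kap_le {N : ℕ} (P : Matrix (Fin N) (Fin N) ℝ) : kap P.charpoly ≤ N := by
  have := card_roots' P.charpoly
  rw [charpoly_natDegree_eq_dim, Fintype.card_fin] at this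
  exact (Nat.div_le_self _ _).trans this

lemma charMeas_kap (N : ℕ) (g : ℕ → ℝ) : CharMeas N fun q => g (kap q) :=
  (Measurable.of_discrete (f := fun n : ℕ => g (n / 2))).comp measurable_card_roots

lemma integrable_kap (N k : ℕ) (g : ℕ → ℝ) :
    Integrable (fun P => g (kap P.charpoly)) (prodLaw (Fin N) k) := by
  have hm : Measurable fun P : Matrix (Fin N) (Fin N) ℝ => g (kap P.charpoly) := charMeas_kap N g
  refine Integrable.of_bound (C := ∑ i ∈ Finset.range (N + 1), |g i|) hm.aestronglyMeasurable
    (ae_of_all _ fun P => ?_)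
  exact Finset.single_le_sum (f := fun i => |g i|) (fun i _ => abs_nonneg _)
    (Finset.mem_range.2 (Nat.lt_succ_of_le (kap_le P)))

/-- The pairing matrix of even and odd monomials. -/
noncomputable def totMat (k l : ℕ) : Matrix (Fin l) (Fin l) ℝ :=
  of fun i j => ∫ b, minor b (2 * (i : ℕ)) (2 * (j : ℕ) + 1) ∂prodLaw (Fin 2) (k + 1)

/-- The pairing matrix of even and odd monomials, restricted to real eigenvalues. -/
noncomputable def realMat (k l : ℕ) : Matrix (Fin l) (Fin l) ℝ :=
  of fun i j => ∫ b, realInd b * minor b (2 * (i : ℕ)) (2 * (j : ℕ) + 1) ∂prodLaw (Fin 2) (k + 1)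

theorem exists_integral_kap_eq_det (k l : ℕ) :
    ∃ C : ℝ, ∀ w : ℝ, ∫ P, (1 + w) ^ kap P.charpoly ∂prodLaw (Fin (2 * l)) (k + 1) =
      C * (totMat k l + w • realMat k l).det := by
  obtain ⟨C, hC⟩ := exists_integral_charpoly_eq k l
  obtain ⟨K, hK⟩ := exists_pairSum_eq_det l
  refine ⟨C * K, fun w => ?_⟩
  rw [hC (fun q => (1 + w) ^ kap q) (charMeas_kap _ fun n => (1 + w) ^ n)
    (integrable_kap _ _ fun n => (1 + w) ^ n)]
  simp_rw [kap_prod]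
  have hψm : Measurable fun b => 1 + w * realInd b :=
    measurable_const.add (measurable_const.mul measurable_realInd)
  have hψb : ∀ b, |1 + w * realInd b| ≤ 1 + |w| := by
    intro b
    refine (abs_add_le _ _).trans ?_
    rcases realInd_eq b with h | h <;> simp [h]
  have hInt : ∀ a d : ℕ, Integrable (fun b => (1 + w * realInd b) *
      (rho b 0 (X ^ a) * rho b 1 (X ^ d))) (prodLaw (Fin 2) (k + 1)) := fun a d =>
    AllMom.bdd_mul ((allMom_rho (k + 1) a).1.mul (allMom_rho (k + 1) d).2)
      hψm.aestronglyMeasurable hψb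
  have hsub : ∀ a d : ℕ, ∫ b, (1 + w * realInd b) * (rho b 0 (X ^ a) * rho b 1 (X ^ d))
        ∂prodLaw (Fin 2) (k + 1) -
      ∫ b, (1 + w * realInd b) * (rho b 0 (X ^ d) * rho b 1 (X ^ a)) ∂prodLaw (Fin 2) (k + 1) =
      ∫ b, (1 + w * realInd b) * minor b a d ∂prodLaw (Fin 2) (k + 1) := by
    intro a d
    rw [← integral_sub (hInt a d) (hInt d a)]
    refine integral_congr_ae (ae_of_all _ fun b => ?_)
    simp only [minor]
    ring
  rw [integral_vand_eq_pairSum k l _ hψm _ hψb, hK]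
  · rw [mul_assoc]
    congr 3
    ext i j
    simp only [of_apply, Fin.val_zero, Fin.val_one, add_zero, Matrix.add_apply, Matrix.smul_apply,
      smul_eq_mul, totMat, realMat]
    rw [hsub, ← integral_const_mul, ← integral_add]
    · refine integral_congr_ae (ae_of_all _ fun b => ?_)
      beta_reduce
      ring
    · exact (allMom_minor _ _ _).integrable
    · refine Integrable.const_mul ?_ _
      refine AllMom.bdd_mul (c := 1) (allMom_minor _ _ _)
        measurable_realInd.aestronglyMeasurable fun b => ?_
      rcases realInd_eq b with h | h <;> simp [h]
  · intro i j ε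
    rw [← sub_eq_zero, hsub]
    refine integral_mul_minor_eq_zero k _ _ ⟨(i : ℕ) + j + ε, by ring⟩ _ hψm fun b => ?_
    rw [realInd_neg]

end DeBruijn

section Spherical
open Polynomial

lemma integral_comp_mp {A B : Type*} [MeasurableSpace A] [MeasurableSpace B] {μ : Measure A}
    {ν : Measure B} {T : A → B} (hT : MeasurePreserving T μ ν) {g : B → ℝ}
    (hg : AEStronglyMeasurable g ν) : ∫ x, g (T x) ∂μ = ∫ y, g y ∂ν := by
  rw [← hT.map_eq, integral_map hT.measurable.aemeasurable (by rwa [hT.map_eq])]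

/-- Laws of `2 × 2` matrices with all moments, invariant under rotations from the right. -/
structure RightInv (μ : Measure (Matrix (Fin 2) (Fin 2) ℝ)) : Prop where
  prob : IsProbabilityMeasure μ
  mom : ∀ i j, AllMom (fun b : Matrix (Fin 2) (Fin 2) ℝ => b i j) μ
  inv : ∀ O : Matrix (Fin 2) (Fin 2) ℝ, Oᵀ * O = 1 →
    MeasurePreserving (fun X : Matrix (Fin 2) (Fin 2) ℝ => X * O) μ μ

variable {μ : Measure (Matrix (Fin 2) (Fin 2) ℝ)}

lemma rightInv_prodLaw (k : ℕ) : RightInv (prodLaw (Fin 2) (k + 1)) :=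
  ⟨inferInstance, allMom_entry _, measurePreserving_mul_orth k⟩

lemma prodLaw_one {ι : Type*} [Fintype ι] [DecidableEq ι] : prodLaw ι 1 = stdGaussian ι ι := by
  refine Measure.ext_of_lintegral _ fun F hF => ?_
  rw [lintegral_prodLaw_succ 0 F hF]
  refine lintegral_congr fun X => ?_
  have h : Measurable fun Y : Matrix ι ι ℝ => F (X * Y) := hF.comp (measurable_const_mul X)
  rw [lintegral_prodLaw_zero _ h, mul_one]

lemma RightInv.allMom_det (h : RightInv μ) :
    AllMom (fun b : Matrix (Fin 2) (Fin 2) ℝ => b.det) μ := by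
  simp only [det_fin_two]
  exact ((h.mom 0 0).mul (h.mom 1 1)).sub ((h.mom 0 1).mul (h.mom 1 0))

lemma RightInv.integral_rotate (h : RightInv μ) (a i k d : ℕ) (hd : i + k = 2 * d) (x y : ℝ) :
    ∫ b, b.det ^ a * (b 0 0 * x + b 0 1 * y) ^ i * (b 1 0 * x + b 1 1 * y) ^ k ∂μ =
    (x ^ 2 + y ^ 2) ^ d * ∫ b, b.det ^ a * b 0 0 ^ i * b 1 0 ^ k ∂μ := by
  have := h.prob
  by_cases h0 : x ^ 2 + y ^ 2 = 0
  · have hx : x = 0 := by nlinarith [sq_nonneg x, sq_nonneg y]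
    have hy : y = 0 := by nlinarith [sq_nonneg x, sq_nonneg y]
    subst hx hy
    rcases Nat.eq_zero_or_pos d with rfl | hdp
    · obtain ⟨rfl, rfl⟩ : i = 0 ∧ k = 0 := by omega
      simp
    · rcases Nat.eq_zero_or_pos i with hi | hi
      · have hk : k ≠ 0 := by omega
        simp [hk, hdp.ne']
      · simp [hi.ne', hdp.ne']
  · have hp : 0 < x ^ 2 + y ^ 2 := lt_of_le_of_ne (by positivity) (Ne.symm h0)
    set ρ := Real.sqrt (x ^ 2 + y ^ 2) with hρ
    have hρ0 : ρ ≠ 0 := (Real.sqrt_pos.2 hp).ne'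
    have hρ2 : ρ ^ 2 = x ^ 2 + y ^ 2 := Real.sq_sqrt hp.le
    have hO : (!![x / ρ, -(y / ρ); y / ρ, x / ρ] : Matrix (Fin 2) (Fin 2) ℝ)ᵀ *
        !![x / ρ, -(y / ρ); y / ρ, x / ρ] = 1 := by
      ext i j
      fin_cases i <;> fin_cases j <;> simp [Matrix.mul_apply, Fin.sum_univ_two] <;>
        field_simp <;> linarith
    have hm := ((h.allMom_det.pow a).mul ((h.mom 0 0).pow i)).mul ((h.mom 1 0).pow k)
    rw [← integral_comp_mp (h.inv _ hO) hm.1, ← integral_const_mul]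
    refine integral_congr_ae (ae_of_all _ fun b => ?_)
    beta_reduce
    have hdet : (!![x / ρ, -(y / ρ); y / ρ, x / ρ] : Matrix (Fin 2) (Fin 2) ℝ).det = 1 := by
      rw [det_fin_two_of]
      field_simp
      linarith
    rw [det_mul, hdet, mul_one, ← hρ2, ← pow_mul, ← hd, pow_add]
    simp only [Matrix.mul_apply, Fin.sum_univ_two, Matrix.of_apply, Matrix.cons_val_zero,
      Matrix.cons_val_one, Matrix.cons_val', Matrix.cons_val_fin_one]
    have e1 : b 0 0 * x + b 0 1 * y = ρ * (b 0 0 * (x / ρ) + b 0 1 * (y / ρ)) := by field_simp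
    have e2 : b 1 0 * x + b 1 1 * y = ρ * (b 1 0 * (x / ρ) + b 1 1 * (y / ρ)) := by field_simp
    rw [e1, e2, mul_pow, mul_pow]
    ring

/-- The trace of the action of a `2 × 2` matrix on binary forms of degree `r`. -/
noncomputable def symTrace (b : Matrix (Fin 2) (Fin 2) ℝ) (r : ℕ) : ℝ :=
  ∑ k ∈ Finset.range (r + 1), ((C (b 0 0) + C (b 0 1) * X) ^ (r - k) *
    (C (b 1 0) + C (b 1 1) * X) ^ k : ℝ[X]).coeff k

/-- Auxiliary off-diagonal sum. -/
noncomputable def symOff (b : Matrix (Fin 2) (Fin 2) ℝ) (r : ℕ) : ℝ :=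
  ∑ k ∈ Finset.range r, ((C (b 0 0) + C (b 0 1) * X) ^ (r - (k + 1)) *
    (C (b 1 0) + C (b 1 1) * X) ^ (k + 1) : ℝ[X]).coeff k

lemma coeff_linear_pow_top (c d : ℝ) (r : ℕ) : ((C c + C d * X) ^ r : ℝ[X]).coeff r = d ^ r := by
  have h : (C c + C d * X : ℝ[X]).natDegree ≤ 1 := by
    rw [add_comm]; exact natDegree_linear_le
  have := coeff_pow_of_natDegree_le (m := r) (n := 1) h
  simpa using this

lemma symTrace_succ (b : Matrix (Fin 2) (Fin 2) ℝ) (r : ℕ) :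
    symTrace b (r + 1) = b 0 0 * symTrace b r + b 0 1 * symOff b r + b 1 1 ^ (r + 1) := by
  rw [symTrace, Finset.sum_range_succ, Nat.sub_self, pow_zero, one_mul, coeff_linear_pow_top]
  congr 1
  have e : ∀ k ∈ Finset.range (r + 1), ((C (b 0 0) + C (b 0 1) * X) ^ (r + 1 - k) *
      (C (b 1 0) + C (b 1 1) * X) ^ k : ℝ[X]).coeff k =
      b 0 0 * ((C (b 0 0) + C (b 0 1) * X) ^ (r - k) *
      (C (b 1 0) + C (b 1 1) * X) ^ k : ℝ[X]).coeff k + b 0 1 *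
      (X * ((C (b 0 0) + C (b 0 1) * X) ^ (r - k) *
      (C (b 1 0) + C (b 1 1) * X) ^ k) : ℝ[X]).coeff k := by
    intro k hk
    have : r + 1 - k = (r - k) + 1 := by have := Finset.mem_range.1 hk; omega
    rw [this, ← coeff_C_mul, ← coeff_C_mul, ← coeff_add]
    congr 1
    ring
  rw [Finset.sum_congr rfl e, Finset.sum_add_distrib, ← Finset.mul_sum, ← Finset.mul_sum, symTrace,
    symOff, Finset.sum_range_succ' (fun k => (X * ((C (b 0 0) + C (b 0 1) * X) ^ (r - k) *
      (C (b 1 0) + C (b 1 1) * X) ^ k) : ℝ[X]).coeff k)]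
  simp only [coeff_X_mul, mul_coeff_zero, coeff_X_zero, zero_mul, add_zero]

lemma symOff_succ (b : Matrix (Fin 2) (Fin 2) ℝ) (r : ℕ) :
    symOff b (r + 1) = b 1 0 * symTrace b r + b 1 1 * symOff b r := by
  have e : ∀ k ∈ Finset.range (r + 1), ((C (b 0 0) + C (b 0 1) * X) ^ (r + 1 - (k + 1)) *
      (C (b 1 0) + C (b 1 1) * X) ^ (k + 1) : ℝ[X]).coeff k =
      b 1 0 * ((C (b 0 0) + C (b 0 1) * X) ^ (r - k) *
      (C (b 1 0) + C (b 1 1) * X) ^ k : ℝ[X]).coeff k + b 1 1 *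
      (X * ((C (b 0 0) + C (b 0 1) * X) ^ (r - k) *
      (C (b 1 0) + C (b 1 1) * X) ^ k) : ℝ[X]).coeff k := by
    intro k hk
    have : r + 1 - (k + 1) = r - k := by omega
    rw [this, ← coeff_C_mul, ← coeff_C_mul, ← coeff_add]
    congr 1
    ring
  rw [symOff, Finset.sum_congr rfl e, Finset.sum_add_distrib, ← Finset.mul_sum, ← Finset.mul_sum,
    symTrace,
    symOff, Finset.sum_range_succ' (fun k => (X * ((C (b 0 0) + C (b 0 1) * X) ^ (r - k) *
      (C (b 1 0) + C (b 1 1) * X) ^ k) : ℝ[X]).coeff k)]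
  simp only [coeff_X_mul, mul_coeff_zero, coeff_X_zero, zero_mul, add_zero]

lemma symTrace_add_two (b : Matrix (Fin 2) (Fin 2) ℝ) (r : ℕ) :
    symTrace b (r + 2) = b.trace * symTrace b (r + 1) - b.det * symTrace b r := by
  rw [symTrace_succ b (r + 1), symOff_succ, symTrace_succ b r, trace_fin_two, det_fin_two]
  ring

lemma rho_eq_symTrace (b : Matrix (Fin 2) (Fin 2) ℝ) (r : ℕ) :
    rho b 1 (X ^ (r + 1)) = symTrace b r := by
  induction r using Nat.twoStepInduction with
  | zero =>
    rw [pow_succ', (rho_X_mul _ _).2, pow_zero, (rho_one b).1, (rho_one b).2]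
    simp [symTrace]
  | one =>
    rw [pow_succ', (rho_X_mul _ _).2, pow_succ', (rho_X_mul _ _).1, (rho_X_mul _ _).2, pow_zero,
      (rho_one b).1, (rho_one b).2, symTrace_succ]
    simp [symTrace, symOff, trace_fin_two]
  | more r h0 h1 =>
    rw [pow_succ', (rho_X_mul _ _).2, pow_succ', (rho_X_mul _ _).1, ← pow_succ', h0, h1,
      symTrace_add_two]
    ring

lemma minor_add (b : Matrix (Fin 2) (Fin 2) ℝ) (c e : ℕ) :
    minor b c (c + e + 1) = b.det ^ c * symTrace b e := by
  induction c with
  | zero => simp [minor, rho_one, rho_eq_symTrace]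
  | succ c ih =>
    have : c + 1 + e + 1 = (c + e + 1) + 1 := by ring
    rw [this, minor, pow_succ' X c, pow_succ' X (c + e + 1), (rho_X_mul _ _).1, (rho_X_mul _ _).2, (rho_X_mul _ _).1,
      (rho_X_mul _ _).2]
    rw [minor] at ih
    linear_combination b.det * ih

lemma minor_swap (b : Matrix (Fin 2) (Fin 2) ℝ) (c d : ℕ) : minor b c d = -minor b d c := by
  rw [minor, minor]; ring

lemma coeff_one_add_sq_pow (d k : ℕ) : ((1 + X ^ 2) ^ d : ℝ[X]).coeff k =
    ∑ i ∈ Finset.range (d + 1), if k = 2 * i then (d.choose i : ℝ) else 0 := by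
  rw [add_comm, add_pow, finsetSum_coeff]
  refine Finset.sum_congr rfl fun i _ => ?_
  rw [one_pow, mul_one, ← pow_mul, ← C_eq_natCast, coeff_mul_C, coeff_X_pow]
  simp

lemma RightInv.allMom_coeff (h : RightInv μ) (i k n : ℕ) :
    AllMom (fun b : Matrix (Fin 2) (Fin 2) ℝ => ((C (b 0 0) + C (b 0 1) * X) ^ i *
      (C (b 1 0) + C (b 1 1) * X) ^ k : ℝ[X]).coeff n) μ := by
  have := h.prob
  have hlin : ∀ (s : Fin 2) (i n : ℕ), AllMom (fun b : Matrix (Fin 2) (Fin 2) ℝ =>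
      ((C (b s 0) + C (b s 1) * X) ^ i : ℝ[X]).coeff n) μ := by
    intro s i
    induction i with
    | zero => exact fun n => allMom_const _
    | succ i ih =>
      intro n
      simp_rw [pow_succ', add_mul, mul_assoc, coeff_add, coeff_C_mul]
      refine ((h.mom s 0).mul (ih n)).add ((h.mom s 1).mul ?_)
      cases n with
      | zero => simpa using allMom_const 0
      | succ n => simpa [coeff_X_mul] using ih n
  simp_rw [coeff_mul]
  exact AllMom.sum _ fun x => (hlin 0 i _).mul (hlin 1 k _)

lemma RightInv.integral_coeff (h : RightInv μ) (a i k d n : ℕ) (hd : i + k = 2 * d) :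
    ∫ b, b.det ^ a * ((C (b 0 0) + C (b 0 1) * X) ^ i *
      (C (b 1 0) + C (b 1 1) * X) ^ k : ℝ[X]).coeff n ∂μ =
    ((1 + X ^ 2) ^ d : ℝ[X]).coeff n * ∫ b, b.det ^ a * b 0 0 ^ i * b 1 0 ^ k ∂μ := by
  have := h.prob
  have hmul : ∀ n, AllMom (fun b : Matrix (Fin 2) (Fin 2) ℝ => b.det ^ a *
      ((C (b 0 0) + C (b 0 1) * X) ^ i * (C (b 1 0) + C (b 1 1) * X) ^ k : ℝ[X]).coeff n) μ :=
    fun n => (h.allMom_det.pow a).mul (h.allMom_coeff i k n)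
  have hdeg : ∀ b : Matrix (Fin 2) (Fin 2) ℝ, ((C (b 0 0) + C (b 0 1) * X) ^ i *
      (C (b 1 0) + C (b 1 1) * X) ^ k : ℝ[X]).natDegree < 2 * d + 1 := by
    intro b
    have h1 : ∀ s, (C (b s 0) + C (b s 1) * X : ℝ[X]).natDegree ≤ 1 := fun s => by
      rw [add_comm]; exact natDegree_linear_le
    have := natDegree_mul_le_of_le (natDegree_pow_le_of_le i (h1 0)) (natDegree_pow_le_of_le k (h1 1))
    omega
  set J := ∫ b, b.det ^ a * b 0 0 ^ i * b 1 0 ^ k ∂μ with hJ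
  have hpoly : (∑ n ∈ Finset.range (2 * d + 1), C (∫ b, b.det ^ a *
      ((C (b 0 0) + C (b 0 1) * X) ^ i * (C (b 1 0) + C (b 1 1) * X) ^ k : ℝ[X]).coeff n ∂μ) * X ^ n
      : ℝ[X]) = (1 + X ^ 2) ^ d * C J := by
    refine Polynomial.funext fun x => ?_
    simp only [eval_finsetSum, eval_mul, eval_C, eval_pow, eval_X, eval_add, eval_one]
    have hr := h.integral_rotate a i k d hd 1 x
    rw [one_pow, ← hJ] at hr
    rw [← hr]
    simp_rw [← integral_mul_const]
    rw [← integral_finsetSum _ fun n _ => (hmul n).integrable.mul_const _]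
    refine integral_congr_ae (ae_of_all _ fun b => ?_)
    beta_reduce
    simp_rw [mul_assoc (b.det ^ a)]
    rw [← Finset.mul_sum, ← eval_eq_sum_range' (hdeg b)]
    simp
  have hc := congrArg (fun p : ℝ[X] => p.coeff n) hpoly
  simp only [coeff_mul_C] at hc
  rw [← hc, finsetSum_coeff]
  simp only [coeff_C_mul, coeff_X_pow, mul_ite, mul_one, mul_zero]
  by_cases hn : n < 2 * d + 1
  · rw [Finset.sum_eq_single n (fun j _ hj => if_neg hj.symm)
      (fun hh => absurd (Finset.mem_range.2 hn) hh), if_pos rfl]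
  · rw [Finset.sum_eq_zero fun j hj => if_neg (by have := Finset.mem_range.1 hj; omega)]
    rw [← integral_zero (Matrix (Fin 2) (Fin 2) ℝ) ℝ (μ := μ)]
    refine integral_congr_ae (ae_of_all _ fun b => ?_)
    beta_reduce
    rw [coeff_eq_zero_of_natDegree_lt (by have := hdeg b; omega), mul_zero]

lemma RightInv.integral_symTrace (h : RightInv μ) (a d : ℕ) :
    ∫ b, b.det ^ a * symTrace b (2 * d) ∂μ =
    ∫ b, b.det ^ a * (b 0 0 ^ 2 + b 1 0 ^ 2) ^ d ∂μ := by
  have := h.prob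
  have hm : ∀ k, AllMom (fun b : Matrix (Fin 2) (Fin 2) ℝ =>
      b.det ^ a * b 0 0 ^ (2 * d - k) * b 1 0 ^ k) μ := fun k =>
    ((h.allMom_det.pow a).mul ((h.mom 0 0).pow _)).mul ((h.mom 1 0).pow k)
  have e : ∀ b : Matrix (Fin 2) (Fin 2) ℝ, b.det ^ a * (b 0 0 ^ 2 + b 1 0 ^ 2) ^ d =
      ∑ k ∈ Finset.range (2 * d + 1), ((1 + X ^ 2) ^ d : ℝ[X]).coeff k *
        (b.det ^ a * b 0 0 ^ (2 * d - k) * b 1 0 ^ k) := by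
    intro b
    simp_rw [coeff_one_add_sq_pow, Finset.sum_mul]
    rw [Finset.sum_comm, add_comm (b 0 0 ^ 2), add_pow, Finset.mul_sum]
    refine Finset.sum_congr rfl fun i hi => ?_
    have hi' := Finset.mem_range.1 hi
    rw [Finset.sum_eq_single (2 * i) (fun j _ hj => by rw [if_neg hj, zero_mul])
      (fun hh => absurd (Finset.mem_range.2 (by omega)) hh), if_pos rfl, ← pow_mul, ← pow_mul,
      ← Nat.mul_sub]
    ring
  have hs : ∀ k, Integrable (fun b : Matrix (Fin 2) (Fin 2) ℝ => b.det ^ a *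
      ((C (b 0 0) + C (b 0 1) * X) ^ (2 * d - k) *
        (C (b 1 0) + C (b 1 1) * X) ^ k : ℝ[X]).coeff k) μ := fun k =>
    ((h.allMom_det.pow a).mul (h.allMom_coeff _ _ _)).integrable
  simp_rw [e, symTrace, Finset.mul_sum]
  rw [integral_finsetSum _ fun k _ => hs k,
    integral_finsetSum _ fun k _ => (hm k).integrable.const_mul _]
  refine Finset.sum_congr rfl fun k hk => ?_
  rw [integral_const_mul, h.integral_coeff a _ k d k (by have := Finset.mem_range.1 hk; omega)]

/-- The spherical moments of a matrix. -/
noncomputable def sphMom (μ : Measure (Matrix (Fin 2) (Fin 2) ℝ)) (a d : ℕ) : ℝ :=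
  ∫ b, b.det ^ a * (b 0 0 ^ 2 + b 1 0 ^ 2) ^ d ∂μ

lemma RightInv.allMom_sph (h : RightInv μ) (a d : ℕ) :
    AllMom (fun b : Matrix (Fin 2) (Fin 2) ℝ => b.det ^ a * (b 0 0 ^ 2 + b 1 0 ^ 2) ^ d) μ := by
  have := h.prob
  exact (h.allMom_det.pow a).mul ((((h.mom 0 0).pow 2).add ((h.mom 1 0).pow 2)).pow d)

lemma RightInv.integral_sph (h : RightInv μ) (a d : ℕ) (x y : ℝ) :
    ∫ b, b.det ^ a * ((b 0 0 * x + b 0 1 * y) ^ 2 + (b 1 0 * x + b 1 1 * y) ^ 2) ^ d ∂μ =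
    (x ^ 2 + y ^ 2) ^ d * sphMom μ a d := by
  have := h.prob
  have hl : ∀ s, AllMom (fun b : Matrix (Fin 2) (Fin 2) ℝ => b s 0 * x + b s 1 * y) μ := fun s =>
    ((h.mom s 0).mul (allMom_const x)).add ((h.mom s 1).mul (allMom_const y))
  have e : ∀ u v : ℝ, (u ^ 2 + v ^ 2) ^ d = ∑ i ∈ Finset.range (d + 1),
      u ^ (2 * i) * v ^ (2 * (d - i)) * (d.choose i) := fun u v => by
    simp_rw [add_pow, ← pow_mul]
  have e' : ∀ b : Matrix (Fin 2) (Fin 2) ℝ, b.det ^ a * (b 0 0 ^ 2 + b 1 0 ^ 2) ^ d =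
      ∑ i ∈ Finset.range (d + 1), b.det ^ a * b 0 0 ^ (2 * i) * b 1 0 ^ (2 * (d - i)) *
        (d.choose i) := fun b => by
    rw [e, Finset.mul_sum]
    exact Finset.sum_congr rfl fun i _ => by ring
  simp_rw [sphMom, e', e (_ + _), Finset.mul_sum, ← mul_assoc]
  rw [integral_finsetSum _ fun i _ => ((((h.allMom_det.pow a).mul ((hl 0).pow _)).mul
      ((hl 1).pow _)).mul (allMom_const _)).integrable,
    integral_finsetSum _ fun i _ => ((((h.allMom_det.pow a).mul ((h.mom 0 0).pow _)).mul
      ((h.mom 1 0).pow _)).mul (allMom_const _)).integrable, Finset.mul_sum]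
  refine Finset.sum_congr rfl fun i hi => ?_
  have := Finset.mem_range.1 hi
  rw [integral_mul_const, integral_mul_const, h.integral_rotate a _ _ d (by omega)]
  ring

lemma sphMom_prodLaw_succ (k a d : ℕ) : sphMom (prodLaw (Fin 2) (k + 1)) a d =
    sphMom (prodLaw (Fin 2) 1) a d * sphMom (prodLaw (Fin 2) k) a d := by
  have h := rightInv_prodLaw (k + 1 - 1)
  rw [Nat.add_sub_cancel] at h
  have h1 := rightInv_prodLaw 0
  rw [zero_add] at h1
  have hm := (h.allMom_sph a d)
  rw [sphMom, ← integral_comp_mp (measurePreserving_mul_prodLaw k) hm.1, integral_prod_symm]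
  · rw [sphMom, sphMom, ← integral_const_mul]
    refine integral_congr_ae (ae_of_all _ fun Y => ?_)
    beta_reduce
    have := h1.integral_sph a d (Y 0 0) (Y 1 0)
    rw [sphMom, prodLaw_one] at this
    simp only [det_mul, mul_pow, Matrix.mul_apply, Fin.sum_univ_two]
    rw [prodLaw_one]
    calc ∫ X, X.det ^ a * Y.det ^ a * ((X 0 0 * Y 0 0 + X 0 1 * Y 1 0) ^ 2 +
          (X 1 0 * Y 0 0 + X 1 1 * Y 1 0) ^ 2) ^ d ∂stdGaussian (Fin 2) (Fin 2)
        = ∫ X, Y.det ^ a * (X.det ^ a * ((X 0 0 * Y 0 0 + X 0 1 * Y 1 0) ^ 2 +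
          (X 1 0 * Y 0 0 + X 1 1 * Y 1 0) ^ 2) ^ d) ∂stdGaussian (Fin 2) (Fin 2) := by
          refine integral_congr_ae (ae_of_all _ fun X => ?_)
          beta_reduce
          ring
      _ = _ := by
          rw [integral_const_mul, this]
          ring
  · exact (hm.comp (measurePreserving_mul_prodLaw k)).integrable

lemma sphMom_prodLaw (k a d : ℕ) : sphMom (prodLaw (Fin 2) k) a d =
    sphMom (prodLaw (Fin 2) 1) a d ^ k := by
  induction k with
  | zero =>
    rw [sphMom, prodLaw, integral_dirac]
    simp
  | succ k ih => rw [sphMom_prodLaw_succ, ih, pow_succ']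

lemma totMat_apply (k l : ℕ) (i j : Fin l) : totMat k l i j =
    if i ≤ j then sphMom (prodLaw (Fin 2) 1) (2 * i) (j - i) ^ (k + 1)
    else -sphMom (prodLaw (Fin 2) 1) (2 * j + 1) (i - j - 1) ^ (k + 1) := by
  have h := rightInv_prodLaw k
  rw [totMat, of_apply]
  split_ifs with hij
  · have e : 2 * (j : ℕ) + 1 = 2 * (i : ℕ) + 2 * (j - i) + 1 := by
      have : (i : ℕ) ≤ j := hij
      omega
    simp_rw [e, minor_add]
    rw [h.integral_symTrace, ← sphMom_prodLaw, sphMom]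
  · have e : 2 * (i : ℕ) = 2 * (j : ℕ) + 1 + 2 * (i - j - 1) + 1 := by
      have : ¬ (i : ℕ) ≤ j := hij
      omega
    have : ∀ b, minor b (2 * (i : ℕ)) (2 * (j : ℕ) + 1) = -(b.det ^ (2 * (j : ℕ) + 1) *
        symTrace b (2 * (i - j - 1))) := fun b => by rw [minor_swap, e, minor_add]
    simp_rw [this]
    rw [integral_neg, h.integral_symTrace, ← sphMom_prodLaw, sphMom]

lemma sphMom_odd (a d : ℕ) (ha : Odd a) : sphMom (prodLaw (Fin 2) 1) a d = 0 := by
  have h := rightInv_prodLaw 0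
  rw [zero_add] at h
  have hO : (!![1, 0; 0, -1] : Matrix (Fin 2) (Fin 2) ℝ)ᵀ * !![1, 0; 0, -1] = 1 := by
    ext i j
    fin_cases i <;> fin_cases j <;> simp [Matrix.mul_apply, Fin.sum_univ_two]
  have e := integral_comp_mp (h.inv _ hO) (h.allMom_sph a d).1
  have : sphMom (prodLaw (Fin 2) 1) a d = -sphMom (prodLaw (Fin 2) 1) a d := by
    conv_lhs => rw [sphMom, ← e]
    rw [sphMom, ← integral_neg]
    refine integral_congr_ae (ae_of_all _ fun b => ?_)
    beta_reduce
    rw [det_mul, mul_pow]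
    simp [Matrix.mul_apply, Fin.sum_univ_two, ha.neg_one_pow]
  linarith

/-- Absolute moments of the standard normal law. -/
noncomputable def gMom (s : ℕ) : ℝ := ∫ x, |x| ^ s ∂gaussianReal 0 1

lemma gMom_even (j : ℕ) : gMom (2 * j) = ∫ x, x ^ (2 * j) ∂gaussianReal 0 1 := by
  simp_rw [gMom, (even_two_mul j).pow_abs]

lemma gMom_pos (s : ℕ) : 0 < gMom s := by
  refine (integral_pos_iff_support_of_nonneg_ae (ae_of_all _ fun x => by positivity)
    (allMom_gaussian.2 s)).2 ?_
  have := nullSingletonClass_gaussianReal (μ := 0) (v := 1) one_ne_zero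
  refine lt_of_lt_of_le ?_ (measure_mono (s := ({0}ᶜ : Set ℝ)) fun x hx => ?_)
  · rw [(prob_compl_eq_one_iff (measurableSet_singleton _)).2 (measure_singleton _)]
    exact one_pos
  · exact pow_ne_zero s (abs_ne_zero.2 hx)

lemma measurePreserving_prodProdProdComm {A B C D : Type*} [MeasurableSpace A] [MeasurableSpace B]
    [MeasurableSpace C] [MeasurableSpace D] (μA : Measure A) (μB : Measure B) (μC : Measure C)
    (μD : Measure D) [SFinite μA] [SFinite μB] [SFinite μC] [SFinite μD] :
    MeasurePreserving (fun z : (A × C) × (B × D) => ((z.1.1, z.2.1), (z.1.2, z.2.2)))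
      ((μA.prod μC).prod (μB.prod μD)) ((μA.prod μB).prod (μC.prod μD)) := by
  have hm : Measurable fun z : (A × C) × (B × D) => ((z.1.1, z.2.1), (z.1.2, z.2.2)) := by
    fun_prop
  refine ⟨hm, Measure.ext_of_lintegral _ fun F hF => ?_⟩
  have h0 : Measurable fun z : (A × C) × (B × D) => F ((z.1.1, z.2.1), (z.1.2, z.2.2)) :=
    hF.comp hm
  rw [lintegral_map hF hm, lintegral_prod _ h0.aemeasurable, lintegral_prod _ hF.aemeasurable]
  have h1 : Measurable fun x : A × C => ∫⁻ y : B × D, F ((x.1, y.1), (x.2, y.2)) ∂μB.prod μD :=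
    h0.lintegral_prod_right'
  have h2 : Measurable fun x : A × B => ∫⁻ y : C × D, F (x, y) ∂μC.prod μD :=
    hF.lintegral_prod_right'
  rw [lintegral_prod _ h1.aemeasurable, lintegral_prod _ h2.aemeasurable]
  refine lintegral_congr fun a => ?_
  have e1 : ∀ c, ∫⁻ y : B × D, F ((a, y.1), (c, y.2)) ∂μB.prod μD =
      ∫⁻ b, ∫⁻ d, F ((a, b), (c, d)) ∂μD ∂μB := fun c =>
    lintegral_prod (fun y : B × D => F ((a, y.1), (c, y.2))) (by fun_prop)
  have e2 : ∀ b, ∫⁻ y : C × D, F ((a, b), y) ∂μC.prod μD =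
      ∫⁻ c, ∫⁻ d, F ((a, b), (c, d)) ∂μD ∂μC := fun b =>
    lintegral_prod (fun y : C × D => F ((a, b), y)) (by fun_prop)
  simp_rw [e1, e2]
  refine lintegral_lintegral_swap (f := fun c b => ∫⁻ d, F ((a, b), (c, d)) ∂μD) ?_
  have h3 : Measurable fun x : (C × B) × D => F ((a, x.1.2), (x.1.1, x.2)) := by fun_prop
  exact h3.lintegral_prod_right'.aemeasurable

lemma measurePreserving_quad : MeasurePreserving
    (fun z : (ℝ × ℝ) × (ℝ × ℝ) => (!![z.1.1, z.2.1; z.1.2, z.2.2] : Matrix (Fin 2) (Fin 2) ℝ))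
    (((gaussianReal 0 1).prod (gaussianReal 0 1)).prod
      ((gaussianReal 0 1).prod (gaussianReal 0 1))) (stdGaussian (Fin 2) (Fin 2)) := by
  have h1 := (measurePreserving_finTwoArrow (gaussianReal 0 1)).symm
  have h2 := (measurePreserving_finTwoArrow (Measure.pi fun _ : Fin 2 => gaussianReal 0 1)).symm
  have h3 := (h2.comp (h1.prod h1)).comp (measurePreserving_prodProdProdComm (gaussianReal 0 1)
    (gaussianReal 0 1) (gaussianReal 0 1) (gaussianReal 0 1))
  exact h3

lemma integral_linear_gaussian (a c : ℝ) (j : ℕ) :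
    ∫ z : ℝ × ℝ, (a * z.2 - z.1 * c) ^ (2 * j) ∂(gaussianReal 0 1).prod (gaussianReal 0 1) =
    (a ^ 2 + c ^ 2) ^ j * gMom (2 * j) := by
  have h := rightInv_prodLaw 0
  rw [zero_add, prodLaw_one] at h
  have h1 := h.integral_rotate 0 (2 * j) 0 j (by ring) (-c) a
  simp only [pow_zero, one_mul, mul_one] at h1
  have hm : AllMom (fun b : Matrix (Fin 2) (Fin 2) ℝ => (b 0 0 * -c + b 0 1 * a) ^ (2 * j))
      (stdGaussian (Fin 2) (Fin 2)) :=
    have := h.prob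
    (((h.mom 0 0).mul (allMom_const _)).add ((h.mom 0 1).mul (allMom_const _))).pow _
  rw [integral_comp_mp (measurePreserving_entry_stdGaussian 0 0)
      (g := fun x => x ^ (2 * j)) (allMom_gaussian.pow _).1, ← gMom_even,
    ← integral_comp_mp measurePreserving_quad hm.1] at h1
  have hp : MeasurePreserving (fun z : (ℝ × ℝ) × (ℝ × ℝ) => (z.1.1, z.2.1))
      (((gaussianReal 0 1).prod (gaussianReal 0 1)).prod
      ((gaussianReal 0 1).prod (gaussianReal 0 1))) ((gaussianReal 0 1).prod (gaussianReal 0 1)) :=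
    measurePreserving_fst.prod measurePreserving_fst
  have hmeas : Measurable fun z : ℝ × ℝ => (a * z.2 - z.1 * c) ^ (2 * j) := by fun_prop
  rw [← integral_comp_mp hp hmeas.aestronglyMeasurable]
  rw [neg_sq, add_comm (c ^ 2)] at h1
  rw [← h1]
  refine integral_congr_ae (ae_of_all _ fun z => ?_)
  simp only [Matrix.of_apply, Matrix.cons_val_zero,
      Matrix.cons_val_one, Matrix.cons_val', Matrix.cons_val_fin_one]
  ring

/-- The unnormalized half-line Gaussian moments. -/
noncomputable def halfMom (s : ℕ) : ℝ := ∫ r in Ioi (0 : ℝ), r ^ s * Real.exp (-r ^ 2 / 2)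

lemma gMom_eq_halfMom (s : ℕ) : gMom s = 2 * (Real.sqrt (2 * Real.pi))⁻¹ * halfMom s := by
  rw [gMom, integral_gaussianReal_eq_integral_smul one_ne_zero, halfMom, mul_assoc,
    ← integral_const_mul,
    ← integral_comp_abs (f := fun r => (√(2 * Real.pi))⁻¹ * (r ^ s * Real.exp (-r ^ 2 / 2)))]
  refine integral_congr_ae (ae_of_all _ fun x => ?_)
  simp [gaussianPDFReal]
  ring

lemma integral_radial_eq_halfMom (d : ℕ) :
    ∫ z : ℝ × ℝ, (z.1 ^ 2 + z.2 ^ 2) ^ d ∂(gaussianReal 0 1).prod (gaussianReal 0 1) =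
    halfMom (2 * d + 1) := by
  rw [gaussianReal_of_var_ne_zero 0 one_ne_zero,
    prod_withDensity (measurable_gaussianPDF _ _) (measurable_gaussianPDF _ _),
    integral_withDensity_eq_integral_toReal_smul (by fun_prop)
      (ae_of_all _ fun z => ENNReal.mul_lt_top gaussianPDF_lt_top gaussianPDF_lt_top),
    ← Measure.volume_eq_prod, ← integral_comp_polarCoord_symm, polarCoord_target]
  have e : ∀ p : ℝ × ℝ, p.1 • ((gaussianPDF 0 1 (polarCoord.symm p).1 *
      gaussianPDF 0 1 (polarCoord.symm p).2).toReal •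
      ((polarCoord.symm p).1 ^ 2 + (polarCoord.symm p).2 ^ 2) ^ d) =
      p.1 ^ (2 * d + 1) * Real.exp (-p.1 ^ 2 / 2) * (2 * Real.pi)⁻¹ := by
    intro p
    have hs : (polarCoord.symm p).1 ^ 2 + (polarCoord.symm p).2 ^ 2 = p.1 ^ 2 := by
      simp only [polarCoord_symm_apply]
      nlinarith [Real.cos_sq_add_sin_sq p.2]
    rw [hs, ENNReal.toReal_mul, toReal_gaussianPDF, toReal_gaussianPDF, gaussianPDFReal,
      gaussianPDFReal, mul_mul_mul_comm, ← Real.exp_add]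
    have h2 : (√(2 * Real.pi * ((1 : ℝ≥0) : ℝ)))⁻¹ * (√(2 * Real.pi * ((1 : ℝ≥0) : ℝ)))⁻¹ =
        (2 * Real.pi)⁻¹ := by
      rw [← mul_inv, Real.mul_self_sqrt (by positivity), NNReal.coe_one, mul_one]
    have h3 : -((polarCoord.symm p).1 - 0) ^ 2 / (2 * ((1 : ℝ≥0) : ℝ)) +
        -((polarCoord.symm p).2 - 0) ^ 2 / (2 * ((1 : ℝ≥0) : ℝ)) = -p.1 ^ 2 / 2 := by
      rw [← hs, NNReal.coe_one]
      ring
    rw [h2, h3, smul_eq_mul, smul_eq_mul]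
    ring
  simp_rw [e]
  rw [Measure.volume_eq_prod,
    setIntegral_prod_mul (fun r : ℝ => r ^ (2 * d + 1) * Real.exp (-r ^ 2 / 2))
      (fun _ : ℝ => (2 * Real.pi)⁻¹)]
  rw [halfMom, setIntegral_const, Real.volume_real_Ioo_of_le (by linarith [Real.pi_pos]),
    smul_eq_mul]
  have := Real.pi_pos
  field_simp
  ring

lemma integral_radial_gaussian (d : ℕ) :
    ∫ z : ℝ × ℝ, (z.1 ^ 2 + z.2 ^ 2) ^ d ∂(gaussianReal 0 1).prod (gaussianReal 0 1) =
    gMom (2 * d + 1) / gMom 1 := by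
  have h0 : halfMom 1 = 1 := by
    rw [← integral_radial_eq_halfMom 0]
    simp
  have h1 : (√(2 * Real.pi))⁻¹ ≠ 0 := by positivity
  rw [integral_radial_eq_halfMom, gMom_eq_halfMom, gMom_eq_halfMom 1, h0, mul_one]
  field_simp

lemma sphMom_even (j d : ℕ) : sphMom (prodLaw (Fin 2) 1) (2 * j) d =
    gMom (2 * j) * (gMom (2 * (j + d) + 1) / gMom 1) := by
  have h := rightInv_prodLaw 0
  rw [zero_add, prodLaw_one] at h
  have hm := h.allMom_sph (2 * j) d
  rw [sphMom, prodLaw_one, ← integral_comp_mp measurePreserving_quad hm.1, integral_prod]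
  · rw [← integral_radial_gaussian, ← integral_const_mul]
    refine integral_congr_ae (ae_of_all _ fun z => ?_)
    simp only [det_fin_two_of, Matrix.of_apply, Matrix.cons_val_zero,
      Matrix.cons_val_one, Matrix.cons_val', Matrix.cons_val_fin_one]
    rw [integral_mul_const, integral_linear_gaussian]
    ring
  · exact (hm.comp measurePreserving_quad).integrable

theorem totMat_eq (k l : ℕ) (i j : Fin l) : totMat k l i j =
    if i ≤ j then (gMom (2 * i) * (gMom (2 * j + 1) / gMom 1)) ^ (k + 1) else 0 := by
  rw [totMat_apply]
  split_ifs with hij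
  · have : (i : ℕ) ≤ j := hij
    rw [sphMom_even, Nat.add_sub_cancel' this]
  · rw [sphMom_odd _ _ ⟨j, rfl⟩, zero_pow (by omega), neg_zero]

end Spherical

section Scalar

lemma sylvDet_fin_one (b y : Matrix (Fin 1) (Fin 1) ℝ) : sylvDet b y = b 0 0 - y 0 0 := by
  have : sylv b y = (b 0 0 - y 0 0) • LinearMap.id := by
    ext W i j
    fin_cases i; fin_cases j
    simp [sylv, Matrix.mul_apply]
    ring
  rw [sylvDet, this, LinearMap.det_smul, LinearMap.det_id, Module.finrank_matrix]
  simp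

/-- The discriminant of the characteristic polynomial of a `2 × 2` matrix. -/
def disc (t d : ℝ) : ℝ := t ^ 2 - 4 * d

lemma graphSum_fin_one (F : ℝ → ℝ → ℝ≥0∞) (P : Matrix (Fin 1 ⊕ Fin 1) (Fin 1 ⊕ Fin 1) ℝ)
    (hb : P (Sum.inl 0) (Sum.inr 0) ≠ 0) (hd : disc P.trace P.det ≠ 0) :
    graphSum (fun x y => if x 0 0 < y 0 0 then F (x 0 0 + y 0 0) (x 0 0 * y 0 0) else 0) P =
      if 0 < disc P.trace P.det then F P.trace P.det else 0 := by
  obtain ⟨a, ha⟩ : ∃ a, a = P (Sum.inl 0) (Sum.inl 0) := ⟨_, rfl⟩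
  obtain ⟨b, hb'⟩ : ∃ b, b = P (Sum.inl 0) (Sum.inr 0) := ⟨_, rfl⟩
  obtain ⟨c, hc⟩ : ∃ c, c = P (Sum.inr 0) (Sum.inl 0) := ⟨_, rfl⟩
  obtain ⟨d, hd'⟩ : ∃ d, d = P (Sum.inr 0) (Sum.inr 0) := ⟨_, rfl⟩
  have htr : P.trace = a + d := by
    rw [Matrix.trace, Fintype.sum_sum_type]
    simp [ha, hd']
  have hdet : P.det = a * d - b * c := by
    rw [← Matrix.det_submatrix_equiv_self (finSumFinEquiv (m := 1) (n := 1)).symm, Matrix.det_fin_two]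
    simp only [Matrix.submatrix_apply]
    rw [ha, hb', hc, hd']
    rfl
  have hmem : ∀ U : Matrix (Fin 1) (Fin 1) ℝ, U ∈ invGraph P ↔
      U 0 0 * a + U 0 0 * b * U 0 0 - d * U 0 0 = c := by
    intro U
    rw [invGraph, Set.mem_ofPred_eq, ← Matrix.ext_iff]
    simp [Matrix.mul_apply, Matrix.toBlocks₁₁, Matrix.toBlocks₁₂, Matrix.toBlocks₂₁,
      Matrix.toBlocks₂₂, ha, hb', hc, hd']
  have hx : ∀ U : Matrix (Fin 1) (Fin 1) ℝ, (P.toBlocks₁₁ + P.toBlocks₁₂ * U) 0 0 = a + b * U 0 0 := by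
    intro U
    simp [Matrix.mul_apply, Matrix.toBlocks₁₁, Matrix.toBlocks₁₂, ha, hb']
  have hy : ∀ U : Matrix (Fin 1) (Fin 1) ℝ, (P.toBlocks₂₂ - U * P.toBlocks₁₂) 0 0 = d - U 0 0 * b := by
    intro U
    simp [Matrix.mul_apply, Matrix.toBlocks₂₂, Matrix.toBlocks₁₂, hd', hb']
  rw [← hb'] at hb
  have hsq : ∀ U ∈ invGraph P, (2 * b * U 0 0 + a - d) ^ 2 = disc P.trace P.det := by
    intro U hU
    rw [hmem] at hU
    rw [disc, htr, hdet]
    linear_combination 4 * b * hU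
  unfold graphSum
  simp only [hx, hy]
  split_ifs with hpos
  · set s := Real.sqrt (disc P.trace P.det) with hs
    have hs0 : 0 < s := Real.sqrt_pos.2 hpos
    have hss : s ^ 2 = disc P.trace P.det := Real.sq_sqrt hpos.le
    have hU0 : (Matrix.of fun _ _ => (d - a - s) / (2 * b) : Matrix (Fin 1) (Fin 1) ℝ) ∈ invGraph P := by
      rw [hmem]
      simp only [Matrix.of_apply]
      rw [disc, htr, hdet] at hss
      field_simp
      linear_combination hss
    rw [tsum_eq_single ⟨_, hU0⟩]
    · have hu : ∀ u, u = (d - a - s) / (2 * b) → (if a + b * u < d - u * b then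
          F (a + b * u + (d - u * b)) ((a + b * u) * (d - u * b)) else 0) = F P.trace P.det := by
        intro u hu
        have e1 : b * u = (d - a - s) / 2 := by rw [hu]; field_simp
        have e2 : u * b = (d - a - s) / 2 := by rw [mul_comm, e1]
        rw [if_pos (by rw [e1, e2]; linarith), e1, e2, htr, hdet]
        congr 1
        · ring
        · rw [disc, htr, hdet] at hss
          linear_combination (-1 / 4) * hss
      exact hu _ rfl
    · rintro ⟨U, hU⟩ hne
      refine if_neg fun hlt => hne ?_
      have h1 := hsq U hU
      rw [← hss] at h1
      have h2 : 2 * b * U 0 0 + a - d = -s := by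
        rcases sq_eq_sq_iff_eq_or_eq_neg.1 h1 with h | h
        · simp only at hlt
          nlinarith
        · exact h
      refine Subtype.ext (Matrix.ext fun i j => ?_)
      fin_cases i; fin_cases j
      simp only [Matrix.of_apply]
      field_simp
      simp
      linarith
  · refine ENNReal.tsum_eq_zero.2 fun U => ?_
    exact absurd (lt_of_le_of_ne (hsq U.1 U.2 ▸ sq_nonneg _) hd.symm) hpos

lemma trace_submatrix_symm {ι κ : Type*} [Fintype ι] [Fintype κ] (e : ι ≃ κ) (P : Matrix ι ι ℝ) :
    (P.submatrix e.symm e.symm).trace = P.trace := Equiv.sum_comp e.symm fun i => P i i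

lemma ae_disc_ne_zero : ∀ᵐ P : Matrix (Fin 2) (Fin 2) ℝ, disc P.trace P.det ≠ 0 := by
  refine ae_ne_zero_of_polyOnLines (x₀ := !![0, 1; 1, 0]) ?_ ?_ ?_
  · have h : (fun P : Matrix (Fin 2) (Fin 2) ℝ => disc P.trace P.det) =
        ((fun P : Matrix (Fin 2) (Fin 2) ℝ => P 0 0) - fun P => P 1 1) ^ 2 +
        (4 : ℝ) • ((fun P : Matrix (Fin 2) (Fin 2) ℝ => P 0 1) * fun P => P 1 0) := by
      funext P
      simp [disc, Matrix.trace_fin_two, Matrix.det_fin_two]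
      ring
    rw [h]
    exact add_mem (pow_mem (sub_mem (entry_mem_polyOnLines _ _) (entry_mem_polyOnLines _ _)) _)
      (Subalgebra.smul_mem _ (mul_mem (entry_mem_polyOnLines _ _) (entry_mem_polyOnLines _ _)) _)
  · unfold disc
    exact ((Continuous.matrix_trace continuous_id).pow 2 |>.sub
      (continuous_const.mul (Continuous.matrix_det continuous_id))).measurable
  · simp [disc, Matrix.trace_fin_two, Matrix.det_fin_two]

lemma realInd_eq_ite (b : Matrix (Fin 2) (Fin 2) ℝ) (hb : disc b.trace b.det ≠ 0) :
    realInd b = if 0 < disc b.trace b.det then 1 else 0 := by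
  have hroot : b.charpoly.roots.card ≠ 0 ↔ ∃ x : ℝ, b.charpoly.IsRoot x := by
    rw [← Nat.pos_iff_ne_zero, Multiset.card_pos_iff_exists_mem]
    simp [(Matrix.charpoly_monic b).ne_zero]
  have hev : ∀ x : ℝ, b.charpoly.IsRoot x ↔ 1 * (x * x) + (-b.trace) * x + b.det = 0 := by
    intro x
    rw [Polynomial.IsRoot, Matrix.charpoly_fin_two]
    simp only [Polynomial.eval_add, Polynomial.eval_sub, Polynomial.eval_mul, Polynomial.eval_pow,
      Polynomial.eval_X, Polynomial.eval_C]
    rw [show x ^ 2 - b.trace * x + b.det = 1 * (x * x) + (-b.trace) * x + b.det by ring]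
  have hdisc : discrim 1 (-b.trace) b.det = disc b.trace b.det := by
    rw [discrim, disc]; ring
  rw [realInd]
  split_ifs with h
  · obtain ⟨x, hx⟩ := exists_quadratic_eq_zero (a := (1 : ℝ)) (b := -b.trace) (c := b.det)
      one_ne_zero ⟨Real.sqrt (disc b.trace b.det), by rw [hdisc, Real.mul_self_sqrt h.le]⟩
    have := hroot.2 ⟨x, (hev x).2 hx⟩
    rcases card_roots_fin_two b with h0 | h0
    · exact absurd h0 this
    · simp [h0]
  · have : b.charpoly.roots.card = 0 := by
      by_contra h0
      obtain ⟨x, hx⟩ := hroot.1 h0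
      have := discrim_eq_sq_of_quadratic_eq_zero ((hev x).1 hx)
      rw [hdisc] at this
      exact h (lt_of_le_of_ne (this ▸ sq_nonneg _) hb.symm)
    simp [this]

/-- The law of a product of independent standard Gaussian variables. -/
noncomputable def scalarLaw (k : ℕ) : Measure ℝ :=
  (prodLaw (Fin 1) k).map fun b : Matrix (Fin 1) (Fin 1) ℝ => b 0 0

lemma measurePreserving_scalarLaw (k : ℕ) :
    MeasurePreserving (fun b : Matrix (Fin 1) (Fin 1) ℝ => b 0 0) (prodLaw (Fin 1) k)
      (scalarLaw k) := ⟨measurable_entry 0 0, rfl⟩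

instance (k : ℕ) : IsProbabilityMeasure (scalarLaw k) :=
  Measure.isProbabilityMeasure_map (measurable_entry 0 0).aemeasurable

lemma lintegral_scalarLaw_zero {f : ℝ → ℝ≥0∞} (hf : Measurable f) :
    ∫⁻ x, f x ∂scalarLaw 0 = f 1 := by
  rw [← (measurePreserving_scalarLaw 0).lintegral_comp hf]
  have h : Measurable fun b : Matrix (Fin 1) (Fin 1) ℝ => f (b 0 0) := hf.comp (measurable_entry 0 0)
  rw [lintegral_prodLaw_zero _ h, Matrix.one_apply_eq]

lemma lintegral_scalarLaw_succ (k : ℕ) {f : ℝ → ℝ≥0∞} (hf : Measurable f) :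
    ∫⁻ x, f x ∂scalarLaw (k + 1) = ∫⁻ x, ∫⁻ y, f (x * y) ∂scalarLaw k ∂gaussianReal 0 1 := by
  rw [← (measurePreserving_scalarLaw (k + 1)).lintegral_comp hf]
  have h : Measurable fun b : Matrix (Fin 1) (Fin 1) ℝ => f (b 0 0) := hf.comp (measurable_entry 0 0)
  rw [lintegral_prodLaw_succ k _ h]
  have hm : Measurable fun p : ℝ × ℝ => f (p.1 * p.2) := hf.comp measurable_mul
  have hm2 : Measurable fun x : ℝ => ∫⁻ y, f (x * y) ∂scalarLaw k := hm.lintegral_prod_right'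
  rw [← (measurePreserving_entry_stdGaussian (0 : Fin 1) 0).lintegral_comp hm2]
  refine lintegral_congr fun X => ?_
  have hX : Measurable fun y : ℝ => f (X 0 0 * y) := hf.comp (measurable_const_mul _)
  rw [← (measurePreserving_scalarLaw k).lintegral_comp hX]
  refine lintegral_congr fun Y => ?_
  simp [Matrix.mul_apply]

lemma qrConst_fin_one : qrConst (Fin 1) (Fin 1) = (ENNReal.ofReal (gMom 1))⁻¹ := by
  refine ENNReal.eq_inv_of_mul_eq_one_left ?_
  rw [← qrConst_mul (Fin 1) (Fin 1)]
  congr 1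
  have hm : Measurable fun x : ℝ => ENNReal.ofReal (|x| ^ 1) := by fun_prop
  have hi : Integrable (fun x : ℝ => |x| ^ 1) (gaussianReal 0 1) :=
    ((allMom_gaussian).abs.pow 1).integrable
  rw [gMom, ofReal_integral_eq_lintegral_ofReal hi (ae_of_all _ fun x => by positivity),
    ← (measurePreserving_entry_stdGaussian (0 : Fin 1) 0).lintegral_comp hm]
  simp [Matrix.det_fin_one]

/-- The joint law of the real eigenvalues of a product of `2 × 2` Gaussian matrices. -/
theorem lintegral_realEig (k : ℕ) {F : ℝ → ℝ → ℝ≥0∞} (hF : Measurable (uncurry F)) :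
    ∫⁻ b, (if 0 < disc b.trace b.det then F b.trace b.det else 0) ∂prodLaw (Fin 2) (k + 1) =
      (ENNReal.ofReal (gMom 1))⁻¹ ^ (k + 1) * ∫⁻ x, ∫⁻ y, ENNReal.ofReal |x - y| *
        (if x < y then F (x + y) (x * y) else 0) ∂scalarLaw (k + 1) ∂scalarLaw (k + 1) := by
  obtain ⟨Φ, hΦdef⟩ : ∃ Φ : Matrix (Fin 1) (Fin 1) ℝ → Matrix (Fin 1) (Fin 1) ℝ → ℝ≥0∞, Φ =
    fun x y => if x 0 0 < y 0 0 then F (x 0 0 + y 0 0) (x 0 0 * y 0 0) else 0 := ⟨_, rfl⟩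
  have hf : Measurable fun p : ℝ × ℝ => if p.1 < p.2 then F (p.1 + p.2) (p.1 * p.2) else 0 := by
    have h1 : Measurable fun p : ℝ × ℝ => F (p.1 + p.2) (p.1 * p.2) :=
      hF.comp (measurable_add.prodMk measurable_mul)
    exact Measurable.ite (measurableSet_lt measurable_fst measurable_snd) h1 measurable_const
  have hΦ : Measurable (uncurry Φ) := by
    subst hΦdef
    have h2 : Measurable fun p : Matrix (Fin 1) (Fin 1) ℝ × Matrix (Fin 1) (Fin 1) ℝ =>
        (p.1 0 0, p.2 0 0) :=
      ((measurable_entry 0 0).comp measurable_fst).prodMk ((measurable_entry 0 0).comp measurable_snd)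
    exact hf.comp h2
  have h0 : ∀ b y, sylvDet b y = 0 → Φ b y = 0 := by
    intro b y h
    rw [sylvDet_fin_one] at h
    subst hΦdef
    exact if_neg (by linarith)
  have hone : ∀ g b : Matrix (Fin 1) (Fin 1) ℝ, IsUnit g.det → g * b * g⁻¹ = b := by
    intro g b hg
    have hc : g * b = b * g := by
      ext i j
      fin_cases i; fin_cases j
      simp [Matrix.mul_apply, mul_comm]
    rw [hc, Matrix.mul_assoc, Matrix.mul_nonsing_inv _ hg, Matrix.mul_one]
  have key := lintegral_graphSum_prodLaw (α := Fin 1) (β := Fin 1) k Φ hΦ h0 fun b y g h hg hh => by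
    rw [hone g b hg, hone h y hh]
  rw [qrConst_fin_one] at key
  have hG : Measurable fun b : Matrix (Fin 2) (Fin 2) ℝ =>
      if 0 < disc b.trace b.det then F b.trace b.det else 0 := by
    have h1 : Measurable fun b : Matrix (Fin 2) (Fin 2) ℝ => (b.trace, b.det) :=
      ((Continuous.matrix_trace continuous_id).prodMk (Continuous.matrix_det continuous_id)).measurable
    have h2 : Measurable fun p : ℝ × ℝ => if 0 < disc p.1 p.2 then F p.1 p.2 else 0 := by
      refine Measurable.ite (measurableSet_lt measurable_const ?_) hF measurable_const
      unfold disc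
      fun_prop
    exact h2.comp h1
  rw [← (measurePreserving_reindex_prodLaw (finSumFinEquiv (m := 1) (n := 1)) (k + 1)).lintegral_comp
    hG]
  have hae : ∀ᵐ P ∂prodLaw (Fin 1 ⊕ Fin 1) (k + 1), P (Sum.inl 0) (Sum.inr 0) ≠ 0 ∧
      disc P.trace P.det ≠ 0 := by
    have h1 : ∀ᵐ P : Matrix (Fin 1 ⊕ Fin 1) (Fin 1 ⊕ Fin 1) ℝ, P (Sum.inl 0) (Sum.inr 0) ≠ 0 :=
      ae_ne_zero_of_polyOnLines (x₀ := fun _ _ => 1) (entry_mem_polyOnLines _ _)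
        (measurable_entry _ _) one_ne_zero
    have h2 := prodLaw_absolutelyContinuous (ι := Fin 2) k ae_disc_ne_zero
    have h3 := (measurePreserving_reindex_prodLaw (finSumFinEquiv (m := 1) (n := 1))
      (k + 1)).quasiMeasurePreserving.ae h2
    filter_upwards [prodLaw_absolutelyContinuous k h1, h3] with P hP hP3
    refine ⟨hP, ?_⟩
    rwa [Matrix.det_submatrix_equiv_self, trace_submatrix_symm] at hP3
  calc _ = ∫⁻ P, graphSum Φ P ∂prodLaw (Fin 1 ⊕ Fin 1) (k + 1) := by
        refine lintegral_congr_ae ?_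
        filter_upwards [hae] with P hP
        rw [Matrix.det_submatrix_equiv_self, trace_submatrix_symm, hΦdef,
          graphSum_fin_one F P hP.1 hP.2]
    _ = _ := by
        rw [key]
        congr 1
        have hf' : Measurable fun p : ℝ × ℝ => ENNReal.ofReal |p.1 - p.2| *
            (if p.1 < p.2 then F (p.1 + p.2) (p.1 * p.2) else 0) :=
          (by fun_prop : Measurable fun p : ℝ × ℝ => ENNReal.ofReal |p.1 - p.2|).mul hf
        rw [← (measurePreserving_scalarLaw (k + 1)).lintegral_comp hf'.lintegral_prod_right']
        refine lintegral_congr fun b => ?_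
        have hb : Measurable fun y : ℝ => ENNReal.ofReal |b 0 0 - y| *
            (if b 0 0 < y then F (b 0 0 + y) (b 0 0 * y) else 0) := hf'.comp measurable_prodMk_left
        rw [← (measurePreserving_scalarLaw (k + 1)).lintegral_comp hb]
        simp only [sylvDet_fin_one, hΦdef]

/-- The real form of `lintegral_realEig`. -/
theorem integral_realEig (k : ℕ) {g : ℝ × ℝ → ℝ} (hg : Measurable g) :
    ∫ b, realInd b * g (b.trace, b.det) ∂prodLaw (Fin 2) (k + 1) =
      ((gMom 1)⁻¹) ^ (k + 1) * ∫ p, (if p.1 < p.2 then p.2 - p.1 else 0) *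
        g (p.1 + p.2, p.1 * p.2) ∂(scalarLaw (k + 1)).prod (scalarLaw (k + 1)) := by
  have htd : Measurable fun b : Matrix (Fin 2) (Fin 2) ℝ => (b.trace, b.det) :=
    ((Continuous.matrix_trace continuous_id).prodMk (Continuous.matrix_det continuous_id)).measurable
  have hsm : Measurable fun p : ℝ × ℝ => (p.1 + p.2, p.1 * p.2) := by fun_prop
  have hr0 : ∀ b, 0 ≤ realInd b := fun b => by rcases realInd_eq b with h | h <;> simp [h]
  have hw0 : ∀ p : ℝ × ℝ, 0 ≤ if p.1 < p.2 then p.2 - p.1 else 0 := fun p => by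
    split_ifs <;> linarith
  have hwm : Measurable fun p : ℝ × ℝ => if p.1 < p.2 then p.2 - p.1 else 0 :=
    Measurable.ite (measurableSet_lt measurable_fst measurable_snd) (by fun_prop) measurable_const
  have hrm : Measurable fun b => ENNReal.ofReal (realInd b) := measurable_realInd.ennreal_ofReal
  have hwm' : Measurable fun p : ℝ × ℝ => ENNReal.ofReal (if p.1 < p.2 then p.2 - p.1 else 0) :=
    hwm.ennreal_ofReal
  obtain ⟨c, hc⟩ : ∃ c : ℝ≥0∞, c = (ENNReal.ofReal (gMom 1))⁻¹ ^ (k + 1) := ⟨_, rfl⟩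
  have hcr : c.toReal = ((gMom 1)⁻¹) ^ (k + 1) := by
    rw [hc, ENNReal.toReal_pow, ENNReal.toReal_inv, ENNReal.toReal_ofReal (gMom_pos 1).le]
  have hmeas : ((prodLaw (Fin 2) (k + 1)).withDensity fun b => ENNReal.ofReal (realInd b)).map
      (fun b : Matrix (Fin 2) (Fin 2) ℝ => (b.trace, b.det)) =
      c • (((scalarLaw (k + 1)).prod (scalarLaw (k + 1))).withDensity fun p =>
        ENNReal.ofReal (if p.1 < p.2 then p.2 - p.1 else 0)).map
          fun p : ℝ × ℝ => (p.1 + p.2, p.1 * p.2) := by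
    refine Measure.ext_of_lintegral _ fun f hf => ?_
    have hf1 : Measurable fun b : Matrix (Fin 2) (Fin 2) ℝ => f (b.trace, b.det) := hf.comp htd
    have hf2 : Measurable fun p : ℝ × ℝ => f (p.1 + p.2, p.1 * p.2) := hf.comp hsm
    rw [lintegral_map hf htd, lintegral_smul_measure, lintegral_map hf hsm,
      lintegral_withDensity_eq_lintegral_mul _ hrm hf1,
      lintegral_withDensity_eq_lintegral_mul _ hwm' hf2, lintegral_prod _
        (hwm'.mul hf2).aemeasurable]
    have := lintegral_realEig k (F := fun t d => f (t, d)) hf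
    rw [← hc] at this
    calc _ = ∫⁻ b, (if 0 < disc b.trace b.det then f (b.trace, b.det) else 0)
          ∂prodLaw (Fin 2) (k + 1) := by
          refine lintegral_congr_ae ?_
          filter_upwards [prodLaw_absolutelyContinuous (ι := Fin 2) k ae_disc_ne_zero] with b hb
          rw [Pi.mul_apply, realInd_eq_ite b hb]
          split_ifs <;> simp
      _ = _ := by
          rw [this]
          congr 1
          refine lintegral_congr fun x => lintegral_congr fun y => ?_
          simp only [Pi.mul_apply, Function.comp_apply]
          split_ifs with h
          · rw [abs_of_neg (by linarith), neg_sub]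
          · simp
  have h1 := congrArg (fun μ => ∫ p, g p ∂μ) hmeas
  beta_reduce at h1
  rw [integral_map htd.aemeasurable hg.aestronglyMeasurable, integral_smul_measure,
    integral_map hsm.aemeasurable hg.aestronglyMeasurable,
    integral_withDensity_eq_integral_toReal_smul hrm (ae_of_all _ fun _ => ENNReal.ofReal_lt_top),
    integral_withDensity_eq_integral_toReal_smul hwm' (ae_of_all _ fun _ => ENNReal.ofReal_lt_top),
    hcr] at h1
  simp only [ENNReal.toReal_ofReal (hr0 _), ENNReal.toReal_ofReal (hw0 _), smul_eq_mul] at h1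
  exact h1

end Scalar

section LogLaw

lemma exists_minor_eq (c d : ℕ) : ∃ g : ℝ × ℝ → ℝ, Measurable g ∧
    (∀ b : Matrix (Fin 2) (Fin 2) ℝ, minor b c d = g (b.trace, b.det)) ∧
    ∀ x y : ℝ, (y - x) * g (x + y, x * y) = x ^ c * y ^ d - x ^ d * y ^ c := by
  have hsym : ∀ r : ℕ, ∃ g : ℝ × ℝ → ℝ, Measurable g ∧
      (∀ b : Matrix (Fin 2) (Fin 2) ℝ, symTrace b r = g (b.trace, b.det)) ∧
      ∀ x y : ℝ, (y - x) * g (x + y, x * y) = y ^ (r + 1) - x ^ (r + 1) := by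
    intro r
    induction r using Nat.twoStepInduction with
    | zero => exact ⟨fun _ => 1, measurable_const, fun b => by simp [symTrace], fun x y => by ring⟩
    | one =>
      refine ⟨fun p => p.1, measurable_fst, fun b => ?_, fun x y => by ring⟩
      rw [symTrace_succ]
      simp [symTrace, symOff, trace_fin_two]
    | more r h0 h1 =>
      obtain ⟨g0, m0, e0, f0⟩ := h0
      obtain ⟨g1, m1, e1, f1⟩ := h1
      refine ⟨fun p => p.1 * g1 p - p.2 * g0 p, (measurable_fst.mul m1).sub (measurable_snd.mul m0),
        fun b => by rw [symTrace_add_two, e0, e1], fun x y => ?_⟩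
      linear_combination (x + y) * f1 x y - x * y * f0 x y
  have hlt : ∀ c e : ℕ, ∃ g : ℝ × ℝ → ℝ, Measurable g ∧
      (∀ b : Matrix (Fin 2) (Fin 2) ℝ, minor b c (c + e + 1) = g (b.trace, b.det)) ∧
      ∀ x y : ℝ, (y - x) * g (x + y, x * y) = x ^ c * y ^ (c + e + 1) - x ^ (c + e + 1) * y ^ c := by
    intro c e
    obtain ⟨g, m, h1, h2⟩ := hsym e
    refine ⟨fun p => p.2 ^ c * g p, (measurable_snd.pow_const c).mul m, fun b => by
      rw [minor_add, h1], fun x y => ?_⟩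
    simp only [mul_pow]
    linear_combination x ^ c * y ^ c * h2 x y
  rcases lt_trichotomy c d with h | h | h
  · obtain ⟨e, rfl⟩ := Nat.exists_eq_add_of_lt h
    exact hlt c e
  · subst h
    exact ⟨fun _ => 0, measurable_const, fun b => by rw [minor]; ring, fun x y => by ring⟩
  · obtain ⟨e, rfl⟩ := Nat.exists_eq_add_of_lt h
    obtain ⟨g, m, h1, h2⟩ := hlt d e
    refine ⟨fun p => - g p, m.neg, fun b => by rw [minor_swap, h1], fun x y => ?_⟩
    linear_combination - h2 x y

lemma measurePreserving_neg_scalarLaw (k : ℕ) :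
    MeasurePreserving (fun x : ℝ => -x) (scalarLaw (k + 1)) (scalarLaw (k + 1)) := by
  refine ⟨measurable_neg, Measure.ext_of_lintegral _ fun f hf => ?_⟩
  rw [lintegral_map hf measurable_neg, lintegral_scalarLaw_succ k hf,
    lintegral_scalarLaw_succ k (f := fun x => f (-x)) (hf.comp measurable_neg)]
  have hm : Measurable fun x : ℝ => ∫⁻ y, f (x * y) ∂scalarLaw k :=
    (hf.comp measurable_mul : Measurable fun p : ℝ × ℝ => f (p.1 * p.2)).lintegral_prod_right'
  have hg : MeasurePreserving (fun x : ℝ => -x) (gaussianReal 0 1) (gaussianReal 0 1) :=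
    ⟨measurable_neg, by rw [gaussianReal_map_neg, neg_zero]⟩
  rw [← hg.lintegral_comp hm]
  simp only [neg_mul]

lemma ae_scalarLaw_ne (k : ℕ) (a : ℝ) : ∀ᵐ x ∂scalarLaw (k + 1), x ≠ a := by
  have hS : MeasurableSet {x : ℝ | x ≠ a} := (measurableSet_singleton a).compl
  rw [scalarLaw, ae_map_iff (measurable_entry 0 0).aemeasurable hS]
  refine prodLaw_absolutelyContinuous k ?_
  have := ae_ne_zero_of_polyOnLines (f := fun b : Matrix (Fin 1) (Fin 1) ℝ => b 0 0 - a)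
    (x₀ := fun _ _ => a + 1) (sub_mem (entry_mem_polyOnLines 0 0)
      (Subalgebra.algebraMap_mem _ a)) ((measurable_entry 0 0).sub measurable_const) (by simp)
  exact this.mono fun b hb => sub_ne_zero.1 hb

lemma ae_abs_ne (k : ℕ) : ∀ᵐ p ∂(scalarLaw (k + 1)).prod (scalarLaw (k + 1)), |p.1| ≠ |p.2| := by
  have hS : MeasurableSet {p : ℝ × ℝ | |p.1| ≠ |p.2|} :=
    (measurableSet_eq_fun (by fun_prop) (by fun_prop)).compl
  refine (Measure.ae_prod_iff_ae_ae hS).2 (ae_of_all _ fun x => ?_)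
  filter_upwards [ae_scalarLaw_ne k x, ae_scalarLaw_ne k (-x)] with y h1 h2 h
  rcases abs_eq_abs.1 h with h | h
  · exact h1 h.symm
  · exact h2 (by linarith)

lemma ae_ne_zero_prod (k : ℕ) :
    ∀ᵐ p ∂(scalarLaw (k + 1)).prod (scalarLaw (k + 1)), p.1 ≠ 0 ∧ p.2 ≠ 0 := by
  have h1 := (measurePreserving_fst (μ := scalarLaw (k + 1))
    (ν := scalarLaw (k + 1))).quasiMeasurePreserving.ae (ae_scalarLaw_ne k 0)
  have h2 := (measurePreserving_snd (μ := scalarLaw (k + 1))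
    (ν := scalarLaw (k + 1))).quasiMeasurePreserving.ae (ae_scalarLaw_ne k 0)
  exact h1.and h2

lemma allMom_scalarLaw (k : ℕ) : AllMom (fun x : ℝ => x) (scalarLaw k) :=
  AllMom.of_comp (measurePreserving_scalarLaw k) measurable_id (allMom_entry k 0 0)

lemma integral_antisymm (k c d : ℕ) (hc : Even c) (hd : Odd d) :
    ∫ p, (if p.1 < p.2 then (1 : ℝ) else 0) * (p.1 ^ c * p.2 ^ d - p.1 ^ d * p.2 ^ c)
      ∂(scalarLaw (k + 1)).prod (scalarLaw (k + 1)) =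
    ∫ p, (if |p.1| < |p.2| then (1 : ℝ) else 0) * (|p.1| ^ c * |p.2| ^ d)
      ∂(scalarLaw (k + 1)).prod (scalarLaw (k + 1)) := by
  set μ := (scalarLaw (k + 1)).prod (scalarLaw (k + 1)) with hμ
  have h1 : AllMom (fun p : ℝ × ℝ => p.1) μ := AllMom.comp measurePreserving_fst (allMom_scalarLaw _)
  have h2 : AllMom (fun p : ℝ × ℝ => p.2) μ := AllMom.comp measurePreserving_snd (allMom_scalarLaw _)
  have hS : Measurable fun p : ℝ × ℝ => if p.1 < p.2 then (1 : ℝ) else 0 :=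
    Measurable.ite (measurableSet_lt measurable_fst measurable_snd) measurable_const measurable_const
  have hInt : ∀ (T : ℝ × ℝ → ℝ × ℝ), Measurable T → ∀ a b : ℕ,
      Integrable (fun p => (if (T p).1 < (T p).2 then (1 : ℝ) else 0) * (p.1 ^ a * p.2 ^ b)) μ := by
    intro T hT a b
    refine AllMom.bdd_mul ((h1.pow a).mul (h2.pow b)) (c := 1) (hS.comp hT).aestronglyMeasurable
      fun p => ?_
    split_ifs <;> simp
  have hsw : MeasurePreserving Prod.swap μ μ := Measure.measurePreserving_swap
  have hR : MeasurePreserving (fun p : ℝ × ℝ => (p.1, -p.2)) μ μ :=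
    (MeasurePreserving.id _).prod (measurePreserving_neg_scalarLaw k)
  have i1 : ∀ a b : ℕ, Integrable (fun p : ℝ × ℝ => (if p.1 < p.2 then (1 : ℝ) else 0) *
      (p.1 ^ a * p.2 ^ b)) μ := hInt id measurable_id
  have i2 : Integrable (fun p : ℝ × ℝ => (if p.2 < p.1 then (1 : ℝ) else 0) *
      (p.1 ^ c * p.2 ^ d)) μ := hInt Prod.swap measurable_swap c d
  obtain ⟨H, hH⟩ : ∃ H : ℝ × ℝ → ℝ, H = fun p => ((if p.1 < p.2 then (1 : ℝ) else 0) -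
      if p.2 < p.1 then (1 : ℝ) else 0) * (p.1 ^ c * p.2 ^ d) := ⟨_, rfl⟩
  have hHint : Integrable H μ := by
    refine ((i1 c d).sub i2).congr (ae_of_all _ fun p => ?_)
    simp [hH, sub_mul]
  have e1 : ∫ p, (if p.1 < p.2 then (1 : ℝ) else 0) * (p.1 ^ c * p.2 ^ d - p.1 ^ d * p.2 ^ c) ∂μ =
      ∫ p, H p ∂μ := by
    have s1 : ∫ p, (if p.1 < p.2 then (1 : ℝ) else 0) * (p.1 ^ d * p.2 ^ c) ∂μ =
        ∫ p, (if p.2 < p.1 then (1 : ℝ) else 0) * (p.1 ^ c * p.2 ^ d) ∂μ := by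
      rw [← integral_comp_mp hsw (g := fun p => (if p.1 < p.2 then (1 : ℝ) else 0) *
        (p.1 ^ d * p.2 ^ c)) (i1 d c).aestronglyMeasurable]
      refine integral_congr_ae (ae_of_all _ fun p => ?_)
      simp [mul_comm]
    simp only [mul_sub]
    rw [integral_sub (i1 c d) (i1 d c), s1, ← integral_sub (i1 c d) i2]
    refine integral_congr_ae (ae_of_all _ fun p => ?_)
    simp [hH, sub_mul]
  have e2 : ∫ p, H p ∂μ = ∫ p, H (p.1, -p.2) ∂μ :=
    (integral_comp_mp hR hHint.aestronglyMeasurable).symm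
  have hHR : Integrable (fun p => H (p.1, -p.2)) μ := hR.integrable_comp_of_integrable hHint
  have e3 : 2 * ∫ p, H p ∂μ = ∫ p, (H p + H (p.1, -p.2)) ∂μ := by
    rw [integral_add hHint hHR, ← e2]
    ring
  have e4 : ∫ p, (H p + H (p.1, -p.2)) ∂μ =
      ∫ p, 2 * ((if |p.1| < |p.2| then (1 : ℝ) else 0) * (|p.1| ^ c * |p.2| ^ d)) ∂μ := by
    refine integral_congr_ae ?_
    filter_upwards [ae_abs_ne k] with p hp
    rw [hH]
    beta_reduce
    rw [hc.pow_abs, hd.neg_pow]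
    rcases lt_or_gt_of_ne hp with h | h
    · rw [if_pos h]
      rcases le_or_gt 0 p.2 with hy | hy
      · rw [abs_of_nonneg hy] at h ⊢
        obtain ⟨h1, h2⟩ := abs_lt.1 h
        simp only
        rw [if_pos (by linarith), if_neg (by linarith), if_neg (by linarith), if_pos (by linarith)]
        ring
      · rw [abs_of_neg hy] at h ⊢
        obtain ⟨h1, h2⟩ := abs_lt.1 h
        simp only
        rw [hd.neg_pow, if_neg (by linarith), if_pos (by linarith), if_pos (by linarith),
          if_neg (by linarith)]
        ring
    · rw [if_neg (not_lt.2 h.le : ¬ |p.1| < |p.2|)]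
      rcases lt_abs.1 h with hx | hx
      · obtain ⟨h1, h2⟩ := abs_lt.1 hx
        simp only
        rw [if_neg (by linarith), if_pos (by linarith), if_neg (by linarith), if_pos (by linarith)]
        ring
      · obtain ⟨h1, h2⟩ := abs_lt.1 hx
        simp only
        rw [if_pos (by linarith), if_neg (by linarith), if_pos (by linarith), if_neg (by linarith)]
        ring
  rw [integral_const_mul] at e4
  rw [e1]
  linarith

/-- The law of `log |g|` for a standard Gaussian `g` tilted by `|g| ^ s`. -/
noncomputable def logTilt (s : ℕ) : Measure ℝ :=
  ((gaussianReal 0 1).withDensity fun x => ENNReal.ofReal ((gMom s)⁻¹ * |x| ^ s)).map Real.log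

lemma lintegral_logTilt (s : ℕ) {f : ℝ → ℝ≥0∞} (hf : Measurable f) :
    ENNReal.ofReal (gMom s) * ∫⁻ x, f x ∂logTilt s =
      ∫⁻ x, ENNReal.ofReal (|x| ^ s) * f (Real.log x) ∂gaussianReal 0 1 := by
  have h1 : Measurable fun x : ℝ => ENNReal.ofReal ((gMom s)⁻¹ * |x| ^ s) := by fun_prop
  have h2 : Measurable fun x : ℝ => f (Real.log x) := hf.comp Real.measurable_log
  rw [logTilt, lintegral_map hf Real.measurable_log,
    lintegral_withDensity_eq_lintegral_mul _ h1 h2, ← lintegral_const_mul _ (h1.mul h2)]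
  refine lintegral_congr fun x => ?_
  rw [Pi.mul_apply, ← mul_assoc, ← ENNReal.ofReal_mul (gMom_pos s).le,
    mul_inv_cancel_left₀ (gMom_pos s).ne']

lemma ofReal_gMom (s : ℕ) :
    ENNReal.ofReal (gMom s) = ∫⁻ x, ENNReal.ofReal (|x| ^ s) ∂gaussianReal 0 1 := by
  rw [gMom, ofReal_integral_eq_lintegral_ofReal (allMom_gaussian.abs.pow s).integrable
    (ae_of_all _ fun x => by positivity)]

instance (s : ℕ) : IsProbabilityMeasure (logTilt s) := by
  refine ⟨?_⟩
  have h := lintegral_logTilt s (f := fun _ => 1) measurable_const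
  simp only [mul_one, lintegral_one] at h
  rw [← ofReal_gMom] at h
  have h0 : ENNReal.ofReal (gMom s) ≠ 0 := by
    simpa using gMom_pos s
  exact (ENNReal.mul_right_inj h0 ENNReal.ofReal_ne_top).1 (by rw [h, mul_one])

/-- The law of a sum of `k` independent variables of law `logTilt s`. -/
noncomputable def logLaw (s : ℕ) : ℕ → Measure ℝ
  | 0 => Measure.dirac 0
  | k + 1 => Measure.conv (logTilt s) (logLaw s k)

instance (s k : ℕ) : IsProbabilityMeasure (logLaw s k) := by
  induction k with
  | zero => rw [logLaw]; infer_instance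
  | succ k ih => rw [logLaw]; infer_instance

lemma lintegral_logLaw (s k : ℕ) {f : ℝ → ℝ≥0∞} (hf : Measurable f) :
    ENNReal.ofReal (gMom s) ^ k * ∫⁻ x, f x ∂logLaw s k =
      ∫⁻ x, ENNReal.ofReal (|x| ^ s) * f (Real.log x) ∂scalarLaw k := by
  induction k generalizing f with
  | zero =>
    have hm : Measurable fun x : ℝ => ENNReal.ofReal (|x| ^ s) * f (Real.log x) :=
      (by fun_prop : Measurable fun x : ℝ => ENNReal.ofReal (|x| ^ s)).mul
        (hf.comp Real.measurable_log)
    rw [lintegral_scalarLaw_zero hm, logLaw, lintegral_dirac' _ hf]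
    simp
  | succ k ih =>
    have hm : Measurable fun x : ℝ => ENNReal.ofReal (|x| ^ s) * f (Real.log x) :=
      (by fun_prop : Measurable fun x : ℝ => ENNReal.ofReal (|x| ^ s)).mul
        (hf.comp Real.measurable_log)
    have hc : Measurable fun x : ℝ => ∫⁻ y, f (x + y) ∂logLaw s k :=
      (hf.comp measurable_add : Measurable fun p : ℝ × ℝ => f (p.1 + p.2)).lintegral_prod_right'
    have hc' : Measurable fun x : ℝ => ∫⁻ y, f (Real.log x + y) ∂logLaw s k :=
      hc.comp Real.measurable_log
    have hmc : Measurable fun x : ℝ => ENNReal.ofReal (|x| ^ s) *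
        ∫⁻ y, f (Real.log x + y) ∂logLaw s k :=
      (by fun_prop : Measurable fun x : ℝ => ENNReal.ofReal (|x| ^ s)).mul hc'
    rw [lintegral_scalarLaw_succ k hm, logLaw, Measure.lintegral_conv hf, pow_succ, mul_assoc,
      lintegral_logTilt s hc, ← lintegral_const_mul _ hmc]
    have := nullSingletonClass_gaussianReal (μ := 0) (v := 1) one_ne_zero
    have h0 : ∀ᵐ x ∂gaussianReal 0 1, x ≠ (0 : ℝ) := by
      rw [ae_iff]; simp
    refine lintegral_congr_ae ?_
    filter_upwards [h0] with x hx
    have hf' : Measurable fun y : ℝ => f (Real.log x + y) := hf.comp (measurable_const_add _)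
    have hm' : Measurable fun y : ℝ => ENNReal.ofReal (|y| ^ s) * f (Real.log x + Real.log y) :=
      (by fun_prop : Measurable fun x : ℝ => ENNReal.ofReal (|x| ^ s)).mul
        (hf'.comp Real.measurable_log)
    rw [mul_left_comm, ih hf', ← lintegral_const_mul _ hm']
    have hk : ∀ᵐ y ∂scalarLaw k, y ≠ 0 := by
      rcases k with _ | k
      · have hS : MeasurableSet {x : ℝ | x ≠ 0} := (measurableSet_singleton 0).compl
        rw [scalarLaw, ae_map_iff (measurable_entry 0 0).aemeasurable hS]
        filter_upwards [ae_prodLaw_det_ne_zero 0] with b hb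
        rwa [Matrix.det_fin_one] at hb
      · exact ae_scalarLaw_ne k 0
    refine lintegral_congr_ae ?_
    filter_upwards [hk] with y hy
    rw [Real.log_mul hx hy, abs_mul, mul_pow, ENNReal.ofReal_mul (by positivity), mul_assoc]

/-- The probability that a tilted sum of index `s` is smaller than an independent one of index
`t`. -/
noncomputable def pLess (s t k : ℕ) : ℝ :=
  ((logLaw s k).prod (logLaw t k)).real {p | p.1 < p.2}

lemma integral_abs_lt (k c d : ℕ) :
    ∫ p, (if |p.1| < |p.2| then (1 : ℝ) else 0) * (|p.1| ^ c * |p.2| ^ d)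
      ∂(scalarLaw (k + 1)).prod (scalarLaw (k + 1)) =
    (gMom c * gMom d) ^ (k + 1) * pLess c d (k + 1) := by
  have hS : MeasurableSet {p : ℝ × ℝ | p.1 < p.2} := measurableSet_lt measurable_fst measurable_snd
  have hI : Measurable fun p : ℝ × ℝ => if p.1 < p.2 then (1 : ℝ≥0∞) else 0 :=
    Measurable.ite hS measurable_const measurable_const
  have hA : Measurable fun p : ℝ × ℝ => (if |p.1| < |p.2| then (1 : ℝ) else 0) *
      (|p.1| ^ c * |p.2| ^ d) := by
    refine Measurable.mul ?_ (by fun_prop)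
    exact Measurable.ite (measurableSet_lt (by fun_prop) (by fun_prop)) measurable_const
      measurable_const
  rw [integral_eq_lintegral_of_nonneg_ae (ae_of_all _ fun p => ?_) hA.aestronglyMeasurable]
  swap
  · show 0 ≤ (if |p.1| < |p.2| then (1 : ℝ) else 0) * (|p.1| ^ c * |p.2| ^ d)
    split_ifs <;> positivity
  have hlog : Measurable fun p : ℝ × ℝ => ENNReal.ofReal (|p.1| ^ c) * (ENNReal.ofReal (|p.2| ^ d) *
      if Real.log p.1 < Real.log p.2 then (1 : ℝ≥0∞) else 0) := by
    refine Measurable.mul (by fun_prop) (Measurable.mul (by fun_prop) ?_)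
    have : Measurable fun p : ℝ × ℝ => (Real.log p.1, Real.log p.2) :=
      (Real.measurable_log.comp measurable_fst).prodMk (Real.measurable_log.comp measurable_snd)
    exact hI.comp this
  have e1 : ∫⁻ p, ENNReal.ofReal ((if |p.1| < |p.2| then (1 : ℝ) else 0) * (|p.1| ^ c * |p.2| ^ d))
      ∂(scalarLaw (k + 1)).prod (scalarLaw (k + 1)) =
      ∫⁻ p, ENNReal.ofReal (|p.1| ^ c) * (ENNReal.ofReal (|p.2| ^ d) *
        if Real.log p.1 < Real.log p.2 then (1 : ℝ≥0∞) else 0)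
        ∂(scalarLaw (k + 1)).prod (scalarLaw (k + 1)) := by
    refine lintegral_congr_ae ?_
    filter_upwards [ae_ne_zero_prod k] with p hp
    have : |p.1| < |p.2| ↔ Real.log p.1 < Real.log p.2 := by
      rw [← Real.log_abs p.1, ← Real.log_abs p.2,
        Real.log_lt_log_iff (abs_pos.2 hp.1) (abs_pos.2 hp.2)]
    simp only [this]
    split_ifs
    · rw [one_mul, mul_one, ENNReal.ofReal_mul (by positivity)]
    · simp
  have e2 : ∫⁻ p, (if p.1 < p.2 then (1 : ℝ≥0∞) else 0) ∂(logLaw c (k + 1)).prod (logLaw d (k + 1)) =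
      ((logLaw c (k + 1)).prod (logLaw d (k + 1))) {p | p.1 < p.2} := by
    rw [← lintegral_indicator_one hS]
    refine lintegral_congr fun p => ?_
    simp [Set.indicator]
  have e3 : ∀ x, ∫⁻ y, ENNReal.ofReal (|x| ^ c) * (ENNReal.ofReal (|y| ^ d) *
      if Real.log x < Real.log y then (1 : ℝ≥0∞) else 0) ∂scalarLaw (k + 1) =
      ENNReal.ofReal (|x| ^ c) * (ENNReal.ofReal (gMom d) ^ (k + 1) *
        ∫⁻ w, (if Real.log x < w then (1 : ℝ≥0∞) else 0) ∂logLaw d (k + 1)) := by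
    intro x
    have hw : Measurable fun w : ℝ => if Real.log x < w then (1 : ℝ≥0∞) else 0 :=
      hI.comp measurable_prodMk_left
    rw [lintegral_logLaw d (k + 1) hw, lintegral_const_mul]
    exact (by fun_prop : Measurable fun y : ℝ => ENNReal.ofReal (|y| ^ d)).mul
      (hw.comp Real.measurable_log)
  rw [e1, lintegral_prod _ hlog.aemeasurable]
  simp only [e3]
  have hm : Measurable fun z : ℝ => ENNReal.ofReal (gMom d) ^ (k + 1) *
      ∫⁻ w, (if z < w then (1 : ℝ≥0∞) else 0) ∂logLaw d (k + 1) :=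
    measurable_const.mul hI.lintegral_prod_right'
  rw [← lintegral_logLaw c (k + 1) hm, lintegral_const_mul _ hI.lintegral_prod_right',
    ← lintegral_prod (fun p : ℝ × ℝ => if p.1 < p.2 then (1 : ℝ≥0∞) else 0) hI.aemeasurable, e2,
    ENNReal.toReal_mul, ENNReal.toReal_mul, ENNReal.toReal_pow, ENNReal.toReal_pow,
    ENNReal.toReal_ofReal (gMom_pos _).le, ENNReal.toReal_ofReal (gMom_pos _).le, mul_pow, mul_assoc,
    pLess, measureReal_def]

theorem realMat_eq (k l : ℕ) (i j : Fin l) : realMat k l i j =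
    (gMom (2 * i) * (gMom (2 * j + 1) / gMom 1)) ^ (k + 1) * pLess (2 * i) (2 * j + 1) (k + 1) := by
  obtain ⟨g, hg, h1, h2⟩ := exists_minor_eq (2 * i) (2 * j + 1)
  rw [realMat, Matrix.of_apply]
  simp only [h1]
  rw [integral_realEig k hg]
  have : ∀ p : ℝ × ℝ, (if p.1 < p.2 then p.2 - p.1 else 0) * g (p.1 + p.2, p.1 * p.2) =
      (if p.1 < p.2 then (1 : ℝ) else 0) * (p.1 ^ (2 * (i : ℕ)) * p.2 ^ (2 * (j : ℕ) + 1) -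
        p.1 ^ (2 * (j : ℕ) + 1) * p.2 ^ (2 * (i : ℕ))) := by
    intro p
    rw [← h2]
    split_ifs <;> simp
  simp only [this]
  rw [integral_antisymm k _ _ (even_two_mul _) (odd_two_mul_add_one _), integral_abs_lt, ← mul_assoc,
    ← mul_pow]
  congr 2
  ring

end LogLaw

section Variance
open Polynomial

/-- The matrix whose determinant `det (1 + w M)` generates the number of pairs of real
eigenvalues. -/
noncomputable def pDiff (k i j : ℕ) : ℝ :=
  pLess (2 * i) (2 * j + 1) k - if j = 0 then 0 else pLess (2 * i) (2 * j - 1) k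

noncomputable def pMat (k l : ℕ) : Matrix (Fin l) (Fin l) ℝ := of fun i j => pDiff k i j

lemma sum_pDiff (k i j : ℕ) :
    ∑ r ∈ Finset.range (j + 1), pDiff k i r = pLess (2 * i) (2 * j + 1) k := by
  induction j with
  | zero => simp [pDiff]
  | succ j ih => rw [Finset.sum_range_succ, ih, pDiff, if_neg j.succ_ne_zero,
      show 2 * (j + 1) - 1 = 2 * j + 1 by omega]; ring

theorem integral_kap_eq_det (k l : ℕ) (w : ℝ) :
    ∫ P, (1 + w) ^ kap P.charpoly ∂prodLaw (Fin (2 * l)) (k + 1) =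
      (1 + w • pMat (k + 1) l).det := by
  obtain ⟨C, hC⟩ := exists_integral_kap_eq_det k l
  obtain ⟨a, ha⟩ : ∃ a : Fin l → ℝ, a = fun i : Fin l => gMom (2 * (i : ℕ)) ^ (k + 1) :=
    ⟨_, rfl⟩
  obtain ⟨b, hb⟩ : ∃ b : Fin l → ℝ, b = fun j : Fin l => (gMom (2 * (j : ℕ) + 1) / gMom 1) ^ (k + 1) :=
    ⟨_, rfl⟩
  obtain ⟨T, hT⟩ : ∃ T : Matrix (Fin l) (Fin l) ℝ, T = of fun i j => if i ≤ j then 1 else 0 :=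
    ⟨_, rfl⟩
  have h1 : totMat k l = diagonal a * (T * diagonal b) := by
    ext i j
    rw [totMat_eq, diagonal_mul, mul_diagonal, hT, ha, hb, of_apply]
    split_ifs
    · rw [mul_pow]; ring
    · ring
  have hMT : ∀ i j, (pMat (k + 1) l * T) i j = pLess (2 * i) (2 * j + 1) (k + 1) := by
    intro i j
    rw [mul_apply, hT, ← sum_pDiff]
    simp only [pMat, of_apply, mul_ite, mul_one, mul_zero, Fin.le_def]
    rw [Fin.sum_univ_eq_sum_range (fun r => if r ≤ j then pDiff (k + 1) i r else 0) l,
      ← Finset.sum_filter]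
    congr 1
    ext r
    have := j.2
    simp only [Finset.mem_filter, Finset.mem_range]
    omega
  have h2 : realMat k l = diagonal a * ((pMat (k + 1) l * T) * diagonal b) := by
    ext i j
    rw [realMat_eq, diagonal_mul, mul_diagonal, hMT, ha, hb, mul_pow]
    ring
  have h3 : ∀ w : ℝ, totMat k l + w • realMat k l =
      diagonal a * ((1 + w • pMat (k + 1) l) * (T * diagonal b)) := by
    intro w
    rw [h1, h2, add_mul, one_mul, smul_mul_assoc, mul_add, mul_smul_comm, Matrix.mul_assoc]
  have h4 : ∀ w : ℝ, ∫ P, (1 + w) ^ kap P.charpoly ∂prodLaw (Fin (2 * l)) (k + 1) =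
      (C * ((diagonal a).det * (T * diagonal b).det)) * (1 + w • pMat (k + 1) l).det := by
    intro w
    rw [hC, h3, det_mul, det_mul]
    ring
  have h5 := h4 0
  simp only [add_zero, one_pow, zero_smul, det_one, mul_one, integral_const, probReal_univ,
    smul_eq_mul] at h5
  rw [h4, ← h5, one_mul]

lemma det_moments {l n : ℕ} (M : Matrix (Fin l) (Fin l) ℝ) (q : ℕ → ℝ)
    (h : ∀ w : ℝ, ∑ c ∈ Finset.range n, q c * (1 + w) ^ c = (1 + w • M).det) :
    ∑ c ∈ Finset.range n, q c = 1 ∧ ∑ c ∈ Finset.range n, q c * c = M.trace ∧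
    ∑ c ∈ Finset.range n, q c * c ^ 2 = M.trace ^ 2 + M.trace - (M * M).trace := by
  obtain ⟨P, hP⟩ : ∃ P : ℝ[X], P = ∑ c ∈ Finset.range n, C (q c) * (1 + X) ^ c := ⟨_, rfl⟩
  have hdet : ∀ (A : Matrix (Fin l) (Fin l) ℝ) (w : ℝ),
      Polynomial.eval w (det (1 + (X : ℝ[X]) • A.map C)) = (1 + w • A).det := by
    intro A w
    rw [← coe_evalRingHom, RingHom.map_det]
    congr 1
    ext i j
    by_cases hij : i = j <;> simp [hij, mul_comm w]
  have hPM : P = det (1 + (X : ℝ[X]) • M.map C) := by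
    refine Polynomial.funext fun w => ?_
    rw [hdet, ← h, hP, eval_finsetSum]
    simp only [eval_mul, eval_pow, eval_add, eval_one, eval_X, eval_C]
  have hc : ∀ r, P.coeff r = ∑ c ∈ Finset.range n, q c * (c.choose r : ℝ) := by
    intro r
    rw [hP, finsetSum_coeff]
    simp only [coeff_C_mul, coeff_one_add_X_pow]
  have h0 : P.coeff 0 = 1 := by
    rw [coeff_zero_eq_eval_zero, hPM, hdet]
    simp
  have h1 : P.coeff 1 = M.trace := by rw [hPM, coeff_det_one_add_X_smul_one]
  have hpp : P * P.comp (C (-1) * X) = expand ℝ 2 (det (1 + (X : ℝ[X]) • (-(M * M)).map C)) := by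
    refine Polynomial.funext fun w => ?_
    rw [expand_eval, eval_mul, eval_comp, hPM, hdet, hdet, hdet, ← det_mul]
    congr 1
    simp only [eval_mul, eval_C, eval_X, mul_add, add_mul, one_mul, mul_one, Matrix.smul_mul,
      Matrix.mul_smul]
    module
  have h2 : P.coeff 2 * 2 - M.trace ^ 2 = -(M * M).trace := by
    have := congrArg (fun r : ℝ[X] => r.coeff (1 * 2)) hpp
    beta_reduce at this
    rw [coeff_expand_mul two_pos, coeff_det_one_add_X_smul_one,
      coeff_mul, one_mul, Finset.Nat.sum_antidiagonal_eq_sum_range_succ_mk] at this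
    simp only [comp_C_mul_X_coeff, Finset.sum_range_succ, Finset.sum_range_zero, h0, h1, trace_neg] at this
    norm_num at this
    linarith
  have e0 := hc 0
  have e1 := hc 1
  have e2 := hc 2
  simp only [Nat.choose_zero_right, Nat.choose_one_right, Nat.cast_one, mul_one, h0, h1] at e0 e1
  refine ⟨e0.symm, e1.symm, ?_⟩
  have : ∑ c ∈ Finset.range n, q c * (c : ℝ) ^ 2 = P.coeff 2 * 2 + M.trace := by
    rw [e1, e2, Finset.sum_mul, ← Finset.sum_add_distrib]
    refine Finset.sum_congr rfl fun c _ => ?_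
    rw [Nat.cast_choose_two]
    ring
  linarith

theorem integral_kap_sub_sq_le (k l : ℕ) (h : ∀ i j, 0 ≤ pDiff (k + 1) i j) :
    ∫ P, ((kap P.charpoly : ℝ) - (pMat (k + 1) l).trace) ^ 2 ∂prodLaw (Fin (2 * l)) (k + 1) ≤
      (pMat (k + 1) l).trace := by
  set μ := prodLaw (Fin (2 * l)) (k + 1) with hμ
  set M := pMat (k + 1) l with hM
  obtain ⟨q, hq⟩ : ∃ q : ℕ → ℝ, q = fun c => ∫ P, (if kap P.charpoly = c then (1 : ℝ) else 0) ∂μ :=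
    ⟨_, rfl⟩
  have hg : ∀ g : ℕ → ℝ, ∫ P, g (kap P.charpoly) ∂μ =
      ∑ c ∈ Finset.range (2 * l + 1), q c * g c := by
    intro g
    rw [hq]
    simp only [← integral_mul_const]
    rw [← integral_finsetSum]
    · refine integral_congr_ae (ae_of_all _ fun P => ?_)
      have := Nat.lt_succ_of_le (kap_le P)
      simp [this]
    · intro c _
      exact (integrable_kap (2 * l) (k + 1) fun r => (if r = c then (1 : ℝ) else 0) * g c)
  obtain ⟨m0, m1, m2⟩ := det_moments M q fun w => by
    rw [← integral_kap_eq_det k l w, ← hμ, hg fun c => (1 + w) ^ c]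
  have hM2 : 0 ≤ (M * M).trace := by
    refine Finset.sum_nonneg fun i _ => ?_
    rw [Matrix.diag_apply, mul_apply]
    exact Finset.sum_nonneg fun j _ => mul_nonneg (h _ _) (h _ _)
  rw [hg fun c => ((c : ℝ) - M.trace) ^ 2]
  have : ∑ c ∈ Finset.range (2 * l + 1), q c * ((c : ℝ) - M.trace) ^ 2 =
      ∑ c ∈ Finset.range (2 * l + 1), q c * (c : ℝ) ^ 2 - 2 * M.trace *
        ∑ c ∈ Finset.range (2 * l + 1), q c * c +
        M.trace ^ 2 * ∑ c ∈ Finset.range (2 * l + 1), q c := by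
    rw [Finset.mul_sum, Finset.mul_sum, ← Finset.sum_sub_distrib, ← Finset.sum_add_distrib]
    exact Finset.sum_congr rfl fun c _ => by ring
  rw [this, m0, m1, m2]
  nlinarith

lemma pLess_nonneg (s t k : ℕ) : 0 ≤ pLess s t k := measureReal_nonneg

lemma pLess_le_one (s t k : ℕ) : pLess s t k ≤ 1 := measureReal_le_one

lemma integral_abs_pow_scalarLaw (d k : ℕ) :
    ∫ y, |y| ^ d ∂scalarLaw k = gMom d ^ k := by
  have h := lintegral_logLaw d k (f := fun _ => 1) measurable_const
  simp only [mul_one, lintegral_one, measure_univ] at h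
  rw [integral_eq_lintegral_of_nonneg_ae (ae_of_all _ fun y => by positivity)
    (by fun_prop : Measurable fun y : ℝ => |y| ^ d).aestronglyMeasurable, ← h, ENNReal.toReal_pow,
    ENNReal.toReal_ofReal (gMom_pos d).le]

lemma pLess_mono (s t k : ℕ) : pLess s t (k + 1) ≤ pLess s (t + 2) (k + 1) := by
  set ν := scalarLaw (k + 1) with hν
  obtain ⟨F, hF⟩ : ∃ F : ℝ → ℝ, F = fun y => ∫ x, (if |x| < |y| then (1 : ℝ) else 0) * |x| ^ s ∂ν :=
    ⟨_, rfl⟩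
  have hmom := allMom_scalarLaw (k + 1)
  have hI : Measurable fun p : ℝ × ℝ => if |p.1| < |p.2| then (1 : ℝ) else 0 :=
    Measurable.ite (measurableSet_lt (by fun_prop) (by fun_prop)) measurable_const measurable_const
  have hInt : ∀ d : ℕ, Integrable (fun p : ℝ × ℝ => (if |p.1| < |p.2| then (1 : ℝ) else 0) *
      (|p.1| ^ s * |p.2| ^ d)) (ν.prod ν) := by
    intro d
    have := Integrable.mul_prod ((hmom.abs.pow s).integrable) ((hmom.abs.pow d).integrable)
    refine this.bdd_mul (c := 1) hI.aestronglyMeasurable (ae_of_all _ fun p => ?_)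
    split_ifs <;> simp
  have hFd : ∀ (d : ℕ) (y : ℝ), ∫ x, (if |x| < |y| then (1 : ℝ) else 0) * (|x| ^ s * |y| ^ d) ∂ν =
      F y * |y| ^ d := by
    intro d y
    rw [hF, ← integral_mul_const]
    simp only [mul_assoc]
  have hFi : ∀ d : ℕ, Integrable (fun y => F y * |y| ^ d) ν := by
    intro d
    have := (hInt d).integral_prod_right
    simpa only [hFd] using this
  have hA : ∀ d : ℕ, ∫ y, F y * |y| ^ d ∂ν = (gMom s * gMom d) ^ (k + 1) * pLess s d (k + 1) := by
    intro d
    rw [← integral_abs_lt, ← hν, integral_prod_symm _ (hInt d)]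
    simp only [hFd]
  have hB : ∀ d : ℕ, Integrable (fun y : ℝ => |y| ^ d) ν := fun d => (hmom.abs.pow d).integrable
  have hmono : ∀ y z : ℝ, |y| ≤ |z| → F y ≤ F z := by
    intro y z hyz
    rw [hF]
    have hi : ∀ y : ℝ, Integrable (fun x : ℝ => (if |x| < |y| then (1 : ℝ) else 0) * |x| ^ s) ν := by
      intro y
      refine (hB s).bdd_mul (c := 1) (hI.comp (measurable_prodMk_right (y := y))).aestronglyMeasurable
        (ae_of_all _ fun p => ?_)
      split_ifs <;> simp
    refine integral_mono (hi y) (hi z) fun x => ?_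
    refine mul_le_mul_of_nonneg_right ?_ (by positivity)
    split_ifs with h1 h2
    · exact le_rfl
    · exact absurd (h1.trans_le hyz) h2
    · exact zero_le_one
    · exact le_rfl
  have hprod : ∀ a b : ℕ, Integrable (fun p : ℝ × ℝ => F p.1 * |p.1| ^ a * |p.2| ^ b) (ν.prod ν) :=
    fun a b => Integrable.mul_prod (hFi a) (hB b)
  have hprod' : ∀ a b : ℕ, Integrable (fun p : ℝ × ℝ => |p.1| ^ b * (F p.2 * |p.2| ^ a))
      (ν.prod ν) := fun a b => Integrable.mul_prod (hB b) (hFi a)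
  have key : 0 ≤ ∫ p, (F p.1 * |p.1| ^ (t + 2) * |p.2| ^ t - F p.1 * |p.1| ^ t * |p.2| ^ (t + 2) +
      (|p.1| ^ t * (F p.2 * |p.2| ^ (t + 2)) - |p.1| ^ (t + 2) * (F p.2 * |p.2| ^ t))) ∂ν.prod ν := by
    refine integral_nonneg fun p => ?_
    have e : F p.1 * |p.1| ^ (t + 2) * |p.2| ^ t - F p.1 * |p.1| ^ t * |p.2| ^ (t + 2) +
        (|p.1| ^ t * (F p.2 * |p.2| ^ (t + 2)) - |p.1| ^ (t + 2) * (F p.2 * |p.2| ^ t)) =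
        (F p.1 - F p.2) * (|p.1| - |p.2|) * (|p.1| ^ t * |p.2| ^ t * (|p.1| + |p.2|)) := by ring
    show 0 ≤ _
    rw [e]
    refine mul_nonneg ?_ (by positivity)
    rcases le_total |p.1| |p.2| with h | h
    · exact mul_nonneg_of_nonpos_of_nonpos (sub_nonpos.2 (hmono _ _ h)) (sub_nonpos.2 h)
    · exact mul_nonneg (sub_nonneg.2 (hmono _ _ h)) (sub_nonneg.2 h)
  have i1 : Integrable (fun p : ℝ × ℝ => F p.1 * |p.1| ^ (t + 2) * |p.2| ^ t -
      F p.1 * |p.1| ^ t * |p.2| ^ (t + 2)) (ν.prod ν) := (hprod _ _).sub (hprod _ _)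
  have i2 : Integrable (fun p : ℝ × ℝ => |p.1| ^ t * (F p.2 * |p.2| ^ (t + 2)) -
      |p.1| ^ (t + 2) * (F p.2 * |p.2| ^ t)) (ν.prod ν) := (hprod' _ _).sub (hprod' _ _)
  rw [integral_add i1 i2,
    integral_sub (hprod _ _) (hprod _ _), integral_sub (hprod' _ _) (hprod' _ _),
    integral_prod_mul (fun y => F y * |y| ^ (t + 2)) (fun y => |y| ^ t),
    integral_prod_mul (fun y => F y * |y| ^ t) (fun y => |y| ^ (t + 2)),
    integral_prod_mul (fun y => |y| ^ t) (fun y => F y * |y| ^ (t + 2)),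
    integral_prod_mul (fun y => |y| ^ (t + 2)) (fun y => F y * |y| ^ t), hA, hA,
    integral_abs_pow_scalarLaw, integral_abs_pow_scalarLaw, mul_pow, mul_pow] at key
  have hpos : 0 < gMom s ^ (k + 1) * gMom t ^ (k + 1) * gMom (t + 2) ^ (k + 1) := by
    have h1 := gMom_pos s
    have h2 := gMom_pos t
    have h3 := gMom_pos (t + 2)
    positivity
  nlinarith

lemma pDiff_nonneg (k i j : ℕ) : 0 ≤ pDiff (k + 1) i j := by
  rw [pDiff]
  split_ifs with h
  · rw [sub_zero]; exact pLess_nonneg _ _ _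
  · obtain ⟨r, rfl⟩ := Nat.exists_eq_succ_of_ne_zero h
    exact sub_nonneg.2 (pLess_mono _ (2 * r + 1) _)

lemma pDiff_le_one (k i j : ℕ) : pDiff k i j ≤ 1 := by
  have h1 := pLess_le_one (2 * i) (2 * j + 1) k
  have h2 := pLess_nonneg (2 * i) (2 * j - 1) k
  rw [pDiff]
  split_ifs <;> linarith

end Variance

section CLT
open Topology

lemma gMom_add_two (s : ℕ) : gMom (s + 2) = (s + 1) * gMom s := by
  have h : ∀ r : ℕ, halfMom r =
      (1 / 2 : ℝ) ^ (-((r : ℝ) + 1) / 2) * (1 / 2) * Real.Gamma (((r : ℝ) + 1) / 2) := by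
    intro r
    rw [← integral_rpow_mul_exp_neg_mul_rpow (p := 2) (q := r) (b := 1 / 2) two_pos
      (by linarith [r.cast_nonneg (α := ℝ)]) (by norm_num), halfMom]
    refine setIntegral_congr_fun measurableSet_Ioi fun x _ => ?_
    rw [Real.rpow_natCast, Real.rpow_two]
    congr 2
    ring
  rw [gMom_eq_halfMom, gMom_eq_halfMom, h, h]
  push_cast
  rw [show ((s : ℝ) + 2 + 1) / 2 = (s + 1) / 2 + 1 by ring, Real.Gamma_add_one (by positivity),
    show -((s : ℝ) + 2 + 1) / 2 = -((s : ℝ) + 1) / 2 - 1 by ring,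
    Real.rpow_sub_one (by norm_num : (1 / 2 : ℝ) ≠ 0)]
  ring

lemma sq_le_cosh (v : ℝ) : v ^ 2 / 2 ≤ Real.cosh v - 1 := by
  have h1 : Real.cosh v - 1 = 2 * Real.sinh (v / 2) ^ 2 := by
    have := Real.cosh_two_mul (v / 2)
    rw [mul_div_cancel₀ v two_ne_zero, Real.cosh_sq] at this
    linarith
  have h2 : |v / 2| ≤ |Real.sinh (v / 2)| := by
    rw [Real.abs_sinh]
    exact Real.self_le_sinh_iff.2 (abs_nonneg _)
  have := sq_le_sq.2 h2
  rw [h1]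
  linarith

lemma norm_exp_sub_quadratic_le {z : ℂ} (hz : ‖z‖ ≤ 1) :
    ‖Complex.exp z - (1 + z + z ^ 2 / 2)‖ ≤ ‖z‖ ^ 3 := by
  have h := Complex.exp_bound hz (n := 3) (by norm_num)
  simp only [Finset.sum_range_succ, Finset.sum_range_zero, Nat.factorial] at h
  norm_num at h
  refine h.trans ?_
  have : (0 : ℝ) ≤ ‖z‖ ^ 3 := by positivity
  linarith

lemma exists_norm_exp_sub_le (θ : ℝ) {ε : ℝ} (hε : 0 < ε) : ∃ C : ℝ, ∀ v : ℝ,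
    ‖Complex.exp (θ * v * Complex.I) - 1 - θ * Complex.I * (Real.sinh v : ℂ) +
      θ ^ 2 * ((Real.cosh v - 1 : ℝ) : ℂ)‖ ≤
      ε * (Real.cosh v - 1) + C * (Real.cosh v - 1) ^ 2 := by
  obtain ⟨K, hK⟩ : ∃ K : ℝ, K = |θ| ^ 3 + |θ| + θ ^ 2 := ⟨_, rfl⟩
  have hK0 : 0 ≤ K := by rw [hK]; positivity
  obtain ⟨δ, hδ0, hδ1, hδ2, hδ3⟩ : ∃ δ : ℝ, 0 < δ ∧ δ ≤ 1 ∧ |θ| * δ ≤ 1 ∧ 2 * K * δ ≤ ε := by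
    refine ⟨min 1 (min (1 / (|θ| + 1)) (ε / (2 * K + 1))), by positivity, min_le_left _ _, ?_, ?_⟩
    · calc |θ| * _ ≤ |θ| * (1 / (|θ| + 1)) := by
            gcongr; exact (min_le_right _ _).trans (min_le_left _ _)
        _ ≤ 1 := by rw [mul_one_div, div_le_one (by positivity)]; linarith
    · calc 2 * K * _ ≤ 2 * K * (ε / (2 * K + 1)) := by
            gcongr; exact (min_le_right _ _).trans (min_le_right _ _)
        _ ≤ ε := by
            rw [mul_div_assoc', div_le_iff₀ (by positivity)]
            nlinarith
  refine ⟨(2 + |θ|) / (δ ^ 2 / 2) ^ 2 + (|θ| + θ ^ 2) / (δ ^ 2 / 2), fun v => ?_⟩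
  have hc := sq_le_cosh v
  obtain ⟨c, hcd⟩ : ∃ c : ℝ, c = Real.cosh v - 1 := ⟨_, rfl⟩
  rw [← hcd] at hc ⊢
  have hc0 : 0 ≤ c := le_trans (by positivity) hc
  rcases le_or_gt |v| δ with hv | hv
  · have hv1 : ‖(v : ℂ)‖ ≤ 1 := by rw [Complex.norm_real]; exact hv.trans hδ1
    have hv2 : ‖-(v : ℂ)‖ ≤ 1 := by rwa [norm_neg]
    have hn : ‖(θ : ℂ) * v * Complex.I‖ = |θ| * |v| := by simp
    have hv3 : ‖(θ : ℂ) * v * Complex.I‖ ≤ 1 := by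
      rw [hn]
      exact (mul_le_mul_of_nonneg_left hv (abs_nonneg _)).trans hδ2
    have b1 := norm_exp_sub_quadratic_le hv1
    have b2 := norm_exp_sub_quadratic_le hv2
    have b3 := norm_exp_sub_quadratic_le hv3
    rw [hn] at b3
    rw [norm_neg] at b2
    rw [Complex.norm_real, Real.norm_eq_abs] at b1 b2
    set R1 := Complex.exp v - (1 + v + (v : ℂ) ^ 2 / 2) with hR1
    set R2 := Complex.exp (-(v : ℂ)) - (1 + -v + (-(v : ℂ)) ^ 2 / 2) with hR2
    set R3 := Complex.exp (θ * v * Complex.I) - (1 + θ * v * Complex.I +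
      (θ * v * Complex.I) ^ 2 / 2) with hR3
    have hs : ‖(R1 - R2) / 2‖ ≤ |v| ^ 3 := by
      rw [norm_div, Complex.norm_ofNat]
      linarith [norm_sub_le R1 R2]
    have ha : ‖(R1 + R2) / 2‖ ≤ |v| ^ 3 := by
      rw [norm_div, Complex.norm_ofNat]
      linarith [norm_add_le R1 R2]
    have e : Complex.exp (θ * v * Complex.I) - 1 - θ * Complex.I * (Real.sinh v : ℂ) +
        θ ^ 2 * (c : ℂ) = R3 - θ * Complex.I * ((R1 - R2) / 2) + θ ^ 2 * ((R1 + R2) / 2) := by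
      rw [hR1, hR2, hR3, hcd, Complex.ofReal_sub, Complex.ofReal_sinh, Complex.ofReal_cosh,
        Complex.ofReal_one, Complex.sinh, Complex.cosh, mul_pow, Complex.I_sq]
      ring
    rw [e]
    have n1 : ‖(θ : ℂ) * Complex.I * ((R1 - R2) / 2)‖ ≤ |θ| * |v| ^ 3 := by
      rw [norm_mul, norm_mul, Complex.norm_I, mul_one, Complex.norm_real]
      exact mul_le_mul_of_nonneg_left hs (abs_nonneg _)
    have n2 : ‖(θ : ℂ) ^ 2 * ((R1 + R2) / 2)‖ ≤ θ ^ 2 * |v| ^ 3 := by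
      rw [norm_mul, norm_pow, Complex.norm_real, Real.norm_eq_abs, sq_abs]
      exact mul_le_mul_of_nonneg_left ha (sq_nonneg _)
    have n3 : ‖R3 - θ * Complex.I * ((R1 - R2) / 2) + θ ^ 2 * ((R1 + R2) / 2)‖ ≤ K * |v| ^ 3 := by
      refine (norm_add_le _ _).trans ((add_le_add (norm_sub_le _ _) le_rfl).trans ?_)
      rw [hK, add_mul, add_mul, ← mul_pow]
      linarith
    have n4 : K * |v| ^ 3 ≤ ε * c := by
      have : |v| ^ 2 ≤ 2 * c := by rw [sq_abs]; linarith
      calc K * |v| ^ 3 = K * |v| * |v| ^ 2 := by ring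
        _ ≤ K * δ * (2 * c) := by gcongr
        _ = 2 * K * δ * c := by ring
        _ ≤ ε * c := by gcongr
    refine (n3.trans n4).trans (le_add_of_nonneg_right ?_)
    positivity
  · have hd : δ ^ 2 / 2 ≤ c := by
      refine le_trans ?_ hc
      rw [← sq_abs v]
      gcongr
    have hs : |Real.sinh v| ≤ 1 + c := by
      rw [hcd, add_sub_cancel, Real.abs_sinh, ← Real.cosh_abs]
      exact (Real.sinh_lt_cosh _).le
    have n0 : ‖Complex.exp (θ * v * Complex.I) - 1 - θ * Complex.I * (Real.sinh v : ℂ) +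
        θ ^ 2 * (c : ℂ)‖ ≤ 1 + 1 + |θ| * (1 + c) + θ ^ 2 * c := by
      refine (norm_add_le _ _).trans (add_le_add ((norm_sub_le _ _).trans (add_le_add
        ((norm_sub_le _ _).trans (add_le_add ?_ ?_)) ?_)) ?_)
      · rw [← Complex.ofReal_mul, Complex.norm_exp_ofReal_mul_I]
      · rw [norm_one]
      · rw [norm_mul, norm_mul, Complex.norm_I, mul_one, Complex.norm_real, Complex.norm_real]
        exact mul_le_mul_of_nonneg_left hs (abs_nonneg _)
      · rw [norm_mul, norm_pow, Complex.norm_real, Complex.norm_real, Real.norm_eq_abs, sq_abs,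
          Real.norm_eq_abs, abs_of_nonneg hc0]
    refine n0.trans (le_trans ?_ (le_add_of_nonneg_left (by positivity)))
    have p1 : 2 + |θ| ≤ (2 + |θ|) / (δ ^ 2 / 2) ^ 2 * c ^ 2 := by
      rw [div_mul_eq_mul_div, le_div_iff₀ (by positivity)]
      gcongr
    have p2 : (|θ| + θ ^ 2) * c ≤ (|θ| + θ ^ 2) / (δ ^ 2 / 2) * c ^ 2 := by
      rw [div_mul_eq_mul_div, le_div_iff₀ (by positivity), pow_two c, ← mul_assoc]
      gcongr
    rw [add_mul]
    linarith

lemma exists_norm_charFun_sub_le (θ : ℝ) {ε : ℝ} (hε : 0 < ε) : ∃ C : ℝ, ∀ (μ : Measure ℝ)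
    [IsProbabilityMeasure μ] (E : ℝ → ℝ), (∀ r ∈ ({1, -1, 2, -2} : Set ℝ),
      Integrable (fun x => Real.exp (r * x)) μ ∧ ∫ x, Real.exp (r * x) ∂μ = E r) →
    ‖charFun μ θ - 1 - θ * Complex.I * (((E 1 - E (-1)) / 2 : ℝ) : ℂ) +
      θ ^ 2 * (((E 1 + E (-1)) / 2 - 1 : ℝ) : ℂ)‖ ≤
      ε * ((E 1 + E (-1)) / 2 - 1) + C * ((E 2 + E (-2)) / 4 - (E 1 + E (-1)) + 3 / 2) := by
  obtain ⟨C, hC⟩ := exists_norm_exp_sub_le θ hε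
  refine ⟨C, fun μ _ E hE => ?_⟩
  obtain ⟨i1, e1⟩ := hE 1 (by simp)
  obtain ⟨i2, e2⟩ := hE (-1) (by simp)
  obtain ⟨i3, e3⟩ := hE 2 (by simp)
  obtain ⟨i4, e4⟩ := hE (-2) (by simp)
  have is : Integrable (fun x => (Real.exp (1 * x) - Real.exp (-1 * x)) / 2) μ :=
    (i1.sub i2).div_const 2
  have ia : Integrable (fun x => (Real.exp (1 * x) + Real.exp (-1 * x)) / 2) μ :=
    (i1.add i2).div_const 2
  have ib : Integrable (fun x => (Real.exp (2 * x) + Real.exp (-2 * x)) / 4) μ :=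
    (i3.add i4).div_const 4
  have hs : ∀ x, Real.sinh x = (Real.exp (1 * x) - Real.exp (-1 * x)) / 2 := fun x => by
    rw [Real.sinh_eq, one_mul, neg_one_mul]
  have hch : ∀ x, Real.cosh x = (Real.exp (1 * x) + Real.exp (-1 * x)) / 2 := fun x => by
    rw [Real.cosh_eq, one_mul, neg_one_mul]
  have hc2 : ∀ x, (Real.cosh x - 1) ^ 2 = (Real.exp (2 * x) + Real.exp (-2 * x)) / 4 -
      2 * Real.cosh x + 3 / 2 := fun x => by
    have h1 : Real.exp (2 * x) = Real.exp x ^ 2 := by rw [← Real.exp_nat_mul]; norm_num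
    have h2 : Real.exp (-2 * x) = Real.exp (-x) ^ 2 := by
      rw [← Real.exp_nat_mul]; norm_num
    have h3 : Real.exp x * Real.exp (-x) = 1 := by rw [← Real.exp_add]; simp
    rw [h1, h2, Real.cosh_eq]
    linear_combination h3 / 2
  have js : Integrable Real.sinh μ := is.congr (ae_of_all _ fun x => (hs x).symm)
  have jc : Integrable Real.cosh μ := ia.congr (ae_of_all _ fun x => (hch x).symm)
  have vs : ∫ x, Real.sinh x ∂μ = (E 1 - E (-1)) / 2 := by
    simp only [hs]
    rw [integral_div, integral_sub i1 i2, e1, e2]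
  have vc : ∫ x, Real.cosh x ∂μ = (E 1 + E (-1)) / 2 := by
    simp only [hch]
    rw [integral_div, integral_add i1 i2, e1, e2]
  have jc1 : Integrable (fun x => Real.cosh x - 1) μ := jc.sub (integrable_const 1)
  have vc1 : ∫ x, (Real.cosh x - 1) ∂μ = (E 1 + E (-1)) / 2 - 1 := by
    rw [integral_sub jc (integrable_const 1), vc, integral_const, probReal_univ, one_smul]
  have jc3 : Integrable (fun x => (Real.exp (2 * x) + Real.exp (-2 * x)) / 4 -
      2 * Real.cosh x) μ := ib.sub (jc.const_mul 2)
  have jc2 : Integrable (fun x => (Real.cosh x - 1) ^ 2) μ :=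
    (jc3.add (integrable_const (3 / 2 : ℝ))).congr (ae_of_all _ fun x => (hc2 x).symm)
  have vc2 : ∫ x, (Real.cosh x - 1) ^ 2 ∂μ = (E 2 + E (-2)) / 4 - (E 1 + E (-1)) + 3 / 2 := by
    simp only [hc2]
    rw [integral_add jc3 (integrable_const _), integral_sub ib (jc.const_mul 2), integral_div,
      integral_add i3 i4, e3, e4, integral_const_mul, vc, integral_const, probReal_univ, one_smul]
    ring
  have je : Integrable (fun x : ℝ => Complex.exp (θ * x * Complex.I)) μ := by
    refine (integrable_const (1 : ℝ)).mono' (by fun_prop) (ae_of_all _ fun x => ?_)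
    rw [← Complex.ofReal_mul, Complex.norm_exp_ofReal_mul_I]
  have k1 : Integrable (fun x : ℝ => Complex.exp (θ * x * Complex.I) - 1) μ :=
    je.sub (integrable_const 1)
  have k2 : Integrable (fun x : ℝ => (θ : ℂ) * Complex.I * (Real.sinh x : ℂ)) μ :=
    js.ofReal.const_mul _
  have k3 : Integrable (fun x : ℝ => (θ : ℂ) ^ 2 * ((Real.cosh x - 1 : ℝ) : ℂ)) μ :=
    jc1.ofReal.const_mul _
  have k4 : Integrable (fun x : ℝ => Complex.exp (θ * x * Complex.I) - 1 -
      θ * Complex.I * (Real.sinh x : ℂ)) μ := k1.sub k2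
  have key : ∫ x : ℝ, (Complex.exp (θ * x * Complex.I) - 1 - θ * Complex.I * (Real.sinh x : ℂ) +
      θ ^ 2 * ((Real.cosh x - 1 : ℝ) : ℂ)) ∂μ =
      charFun μ θ - 1 - θ * Complex.I * (((E 1 - E (-1)) / 2 : ℝ) : ℂ) +
      θ ^ 2 * (((E 1 + E (-1)) / 2 - 1 : ℝ) : ℂ) := by
    rw [integral_add k4 k3, integral_sub k1 k2, integral_sub je (integrable_const 1),
      integral_const_mul, integral_const_mul, integral_complex_ofReal, integral_complex_ofReal,
      vs, vc1, charFun_apply_real, integral_const, probReal_univ, one_smul]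
  rw [← key, ← vc1, ← vc2, ← integral_const_mul, ← integral_const_mul,
    ← integral_add (jc1.const_mul ε) (jc2.const_mul C)]
  exact (norm_integral_le_integral_norm _).trans (integral_mono (k4.add k3).norm
    ((jc1.const_mul ε).add (jc2.const_mul C)) hC)

lemma exp_moment_logTilt (s s' : ℕ) {c : ℝ} (hc : (s : ℝ) + c = s') :
    Integrable (fun x => Real.exp (c * x)) (logTilt s) ∧
      ∫ x, Real.exp (c * x) ∂logTilt s = gMom s' / gMom s := by
  have hm : Measurable fun x : ℝ => Real.exp (c * x) := by fun_prop
  have h := lintegral_logTilt s (f := fun x => ENNReal.ofReal (Real.exp (c * x)))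
    hm.ennreal_ofReal
  have := nullSingletonClass_gaussianReal (μ := 0) (v := 1) one_ne_zero
  have h0 : ∀ᵐ x ∂gaussianReal 0 1, x ≠ (0 : ℝ) := by
    rw [ae_iff]; simp
  have e : ∫⁻ x, ENNReal.ofReal (|x| ^ s) * ENNReal.ofReal (Real.exp (c * Real.log x))
      ∂gaussianReal 0 1 = ENNReal.ofReal (gMom s') := by
    rw [ofReal_gMom]
    refine lintegral_congr_ae ?_
    filter_upwards [h0] with x hx
    rw [← ENNReal.ofReal_mul (by positivity), ← Real.log_abs, ← Real.rpow_natCast,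
      ← Real.rpow_natCast, ← hc, Real.rpow_add (abs_pos.2 hx), mul_comm c,
      Real.rpow_def_of_pos (abs_pos.2 hx) c]
  rw [e] at h
  have hg := gMom_pos s
  have h2 : ∫⁻ x, ENNReal.ofReal (Real.exp (c * x)) ∂logTilt s =
      ENNReal.ofReal (gMom s' / gMom s) := by
    have hg' : ENNReal.ofReal (gMom s) ≠ 0 := by simpa using hg
    refine (ENNReal.mul_right_inj hg' ENNReal.ofReal_ne_top).1 ?_
    rw [h, ← ENNReal.ofReal_mul hg.le, mul_div_cancel₀ _ hg.ne']
  refine ⟨⟨hm.aestronglyMeasurable, ?_⟩, ?_⟩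
  · rw [hasFiniteIntegral_iff_ofReal (ae_of_all _ fun x => (Real.exp_pos _).le), h2]
    exact ENNReal.ofReal_lt_top
  · rw [integral_eq_lintegral_of_nonneg_ae (ae_of_all _ fun x => (Real.exp_pos _).le)
      hm.aestronglyMeasurable, h2, ENNReal.toReal_ofReal]
    exact div_nonneg (gMom_pos s').le hg.le

/-- The law of twice the difference of two independent variables. -/
noncomputable def diffLaw (μ ν : Measure ℝ) : Measure ℝ :=
  (μ.prod ν).map fun p => 2 * (p.2 - p.1)

instance (μ ν : Measure ℝ) [IsProbabilityMeasure μ] [IsProbabilityMeasure ν] :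
    IsProbabilityMeasure (diffLaw μ ν) :=
  Measure.isProbabilityMeasure_map (by fun_prop)

lemma charFun_diffLaw (μ ν : Measure ℝ) [IsProbabilityMeasure μ] [IsProbabilityMeasure ν] (θ : ℝ) :
    charFun (diffLaw μ ν) θ = charFun μ (-(2 * θ)) * charFun ν (2 * θ) := by
  rw [charFun_apply_real, diffLaw, integral_map (by fun_prop) (by fun_prop), charFun_apply_real,
    charFun_apply_real, ← integral_prod_mul]
  refine integral_congr_ae (ae_of_all _ fun p => ?_)
  beta_reduce
  rw [← Complex.exp_add]
  push_cast
  ring_nf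

lemma charFun_logLaw (s k : ℕ) (θ : ℝ) : charFun (logLaw s k) θ = charFun (logTilt s) θ ^ k := by
  induction k with
  | zero => rw [logLaw, charFun_dirac]; simp
  | succ k ih => rw [logLaw, charFun_conv, ih, pow_succ, mul_comm]

lemma pLess_eq_diffLaw (s t k : ℕ) :
    pLess s t k = (diffLaw (logLaw s k) (logLaw t k)).real (Ioi 0) := by
  rw [pLess, diffLaw, map_measureReal_apply (by fun_prop) measurableSet_Ioi]
  congr 1
  ext p
  simp

lemma exp_moment_diffLaw (s s' t t' : ℕ) {c : ℝ} (hs : (s : ℝ) - 2 * c = s')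
    (ht : (t : ℝ) + 2 * c = t') :
    Integrable (fun x => Real.exp (c * x)) (diffLaw (logTilt s) (logTilt t)) ∧
      ∫ x, Real.exp (c * x) ∂diffLaw (logTilt s) (logTilt t) =
        gMom s' / gMom s * (gMom t' / gMom t) := by
  obtain ⟨i1, e1⟩ := exp_moment_logTilt s s' (c := -(2 * c)) (by linarith)
  obtain ⟨i2, e2⟩ := exp_moment_logTilt t t' (c := 2 * c) ht
  have he : ∀ p : ℝ × ℝ, Real.exp (c * (2 * (p.2 - p.1))) =
      Real.exp (-(2 * c) * p.1) * Real.exp (2 * c * p.2) := fun p => by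
    rw [← Real.exp_add]; ring_nf
  constructor
  · rw [diffLaw, integrable_map_measure (by fun_prop) (by fun_prop)]
    exact (i1.mul_prod i2).congr (ae_of_all _ fun p => (he p).symm)
  · rw [diffLaw, integral_map (by fun_prop) (by fun_prop)]
    simp only [he]
    rw [integral_prod_mul (fun x => Real.exp (-(2 * c) * x)) (fun y => Real.exp (2 * c * y)), e1, e2]

end CLT

section Limit
open Topology

lemma tendsto_add_div_add {x : ℕ → ℝ} (hx : Tendsto x atTop atTop) (a b : ℝ) :
    Tendsto (fun n => (x n + a) / (x n + b)) atTop (𝓝 1) := by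
  have h : ∀ c : ℝ, Tendsto (fun n => 1 + c * (x n)⁻¹) atTop (𝓝 1) := fun c => by
    simpa using ((tendsto_inv_atTop_zero.comp hx).const_mul c).const_add 1
  have := (h a).div (h b) one_ne_zero
  rw [div_one] at this
  refine this.congr' ?_
  filter_upwards [hx.eventually_gt_atTop 0] with n hn
  rw [Pi.div_apply, ← mul_div_mul_left _ _ hn.ne']
  congr 1 <;> field_simp

lemma tendsto_mul_ratio_sub_one {x k : ℕ → ℝ} {β : ℝ} (hx : Tendsto x atTop atTop)
    (hk : Tendsto (fun n => k n / x n) atTop (𝓝 β)) (a b : ℝ) :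
    Tendsto (fun n => k n * ((x n + a) / (x n + b) - 1)) atTop (𝓝 ((a - b) * β)) := by
  have := ((tendsto_add_div_add hx 0 b).mul hk).const_mul (a - b)
  rw [one_mul] at this
  refine this.congr' ?_
  filter_upwards [hx.eventually_gt_atTop 0, hx.eventually_gt_atTop (-b)] with n h0 hb
  have : x n + b ≠ 0 := by linarith
  field_simp
  ring

lemma tendsto_mul_mul_sub_one {k f g : ℕ → ℝ} {A B : ℝ}
    (hf : Tendsto (fun n => k n * (f n - 1)) atTop (𝓝 A))
    (hg : Tendsto (fun n => k n * (g n - 1)) atTop (𝓝 B)) (hg1 : Tendsto g atTop (𝓝 1)) :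
    Tendsto (fun n => k n * (f n * g n - 1)) atTop (𝓝 (A + B)) := by
  have := (hf.mul hg1).add hg
  rw [mul_one] at this
  refine this.congr fun n => ?_
  ring

lemma tendsto_one_add_pow_exp {z : ℕ → ℂ} {k : ℕ → ℕ} {L : ℂ} (hz : Tendsto z atTop (𝓝 0))
    (h : Tendsto (fun n => (k n : ℂ) * z n) atTop (𝓝 L)) :
    Tendsto (fun n => (1 + z n) ^ k n) atTop (𝓝 (Complex.exp L)) := by
  have hd : HasDerivAt (fun w : ℂ => Complex.log (1 + w)) 1 0 := by
    have := ((hasDerivAt_id (0 : ℂ)).const_add 1).clog (by simp)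
    simpa using this
  have hc := (continuousAt_dslope_same.2 hd.differentiableAt).tendsto.comp hz
  rw [dslope_same, hd.deriv] at hc
  have h2 := h.mul hc
  rw [mul_one] at h2
  refine ((Complex.continuous_exp.tendsto L).comp h2).congr' ?_
  have hz1 : ∀ᶠ n in atTop, z n ≠ -1 := hz.eventually_ne (by simp)
  filter_upwards [hz1] with n hn
  have hne : 1 + z n ≠ 0 := fun h0 => hn (by linear_combination h0)
  have hs := sub_smul_dslope (fun w : ℂ => Complex.log (1 + w)) 0 (z n)
  simp only [sub_zero, add_zero, Complex.log_one, smul_eq_mul] at hs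
  rw [Function.comp_apply, Function.comp_apply, mul_assoc, hs, Complex.exp_nat_mul,
    Complex.exp_log hne]

theorem tendsto_pLess {s t k : ℕ → ℕ} {δ β : ℝ} (hβ : 0 < β)
    (ht : ∀ᶠ n in atTop, (t n : ℝ) = s n + δ) (hs : Tendsto (fun n => (s n : ℝ)) atTop atTop)
    (hk : Tendsto (fun n => (k n : ℝ) / s n) atTop (𝓝 β)) :
    Tendsto (fun n => pLess (s n) (t n) (k n)) atTop
      (𝓝 ((gaussianReal (δ * β) (Real.toNNReal (4 * β))).real (Ioi 0))) := by
  obtain ⟨x, hx⟩ : ∃ x : ℕ → ℝ, x = fun n => (s n : ℝ) := ⟨_, rfl⟩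
  have hs' : Tendsto x atTop atTop := by rw [hx]; exact hs
  have hk' : Tendsto (fun n => (k n : ℝ) / x n) atTop (𝓝 β) := by rw [hx]; exact hk
  obtain ⟨E, hE⟩ : ∃ E : ℕ → ℝ → ℝ, E = fun n r =>
      if r = 1 then (x n + (δ + 1)) / (x n + -1) else
      if r = -1 then (x n + 1) / (x n + (δ - 1)) else
      if r = 2 then (x n + (δ + 1)) / (x n + -1) * ((x n + (δ + 3)) / (x n + -3)) else
      (x n + 1) / (x n + (δ - 1)) * ((x n + 3) / (x n + (δ - 3))) := ⟨_, rfl⟩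
  have E1 : ∀ n, E n 1 = (x n + (δ + 1)) / (x n + -1) := fun n => by rw [hE]; norm_num
  have E1' : ∀ n, E n (-1) = (x n + 1) / (x n + (δ - 1)) := fun n => by rw [hE]; norm_num
  have E2 : ∀ n, E n 2 = (x n + (δ + 1)) / (x n + -1) * ((x n + (δ + 3)) / (x n + -3)) :=
    fun n => by rw [hE]; norm_num
  have E2' : ∀ n, E n (-2) = (x n + 1) / (x n + (δ - 1)) * ((x n + 3) / (x n + (δ - 3))) :=
    fun n => by rw [hE]; norm_num
  have hmom : ∀ᶠ n in atTop, ∀ r ∈ ({1, -1, 2, -2} : Set ℝ),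
      Integrable (fun x => Real.exp (r * x)) (diffLaw (logTilt (s n)) (logTilt (t n))) ∧
        ∫ x, Real.exp (r * x) ∂diffLaw (logTilt (s n)) (logTilt (t n)) = E n r := by
    filter_upwards [ht, hs.eventually_gt_atTop 4, hs.eventually_gt_atTop (4 - δ)] with n hn h1 h2
    obtain ⟨u, hu⟩ : ∃ u, s n = u + 4 :=
      ⟨s n - 4, by have : 4 < s n := by exact_mod_cast h1
                   omega⟩
    obtain ⟨w, hw⟩ : ∃ w, t n = w + 4 :=
      ⟨t n - 4, by have : 4 < t n := by
                     have : (4 : ℝ) < t n := by linarith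
                     exact_mod_cast this
                   omega⟩
    have hxu : x n = u + 4 := by rw [hx]; beta_reduce; rw [hu]; push_cast; ring
    have hδ : δ = w - u := by
      rw [hu, hw] at hn
      push_cast at hn
      linarith
    have g0 : ∀ r, gMom r ≠ 0 := fun r => (gMom_pos r).ne'
    have p1 : ∀ r : ℕ, (r : ℝ) + 1 ≠ 0 := fun r => by positivity
    have p2 : ∀ r : ℕ, (r : ℝ) + 3 ≠ 0 := fun r => by positivity
    have R : ∀ r : ℕ, gMom (r + 4 + 4) = (r + 7) * ((r + 5) * gMom (r + 4)) ∧
        gMom (r + 4 + 2) = (r + 5) * gMom (r + 4) ∧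
        gMom (r + 4) = (r + 3) * gMom (r + 2) ∧ gMom (r + 2) = (r + 1) * gMom r := by
      intro r
      have a1 := gMom_add_two (r + 4 + 2)
      have a2 := gMom_add_two (r + 4)
      have a3 := gMom_add_two (r + 2)
      push_cast at a1 a2 a3
      refine ⟨?_, ?_, ?_, gMom_add_two r⟩
      · rw [a1, a2]; ring
      · rw [a2]; ring
      · rw [a3]; ring
    obtain ⟨u4, u3, u2, u1⟩ := R u
    obtain ⟨w4, w3, w2, w1⟩ := R w
    intro r hr
    simp only [mem_insert_iff, mem_singleton_iff] at hr
    rw [hu, hw]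
    have d1 : (u : ℝ) + 4 + -1 = u + 3 := by ring
    have d2 : (u : ℝ) + 4 + -3 = u + 1 := by ring
    have d3 : (u : ℝ) + 4 + (w - u - 1) = w + 3 := by ring
    have d4 : (u : ℝ) + 4 + (w - u - 3) = w + 1 := by ring
    have q1 := g0 u
    have q2 := g0 (u + 2)
    have q3 := g0 (u + 4)
    have q4 := g0 w
    have q5 := g0 (w + 2)
    have q6 := g0 (w + 4)
    have p1u := p1 u
    have p2u := p2 u
    have p1w := p1 w
    have p2w := p2 w
    rcases hr with rfl | rfl | rfl | rfl
    · obtain ⟨i, e⟩ := exp_moment_diffLaw (u + 4) (u + 2) (w + 4) (w + 4 + 2) (c := 1)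
        (by push_cast; ring) (by push_cast; ring)
      refine ⟨i, ?_⟩
      rw [e, E1, hxu, hδ, d1, w3, u2]
      field_simp
      ring
    · obtain ⟨i, e⟩ := exp_moment_diffLaw (u + 4) (u + 4 + 2) (w + 4) (w + 2) (c := -1)
        (by push_cast; ring) (by push_cast; ring)
      refine ⟨i, ?_⟩
      rw [e, E1', hxu, hδ, d3, u3, w2]
      field_simp
      ring
    · obtain ⟨i, e⟩ := exp_moment_diffLaw (u + 4) u (w + 4) (w + 4 + 4) (c := 2)
        (by push_cast; ring) (by push_cast; ring)
      refine ⟨i, ?_⟩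
      rw [e, E2, hxu, hδ, d1, d2, w4, u2, u1]
      field_simp
      ring
    · obtain ⟨i, e⟩ := exp_moment_diffLaw (u + 4) (u + 4 + 4) (w + 4) w (c := -2)
        (by push_cast; ring) (by push_cast; ring)
      refine ⟨i, ?_⟩
      rw [e, E2', hxu, hδ, d3, d4, u4, w2, w1]
      field_simp
      ring
  have L1 : Tendsto (fun n => k n * (E n 1 - 1)) atTop (𝓝 ((δ + 2) * β)) := by
    simp only [E1]
    convert! tendsto_mul_ratio_sub_one hs' hk' (δ + 1) (-1) using 2
    ring
  have L1' : Tendsto (fun n => k n * (E n (-1) - 1)) atTop (𝓝 ((2 - δ) * β)) := by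
    simp only [E1']
    convert! tendsto_mul_ratio_sub_one hs' hk' 1 (δ - 1) using 2
    ring
  have L2 : Tendsto (fun n => k n * (E n 2 - 1)) atTop (𝓝 ((2 * δ + 8) * β)) := by
    simp only [E2]
    convert! tendsto_mul_mul_sub_one (tendsto_mul_ratio_sub_one hs' hk' (δ + 1) (-1))
      (tendsto_mul_ratio_sub_one hs' hk' (δ + 3) (-3)) (tendsto_add_div_add hs' _ _) using 2
    ring
  have L2' : Tendsto (fun n => k n * (E n (-2) - 1)) atTop (𝓝 ((8 - 2 * δ) * β)) := by
    simp only [E2']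
    convert! tendsto_mul_mul_sub_one (tendsto_mul_ratio_sub_one hs' hk' 1 (δ - 1))
      (tendsto_mul_ratio_sub_one hs' hk' 3 (δ - 3)) (tendsto_add_div_add hs' _ _) using 2
    ring
  have LS : Tendsto (fun n => k n * ((E n 1 - E n (-1)) / 2)) atTop (𝓝 (δ * β)) := by
    convert! (L1.sub L1').div_const 2 using 2 <;> ring
  have LQ : Tendsto (fun n => k n * ((E n 1 + E n (-1)) / 2 - 1)) atTop (𝓝 (2 * β)) := by
    convert! (L1.add L1').div_const 2 using 2 <;> ring
  have LW : Tendsto (fun n => k n * ((E n 2 + E n (-2)) / 4 - (E n 1 + E n (-1)) + 3 / 2)) atTop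
      (𝓝 0) := by
    convert! ((L2.add L2').div_const 4).sub (L1.add L1') using 2 <;> ring
  have hchar : ∀ θ : ℝ, Tendsto (fun n => charFun (diffLaw (logLaw (s n) (k n))
      (logLaw (t n) (k n))) θ) atTop
      (𝓝 (charFun (gaussianReal (δ * β) (Real.toNNReal (4 * β))) θ)) := by
    intro θ
    obtain ⟨φ, hφ⟩ : ∃ φ : ℕ → ℂ, φ = fun n =>
      charFun (diffLaw (logTilt (s n)) (logTilt (t n))) θ := ⟨_, rfl⟩
    have hpow : ∀ n, charFun (diffLaw (logLaw (s n) (k n)) (logLaw (t n) (k n))) θ =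
        (1 + (φ n - 1)) ^ k n := by
      intro n
      rw [charFun_diffLaw, charFun_logLaw, charFun_logLaw, ← mul_pow, ← charFun_diffLaw, hφ,
        add_sub_cancel]
    have herr : Tendsto (fun n => (k n : ℂ) * (φ n - 1 - θ * Complex.I *
        (((E n 1 - E n (-1)) / 2 : ℝ) : ℂ) + θ ^ 2 * (((E n 1 + E n (-1)) / 2 - 1 : ℝ) : ℂ)))
        atTop (𝓝 0) := by
      rw [tendsto_zero_iff_norm_tendsto_zero]
      refine tendsto_order.2 ⟨fun a ha => Eventually.of_forall fun n => ha.trans_le (norm_nonneg _),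
        fun η hη => ?_⟩
      obtain ⟨C, hC⟩ := exists_norm_charFun_sub_le θ (ε := η / (4 * β)) (by positivity)
      have hb := (LQ.const_mul (η / (4 * β))).add (LW.const_mul C)
      have hlt : η / (4 * β) * (2 * β) + C * 0 < η := by
        rw [mul_zero, add_zero, div_mul_eq_mul_div, div_lt_iff₀ (by positivity)]
        nlinarith [mul_pos hη hβ]
      filter_upwards [hb.eventually_lt_const hlt, hmom] with n hn hm
      refine lt_of_le_of_lt ?_ hn
      rw [norm_mul, Complex.norm_natCast, hφ]
      have := mul_le_mul_of_nonneg_left (hC _ (E n) hm) (k n).cast_nonneg (α := ℝ)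
      refine this.trans (le_of_eq ?_)
      ring
    have hlim : Tendsto (fun n => (k n : ℂ) * (φ n - 1)) atTop
        (𝓝 (θ * Complex.I * ((δ * β : ℝ) : ℂ) - θ ^ 2 * ((2 * β : ℝ) : ℂ))) := by
      have c1 := ((Complex.continuous_ofReal.tendsto _).comp LS).const_mul ((θ : ℂ) * Complex.I)
      have c2 := ((Complex.continuous_ofReal.tendsto _).comp LQ).const_mul ((θ : ℂ) ^ 2)
      have := (herr.add c1).sub c2
      rw [zero_add] at this
      refine this.congr fun n => ?_
      simp only [Function.comp_apply]
      push_cast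
      ring
    have hkt : Tendsto (fun n => (k n : ℝ)) atTop atTop := by
      refine (Tendsto.pos_mul_atTop hβ hk' hs').congr' ?_
      filter_upwards [hs'.eventually_gt_atTop 0] with n hn
      exact div_mul_cancel₀ _ hn.ne'
    have hz : Tendsto (fun n => φ n - 1) atTop (𝓝 0) := by
      have h1 := (Complex.continuous_ofReal.tendsto _).comp (tendsto_inv_atTop_zero.comp hkt)
      have := h1.mul hlim
      rw [Complex.ofReal_zero, zero_mul] at this
      refine this.congr' ?_
      filter_upwards [hkt.eventually_gt_atTop 0] with n hn
      have : (k n : ℂ) ≠ 0 := by exact_mod_cast hn.ne'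
      simp only [Function.comp_apply]
      push_cast
      rw [inv_mul_cancel_left₀ this]
    simp only [hpow]
    convert! tendsto_one_add_pow_exp hz hlim using 2
    rw [charFun_gaussianReal, Real.coe_toNNReal _ (by positivity)]
    congr 1
    push_cast
    ring
  obtain ⟨μs, hμs⟩ : ∃ μs : ℕ → ProbabilityMeasure ℝ, μs = fun n =>
    ⟨diffLaw (logLaw (s n) (k n)) (logLaw (t n) (k n)), inferInstance⟩ := ⟨_, rfl⟩
  obtain ⟨μ₀, hμ₀⟩ : ∃ μ₀ : ProbabilityMeasure ℝ, μ₀ =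
    ⟨gaussianReal (δ * β) (Real.toNNReal (4 * β)), inferInstance⟩ := ⟨_, rfl⟩
  have hw : Tendsto μs atTop (𝓝 μ₀) := by
    refine ProbabilityMeasure.tendsto_of_tendsto_charFun fun θ => ?_
    rw [hμs, hμ₀]
    exact hchar θ
  have hv : Real.toNNReal (4 * β) ≠ 0 := by
    rw [Ne, Real.toNNReal_eq_zero, not_le]
    positivity
  have := nullSingletonClass_gaussianReal (μ := δ * β) hv
  have hfin := ProbabilityMeasure.tendsto_measure_of_null_frontier_of_tendsto hw (E := Ioi 0) (by
    rw [frontier_Ioi, hμ₀]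
    exact NNReal.coe_injective (by simp [ProbabilityMeasure.coeFn_def]))
  have hreal := (NNReal.continuous_coe.tendsto _).comp hfin
  rw [hμs, hμ₀] at hreal
  refine hreal.congr fun n => ?_
  rw [pLess_eq_diffLaw]
  rfl

lemma gaussian_diff_eq_erf {β : ℝ} (hβ : 0 < β) :
    (gaussianReal (1 * β) (Real.toNNReal (4 * β))).real (Ioi 0) -
      (gaussianReal (-1 * β) (Real.toNNReal (4 * β))).real (Ioi 0) = erf (Real.sqrt (β / 8)) := by
  set v := Real.toNNReal (4 * β) with hvd
  have hv : v ≠ 0 := by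
    rw [hvd, Ne, Real.toNNReal_eq_zero, not_le]
    positivity
  have hvc : (v : ℝ) = 4 * β := Real.coe_toNNReal _ (by positivity)
  have h : ∀ y : ℝ, (gaussianReal y v).real (Ioi 0) = ∫ x in Ioi (-y), gaussianPDFReal 0 v x := by
    intro y
    have := gaussianReal_map_add_const (μ := 0) (v := v) y
    rw [zero_add] at this
    rw [← this, map_measureReal_apply (by fun_prop) measurableSet_Ioi, measureReal_def,
      gaussianReal_apply_eq_integral _ hv, ENNReal.toReal_ofReal
        (integral_nonneg fun x => gaussianPDFReal_nonneg _ _ _)]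
    congr 2
    ext x
    simp [neg_lt_iff_pos_add]
  have hi := integrable_gaussianPDFReal 0 v
  rw [h, h, intervalIntegral.integral_Ioi_sub_Ioi hi.integrableOn (by linarith)]
  have hg : ∀ x : ℝ, gaussianPDFReal 0 v x =
      (Real.sqrt (8 * β))⁻¹ * ((Real.sqrt Real.pi)⁻¹ * Real.exp (-(x / Real.sqrt (8 * β)) ^ 2)) := by
    intro x
    have h2 : Real.sqrt (2 * Real.pi * (4 * β)) = Real.sqrt (8 * β) * Real.sqrt Real.pi := by
      rw [← Real.sqrt_mul (by positivity)]
      congr 1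
      ring
    rw [gaussianPDFReal, hvc, h2, div_pow, Real.sq_sqrt (by positivity), _root_.mul_inv, mul_assoc,
      sub_zero]
    congr 4
    ring
  have he : ∫ x in -(1 * β)..0, gaussianPDFReal 0 v x = ∫ x in (0 : ℝ)..β, gaussianPDFReal 0 v x := by
    have := intervalIntegral.integral_comp_neg (a := 0) (b := β) fun x => gaussianPDFReal 0 v x
    rw [neg_zero] at this
    rw [one_mul, ← this]
    simp only [hg, neg_div, neg_sq]
  have hβs : β / Real.sqrt (8 * β) = Real.sqrt (β / 8) := by
    rw [div_eq_iff (by positivity), ← Real.sqrt_mul (by positivity),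
      show β / 8 * (8 * β) = β ^ 2 by ring, Real.sqrt_sq hβ.le]
  rw [← intervalIntegral.integral_add_adjacent_intervals (b := 0) hi.intervalIntegrable
    hi.intervalIntegrable, he, show -(-1 * β) = β by ring, erf]
  simp only [hg]
  rw [intervalIntegral.integral_const_mul, intervalIntegral.integral_const_mul,
    intervalIntegral.integral_comp_div (fun s => Real.exp (-s ^ 2)) (by positivity), zero_div, hβs,
    smul_eq_mul]
  field_simp
  ring

end Limit

section Scaling
open Polynomial

lemma charpoly_smul_eq_scaleRoots {ι : Type*} [Fintype ι] [DecidableEq ι] (c : ℝ) (hc : c ≠ 0)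
    (A : Matrix ι ι ℝ) : (c • A).charpoly = A.charpoly.scaleRoots c := by
  have h : (c • A).charpoly.comp (C c * X) = C (c ^ Fintype.card ι) * A.charpoly := by
    rw [Matrix.charpoly, ← coe_compRingHom_apply, RingHom.map_det, C_pow, Matrix.charpoly,
      ← det_smul]
    congr 1
    ext1 i j
    by_cases hij : i = j
    · subst hij
      simp [charmatrix_apply_eq, mul_sub]
    · simp [charmatrix_apply_ne _ _ _ hij]
  ext n
  have hn := congrArg (fun p : ℝ[X] => p.coeff n) h
  beta_reduce at hn
  rw [comp_C_mul_X_coeff, coeff_C_mul] at hn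
  rw [coeff_scaleRoots, charpoly_natDegree_eq_dim]
  by_cases hle : n ≤ Fintype.card ι
  · rw [← Nat.sub_add_cancel hle, pow_add] at hn
    have := pow_ne_zero n hc
    rw [← mul_left_inj' this, hn]
    ring_nf
  · rw [coeff_eq_zero_of_natDegree_lt, coeff_eq_zero_of_natDegree_lt, zero_mul] <;>
    · rw [charpoly_natDegree_eq_dim]
      omega

lemma card_roots_charpoly_smul {ι : Type*} [Fintype ι] [DecidableEq ι] (c : ℝ) (hc : c ≠ 0)
    (A : Matrix ι ι ℝ) : (c • A).charpoly.roots.card = A.charpoly.roots.card := by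
  rw [charpoly_smul_eq_scaleRoots c hc, roots_scaleRoots _ (isUnit_iff_ne_zero.2 hc),
    Multiset.card_map]

end Scaling

section Ensemble

lemma measurePreserving_smul_gaussian (N : ℕ) (hN : N ≠ 0) :
    MeasurePreserving (fun (X : Fin N → Fin N → ℝ) => Matrix.of fun i j => Real.sqrt N * X i j)
      (Measure.pi fun _ => Measure.pi fun _ => gaussianReal 0 (1 / N))
      (stdGaussian (Fin N) (Fin N)) := by
  have h : MeasurePreserving (fun x : ℝ => Real.sqrt N * x) (gaussianReal 0 (1 / N))
      (gaussianReal 0 1) := by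
    refine ⟨by fun_prop, ?_⟩
    rw [gaussianReal_map_const_mul, mul_zero]
    congr 1
    ext
    have : (N : ℝ) ≠ 0 := by exact_mod_cast hN
    simp [this]
  exact measurePreserving_pi _ _ fun _ => measurePreserving_pi _ _ fun _ => h

lemma measurePreserving_prodMatrix (N : ℕ) (hN : N ≠ 0) (k : ℕ) :
    MeasurePreserving (fun ω => Real.sqrt N ^ k • prodMatrix N k ω) (ensembleMeasure N k)
      (prodLaw (Fin N) k) := by
  induction k with
  | zero =>
    refine ⟨?_, ?_⟩
    · have : (fun ω => Real.sqrt N ^ 0 • prodMatrix N 0 ω) = fun _ => 1 := by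
        ext1 ω
        simp [prodMatrix]
      rw [this]
      exact measurable_const
    · have : (fun ω => Real.sqrt N ^ 0 • prodMatrix N 0 ω) = fun _ => 1 := by
        ext1 ω
        simp [prodMatrix]
      rw [this, Measure.map_const, ensembleMeasure, measure_univ, one_smul]
      rfl
  | succ k ih =>
    have h1 := measurePreserving_piFinSuccAbove
      (fun _ : Fin (k + 1) => (Measure.pi fun _ : Fin N => Measure.pi fun _ : Fin N =>
        gaussianReal 0 (1 / N))) 0
    have : SFinite (ensembleMeasure N k) := by
      unfold ensembleMeasure
      infer_instance
    have h2 := ((measurePreserving_smul_gaussian N hN).prod ih).comp h1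
    have h3 : MeasurePreserving (fun p : Matrix (Fin N) (Fin N) ℝ × Matrix (Fin N) (Fin N) ℝ =>
        p.1 * p.2) ((stdGaussian (Fin N) (Fin N)).prod (prodLaw (Fin N) k))
        (prodLaw (Fin N) (k + 1)) := ⟨measurable_mul, rfl⟩
    convert! h3.comp h2 using 1
    ext1 ω
    have : prodMatrix N (k + 1) ω = of (ω 0) * prodMatrix N k fun i => ω i.succ := by
      simp [prodMatrix, List.ofFn_succ]
    rw [this]
    have h4 : (of fun i j => Real.sqrt N * ω 0 i j : Matrix (Fin N) (Fin N) ℝ) =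
      Real.sqrt N • of (ω 0) := rfl
    change _ = (of fun i j => Real.sqrt N * ω 0 i j : Matrix (Fin N) (Fin N) ℝ) *
      (Real.sqrt N ^ k • prodMatrix N k fun i => ω i.succ)
    rw [h4, Matrix.smul_mul, Matrix.mul_smul, smul_smul, pow_succ']

lemma ensembleMeasure_numRealEigs (N : ℕ) (hN : N ≠ 0) (k : ℕ) (S : Set ℕ) :
    ensembleMeasure N k {ω | numRealEigs N (prodMatrix N k ω) ∈ S} =
      prodLaw (Fin N) k {P | P.charpoly.roots.card ∈ S} := by
  have hc : Real.sqrt N ^ k ≠ 0 := by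
    have : (0 : ℝ) < N := by exact_mod_cast Nat.pos_of_ne_zero hN
    positivity
  have hS : MeasurableSet {P : Matrix (Fin N) (Fin N) ℝ | P.charpoly.roots.card ∈ S} :=
    measurable_card_roots (MeasurableSet.of_discrete (s := S))
  rw [← (measurePreserving_prodMatrix N hN k).measure_preimage hS.nullMeasurableSet]
  congr 1
  ext1 ω
  change _ ↔ (Real.sqrt N ^ k • prodMatrix N k ω).charpoly.roots.card ∈ S
  rw [card_roots_charpoly_smul _ hc]
  rfl

end Ensemble

section Trace
open Topology

lemma trace_pMat_div (k n : ℕ) (hn : n ≠ 0) :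
    (pMat k n).trace / n = ∫ t in (0 : ℝ)..1, pDiff k ⌊t * n⌋₊ ⌊t * n⌋₊ := by
  have hn' : (n : ℝ) ≠ 0 := by exact_mod_cast hn
  have hs := intervalIntegral.integral_comp_mul_right (a := 0) (b := 1)
    (fun x : ℝ => pDiff k ⌊x⌋₊ ⌊x⌋₊) hn'
  rw [hs, zero_mul, one_mul, smul_eq_mul, ← div_eq_inv_mul]
  congr 1
  have hp : ∀ j : ℕ, EqOn (fun _ => pDiff k j j) (fun x : ℝ => pDiff k ⌊x⌋₊ ⌊x⌋₊)
      (Ioo (j : ℝ) ((j + 1 : ℕ) : ℝ)) := by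
    intro j x hx
    have : ⌊x⌋₊ = j := (Nat.floor_eq_iff (by linarith [hx.1, j.cast_nonneg (α := ℝ)])).2
      ⟨hx.1.le, by simpa using hx.2⟩
    simp only [this]
  have hle : ∀ j : ℕ, (j : ℝ) ≤ ((j + 1 : ℕ) : ℝ) := fun j => by simp
  have hI : ∀ j < n, IntervalIntegrable (fun x : ℝ => pDiff k ⌊x⌋₊ ⌊x⌋₊) volume
      (j : ℝ) ((j + 1 : ℕ) : ℝ) := by
    intro j _
    rw [intervalIntegrable_iff_integrableOn_Ioo_of_le (hle j)]
    exact (integrableOn_const (by simp)).congr_fun (hp j) measurableSet_Ioo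
  have := intervalIntegral.sum_integral_adjacent_intervals hI
  rw [Nat.cast_zero] at this
  rw [← this, Matrix.trace, ← Fin.sum_univ_eq_sum_range fun j : ℕ =>
    ∫ x in (j : ℝ)..((j + 1 : ℕ) : ℝ), pDiff k ⌊x⌋₊ ⌊x⌋₊]
  refine Finset.sum_congr rfl fun j _ => ?_
  rw [intervalIntegral.integral_of_le (hle j), integral_Ioc_eq_integral_Ioo,
    ← setIntegral_congr_fun measurableSet_Ioo (hp j)]
  simp [pMat]

lemma tendsto_pDiff {α t : ℝ} (hα : 0 < α) (ht : 0 < t) {m : ℕ → ℕ}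
    (hm : Tendsto (fun n : ℕ => (m n : ℝ) / (2 * n : ℕ)) atTop (𝓝 α)) :
    Tendsto (fun n : ℕ => pDiff (m n) ⌊t * n⌋₊ ⌊t * n⌋₊) atTop
      (𝓝 (erf (Real.sqrt (α / (8 * t))))) := by
  have hfl : Tendsto (fun n : ℕ => ⌊t * n⌋₊) atTop atTop :=
    tendsto_nat_floor_atTop.comp (tendsto_natCast_atTop_atTop.const_mul_atTop ht)
  have hratio : Tendsto (fun n : ℕ => (⌊t * n⌋₊ : ℝ) / n) atTop (𝓝 t) :=
    (tendsto_nat_floor_mul_div_atTop ht.le).comp tendsto_natCast_atTop_atTop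
  have hs : Tendsto (fun n : ℕ => ((2 * ⌊t * n⌋₊ : ℕ) : ℝ)) atTop atTop := by
    refine tendsto_natCast_atTop_atTop.comp (hfl.const_mul_atTop' two_pos)
  have hβ : 0 < α / t := by positivity
  have hk : Tendsto (fun n : ℕ => (m n : ℝ) / ((2 * ⌊t * n⌋₊ : ℕ) : ℝ)) atTop (𝓝 (α / t)) := by
    refine (hm.div hratio ht.ne').congr' ?_
    filter_upwards [eventually_gt_atTop 0, hfl.eventually_gt_atTop 0] with n hn hf
    have h1 : (n : ℝ) ≠ 0 := by exact_mod_cast hn.ne'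
    have h2 : (⌊t * n⌋₊ : ℝ) ≠ 0 := by exact_mod_cast hf.ne'
    rw [Pi.div_apply]
    push_cast
    field_simp
  have h1 := tendsto_pLess (t := fun n => 2 * ⌊t * n⌋₊ + 1) (δ := 1) hβ
    (Eventually.of_forall fun n => by push_cast; ring) hs hk
  have h2 := tendsto_pLess (t := fun n => 2 * ⌊t * n⌋₊ - 1) (δ := -1) hβ (by
    filter_upwards [hfl.eventually_gt_atTop 0] with n hf
    rw [Nat.cast_sub (by omega)]
    push_cast
    ring) hs hk
  have h3 := h1.sub h2
  rw [gaussian_diff_eq_erf hβ, div_div, mul_comm t] at h3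
  refine h3.congr' ?_
  filter_upwards [hfl.eventually_gt_atTop 0] with n hf
  rw [pDiff, if_neg hf.ne']

lemma tendsto_trace_pMat {α : ℝ} (hα : 0 < α) {m : ℕ → ℕ} (hpos : ∀ n, 0 < m n)
    (hm : Tendsto (fun n : ℕ => (m n : ℝ) / (2 * n : ℕ)) atTop (𝓝 α)) :
    Tendsto (fun n : ℕ => (pMat (m n) n).trace / n) atTop (𝓝 (cFun α)) := by
  have h : Tendsto (fun n : ℕ => ∫ t in (0 : ℝ)..1, pDiff (m n) ⌊t * n⌋₊ ⌊t * n⌋₊) atTop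
      (𝓝 (cFun α)) := by
    refine intervalIntegral.tendsto_integral_filter_of_dominated_convergence (fun _ => 1)
      (Eventually.of_forall fun n => ?_) (Eventually.of_forall fun n => ae_of_all _ fun t _ => ?_)
      intervalIntegrable_const (ae_of_all _ fun t ht => ?_)
    · have h1 : Measurable fun t : ℝ => ⌊t * n⌋₊ := Nat.measurable_floor.comp (by fun_prop)
      have h2 : Measurable fun j : ℕ => pDiff (m n) j j := measurable_of_countable _
      exact (h2.comp h1).aestronglyMeasurable
    · obtain ⟨k, hk⟩ := Nat.exists_eq_add_of_lt (hpos n)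
      rw [hk, zero_add, Real.norm_of_nonneg (pDiff_nonneg _ _ _)]
      exact pDiff_le_one _ _ _
    · rw [uIoc_of_le zero_le_one] at ht
      exact tendsto_pDiff hα ht.1 hm
  refine h.congr' ?_
  filter_upwards [eventually_gt_atTop 0] with n hn
  rw [trace_pMat_div _ _ hn.ne']

end Trace

section Concentration

lemma trace_pMat_le (k n : ℕ) : (pMat k n).trace ≤ n := by
  refine (Finset.sum_le_card_nsmul Finset.univ _ 1 fun (j : Fin n) _ =>
    pDiff_le_one k j j).trans ?_
  simp

lemma measure_kap_sub_trace_le (k n : ℕ) {ε : ℝ} (hε : 0 < ε) (hn : n ≠ 0) :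
    prodLaw (Fin (2 * n)) (k + 1)
      {P | ε * n ≤ |(kap P.charpoly : ℝ) - (pMat (k + 1) n).trace|} ≤
      ENNReal.ofReal ((ε ^ 2)⁻¹ / n) := by
  have hn' : (0 : ℝ) < n := by exact_mod_cast Nat.pos_of_ne_zero hn
  have hInt : Integrable (fun P : Matrix (Fin (2 * n)) (Fin (2 * n)) ℝ =>
      ((kap P.charpoly : ℝ) - (pMat (k + 1) n).trace) ^ 2) (prodLaw (Fin (2 * n)) (k + 1)) :=
    integrable_kap (2 * n) (k + 1) fun j => ((j : ℝ) - (pMat (k + 1) n).trace) ^ 2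
  have h := mul_meas_ge_le_integral_of_nonneg (ae_of_all _ fun P => sq_nonneg _) hInt
    ((ε * n) ^ 2)
  have h2 := (h.trans (integral_kap_sub_sq_le k n fun i j => pDiff_nonneg _ _ _)).trans
    (trace_pMat_le _ _)
  have hset : {P : Matrix (Fin (2 * n)) (Fin (2 * n)) ℝ |
      ε * n ≤ |(kap P.charpoly : ℝ) - (pMat (k + 1) n).trace|} =
      {P | (ε * n) ^ 2 ≤ ((kap P.charpoly : ℝ) - (pMat (k + 1) n).trace) ^ 2} := by
    ext1 P
    have : 0 ≤ ε * n := by positivity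
    rw [Set.mem_ofPred_eq, Set.mem_ofPred_eq, sq_le_sq, abs_of_nonneg this]
  rw [hset, ← ofReal_measureReal]
  refine ENNReal.ofReal_le_ofReal ?_
  rw [← le_div_iff₀' (by positivity)] at h2
  refine h2.trans_eq ?_
  field_simp

end Concentration
end RealEig

/-- In the critical regime `m = αN`, the fraction `𝒩_N(m_N)/N` of real
eigenvalues converges in probability to the constant `c(α)`. -/
theorem fraction_real_eigenvalues_tendsto_in_probability (α : ℝ) (hα : 0 < α)
    (m : ℕ → ℕ) (hm : ∀ n, 0 < m n)
    (hlim : Tendsto (fun n : ℕ => (m n : ℝ) / (2 * n : ℕ)) atTop (nhds α)) :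
    ∀ ε : ℝ, 0 < ε →
      Tendsto (fun n : ℕ =>
          ensembleMeasure (2 * n) (m n)
            {ω | ε < |(numRealEigs (2 * n) (prodMatrix (2 * n) (m n) ω) : ℝ) / (2 * n : ℕ)
                    - cFun α|})
        atTop (nhds 0) := by
  intro ε hε
  have htr := RealEig.tendsto_trace_pMat hα hm hlim
  have h0 : Tendsto (fun n : ℕ => ENNReal.ofReal (((ε / 2) ^ 2)⁻¹ / n)) atTop (nhds 0) := by
    have := ENNReal.tendsto_ofReal (tendsto_const_div_atTop_nhds_zero_nat (((ε / 2) ^ 2)⁻¹))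
    rwa [ENNReal.ofReal_zero] at this
  refine tendsto_of_tendsto_of_tendsto_of_le_of_le' tendsto_const_nhds h0
    (Eventually.of_forall fun _ => bot_le) ?_
  filter_upwards [Metric.tendsto_nhds.1 htr (ε / 4) (by positivity), eventually_gt_atTop 0,
    (tendsto_const_div_atTop_nhds_zero_nat (1 : ℝ)).eventually_lt_const
      (show 0 < ε / 2 by positivity)] with n hn1 hn hn2
  obtain ⟨k, hk⟩ := Nat.exists_eq_add_of_lt (hm n)
  rw [zero_add] at hk
  rw [hk] at hn1 ⊢
  have hn' : (0 : ℝ) < n := by exact_mod_cast hn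
  refine (RealEig.ensembleMeasure_numRealEigs (2 * n) (by omega) (k + 1)
    {r : ℕ | ε < |(r : ℝ) / (2 * n : ℕ) - cFun α|}).trans_le ?_
  refine (measure_mono fun P hP => ?_).trans
    (RealEig.measure_kap_sub_trace_le k n (half_pos hε) hn.ne')
  rw [Set.mem_ofPred_eq, Set.mem_ofPred_eq] at hP
  rw [Set.mem_ofPred_eq]
  set r := P.charpoly.roots.card with hr
  set T := (RealEig.pMat (k + 1) n).trace
  have hq1 : 2 * RealEig.kap P.charpoly ≤ r := Nat.mul_div_le _ _
  have hq2 : r ≤ 2 * RealEig.kap P.charpoly + 1 := by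
    unfold RealEig.kap
    omega
  set q := RealEig.kap P.charpoly
  have hq1' : (2 * q : ℝ) ≤ r := by exact_mod_cast hq1
  have hq2' : (r : ℝ) ≤ 2 * q + 1 := by exact_mod_cast hq2
  rw [Real.dist_eq] at hn1
  have e : (r : ℝ) / (2 * n : ℕ) - cFun α =
      (r - 2 * q) / (2 * n) + ((q - T) / n + (T / n - cFun α)) := by
    push_cast
    field_simp
    ring
  have hb : |((r : ℝ) - 2 * q) / (2 * n)| ≤ ε / 4 := by
    rw [abs_of_nonneg (div_nonneg (by linarith) (by positivity)), div_le_iff₀ (by positivity)]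
    rw [div_lt_iff₀ hn'] at hn2
    linarith
  rw [e] at hP
  have h1 := abs_add_le (((r : ℝ) - 2 * q) / (2 * n)) ((q - T) / n + (T / n - cFun α))
  have h2 := abs_add_le (((q : ℝ) - T) / n) (T / n - cFun α)
  have h3 : ε / 2 ≤ |((q : ℝ) - T) / n| := by linarith
  rwa [abs_div, abs_of_pos hn', le_div_iff₀ hn'] at h3
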